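/- For every periodic sequence a : ℕ → ℂ (i.e., there is q ≥ 1 with a(n+q) = a(n) for all n) and every sequence (H_M)_{M≥1} of positive integers with H_M → ∞ and H_M/M → 0 as M → ∞, lim_{M→∞} (1/M) Σ_{M ≤ m < 2M} |(1/H_M) Σ_{m ≤ h < m+H_M} a(h) μ(h)| = 0. -/

import Mathlib

open Filter Topology MeasureTheory
open scoped FourierTransform

namespace MR
noncomputable section

/-- `e^{ix}`. -/
def ee (x : ℝ) : ℂ := Complex.exp (x * Complex.I)

lemma norm_ee (x : ℝ) : ‖ee x‖ = 1 := by simp [ee, Complex.norm_exp_ofReal_mul_I]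
lemma ee_add (x y : ℝ) : ee (x + y) = ee x * ee y := by
  simp [ee, add_mul, Complex.exp_add]
lemma ee_zero : ee 0 = 1 := by simp [ee]
lemma conj_ee (x : ℝ) : (starRingEnd ℂ) (ee x) = ee (-x) := by
  simp [ee, ← Complex.exp_conj]
lemma continuous_ee : Continuous ee := by unfold ee; fun_prop

lemma integrable_exp_abs {a : ℝ} (ha : 0 < a) :
    Integrable (fun x : ℝ => Real.exp (-(a * |x|))) := by
  rw [← integrableOn_univ, ← Set.Iic_union_Ioi (a := (0:ℝ))]
  refine IntegrableOn.union ?_ ?_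
  · refine (integrableOn_exp_mul_Iic ha 0).congr_fun ?_ measurableSet_Iic
    intro x hx
    simp only [Set.mem_Iic] at hx
    simp [abs_of_nonpos hx]
  · refine (integrableOn_exp_mul_Ioi (a := -a) (by linarith) 0).congr_fun ?_ measurableSet_Ioi
    intro x hx
    simp only [Set.mem_Ioi] at hx
    simp [abs_of_pos hx]

lemma fourier_exp_abs (ξ : ℝ) :
    𝓕 (fun x : ℝ => (Real.exp (-(2 * Real.pi * |x|)) : ℂ)) ξ
      = (((1 / Real.pi) * (1 + ξ ^ 2)⁻¹ : ℝ) : ℂ) := by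
  rw [Real.fourier_real_eq_integral_exp_smul]
  have hpi := Real.pi_pos
  set a : ℂ := 2 * Real.pi * (1 - ξ * Complex.I) with ha
  set b : ℂ := -(2 * Real.pi * (1 + ξ * Complex.I)) with hb
  have hare : 0 < a.re := by simp [ha]; positivity
  have hbre : b.re < 0 := by simp [hb]; positivity
  have h1 : ∀ x ∈ Set.Iic (0:ℝ), Complex.exp (a * x) =
      Complex.exp (↑(-2 * Real.pi * x * ξ) * Complex.I) • (Real.exp (-(2 * Real.pi * |x|)) : ℂ) := by
    intro x hx
    simp only [Set.mem_Iic] at hx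
    rw [abs_of_nonpos hx, smul_eq_mul, Complex.ofReal_exp, ← Complex.exp_add]
    congr 1; push_cast; rw [ha]; ring
  have h2 : ∀ x ∈ Set.Ioi (0:ℝ), Complex.exp (b * x) =
      Complex.exp (↑(-2 * Real.pi * x * ξ) * Complex.I) • (Real.exp (-(2 * Real.pi * |x|)) : ℂ) := by
    intro x hx
    simp only [Set.mem_Ioi] at hx
    rw [abs_of_pos hx, smul_eq_mul, Complex.ofReal_exp, ← Complex.exp_add]
    congr 1; push_cast; rw [hb]; ring
  rw [← setIntegral_univ, ← Set.Iic_union_Ioi (a := (0:ℝ)),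
    setIntegral_union (Set.Iic_disjoint_Ioi le_rfl) measurableSet_Ioi
      ((integrableOn_exp_mul_complex_Iic hare 0).congr_fun h1 measurableSet_Iic)
      ((integrableOn_exp_mul_complex_Ioi hbre 0).congr_fun h2 measurableSet_Ioi),
    ← setIntegral_congr_fun measurableSet_Iic h1, ← setIntegral_congr_fun measurableSet_Ioi h2,
    integral_exp_mul_complex_Iic hare, integral_exp_mul_complex_Ioi hbre]
  have e1 : (1 - ξ * Complex.I : ℂ) ≠ 0 := by
    intro h; have := congrArg Complex.re h; simp at this
  have e2 : (1 + ξ * Complex.I : ℂ) ≠ 0 := by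
    intro h; have := congrArg Complex.re h; simp at this
  have e3 : (1 + ξ ^ 2 : ℂ) = (1 - ξ * Complex.I) * (1 + ξ * Complex.I) := by
    ring_nf; simp
  have e4 : (Real.pi : ℂ) ≠ 0 := by exact_mod_cast hpi.ne'
  push_cast
  rw [e3, ha, hb]
  simp
  field_simp
  ring

lemma cauchy_integral (v : ℝ) :
    ∫ τ : ℝ, ee (v * τ) * ((1 + τ ^ 2)⁻¹ : ℝ) = (Real.pi * Real.exp (-|v|) : ℝ) := by
  have hpi := Real.pi_pos
  set f : ℝ → ℂ := fun x : ℝ => (Real.exp (-(2 * Real.pi * |x|)) : ℂ) with hf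
  have hF : 𝓕 f = fun ξ => (((1 / Real.pi) * (1 + ξ ^ 2)⁻¹ : ℝ) : ℂ) := funext fourier_exp_abs
  have hc : Continuous f := by rw [hf]; fun_prop
  have hi : Integrable f := (integrable_exp_abs (a := 2 * Real.pi) (by positivity)).ofReal
  have hi2 : Integrable (𝓕 f) := by
    rw [hF]; exact (integrable_inv_one_add_sq.const_mul _).ofReal
  have := congrFun (hc.fourierInv_fourier_eq hi hi2) (v / (2 * Real.pi))
  rw [Real.fourierInv_eq', hF] at this
  simp only [hf] at this
  rw [abs_div, abs_of_pos (show 0 < 2 * Real.pi by positivity), mul_div_cancel₀ _ (by positivity)] at this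
  rw [Complex.ofReal_mul, ← this, ← integral_const_mul]
  congr 1; ext τ
  have e4 : (Real.pi : ℂ) ≠ 0 := by exact_mod_cast hpi.ne'
  simp only [ee, smul_eq_mul]
  have e5 : ((2 * Real.pi * inner ℝ τ (v / (2 * Real.pi)) : ℝ) : ℂ) = ((v * τ : ℝ) : ℂ) := by
    congr 1
    simp
    field_simp
  rw [e5]
  push_cast
  field_simp

lemma cauchy_integral_scaled {δ : ℝ} (hδ : 0 < δ) (v : ℝ) :
    ∫ τ : ℝ, ee (v * τ) * ((1 + (δ * τ) ^ 2)⁻¹ : ℝ) = (Real.pi / δ * Real.exp (-(|v| / δ)) : ℝ) := by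
  have := Measure.integral_comp_mul_left (fun τ => ee (v / δ * τ) * ((1 + τ ^ 2)⁻¹ : ℝ)) δ
  rw [cauchy_integral, abs_div, abs_of_pos hδ, abs_of_pos (inv_pos.2 hδ)] at this
  have e : ∀ τ, v / δ * (δ * τ) = v * τ := fun τ => by field_simp
  simp only [e] at this
  rw [this, Complex.real_smul, ← Complex.ofReal_mul]
  congr 1; field_simp

lemma integrable_cauchy_scaled {δ : ℝ} (hδ : 0 < δ) :
    Integrable (fun τ : ℝ => (1 + (δ * τ) ^ 2)⁻¹) :=
  integrable_inv_one_add_sq.comp_mul_left' hδ.ne'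

variable {ι : Type*}

/-- generalised finite Dirichlet polynomial -/
def GD (s : Finset ι) (c : ι → ℂ) (l : ι → ℝ) (t : ℝ) : ℂ := ∑ i ∈ s, c i * ee (-(t * l i))

lemma continuous_GD (s : Finset ι) (c : ι → ℂ) (l : ι → ℝ) : Continuous (GD s c l) := by
  unfold GD
  refine continuous_finsetSum _ fun i _ => ?_
  exact continuous_const.mul (continuous_ee.comp (by fun_prop))

lemma norm_GD_le (s : Finset ι) (c : ι → ℂ) (l : ι → ℝ) (t : ℝ) :
    ‖GD s c l t‖ ≤ ∑ i ∈ s, ‖c i‖ := by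
  unfold GD
  refine (norm_sum_le _ _).trans (Finset.sum_le_sum fun i _ => ?_)
  rw [norm_mul, norm_ee, mul_one]

lemma integrable_GD_sq (s : Finset ι) (c : ι → ℂ) (l : ι → ℝ) {δ : ℝ} (hδ : 0 < δ) :
    Integrable (fun t => ‖GD s c l t‖ ^ 2 * (1 + (δ * t) ^ 2)⁻¹) := by
  refine (integrable_cauchy_scaled hδ).bdd_mul (c := (∑ i ∈ s, ‖c i‖) ^ 2) ?_ ?_
  · exact ((continuous_GD s c l).norm.pow 2).aestronglyMeasurable
  · filter_upwards with t
    rw [norm_pow, norm_norm]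
    exact pow_le_pow_left₀ (norm_nonneg _) (norm_GD_le _ _ _ _) 2

lemma normsq_sum (s : Finset ι) (z : ι → ℂ) :
    ((‖∑ i ∈ s, z i‖ ^ 2 : ℝ) : ℂ) = ∑ i ∈ s, ∑ j ∈ s, z i * (starRingEnd ℂ) (z j) := by
  rw [Complex.ofReal_pow, ← Complex.mul_conj', map_sum, Finset.sum_mul_sum]

lemma PLa (s : Finset ι) (c : ι → ℂ) (l : ι → ℝ) {δ : ℝ} (hδ : 0 < δ) :
    ((∫ t, ‖GD s c l t‖ ^ 2 * (1 + (δ * t) ^ 2)⁻¹ : ℝ) : ℂ) =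
      ∑ i ∈ s, ∑ j ∈ s, c i * (starRingEnd ℂ) (c j) *
        (Real.pi / δ * Real.exp (-(|l i - l j| / δ)) : ℝ) := by
  rw [← integral_complex_ofReal]
  have hInt : ∀ v : ℝ, Integrable (fun t : ℝ => ee (v * t) * ((1 + (δ * t) ^ 2)⁻¹ : ℝ)) := by
    intro v
    refine ((integrable_cauchy_scaled hδ).ofReal).bdd_mul (c := 1) ?_ ?_
    · exact (continuous_ee.comp (by fun_prop)).aestronglyMeasurable
    · filter_upwards with t
      rw [norm_ee]
  have h1 : ∀ t : ℝ, ((‖GD s c l t‖ ^ 2 * (1 + (δ * t) ^ 2)⁻¹ : ℝ) : ℂ) =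
      ∑ i ∈ s, ∑ j ∈ s, c i * (starRingEnd ℂ) (c j) *
        (ee ((l j - l i) * t) * ((1 + (δ * t) ^ 2)⁻¹ : ℝ)) := by
    intro t
    rw [Complex.ofReal_mul, GD, normsq_sum, Finset.sum_mul]
    refine Finset.sum_congr rfl fun i _ => ?_
    rw [Finset.sum_mul]
    refine Finset.sum_congr rfl fun j _ => ?_
    rw [map_mul, conj_ee, show (l j - l i) * t = -(t * l i) + - -(t * l j) by ring, ee_add]
    ring
  simp_rw [h1]
  rw [integral_finsetSum _ (fun i _ => integrable_finsetSum _ fun j _ => (hInt _).const_mul _)]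
  refine Finset.sum_congr rfl fun i _ => ?_
  rw [integral_finsetSum _ (fun j _ => (hInt _).const_mul _)]
  refine Finset.sum_congr rfl fun j _ => ?_
  rw [integral_const_mul, cauchy_integral_scaled hδ, abs_sub_comm]

/-- exponential smoothing -/
def GA (s : Finset ι) (c : ι → ℂ) (l : ι → ℝ) (δ u : ℝ) : ℂ :=
  ∑ i ∈ s, c i * ((if u < l i then Real.exp (-((l i - u) / δ)) else 0 : ℝ) : ℂ)

lemma expker_int {δ : ℝ} (hδ : 0 < δ) (x y : ℝ) :
    Integrable (fun u => (if u < x then Real.exp (-((x - u) / δ)) else 0) *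
      (if u < y then Real.exp (-((y - u) / δ)) else 0)) ∧
    ∫ u, (if u < x then Real.exp (-((x - u) / δ)) else 0) *
      (if u < y then Real.exp (-((y - u) / δ)) else 0) = δ / 2 * Real.exp (-(|x - y| / δ)) := by
  have h : (fun u => (if u < x then Real.exp (-((x - u) / δ)) else 0) *
      (if u < y then Real.exp (-((y - u) / δ)) else 0)) =
      (Set.Iio (min x y)).indicator (fun u => Real.exp (-((x + y) / δ)) * Real.exp (2 / δ * u)) := by
    ext u
    rw [Set.indicator_apply]
    by_cases h1 : u < x <;> by_cases h2 : u < y <;> simp [h1, h2, ← Real.exp_add]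
    ring
  have hδ2 : 0 < 2 / δ := by positivity
  have hi : IntegrableOn (fun u => Real.exp (-((x + y) / δ)) * Real.exp (2 / δ * u)) (Set.Iio (min x y)) :=
    ((integrableOn_exp_mul_Iic hδ2 (min x y)).mono_set Set.Iio_subset_Iic_self).const_mul _
  refine ⟨by rw [h]; exact hi.integrable_indicator measurableSet_Iio, ?_⟩
  rw [h, integral_indicator measurableSet_Iio, integral_const_mul, ← integral_Iic_eq_integral_Iio,
    integral_exp_mul_Iic hδ2, mul_div_assoc', ← Real.exp_add]
  have : -((x + y) / δ) + 2 / δ * min x y = -(|x - y| / δ) := by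
    rcases le_total x y with h | h
    · rw [min_eq_left h, abs_of_nonpos (by linarith)]; field_simp; ring
    · rw [min_eq_right h, abs_of_nonneg (by linarith)]; field_simp; ring
  rw [this]; field_simp

lemma PLb_aux (s : Finset ι) (c : ι → ℂ) (l : ι → ℝ) (δ : ℝ) (u : ℝ) :
   ((‖GA s c l δ u‖ ^ 2 : ℝ) : ℂ) = ∑ i ∈ s, ∑ j ∈ s, c i * (starRingEnd ℂ) (c j) *
     (((if u < l i then Real.exp (-((l i - u) / δ)) else 0) *
      (if u < l j then Real.exp (-((l j - u) / δ)) else 0) : ℝ) : ℂ) := by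
  rw [GA, normsq_sum]
  refine Finset.sum_congr rfl fun i _ => Finset.sum_congr rfl fun j _ => ?_
  rw [map_mul, Complex.conj_ofReal, Complex.ofReal_mul]; ring

lemma integrable_GA_sq (s : Finset ι) (c : ι → ℂ) (l : ι → ℝ) {δ : ℝ} (hδ : 0 < δ) :
    Integrable (fun u => ‖GA s c l δ u‖ ^ 2) := by
  have : Integrable (fun u => ((‖GA s c l δ u‖ ^ 2 : ℝ) : ℂ)) := by
    simp_rw [PLb_aux]
    exact integrable_finsetSum _ fun i _ => integrable_finsetSum _ fun j _ =>
      ((expker_int hδ _ _).1.ofReal).const_mul _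
  exact this.re

lemma PLb (s : Finset ι) (c : ι → ℂ) (l : ι → ℝ) {δ : ℝ} (hδ : 0 < δ) :
    ((∫ u, ‖GA s c l δ u‖ ^ 2 : ℝ) : ℂ) =
      ∑ i ∈ s, ∑ j ∈ s, c i * (starRingEnd ℂ) (c j) *
        (δ / 2 * Real.exp (-(|l i - l j| / δ)) : ℝ) := by
  rw [← integral_complex_ofReal]
  simp_rw [PLb_aux]
  rw [integral_finsetSum _ (fun i _ => integrable_finsetSum _ fun j _ =>
    ((expker_int hδ _ _).1.ofReal).const_mul _)]
  refine Finset.sum_congr rfl fun i _ => ?_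
  rw [integral_finsetSum _ (fun j _ => ((expker_int hδ _ _).1.ofReal).const_mul _)]
  refine Finset.sum_congr rfl fun j _ => ?_
  rw [integral_const_mul, integral_complex_ofReal, (expker_int hδ _ _).2]

theorem PL (s : Finset ι) (c : ι → ℂ) (l : ι → ℝ) {δ : ℝ} (hδ : 0 < δ) :
    ∫ t, ‖GD s c l t‖ ^ 2 * (1 + (δ * t) ^ 2)⁻¹ =
      2 * Real.pi / δ ^ 2 * ∫ u, ‖GA s c l δ u‖ ^ 2 := by
  have : ((∫ t, ‖GD s c l t‖ ^ 2 * (1 + (δ * t) ^ 2)⁻¹ : ℝ) : ℂ) =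
      ((2 * Real.pi / δ ^ 2 * ∫ u, ‖GA s c l δ u‖ ^ 2 : ℝ) : ℂ) := by
    rw [PLa s c l hδ, Complex.ofReal_mul, PLb s c l hδ, Finset.mul_sum]
    refine Finset.sum_congr rfl fun i _ => ?_
    rw [Finset.mul_sum]
    refine Finset.sum_congr rfl fun j _ => ?_
    have : (Real.pi / δ * Real.exp (-(|l i - l j| / δ)) : ℝ) =
      2 * Real.pi / δ ^ 2 * (δ / 2 * Real.exp (-(|l i - l j| / δ))) := by field_simp
    rw [this]; push_cast; ring
  exact_mod_cast this

/-- The absolute value bound for the Cauchy-weighted mean square. -/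
lemma PL_le (s : Finset ι) (c : ι → ℂ) (l : ι → ℝ) {δ : ℝ} (hδ : 0 < δ) :
    ∫ t, ‖GD s c l t‖ ^ 2 * (1 + (δ * t) ^ 2)⁻¹ ≤
      Real.pi / δ * ∑ i ∈ s, ∑ j ∈ s, ‖c i‖ * ‖c j‖ * Real.exp (-(|l i - l j| / δ)) := by
  have h0 : 0 ≤ ∫ t, ‖GD s c l t‖ ^ 2 * (1 + (δ * t) ^ 2)⁻¹ :=
    integral_nonneg fun t => by positivity
  have hpi := Real.pi_pos
  have h1 := congrArg norm (PLa s c l hδ)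
  rw [Complex.norm_real, Real.norm_of_nonneg h0] at h1
  rw [h1, Finset.mul_sum]
  refine (norm_sum_le _ _).trans (Finset.sum_le_sum fun i _ => ?_)
  rw [Finset.mul_sum]
  refine (norm_sum_le _ _).trans (Finset.sum_le_sum fun j _ => ?_)
  rw [norm_mul, norm_mul, RCLike.norm_conj, Complex.norm_real, Real.norm_of_nonneg (by positivity)]
  exact le_of_eq (by ring)

/-- Schur test, finite version. -/
lemma schur_sum (s : Finset ι) (x : ι → ℝ) (k : ι → ι → ℝ) (hk : ∀ i ∈ s, ∀ j ∈ s, 0 ≤ k i j)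
    (hs : ∀ i ∈ s, ∀ j ∈ s, k i j = k j i) (B : ℝ) (hB : ∀ i ∈ s, ∑ j ∈ s, k i j ≤ B) :
    ∑ i ∈ s, ∑ j ∈ s, x i * x j * k i j ≤ B * ∑ i ∈ s, x i ^ 2 := by
  have h1 : ∑ i ∈ s, ∑ j ∈ s, x i * x j * k i j ≤
      ∑ i ∈ s, ∑ j ∈ s, (x i ^ 2 * k i j / 2 + x j ^ 2 * k i j / 2) := by
    refine Finset.sum_le_sum fun i hi => Finset.sum_le_sum fun j hj => ?_
    have := mul_nonneg (sq_nonneg (x i - x j)) (hk i hi j hj)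
    nlinarith
  have h2 : ∑ i ∈ s, ∑ j ∈ s, x j ^ 2 * k i j / 2 = ∑ i ∈ s, ∑ j ∈ s, x i ^ 2 * k i j / 2 := by
    rw [Finset.sum_comm]
    exact Finset.sum_congr rfl fun i hi => Finset.sum_congr rfl fun j hj => by rw [hs j hj i hi]
  refine h1.trans ?_
  simp_rw [Finset.sum_add_distrib]
  rw [h2, ← two_mul, Finset.mul_sum, Finset.mul_sum]
  refine Finset.sum_le_sum fun i hi => ?_
  rw [← Finset.sum_div, ← Finset.mul_sum]
  have := mul_le_mul_of_nonneg_left (hB i hi) (sq_nonneg (x i))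
  linarith

lemma GD_mvt_gen (s : Finset ι) (c : ι → ℂ) (l : ι → ℝ) {T : ℝ} (hT : 0 < T) (B : ℝ)
    (hB : ∀ i ∈ s, ∑ j ∈ s, Real.exp (-(T * |l i - l j|)) ≤ B) :
    ∫ t in Set.Icc (-T) T, ‖GD s c l t‖ ^ 2 ≤ 2 * Real.pi * T * B * ∑ i ∈ s, ‖c i‖ ^ 2 := by
  have hδ : 0 < T⁻¹ := inv_pos.2 hT
  have hpi := Real.pi_pos
  have h1 : ∫ t in Set.Icc (-T) T, ‖GD s c l t‖ ^ 2 ≤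
      ∫ t in Set.Icc (-T) T, 2 * (‖GD s c l t‖ ^ 2 * (1 + (T⁻¹ * t) ^ 2)⁻¹) := by
    refine setIntegral_mono_on ?_ ?_ measurableSet_Icc ?_
    · exact ((continuous_GD s c l).norm.pow 2).integrableOn_Icc
    · exact ((integrable_GD_sq s c l hδ).const_mul 2).integrableOn
    · intro t ht
      have h2 : (T⁻¹ * t) ^ 2 ≤ 1 := by
        rw [sq_le_one_iff_abs_le_one, abs_mul, abs_of_pos hδ, inv_mul_le_iff₀ hT, mul_one]
        exact abs_le.2 ht
      have h3 : (1:ℝ)/2 ≤ (1 + (T⁻¹ * t) ^ 2)⁻¹ := by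
        rw [one_div]; apply inv_anti₀ <;> nlinarith [sq_nonneg (T⁻¹ * t)]
      nlinarith [mul_le_mul_of_nonneg_left h3 (sq_nonneg ‖GD s c l t‖)]
  have h2 : ∫ t in Set.Icc (-T) T, 2 * (‖GD s c l t‖ ^ 2 * (1 + (T⁻¹ * t) ^ 2)⁻¹) ≤
      ∫ t, 2 * (‖GD s c l t‖ ^ 2 * (1 + (T⁻¹ * t) ^ 2)⁻¹) :=
    setIntegral_le_integral ((integrable_GD_sq s c l hδ).const_mul 2)
      (Eventually.of_forall fun t => by positivity)
  refine h1.trans (h2.trans ?_)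
  rw [integral_const_mul]
  have h3 := PL_le s c l hδ
  have h4 := schur_sum s (fun i => ‖c i‖) (fun i j => Real.exp (-(T * |l i - l j|)))
    (fun _ _ _ _ => (Real.exp_pos _).le) (fun i _ j _ => by rw [abs_sub_comm]) B hB
  have e : ∀ i j, |l i - l j| / T⁻¹ = T * |l i - l j| := fun i j => by field_simp
  simp_rw [e] at h3
  rw [show Real.pi / T⁻¹ = Real.pi * T by field_simp] at h3
  have h5 := mul_le_mul_of_nonneg_left h4 (show 0 ≤ Real.pi * T by positivity)
  calc _ ≤ 2 * (Real.pi * T * (B * ∑ i ∈ s, ‖c i‖ ^ 2)) := by linarith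
    _ = _ := by ring

/-- Dirichlet polynomial over `1 ≤ n < N`. -/
def D (N : ℕ) (c : ℕ → ℂ) (t : ℝ) : ℂ := GD (Finset.Ico 1 N) c (fun n => Real.log n) t

lemma D_def (N : ℕ) (c : ℕ → ℂ) (t : ℝ) :
    D N c t = ∑ n ∈ Finset.Ico 1 N, c n * ee (-(t * Real.log n)) := rfl

lemma continuous_D (N : ℕ) (c : ℕ → ℂ) : Continuous (D N c) := continuous_GD _ _ _

lemma norm_D_le (N : ℕ) (c : ℕ → ℂ) (t : ℝ) : ‖D N c t‖ ≤ ∑ n ∈ Finset.Ico 1 N, ‖c n‖ :=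
  norm_GD_le _ _ _ _

lemma D_ext {N N' : ℕ} (hN : N ≤ N') {c : ℕ → ℂ} (h : ∀ n, N ≤ n → c n = 0) (t : ℝ) :
    D N' c t = D N c t := by
  rw [D_def, D_def]
  symm
  refine Finset.sum_subset (Finset.Ico_subset_Ico_right hN) fun n hn hn' => ?_
  rw [Finset.mem_Ico] at hn hn'
  rw [h n (by omega), zero_mul]

lemma D_sub (N : ℕ) (c d : ℕ → ℂ) (t : ℝ) : D N (fun n => c n - d n) t = D N c t - D N d t := by
  simp only [D_def, sub_mul, Finset.sum_sub_distrib]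

lemma D_sum {κ : Type*} (N : ℕ) (s : Finset κ) (c : κ → ℕ → ℂ) (t : ℝ) :
    D N (fun n => ∑ k ∈ s, c k n) t = ∑ k ∈ s, D N (c k) t := by
  simp only [D_def, Finset.sum_mul]
  rw [Finset.sum_comm]

lemma D_smul (N : ℕ) (a : ℂ) (c : ℕ → ℂ) (t : ℝ) : D N (fun n => a * c n) t = a * D N c t := by
  simp only [D_def, Finset.mul_sum, mul_assoc]

lemma sum_geom_abs {r : ℝ} (h0 : 0 ≤ r) (h1 : r < 1) (s : Finset ℕ) (n : ℕ) :
    ∑ m ∈ s, r ^ (max n m - min n m) ≤ (1 + r) / (1 - r) := by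
  have hs := hasSum_geometric_of_lt_one h0 h1
  have hb : ∀ t : Finset ℕ, ∑ k ∈ t, r ^ k ≤ (1 - r)⁻¹ := fun t =>
    sum_le_hasSum t (fun i _ => pow_nonneg h0 i) hs
  rw [← Finset.sum_filter_add_sum_filter_not s (fun m => m ≤ n)]
  have e1 : ∑ m ∈ s with m ≤ n, r ^ (max n m - min n m) ≤ (1 - r)⁻¹ := by
    refine le_trans (le_of_eq ?_) (hb ((s.filter (fun m => m ≤ n)).image (fun m => n - m)))
    rw [Finset.sum_image]
    · refine Finset.sum_congr rfl fun m hm => ?_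
      rw [Finset.mem_filter] at hm
      rw [max_eq_left hm.2, min_eq_right hm.2]
    · intro x hx y hy hxy
      simp only [Finset.coe_filter, Set.mem_ofPred_eq] at hx hy
      simp only at hxy
      omega
  have e2 : ∑ m ∈ s with ¬ m ≤ n, r ^ (max n m - min n m) ≤ r * (1 - r)⁻¹ := by
    refine le_trans (le_of_eq ?_) (mul_le_mul_of_nonneg_left
      (hb ((s.filter (fun m => ¬ m ≤ n)).image (fun m => m - n - 1))) h0)
    rw [Finset.sum_image, Finset.mul_sum]
    · refine Finset.sum_congr rfl fun m hm => ?_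
      rw [Finset.mem_filter] at hm
      rw [max_eq_right (by omega), min_eq_left (by omega), ← pow_succ']
      congr 1; omega
    · intro x hx y hy hxy
      simp only [Finset.coe_filter, Set.mem_ofPred_eq] at hx hy
      simp only at hxy
      omega
  calc _ ≤ (1 - r)⁻¹ + r * (1 - r)⁻¹ := add_le_add e1 e2
    _ = _ := by field_simp

lemma abs_log_sub_ge {n m N : ℕ} (hn : 1 ≤ n) (hm : 1 ≤ m) (hn' : n ≤ N) (hm' : m ≤ N) :
    ((max n m - min n m : ℕ) : ℝ) / N ≤ |Real.log n - Real.log m| := by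
  wlog h : m ≤ n generalizing n m
  · rw [max_comm, min_comm, abs_sub_comm]; exact this hm hn hm' hn' (by omega)
  rw [max_eq_left h, min_eq_right h]
  have hn0 : (0:ℝ) < n := by exact_mod_cast hn
  have hm0 : (0:ℝ) < m := by exact_mod_cast hm
  have h1 := Real.one_sub_inv_le_log_of_pos (div_pos hn0 hm0)
  rw [Real.log_div hn0.ne' hm0.ne', inv_div] at h1
  refine le_trans ?_ (h1.trans (le_abs_self _))
  rw [Nat.cast_sub h, one_sub_div hn0.ne']
  apply div_le_div_of_nonneg_left _ hn0 (by exact_mod_cast hn')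
  rw [sub_nonneg]; exact_mod_cast h

lemma exp_log_sum {N n : ℕ} (hn : n ∈ Finset.Ico 1 N) {T : ℝ} (hT : 0 < T) :
    ∑ m ∈ Finset.Ico 1 N, Real.exp (-(T * |Real.log n - Real.log m|)) ≤ 1 + 2 * N / T := by
  rw [Finset.mem_Ico] at hn
  have hN0 : (0:ℝ) < N := by exact_mod_cast (by omega : 0 < N)
  set r := Real.exp (-(T / N)) with hr
  have hr1 : r < 1 := by rw [hr, Real.exp_lt_one_iff]; simp; positivity
  have hr0 : 0 < r := Real.exp_pos _
  have h1 := sum_geom_abs hr0.le hr1 (Finset.Ico 1 N) n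
  have h2 : (1 + r) / (1 - r) ≤ 1 + 2 * N / T := by
    have h3 : T / N + 1 ≤ Real.exp (T / N) := Real.add_one_le_exp _
    have h4 : r * Real.exp (T / N) = 1 := by rw [hr, ← Real.exp_add]; simp
    have h5 : r * (T / N + 1) ≤ 1 := by
      have := mul_le_mul_of_nonneg_left h3 hr0.le; rwa [h4] at this
    rw [div_le_iff₀ (by linarith)]
    have h6 : r * (T / N) ≤ 1 - r := by linarith
    have h7 : r ≤ (1 - r) * (N / T) := by
      calc r = r * (T / N) * (N / T) := by field_simp
        _ ≤ _ := by gcongr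
    have : 2 * (N:ℝ) / T = 2 * (N / T) := by ring
    rw [this]; nlinarith
  refine le_trans (Finset.sum_le_sum fun m hm => ?_) (h1.trans h2)
  rw [Finset.mem_Ico] at hm
  rw [hr, ← Real.exp_nat_mul]
  apply Real.exp_le_exp.2
  have := abs_log_sub_ge hn.1 hm.1 hn.2.le hm.2.le
  have := mul_le_mul_of_nonneg_left this hT.le
  calc _ ≤ -(T * (((max n m - min n m : ℕ) : ℝ) / N)) := by linarith
    _ = _ := by ring

lemma D_mvt (N : ℕ) (c : ℕ → ℂ) {T : ℝ} (hT : 0 < T) :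
    ∫ t in Set.Icc (-T) T, ‖D N c t‖ ^ 2 ≤
      7 * (T + 2 * N) * ∑ n ∈ Finset.Ico 1 N, ‖c n‖ ^ 2 := by
  rcases Nat.eq_zero_or_pos N with rfl | hN
  · simp [D_def]
  have := GD_mvt_gen (Finset.Ico 1 N) c (fun n : ℕ => Real.log n) hT (1 + 2 * N / T) fun n hn => exp_log_sum hn hT
  refine this.trans ?_
  have hpi : Real.pi ≤ 3.5 := Real.pi_lt_d2.le.trans (by norm_num)
  refine mul_le_mul_of_nonneg_right ?_ (by positivity)
  · calc 2 * Real.pi * T * (1 + 2 * N / T) = 2 * Real.pi * (T + 2 * N) := by field_simp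
      _ ≤ 7 * (T + 2 * N) := by gcongr; linarith

/-- multiplication of Dirichlet polynomials -/
lemma GD_mul_D (P : Finset ℕ) (hP : ∀ p ∈ P, 1 ≤ p) (b c : ℕ → ℂ) (N N' : ℕ)
    (hc : ∀ m, N ≤ m → c m = 0) (hN' : ∀ p ∈ P, ∀ m < N, p * m < N') (t : ℝ) :
    GD P b (fun n => Real.log n) t * D N c t =
      D N' (fun n => ∑ p ∈ P with p ∣ n, b p * c (n / p)) t := by
  rw [D_def, D_def, GD, Finset.sum_mul]
  simp only [Finset.sum_filter, Finset.sum_mul]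
  rw [Finset.sum_comm]
  refine Finset.sum_congr rfl fun p hp => ?_
  have hp1 := hP p hp
  rw [Finset.mul_sum]
  rw [← Finset.sum_subset (s₁ := (Finset.Ico 1 N).image (fun m => p * m)) (s₂ := Finset.Ico 1 N')]
  · rw [Finset.sum_image]
    · refine Finset.sum_congr rfl fun m hm => ?_
      rw [Finset.mem_Ico] at hm
      rw [if_pos (dvd_mul_right _ _), Nat.mul_div_cancel_left _ hp1, Nat.cast_mul,
        Real.log_mul (by positivity) (by have := hm.1; positivity),
        show -(t * (Real.log p + Real.log m)) = -(t * Real.log p) + -(t * Real.log m) by ring, ee_add]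
      ring
    · intro x _ y _ hxy
      exact Nat.eq_of_mul_eq_mul_left hp1 hxy
  · intro n hn
    rw [Finset.mem_image] at hn
    obtain ⟨m, hm, rfl⟩ := hn
    rw [Finset.mem_Ico] at hm ⊢
    exact ⟨Nat.mul_pos hp1 hm.1, hN' p hp m hm.2⟩
  · intro n hn hn'
    rw [Finset.mem_Ico] at hn
    split_ifs with h
    · obtain ⟨m, rfl⟩ := h
      rw [Nat.mul_div_cancel_left _ hp1]
      have : N ≤ m := by
        by_contra hlt
        apply hn'
        rw [Finset.mem_image]
        refine ⟨m, Finset.mem_Ico.2 ⟨?_, by omega⟩, rfl⟩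
        rcases Nat.eq_zero_or_pos m with rfl | h
        · simp at hn
        · exact h
      rw [hc m this]; simp
    · simp

/-- the trapezoid -/
def w (x : ℝ) : ℝ := max 0 (min 1 (min (x + 1) (3 - x)))

lemma w_nonneg (x : ℝ) : 0 ≤ w x := le_max_left _ _
lemma w_le_one (x : ℝ) : w x ≤ 1 := max_le zero_le_one (min_le_left _ _)
lemma w_eq_zero_left {x : ℝ} (h : x ≤ -1) : w x = 0 :=
  max_eq_left ((min_le_right _ _).trans ((min_le_left _ _).trans (by linarith)))
lemma w_eq_zero_right {x : ℝ} (h : 3 ≤ x) : w x = 0 :=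
  max_eq_left ((min_le_right _ _).trans ((min_le_right _ _).trans (by linarith)))
lemma w_eq_one {x : ℝ} (h : 0 ≤ x) (h' : x ≤ 2) : w x = 1 := by
  unfold w; rw [min_eq_left (le_min (by linarith) (by linarith)), max_eq_right zero_le_one]
lemma w_lip (x y : ℝ) : |w x - w y| ≤ |x - y| := by
  unfold w
  refine (abs_max_sub_max_le_max _ _ _ _).trans (max_le (by simp) ?_)
  refine (abs_min_sub_min_le_max _ _ _ _).trans (max_le (by simp) ?_)
  refine (abs_min_sub_min_le_max _ _ _ _).trans (max_le ?_ ?_)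
  · rw [show x + 1 - (y + 1) = x - y by ring]
  · rw [show 3 - x - (3 - y) = -(x - y) by ring, abs_neg]
lemma continuous_w : Continuous w := by unfold w; fun_prop

/-- coefficients of `R` -/
def rc (f : ℕ → ℂ) (y : ℝ) (n : ℕ) : ℂ := f n * ((w (Real.log n - y) / n : ℝ) : ℂ)

/-- number of terms -/
def NN (y : ℝ) : ℕ := ⌊Real.exp y⌋₊ + 1

lemma lt_NN (y : ℝ) : Real.exp y < NN y := by
  unfold NN; push_cast; exact Nat.lt_floor_add_one _
lemma NN_le (y : ℝ) : (NN y : ℝ) ≤ Real.exp y + 1 := by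
  unfold NN; push_cast
  linarith [Nat.floor_le (Real.exp_pos y).le]
lemma le_log_of_NN_le {y : ℝ} {n : ℕ} (h : NN y ≤ n) : y ≤ Real.log n := by
  have h1 : Real.exp y ≤ n := (lt_NN y).le.trans (by exact_mod_cast h)
  rwa [Real.le_log_iff_exp_le ((Real.exp_pos y).trans_le h1)]
lemma lt_NN_of_log {y : ℝ} {n : ℕ} (hn : 1 ≤ n) (h : Real.log n ≤ y) : n < NN y := by
  rw [Real.log_le_iff_le_exp (by exact_mod_cast hn)] at h
  exact_mod_cast h.trans_lt (lt_NN y)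

/-- the basic Dirichlet polynomial -/
def R (f : ℕ → ℂ) (y t : ℝ) : ℂ := D (NN (y + 3)) (rc f y) t

lemma rc_eq_zero {f : ℕ → ℂ} {y : ℝ} {n : ℕ} (h : Real.log n ≤ y - 1 ∨ y + 3 ≤ Real.log n) :
    rc f y n = 0 := by
  unfold rc
  rcases h with h | h
  · rw [w_eq_zero_left (by linarith)]; simp
  · rw [w_eq_zero_right (by linarith)]; simp

lemma R_eq (f : ℕ → ℂ) (y t : ℝ) {N : ℕ} (hN : NN (y + 3) ≤ N) : R f y t = D N (rc f y) t :=
  (D_ext hN (fun _ hn => rc_eq_zero (Or.inr (le_log_of_NN_le hn))) t).symm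

lemma continuous_R (f : ℕ → ℂ) (y : ℝ) : Continuous (R f y) := continuous_D _ _

lemma norm_rc_le {f : ℕ → ℂ} (hf : ∀ n, ‖f n‖ ≤ 1) (y : ℝ) (n : ℕ) :
    ‖rc f y n‖ ≤ w (Real.log n - y) / n := by
  unfold rc
  rw [norm_mul, Complex.norm_real, Real.norm_of_nonneg (div_nonneg (w_nonneg _) (Nat.cast_nonneg _))]
  exact mul_le_of_le_one_left (div_nonneg (w_nonneg _) (Nat.cast_nonneg _)) (hf n)

/-- sums of coefficients supported in a logarithmic window -/
lemma sum_window {c : ℕ → ℂ} {g : ℕ → ℝ} (hg : ∀ n, 0 ≤ g n) {z z' : ℝ} (N : ℕ)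
    (hc : ∀ n, 1 ≤ n → ‖c n‖ ≤ g n / n)
    (hs : ∀ n, 1 ≤ n → c n ≠ 0 → z ≤ Real.log n ∧ Real.log n ≤ z') (k : ℕ) (hk : k ≠ 0) :
    ∑ n ∈ Finset.Ico 1 N, ‖c n‖ ^ k ≤
      Real.exp (-(k * z)) * ∑ n ∈ Finset.Ico 1 (NN z'), g n ^ k := by
  rw [← Finset.sum_filter_ne_zero, Finset.mul_sum]
  refine le_trans (Finset.sum_le_sum_of_subset_of_nonneg (t := Finset.Ico 1 (NN z')) (f := fun n => ‖c n‖ ^ k) ?_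
    (fun _ _ _ => by positivity)) (Finset.sum_le_sum fun n hn => ?_)
  · intro n hn
    simp only [Finset.mem_filter, Finset.mem_Ico] at hn ⊢
    have : c n ≠ 0 := by intro h; apply hn.2; rw [h]; simp [hk]
    exact ⟨hn.1.1, lt_NN_of_log hn.1.1 (hs n hn.1.1 this).2⟩
  · rw [Finset.mem_Ico] at hn
    by_cases h0 : c n = 0
    · rw [h0, norm_zero, zero_pow hk]
      have := hg n; positivity
    have h1 := (hs n hn.1 h0).1
    have hn0 : (0:ℝ) < n := by exact_mod_cast hn.1
    rw [Real.le_log_iff_exp_le hn0] at h1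
    calc ‖c n‖ ^ k ≤ (g n / n) ^ k := pow_le_pow_left₀ (norm_nonneg _) (hc n hn.1) k
      _ ≤ (g n / Real.exp z) ^ k := by
        apply pow_le_pow_left₀ (div_nonneg (hg n) hn0.le)
        exact div_le_div_of_nonneg_left (hg n) (Real.exp_pos _) h1
      _ = _ := by
        rw [div_pow, ← Real.exp_nat_mul, Real.exp_neg]; ring

lemma rc_supp {f : ℕ → ℂ} {y : ℝ} (n : ℕ) (h : rc f y n ≠ 0) :
    y - 1 ≤ Real.log n ∧ Real.log n ≤ y + 3 := by
  constructor
  · by_contra hh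
    exact h (rc_eq_zero (Or.inl (by linarith)))
  · by_contra hh
    exact h (rc_eq_zero (Or.inr (by linarith)))

lemma card_NN (y : ℝ) : ((Finset.Ico 1 (NN y)).card : ℝ) ≤ Real.exp y := by
  rw [Nat.card_Ico]; unfold NN; simp only [Nat.add_sub_cancel]
  exact Nat.floor_le (Real.exp_pos y).le

lemma sum_norm_rc_le {f : ℕ → ℂ} (hf : ∀ n, ‖f n‖ ≤ 1) (y : ℝ) (N : ℕ) :
    ∑ n ∈ Finset.Ico 1 N, ‖rc f y n‖ ≤ Real.exp 4 := by
  have := sum_window (c := rc f y) (g := fun _ => 1) (fun _ => zero_le_one) N (z := y - 1) (z' := y + 3)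
    (fun n _ => (norm_rc_le hf y n).trans (by gcongr; exact w_le_one _)) (fun n _ h => rc_supp n h) 1 one_ne_zero
  simp only [pow_one] at this
  refine this.trans ?_
  rw [Finset.sum_const, nsmul_eq_mul, mul_one]
  calc _ ≤ Real.exp (-((1:ℕ) * (y - 1))) * Real.exp (y + 3) := by gcongr; exact card_NN _
    _ = Real.exp 4 := by rw [← Real.exp_add]; congr 1; push_cast; ring

lemma norm_R_le {f : ℕ → ℂ} (hf : ∀ n, ‖f n‖ ≤ 1) (y t : ℝ) : ‖R f y t‖ ≤ Real.exp 4 :=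
  (norm_D_le _ _ _).trans (sum_norm_rc_le hf y _)

lemma sum_norm_rc_sq_le {f : ℕ → ℂ} (hf : ∀ n, ‖f n‖ ≤ 1) (y : ℝ) (N : ℕ) :
    ∑ n ∈ Finset.Ico 1 N, ‖rc f y n‖ ^ 2 ≤ Real.exp (5 - y) := by
  have := sum_window (c := rc f y) (g := fun _ => 1) (fun _ => zero_le_one) N (z := y - 1) (z' := y + 3)
    (fun n _ => (norm_rc_le hf y n).trans (by gcongr; exact w_le_one _)) (fun n _ h => rc_supp n h) 2 two_ne_zero
  simp only [one_pow] at this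
  refine this.trans ?_
  rw [Finset.sum_const, nsmul_eq_mul, mul_one]
  calc _ ≤ Real.exp (-((2:ℕ) * (y - 1))) * Real.exp (y + 3) := by gcongr; exact card_NN _
    _ = _ := by rw [← Real.exp_add]; congr 1; push_cast; ring

lemma norm_R_sub_le {f : ℕ → ℂ} (hf : ∀ n, ‖f n‖ ≤ 1) {y y' : ℝ} (h : y ≤ y') (h' : y' ≤ y + 1) (t : ℝ) :
    ‖R f y t - R f y' t‖ ≤ Real.exp 5 * (y' - y) := by
  have hN : NN (y + 3) ≤ NN (y' + 3) := by
    unfold NN; gcongr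
  rw [R_eq f y t hN, R, ← D_sub]
  refine (norm_D_le _ _ _).trans ?_
  have := sum_window (c := fun n => rc f y n - rc f y' n) (g := fun _ => y' - y)
    (fun _ => sub_nonneg.2 h) (NN (y' + 3)) (z := y - 1) (z' := y + 4)
    (fun n hn => by
      unfold rc
      rw [← mul_sub, ← Complex.ofReal_sub, norm_mul, Complex.norm_real, ← sub_div, norm_div, Real.norm_natCast]
      have h1 := w_lip (Real.log n - y) (Real.log n - y')
      rw [show Real.log n - y - (Real.log n - y') = y' - y by ring, abs_of_nonneg (sub_nonneg.2 h)] at h1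
      calc _ ≤ 1 * (‖w (Real.log n - y) - w (Real.log n - y')‖ / n) := by gcongr; exact hf n
        _ ≤ _ := by rw [one_mul]; gcongr; exact h1)
    (fun n hn hne => by
      by_cases h1 : rc f y n = 0
      · have h2 : rc f y' n ≠ 0 := by intro h2; apply hne; rw [h1, h2, sub_zero]
        have := rc_supp n h2
        constructor <;> linarith
      · have := rc_supp n h1
        constructor <;> linarith) 1 one_ne_zero
  simp only [pow_one] at this
  refine this.trans ?_
  rw [Finset.sum_const, nsmul_eq_mul]
  calc _ ≤ Real.exp (-((1:ℕ) * (y - 1))) * (Real.exp (y + 4) * (y' - y)) := by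
        gcongr
        exact card_NN _
    _ = _ := by rw [← mul_assoc, ← Real.exp_add]; congr 2; push_cast; ring

lemma card_dvd (X d : ℕ) : ∑ n ∈ Finset.Ico 1 (X + 1), (if d ∣ n then (1:ℝ) else 0) = ((X / d : ℕ) : ℝ) := by
  rw [← Nat.Ioc_filter_dvd_card_eq_div, Finset.card_filter]
  push_cast
  rfl

lemma card_dvd_le (X d : ℕ) : ∑ n ∈ Finset.Ico 1 (X + 1), (if d ∣ n then (1:ℝ) else 0) ≤ X / d := by
  rw [card_dvd]; exact Nat.cast_div_le

/-- number of elements of `S` dividing `n` -/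
def om (S : Finset ℕ) (n : ℕ) : ℝ := ∑ p ∈ S, if p ∣ n then (1:ℝ) else 0

lemma om_nonneg (S : Finset ℕ) (n : ℕ) : 0 ≤ om S n :=
  Finset.sum_nonneg fun _ _ => by split_ifs <;> norm_num

lemma om_sq (S : Finset ℕ) (hS : ∀ p ∈ S, ∀ q ∈ S, p ≠ q → Nat.Coprime p q) (X : ℕ) :
    ∑ n ∈ Finset.Ico 1 (X + 1), om S n ^ 2 ≤
      X * ((∑ p ∈ S, 1 / (p:ℝ)) ^ 2 + ∑ p ∈ S, 1 / (p:ℝ)) := by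
  have h1 : ∀ n, om S n ^ 2 = ∑ p ∈ S, ∑ q ∈ S, (if p ∣ n then (1:ℝ) else 0) * (if q ∣ n then (1:ℝ) else 0) := by
    intro n; rw [om, sq, Finset.sum_mul_sum]
  simp_rw [h1]
  rw [Finset.sum_comm, sq, Finset.sum_mul_sum, ← Finset.sum_add_distrib, Finset.mul_sum]
  refine Finset.sum_le_sum fun p hp => ?_
  rw [Finset.sum_comm]
  have h2 : ∀ q ∈ S, ∑ n ∈ Finset.Ico 1 (X + 1), (if p ∣ n then (1:ℝ) else 0) * (if q ∣ n then (1:ℝ) else 0)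
      ≤ X * (1 / (p:ℝ) * (1 / q)) + if p = q then X * (1 / (p:ℝ)) else 0 := by
    intro q hq
    by_cases hpq : p = q
    · subst hpq
      have := card_dvd_le X p
      have e : ∀ n, (if p ∣ n then (1:ℝ) else 0) * (if p ∣ n then (1:ℝ) else 0) = if p ∣ n then (1:ℝ) else 0 := by
        intro n; split_ifs <;> simp
      simp_rw [e]
      have h3 : (0:ℝ) ≤ X * (1 / (p:ℝ) * (1 / p)) := by positivity
      simp only [if_true, mul_one_div] at *; linarith
    · have hc := hS p hp q hq hpq
      have e : ∀ n, (if p ∣ n then (1:ℝ) else 0) * (if q ∣ n then (1:ℝ) else 0) = if p * q ∣ n then (1:ℝ) else 0 := by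
        intro n
        have : p * q ∣ n ↔ p ∣ n ∧ q ∣ n :=
          ⟨fun h => ⟨(dvd_mul_right p q).trans h, (dvd_mul_left q p).trans h⟩, fun h => hc.mul_dvd_of_dvd_of_dvd h.1 h.2⟩
        by_cases h1 : p ∣ n <;> by_cases h2 : q ∣ n <;> simp [this, h1, h2]
      simp_rw [e]
      rw [if_neg hpq, add_zero]
      refine (card_dvd_le X (p * q)).trans (le_of_eq ?_)
      push_cast; rw [div_mul_div_comm]; ring
  refine (Finset.sum_le_sum h2).trans (le_of_eq ?_)
  rw [Finset.sum_add_distrib, Finset.sum_ite_eq, if_pos hp, ← Finset.mul_sum]; ring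

lemma sum_om_ge (S : Finset ℕ) (X : ℕ) :
    X * ∑ p ∈ S, 1 / (p:ℝ) - S.card ≤ ∑ n ∈ Finset.Ico 1 (X + 1), om S n := by
  unfold om
  rw [Finset.sum_comm, Finset.mul_sum, Finset.card_eq_sum_ones, Nat.cast_sum, ← Finset.sum_sub_distrib]
  refine Finset.sum_le_sum fun p _ => ?_
  rw [card_dvd]
  have := Nat.lt_floor_add_one ((X:ℝ) / p)
  rw [Nat.floor_div_natCast, Nat.floor_natCast] at this
  rw [mul_one_div]; push_cast; linarith

/-- Turán–Kubilius -/
lemma turan (S : Finset ℕ) (hS : ∀ p ∈ S, ∀ q ∈ S, p ≠ q → Nat.Coprime p q) (X : ℕ) (hX : S.card ≤ X) :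
    ∑ n ∈ Finset.Ico 1 (X + 1), (om S n - ∑ p ∈ S, 1 / (p:ℝ)) ^ 2 ≤ 3 * X * ∑ p ∈ S, 1 / (p:ℝ) := by
  set W := ∑ p ∈ S, 1 / (p:ℝ) with hW
  have hW0 : 0 ≤ W := Finset.sum_nonneg fun _ _ => by positivity
  have h1 := om_sq S hS X
  have h2 := sum_om_ge S X
  rw [← hW] at h1 h2
  have h3 : ∑ n ∈ Finset.Ico 1 (X + 1), (om S n - W) ^ 2 =
      ∑ n ∈ Finset.Ico 1 (X + 1), om S n ^ 2 - 2 * W * ∑ n ∈ Finset.Ico 1 (X + 1), om S n + X * W ^ 2 := by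
    simp_rw [sub_sq]
    rw [Finset.sum_add_distrib, Finset.sum_sub_distrib, Finset.mul_sum, Finset.sum_const, Nat.card_Ico,
      nsmul_eq_mul]
    simp only [Nat.add_sub_cancel]
    congr 2
    refine Finset.sum_congr rfl fun _ _ => by ring
  have h4 : (S.card : ℝ) ≤ X := by exact_mod_cast hX
  have h5 := mul_le_mul_of_nonneg_left h2 (show 0 ≤ 2 * W by positivity)
  have h6 := mul_le_mul_of_nonneg_left h4 (show 0 ≤ 2 * W by positivity)
  rw [h3]; nlinarith

lemma sum_inv_sq_le (S : Finset ℕ) : ∑ p ∈ S, 1 / ((p:ℝ) ^ 2) ≤ 2 := by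
  refine (sum_le_hasSum S (fun _ _ => by positivity) hasSum_zeta_two).trans ?_
  have := Real.pi_lt_d2
  have := Real.pi_pos
  nlinarith

/-- primes with `v/K ≤ log p < (v+1)/K` -/
def blk (K v : ℕ) : Finset ℕ :=
  (Finset.range (NN ((v + 1) / K))).filter (fun p => p.Prime ∧ ⌊(K:ℝ) * Real.log p⌋₊ = v)

lemma mem_blk {K v p : ℕ} (hK : 1 ≤ K) : p ∈ blk K v ↔ p.Prime ∧ ⌊(K:ℝ) * Real.log p⌋₊ = v := by
  unfold blk
  rw [Finset.mem_filter, Finset.mem_range, and_iff_right_iff_imp]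
  rintro ⟨hp, h⟩
  have hK0 : (0:ℝ) < K := by exact_mod_cast hK
  apply lt_NN_of_log hp.one_lt.le
  rw [le_div_iff₀ hK0, ← h, mul_comm]
  exact (Nat.lt_floor_add_one _).le

lemma blk_log {K v p : ℕ} (hK : 1 ≤ K) (h : p ∈ blk K v) :
    (v:ℝ) / K ≤ Real.log p ∧ Real.log p ≤ (v + 1) / K := by
  rw [mem_blk hK] at h
  have hK0 : (0:ℝ) < K := by exact_mod_cast hK
  have hp : 0 ≤ Real.log p := Real.log_natCast_nonneg _
  rw [← h.2, div_le_iff₀ hK0, le_div_iff₀ hK0, mul_comm (Real.log p)]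
  exact ⟨Nat.floor_le (by positivity), (Nat.lt_floor_add_one _).le⟩

/-- primes of a stage -/
def stg (K a b : ℕ) : Finset ℕ := (Finset.Ico a b).biUnion (blk K)

lemma blk_disj (K : ℕ) (hK : 1 ≤ K) (s : Set ℕ) : s.PairwiseDisjoint (blk K) := by
  intro u _ v _ huv
  rw [Function.onFun, Finset.disjoint_left]
  intro p hp hp'
  rw [mem_blk hK] at hp hp'
  exact huv (hp.2.symm.trans hp'.2)

lemma sum_stg {M : Type*} [AddCommMonoid M] (K a b : ℕ) (hK : 1 ≤ K) (g : ℕ → M) :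
    ∑ p ∈ stg K a b, g p = ∑ v ∈ Finset.Ico a b, ∑ p ∈ blk K v, g p :=
  Finset.sum_biUnion (blk_disj K hK _)

lemma stg_prime {K a b p : ℕ} (hK : 1 ≤ K) (h : p ∈ stg K a b) : p.Prime := by
  rw [stg, Finset.mem_biUnion] at h
  obtain ⟨v, _, hv⟩ := h
  exact ((mem_blk hK).1 hv).1

/-- `W = ∑ 1/p` -/
def SW (K a b : ℕ) : ℝ := ∑ p ∈ stg K a b, 1 / (p:ℝ)

/-- prime Dirichlet polynomial -/
def Q (f : ℕ → ℂ) (K v : ℕ) (t : ℝ) : ℂ := GD (blk K v) (fun p => f p * ((1 / p : ℝ) : ℂ)) (fun n => Real.log n) t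

lemma continuous_Q (f : ℕ → ℂ) (K v : ℕ) : Continuous (Q f K v) := continuous_GD _ _ _

def G (f : ℕ → ℂ) (K a b : ℕ) (y t : ℝ) : ℂ :=
  ∑ v ∈ Finset.Ico a b, Q f K v t * R f (y - v / K) t

lemma continuous_G (f : ℕ → ℂ) (K a b : ℕ) (y : ℝ) : Continuous (G f K a b y) :=
  continuous_finsetSum _ fun _ _ => (continuous_Q _ _ _).mul (continuous_R _ _)

/-- coefficient of `G` -/
def gc (f : ℕ → ℂ) (K a b : ℕ) (y : ℝ) (n : ℕ) : ℂ :=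
  ∑ v ∈ Finset.Ico a b, ∑ p ∈ blk K v with p ∣ n, f p * ((1 / p : ℝ) : ℂ) * rc f (y - v / K) (n / p)

lemma NN_mono {x y : ℝ} (h : x ≤ y) : NN x ≤ NN y := by unfold NN; gcongr

lemma G_eq (f : ℕ → ℂ) (K a b : ℕ) (hK : 1 ≤ K) (y : ℝ) : ∃ N₀, ∀ N, N₀ ≤ N → ∀ t,
    G f K a b y t = D N (gc f K a b y) t := by
  refine ⟨NN (y + 3) * (1 + ∑ p ∈ stg K a b, p), fun N hN t => ?_⟩
  unfold G gc
  rw [D_sum]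
  refine Finset.sum_congr rfl fun v hv => ?_
  have hN1 : NN (y - v / K + 3) ≤ NN (y + 3) := NN_mono (by
    have : (0:ℝ) ≤ v / K := by positivity
    linarith)
  rw [Q, R_eq f (y - v / K) t hN1]
  apply GD_mul_D
  · intro p hp; exact ((mem_blk hK).1 hp).1.one_lt.le
  · intro m hm; exact rc_eq_zero (Or.inr (le_log_of_NN_le (hN1.trans hm)))
  · intro p hp m hm
    have hp' : p ∈ stg K a b := Finset.mem_biUnion.2 ⟨v, hv, hp⟩
    have h1 : p ≤ ∑ p ∈ stg K a b, p := Finset.single_le_sum (f := fun p => p) (fun _ _ => Nat.zero_le _) hp'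
    calc p * m ≤ p * NN (y + 3) := Nat.mul_le_mul_left _ hm.le
      _ < (1 + ∑ p ∈ stg K a b, p) * NN (y + 3) := by
        apply Nat.mul_lt_mul_of_pos_right (by omega); unfold NN; omega
      _ ≤ N := by rw [mul_comm]; exact hN

/-- hypothesis on `f` : 1-bounded and multiplicative over primes -/
structure MF (f : ℕ → ℂ) : Prop where
  bd : ∀ n, ‖f n‖ ≤ 1
  mul : ∀ p m : ℕ, p.Prime → ¬ p ∣ m → f (p * m) = f p * f m

lemma gc_supp {f : ℕ → ℂ} {K a b : ℕ} (hK : 1 ≤ K) {y : ℝ} {n : ℕ} (hn : 1 ≤ n) (h : gc f K a b y n ≠ 0) :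
    y - 1 ≤ Real.log n ∧ Real.log n ≤ y + 4 := by
  obtain ⟨v, hv, h1⟩ := Finset.exists_ne_zero_of_sum_ne_zero h
  obtain ⟨p, hp, h2⟩ := Finset.exists_ne_zero_of_sum_ne_zero h1
  rw [Finset.mem_filter] at hp
  obtain ⟨hp, m, rfl⟩ := hp
  have hpp := ((mem_blk hK).1 hp).1
  rw [Nat.mul_div_cancel_left _ hpp.pos] at h2
  have h3 := rc_supp m (right_ne_zero_of_mul h2)
  have h4 := blk_log hK hp
  have hm : m ≠ 0 := by rintro rfl; simp at hn
  rw [Nat.cast_mul, Real.log_mul (by exact_mod_cast hpp.ne_zero) (by exact_mod_cast hm)]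
  have h5 : ((v:ℝ) + 1) / K ≤ v / K + 1 := by
    rw [add_div]; gcongr; rw [div_le_one (by exact_mod_cast hK)]; exact_mod_cast hK
  constructor <;> linarith

lemma coeff_diff {f : ℕ → ℂ} (hf : MF f) {K a b : ℕ} (hK : 1 ≤ K) (y : ℝ) (n : ℕ) (hn : 1 ≤ n) :
    ‖(SW K a b : ℂ) * rc f y n - gc f K a b y n‖ ≤
      (|om (stg K a b) n - SW K a b| + om (stg K a b) n / K + 2 * om ((stg K a b).image (fun p => p ^ 2)) n) / n := by
  have hn0 : (0:ℝ) < n := by exact_mod_cast hn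
  have hK0 : (0:ℝ) < K := by exact_mod_cast hK
  have e1 : om ((stg K a b).image (fun p => p ^ 2)) n = ∑ p ∈ stg K a b, if p ^ 2 ∣ n then (1:ℝ) else 0 := by
    unfold om
    rw [Finset.sum_image]
    intro x _ y _ h
    exact Nat.pow_left_injective (n := 2) (by norm_num) h
  set W := SW K a b
  have e2 : (W : ℂ) * rc f y n - gc f K a b y n = ((W - om (stg K a b) n : ℝ) : ℂ) * rc f y n
      + ((om (stg K a b) n : ℂ) * rc f y n - gc f K a b y n) := by push_cast; ring
  have e3 : ‖((W - om (stg K a b) n : ℝ) : ℂ) * rc f y n‖ ≤ |om (stg K a b) n - W| / n := by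
    rw [norm_mul, Complex.norm_real, Real.norm_eq_abs, abs_sub_comm, div_eq_mul_one_div]
    gcongr
    exact (norm_rc_le hf.bd y n).trans (by gcongr; exact w_le_one _)
  have e4 : (om (stg K a b) n : ℂ) * rc f y n - gc f K a b y n = ∑ v ∈ Finset.Ico a b, ∑ p ∈ blk K v,
      (if p ∣ n then rc f y n - f p * ((1 / p : ℝ) : ℂ) * rc f (y - v / K) (n / p) else 0) := by
    unfold gc om
    rw [sum_stg K a b hK, Complex.ofReal_sum, Finset.sum_mul, ← Finset.sum_sub_distrib]
    refine Finset.sum_congr rfl fun v _ => ?_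
    rw [Complex.ofReal_sum, Finset.sum_mul, Finset.sum_filter, ← Finset.sum_sub_distrib]
    refine Finset.sum_congr rfl fun p _ => ?_
    split_ifs <;> simp
  have e5 : ‖(om (stg K a b) n : ℂ) * rc f y n - gc f K a b y n‖ ≤
      (om (stg K a b) n / K + 2 * om ((stg K a b).image (fun p => p ^ 2)) n) / n := by
    rw [e4, e1, om, Finset.sum_div, Finset.mul_sum, ← Finset.sum_add_distrib, Finset.sum_div, sum_stg K a b hK]
    refine (norm_sum_le _ _).trans (Finset.sum_le_sum fun v _ => ?_)
    refine (norm_sum_le _ _).trans (Finset.sum_le_sum fun p hp => ?_)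
    have hpp := ((mem_blk hK).1 hp).1
    have hp0 : (0:ℝ) < p := by exact_mod_cast hpp.pos
    by_cases hpn : p ∣ n
    · rw [if_pos hpn, if_pos hpn]
      obtain ⟨m, rfl⟩ := hpn
      have hm : m ≠ 0 := by rintro rfl; simp at hn
      have hm0 : (0:ℝ) < m := by exact_mod_cast Nat.pos_of_ne_zero hm
      rw [Nat.mul_div_cancel_left _ hpp.pos]
      have hlog : Real.log ((p * m : ℕ) : ℝ) = Real.log p + Real.log m := by
        rw [Nat.cast_mul, Real.log_mul hp0.ne' hm0.ne']
      have hx := blk_log hK hp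
      have key : rc f y (p * m) - f p * ((1 / p : ℝ) : ℂ) * rc f (y - v / K) m =
          (f (p * m) * (w (Real.log ((p * m : ℕ) : ℝ) - y) : ℝ) - f p * f m * (w (Real.log m - (y - v / K)) : ℝ))
            * ((1 / (p * m : ℕ) : ℝ) : ℂ) := by
        unfold rc
        have h1 : (p:ℂ) ≠ 0 := by exact_mod_cast hpp.ne_zero
        have h2 : (m:ℂ) ≠ 0 := by exact_mod_cast hm
        push_cast
        field_simp
      rw [key, norm_mul, Complex.norm_real, Real.norm_of_nonneg (by positivity), ← div_eq_mul_one_div]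
      apply div_le_div_of_nonneg_right _ hn0.le
      by_cases hpm : p ∣ m
      · rw [if_pos (by rw [sq]; exact Nat.mul_dvd_mul_left p hpm)]
        have b1 : ‖f (p * m) * (w (Real.log ((p * m : ℕ) : ℝ) - y) : ℝ)‖ ≤ 1 := by
          rw [norm_mul, Complex.norm_real, Real.norm_of_nonneg (w_nonneg _)]
          exact mul_le_one₀ (hf.bd _) (w_nonneg _) (w_le_one _)
        have b2 : ‖f p * f m * (w (Real.log m - (y - v / K)) : ℝ)‖ ≤ 1 := by
          rw [norm_mul, norm_mul, Complex.norm_real, Real.norm_of_nonneg (w_nonneg _)]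
          exact mul_le_one₀ (mul_le_one₀ (hf.bd _) (norm_nonneg _) (hf.bd _)) (w_nonneg _) (w_le_one _)
        have := norm_sub_le (f (p * m) * (w (Real.log ((p * m : ℕ) : ℝ) - y) : ℝ)) (f p * f m * (w (Real.log m - (y - v / K)) : ℝ))
        have : (0:ℝ) ≤ 1 / K := by positivity
        linarith
      · rw [hf.mul p m hpp hpm, ← mul_sub, ← Complex.ofReal_sub, norm_mul, Complex.norm_real]
        have h1 := w_lip (Real.log ((p * m : ℕ) : ℝ) - y) (Real.log m - (y - v / K))
        rw [hlog, show Real.log p + Real.log m - y - (Real.log m - (y - v / K)) = Real.log p - v / K by ring,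
          abs_of_nonneg (show 0 ≤ Real.log (p:ℝ) - (v:ℝ) / (K:ℝ) by linarith)] at h1
        have h2 : Real.log p - v / K ≤ 1 / K := by
          have : ((v:ℝ) + 1) / K = v / K + 1 / K := by rw [add_div]
          linarith
        have h3 : ‖f p * f m‖ ≤ 1 := by
          rw [norm_mul]; exact mul_le_one₀ (hf.bd _) (norm_nonneg _) (hf.bd _)
        have h4 : (0:ℝ) ≤ 2 * (if p ^ 2 ∣ p * m then (1:ℝ) else 0) := by split_ifs <;> norm_num
        have h5 : ‖w (Real.log ((p * m : ℕ) : ℝ) - y) - w (Real.log m - (y - v / K))‖ ≤ 1 / K := by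
          rw [Real.norm_eq_abs, hlog]; linarith
        calc _ ≤ 1 * (1 / (K:ℝ)) := by gcongr
          _ ≤ _ := by linarith
    · rw [if_neg hpn, if_neg hpn, norm_zero]
      split_ifs <;> positivity
  rw [e2]
  refine (norm_add_le _ _).trans ((add_le_add e3 e5).trans (le_of_eq ?_))
  ring

lemma sum_dn_sq {K a b : ℕ} (hK : 1 ≤ K) (X : ℕ) (hX : (stg K a b).card ≤ X) (hW : 1 ≤ SW K a b) :
    ∑ n ∈ Finset.Ico 1 (X + 1), (|om (stg K a b) n - SW K a b| + om (stg K a b) n / K +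
      2 * om ((stg K a b).image (fun p => p ^ 2)) n) ^ 2 ≤ 45 * X * (SW K a b + SW K a b ^ 2 / K ^ 2) := by
  have hcop : ∀ p ∈ stg K a b, ∀ q ∈ stg K a b, p ≠ q → Nat.Coprime p q := fun p hp q hq h =>
    (Nat.coprime_primes (stg_prime hK hp) (stg_prime hK hq)).2 h
  have hK0 : (0:ℝ) < K := by exact_mod_cast hK
  have h1 := turan (stg K a b) hcop X hX
  have h2 := om_sq (stg K a b) hcop X
  have h3 := om_sq ((stg K a b).image (fun p => p ^ 2)) (by
    intro p hp q hq h
    rw [Finset.mem_image] at hp hq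
    obtain ⟨p, hp, rfl⟩ := hp
    obtain ⟨q, hq, rfl⟩ := hq
    exact Nat.Coprime.pow 2 2 (hcop p hp q hq (by rintro rfl; exact h rfl))) X
  have e1 : ∑ p ∈ (stg K a b).image (fun p : ℕ => p ^ 2), 1 / (p:ℝ) = ∑ p ∈ stg K a b, 1 / (p:ℝ) ^ 2 := by
    rw [Finset.sum_image]
    · push_cast; rfl
    · intro x _ y _ h
      exact Nat.pow_left_injective (n := 2) (by norm_num) h
  rw [e1] at h3
  have hV : ∑ p ∈ stg K a b, 1 / (p:ℝ) ^ 2 ≤ SW K a b := by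
    refine Finset.sum_le_sum fun p hp => ?_
    have hp1 : (1:ℝ) ≤ p := by exact_mod_cast (stg_prime hK hp).one_lt.le
    apply one_div_le_one_div_of_le (by linarith); nlinarith
  have hV2 := sum_inv_sq_le (stg K a b)
  set V := ∑ p ∈ stg K a b, 1 / (p:ℝ) ^ 2
  have hV0 : 0 ≤ V := Finset.sum_nonneg fun _ _ => by positivity
  change ∑ n ∈ Finset.Ico 1 (X + 1), (om (stg K a b) n - SW K a b) ^ 2 ≤ 3 * X * SW K a b at h1
  change _ ≤ (X:ℝ) * (SW K a b ^ 2 + SW K a b) at h2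
  set W := SW K a b
  have hX0 : (0:ℝ) ≤ X := Nat.cast_nonneg _
  have h4 : ∀ x y z : ℝ, (x + y + z) ^ 2 ≤ 3 * (x ^ 2 + y ^ 2 + z ^ 2) := fun x y z => by
    nlinarith [sq_nonneg (x - y), sq_nonneg (y - z), sq_nonneg (x - z)]
  refine (Finset.sum_le_sum fun n _ => h4 _ _ _).trans ?_
  rw [← Finset.mul_sum, Finset.sum_add_distrib, Finset.sum_add_distrib]
  simp_rw [sq_abs, div_pow, mul_pow]
  rw [← Finset.sum_div, ← Finset.mul_sum]
  have h5 : (∑ n ∈ Finset.Ico 1 (X + 1), om (stg K a b) n ^ 2) / (K:ℝ) ^ 2 ≤ X * (2 * W ^ 2) / K ^ 2 := by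
    apply div_le_div_of_nonneg_right _ (by positivity)
    refine h2.trans ?_
    gcongr; nlinarith
  have h6 : (X:ℝ) * (V ^ 2 + V) ≤ X * (3 * W) := by gcongr; nlinarith
  have h7 : (X:ℝ) * (2 * W ^ 2) / K ^ 2 = 2 * (X * (W ^ 2 / K ^ 2)) := by ring
  have h8 : 0 ≤ (X:ℝ) * (W ^ 2 / K ^ 2) := by positivity
  rw [h7] at h5
  nlinarith

lemma card_stg_le {K a b : ℕ} (hK : 1 ≤ K) {y : ℝ} (hb : (b:ℝ) / K ≤ y) : ((stg K a b).card : ℝ) ≤ Real.exp y := by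
  refine le_trans ?_ (card_NN y)
  have : stg K a b ⊆ Finset.Ico 1 (NN y) := by
    intro p hp
    have hpp := stg_prime hK hp
    rw [stg, Finset.mem_biUnion] at hp
    obtain ⟨v, hv, hp⟩ := hp
    rw [Finset.mem_Ico] at hv ⊢
    refine ⟨hpp.one_lt.le, lt_NN_of_log hpp.one_lt.le ((blk_log hK hp).2.trans (le_trans ?_ hb))⟩
    gcongr
    exact_mod_cast hv.2
  exact_mod_cast Finset.card_le_card this

/-- the error polynomial -/
lemma R_sub_G {f : ℕ → ℂ} (hf : MF f) {K a b : ℕ} (hK : 1 ≤ K) {y : ℝ} (hb : (b:ℝ) / K ≤ y)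
    (hW : 1 ≤ SW K a b) :
    ∃ c : ℕ → ℂ, (∀ t, R f y t - G f K a b y t / SW K a b = D (NN (y + 4)) c t) ∧
      ∑ n ∈ Finset.Ico 1 (NN (y + 4)), ‖c n‖ ^ 2 ≤
        45 * Real.exp (6 - y) * (1 / SW K a b + 1 / K ^ 2) := by
  obtain ⟨N₀, hN₀⟩ := G_eq f K a b hK y
  set W := SW K a b with hWdef
  have hW0 : 0 < W := by linarith
  have hWc : (W:ℂ) ≠ 0 := by exact_mod_cast hW0.ne'
  have hK0 : (0:ℝ) < K := by exact_mod_cast hK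
  set c : ℕ → ℂ := fun n => (1 / W : ℂ) * ((W:ℂ) * rc f y n - gc f K a b y n) with hc
  have hsupp : ∀ n, 1 ≤ n → c n ≠ 0 → y - 1 ≤ Real.log n ∧ Real.log n ≤ y + 4 := by
    intro n hn h
    by_cases h1 : rc f y n = 0
    · have h2 : gc f K a b y n ≠ 0 := by
        intro h2; apply h; rw [hc]; simp [h1, h2]
      exact gc_supp hK hn h2
    · have := rc_supp n h1
      constructor <;> linarith
  refine ⟨c, fun t => ?_, ?_⟩
  · set N := max N₀ (NN (y + 4) + NN (y + 3))
    have e1 : D N c t = D (NN (y + 4)) c t := by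
      rw [D_def, D_def]
      symm
      refine Finset.sum_subset (Finset.Ico_subset_Ico_right ((Nat.le_add_right _ _).trans (le_max_right _ _))) fun n hn hn' => ?_
      rw [Finset.mem_Ico] at hn hn'
      have : c n = 0 := by
        by_contra h
        exact hn' ⟨hn.1, lt_NN_of_log hn.1 (hsupp n hn.1 h).2⟩
      rw [this, zero_mul]
    rw [← e1, hc, D_smul, D_sub, D_smul, ← hN₀ N (le_max_left _ _), ← R_eq f y t ((Nat.le_add_left _ _).trans (le_max_right _ _))]
    field_simp
  · have h1 := sum_window (c := c)
      (g := fun n => (1 / W) * (|om (stg K a b) n - W| + om (stg K a b) n / K +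
      2 * om ((stg K a b).image (fun p => p ^ 2)) n)) (fun n => by
        have := om_nonneg (stg K a b) n
        have := om_nonneg ((stg K a b).image (fun p => p ^ 2)) n
        positivity) (NN (y + 4)) (z := y - 1) (z' := y + 4) (fun n hn => by
        rw [hc]
        simp only
        rw [norm_mul, mul_div_assoc]
        have : ‖(1 / W : ℂ)‖ = 1 / W := by
          rw [norm_div, norm_one, Complex.norm_real, Real.norm_of_nonneg hW0.le]
        rw [this]
        gcongr
        exact coeff_diff hf hK y n hn) hsupp 2 two_ne_zero
    refine h1.trans ?_
    simp_rw [mul_pow]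
    rw [← Finset.mul_sum]
    have hX : ((⌊Real.exp (y + 4)⌋₊ : ℕ) : ℝ) ≤ Real.exp (y + 4) := Nat.floor_le (Real.exp_pos _).le
    have h2 := sum_dn_sq (a := a) (b := b) hK ⌊Real.exp (y + 4)⌋₊ (Nat.le_floor (card_stg_le hK (by linarith))) hW
    rw [← hWdef] at h2
    calc _ ≤ Real.exp (-((2:ℕ) * (y - 1))) * ((1 / W) ^ 2 * (45 * Real.exp (y + 4) * (W + W ^ 2 / K ^ 2))) := by
          gcongr
          refine h2.trans ?_
          gcongr
      _ = 45 * (Real.exp (-((2:ℕ) * (y - 1))) * Real.exp (y + 4)) * (1 / W + 1 / K ^ 2) := by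
          field_simp
      _ = _ := by
          rw [← Real.exp_add]; congr 3; push_cast; ring

/-- pointwise version -/
lemma R_sub_G_pt {f : ℕ → ℂ} (hf : MF f) {K a b : ℕ} (hK : 1 ≤ K) {y : ℝ} (hb : (b:ℝ) / K ≤ y)
    (hW : 1 ≤ SW K a b) (t : ℝ) :
    ‖R f y t - G f K a b y t / SW K a b‖ ^ 2 ≤ 45 * Real.exp 10 * (1 / SW K a b + 1 / K ^ 2) := by
  obtain ⟨c, h1, h2⟩ := R_sub_G hf hK hb hW
  rw [h1]
  have h3 := norm_D_le (NN (y + 4)) c t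
  have h4 : (∑ n ∈ Finset.Ico 1 (NN (y + 4)), ‖c n‖) ^ 2 ≤
      (Finset.Ico 1 (NN (y + 4))).card * ∑ n ∈ Finset.Ico 1 (NN (y + 4)), ‖c n‖ ^ 2 := sq_sum_le_card_mul_sum_sq
  calc _ ≤ (∑ n ∈ Finset.Ico 1 (NN (y + 4)), ‖c n‖) ^ 2 := by gcongr
    _ ≤ _ := h4
    _ ≤ Real.exp (y + 4) * (45 * Real.exp (6 - y) * (1 / SW K a b + 1 / K ^ 2)) := by
      gcongr
      exact card_NN _
    _ = 45 * (Real.exp (y + 4) * Real.exp (6 - y)) * (1 / SW K a b + 1 / K ^ 2) := by ring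
    _ = _ := by rw [← Real.exp_add]; congr 3; ring

/-- mean square version -/
lemma R_sub_G_ms {f : ℕ → ℂ} (hf : MF f) {K a b : ℕ} (hK : 1 ≤ K) {y : ℝ} (hy : 0 ≤ y) (hb : (b:ℝ) / K ≤ y)
    (hW : 1 ≤ SW K a b) :
    ∫ t in Set.Icc (-Real.exp y) (Real.exp y), ‖R f y t - G f K a b y t / SW K a b‖ ^ 2 ≤
      2000 * Real.exp 10 * (1 / SW K a b + 1 / K ^ 2) := by
  obtain ⟨c, h1, h2⟩ := R_sub_G hf hK hb hW
  simp_rw [h1]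
  refine (D_mvt _ _ (Real.exp_pos y)).trans ?_
  have hN := NN_le (y + 4)
  have he : Real.exp y + 2 * NN (y + 4) ≤ 6 * Real.exp (y + 4) := by
    have h3 : Real.exp y ≤ Real.exp (y + 4) := Real.exp_le_exp.2 (by linarith)
    have h4 : 1 ≤ Real.exp (y + 4) := Real.one_le_exp (by linarith)
    linarith
  have hW0 : 0 < SW K a b := by linarith
  calc _ ≤ 7 * (6 * Real.exp (y + 4)) * (45 * Real.exp (6 - y) * (1 / SW K a b + 1 / K ^ 2)) := by gcongr
    _ = 1890 * (Real.exp (y + 4) * Real.exp (6 - y)) * (1 / SW K a b + 1 / K ^ 2) := by ring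
    _ ≤ 2000 * Real.exp 10 * (1 / SW K a b + 1 / K ^ 2) := by
      rw [← Real.exp_add, show y + 4 + (6 - y) = 10 by ring]; gcongr; norm_num

/-- coefficients of `Q ^ ℓ * D` -/
def mcf (P : Finset ℕ) (b c : ℕ → ℂ) : ℕ → ℕ → ℂ
  | 0 => c
  | ℓ + 1 => fun n => ∑ p ∈ P with p ∣ n, b p * mcf P b c ℓ (n / p)

lemma mcf_eq (P : Finset ℕ) (hP : ∀ p ∈ P, 1 ≤ p) (b c : ℕ → ℂ) (N₁ : ℕ) (hc : ∀ m, N₁ ≤ m → c m = 0) (ℓ : ℕ) :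
    ∃ N₀, (∀ m, N₀ ≤ m → mcf P b c ℓ m = 0) ∧
      ∀ t, GD P b (fun n => Real.log n) t ^ ℓ * D N₁ c t = D N₀ (mcf P b c ℓ) t := by
  induction ℓ with
  | zero => exact ⟨N₁, hc, fun t => by rw [pow_zero, one_mul]; rfl⟩
  | succ ℓ ih =>
    obtain ⟨N₀, h1, h2⟩ := ih
    have hlt : ∀ p ∈ P, ∀ m < N₀, p * m < (N₀ + 1) * (1 + ∑ p ∈ P, p) := by
      intro p hp m hm
      have h3 : p ≤ ∑ p ∈ P, p := Finset.single_le_sum (f := fun p => p) (fun _ _ => Nat.zero_le _) hp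
      nlinarith
    refine ⟨(N₀ + 1) * (1 + ∑ p ∈ P, p), fun m hm => ?_, fun t => ?_⟩
    · refine Finset.sum_eq_zero fun p hp => ?_
      rw [Finset.mem_filter] at hp
      obtain ⟨hp, k, rfl⟩ := hp
      rw [Nat.mul_div_cancel_left _ (hP p hp), h1, mul_zero]
      by_contra! h
      exact absurd (hlt p hp k h) (by omega)
    · rw [pow_succ', mul_assoc, h2, GD_mul_D P hP b (mcf P b c ℓ) N₀ _ h1 hlt]
      rfl

lemma om_mono_dvd (P : Finset ℕ) {m n : ℕ} (h : m ∣ n) : om P m ≤ om P n := by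
  refine Finset.sum_le_sum fun p _ => ?_
  by_cases h1 : p ∣ m
  · rw [if_pos h1, if_pos (h1.trans h)]
  · rw [if_neg h1]; split_ifs <;> norm_num

lemma mcf_bound (P : Finset ℕ) (hP : ∀ p ∈ P, 1 ≤ p) (b c : ℕ → ℂ) (hb : ∀ p ∈ P, ‖b p‖ ≤ 1 / p)
    (hc : ∀ n, 1 ≤ n → ‖c n‖ ≤ 1 / n) (ℓ : ℕ) : ∀ n, 1 ≤ n → ‖mcf P b c ℓ n‖ ≤ om P n ^ ℓ / n := by
  induction ℓ with
  | zero => intro n hn; rw [pow_zero]; exact hc n hn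
  | succ ℓ ih =>
    intro n hn
    have hn0 : (0:ℝ) < n := by exact_mod_cast hn
    have h1 : ∀ p ∈ P.filter (fun p => p ∣ n), ‖b p * mcf P b c ℓ (n / p)‖ ≤ om P n ^ ℓ / n := by
      intro p hp
      rw [Finset.mem_filter] at hp
      obtain ⟨hp, k, rfl⟩ := hp
      have hp0 := hP p hp
      have hk : 1 ≤ k := Nat.pos_of_ne_zero (by rintro rfl; simp at hn)
      have hk0 : (0:ℝ) < k := by exact_mod_cast hk
      have hpp : (0:ℝ) < p := by exact_mod_cast hp0
      rw [Nat.mul_div_cancel_left _ hp0, norm_mul]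
      have := om_nonneg P k
      calc _ ≤ 1 / (p:ℝ) * (om P (p * k) ^ ℓ / k) := by
            gcongr
            · exact hb p hp
            · exact (ih k hk).trans (by gcongr; exact om_mono_dvd P (dvd_mul_left k p))
        _ = _ := by push_cast; field_simp
    calc _ ≤ ∑ p ∈ P with p ∣ n, ‖b p * mcf P b c ℓ (n / p)‖ := norm_sum_le _ _
      _ ≤ ∑ p ∈ P with p ∣ n, om P n ^ ℓ / n := Finset.sum_le_sum h1
      _ = _ := by
        rw [Finset.sum_const, nsmul_eq_mul, pow_succ']
        have : om P n = ((P.filter (fun p => p ∣ n)).card : ℝ) := by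
          rw [om, Finset.card_filter]; push_cast; rfl
        rw [← this]; ring

lemma mcf_supp (P : Finset ℕ) (hP : ∀ p ∈ P, 1 ≤ p) (b c : ℕ → ℂ) {s s' z z' : ℝ}
    (hs : ∀ p ∈ P, s ≤ Real.log p ∧ Real.log p ≤ s')
    (hc : ∀ n, 1 ≤ n → c n ≠ 0 → z ≤ Real.log n ∧ Real.log n ≤ z') (ℓ : ℕ) :
    ∀ n, 1 ≤ n → mcf P b c ℓ n ≠ 0 → z + ℓ * s ≤ Real.log n ∧ Real.log n ≤ z' + ℓ * s' := by
  induction ℓ with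
  | zero => intro n hn h; simpa using hc n hn h
  | succ ℓ ih =>
    intro n hn h
    obtain ⟨p, hp, h1⟩ := Finset.exists_ne_zero_of_sum_ne_zero h
    rw [Finset.mem_filter] at hp
    obtain ⟨hp, k, rfl⟩ := hp
    have hk : 1 ≤ k := Nat.pos_of_ne_zero (by rintro rfl; simp at hn)
    have hk0 : (0:ℝ) < k := by exact_mod_cast hk
    have hpp : (0:ℝ) < p := by exact_mod_cast hP p hp
    rw [Nat.mul_div_cancel_left _ (hP p hp)] at h1
    have h2 := ih k hk (right_ne_zero_of_mul h1)
    have h3 := hs p hp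
    rw [Nat.cast_mul, Real.log_mul hpp.ne' hk0.ne']
    push_cast
    constructor <;> linarith

/-- multiplicative weight -/
def m3 (P : Finset ℕ) (n : ℕ) : ℝ := ∏ p ∈ P, if p ∣ n then (3:ℝ) else 1

lemma sum_m3 (P : Finset ℕ) (hP : ∀ p ∈ P, p.Prime) : ∀ X : ℕ,
    ∑ n ∈ Finset.Ico 1 (X + 1), m3 P n ≤ X * ∏ p ∈ P, (1 + 2 / (p:ℝ)) := by
  induction P using Finset.induction_on with
  | empty => intro X; simp [m3]
  | insert p P hp ih =>
    intro X
    have hpp := hP p (Finset.mem_insert_self _ _)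
    have hP' : ∀ q ∈ P, q.Prime := fun q hq => hP q (Finset.mem_insert_of_mem hq)
    have ih := ih hP'
    have hp0 : (0:ℝ) < p := by exact_mod_cast hpp.pos
    have h1 : ∀ n, m3 (insert p P) n = m3 P n + 2 * (if p ∣ n then m3 P n else 0) := by
      intro n
      rw [m3, Finset.prod_insert hp, ← m3]
      split_ifs <;> ring
    simp_rw [h1]
    rw [Finset.sum_add_distrib, ← Finset.mul_sum, Finset.prod_insert hp]
    have h2 : ∑ n ∈ Finset.Ico 1 (X + 1), (if p ∣ n then m3 P n else 0) =
        ∑ m ∈ Finset.Ico 1 (X / p + 1), m3 P m := by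
      rw [← Finset.sum_filter]
      symm
      refine Finset.sum_bij (fun m _ => p * m) ?_ ?_ ?_ ?_
      · intro m hm
        rw [Finset.mem_Ico] at hm
        rw [Finset.mem_filter, Finset.mem_Ico]
        refine ⟨⟨Nat.mul_pos hpp.pos hm.1, ?_⟩, dvd_mul_right _ _⟩
        have := (Nat.le_div_iff_mul_le hpp.pos).1 (Nat.lt_succ_iff.1 hm.2)
        rw [mul_comm]; omega
      · intro m _ m' _ h; exact Nat.eq_of_mul_eq_mul_left hpp.pos h
      · intro n hn
        rw [Finset.mem_filter, Finset.mem_Ico] at hn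
        obtain ⟨hn, k, rfl⟩ := hn
        refine ⟨k, ?_, rfl⟩
        rw [Finset.mem_Ico]
        refine ⟨Nat.pos_of_ne_zero (by rintro rfl; simp at hn), ?_⟩
        rw [Nat.lt_succ_iff, Nat.le_div_iff_mul_le hpp.pos, mul_comm]; omega
      · intro m _
        unfold m3
        refine Finset.prod_congr rfl fun q hq => ?_
        have : q ∣ p * m ↔ q ∣ m := by
          rw [(hP' q hq).dvd_mul, or_iff_right]
          intro h
          rw [(Nat.prime_dvd_prime_iff_eq (hP' q hq) hpp)] at h
          exact hp (h ▸ hq)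
        simp only [this]
    have hprod : (0:ℝ) ≤ ∏ q ∈ P, (1 + 2 / (q:ℝ)) := Finset.prod_nonneg fun _ _ => by positivity
    rw [h2]
    have h3 : ((X / p : ℕ) : ℝ) ≤ X / p := Nat.cast_div_le
    calc _ ≤ X * ∏ q ∈ P, (1 + 2 / (q:ℝ)) + 2 * (X / p * ∏ q ∈ P, (1 + 2 / (q:ℝ))) := by
          gcongr
          · exact ih X
          · exact (ih (X / p)).trans (by gcongr)
      _ = _ := by field_simp

lemma om_pow_le (P : Finset ℕ) (n k : ℕ) : om P n ^ k ≤ k.factorial * m3 P n := by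
  have h1 := Real.pow_div_factorial_le_exp (om P n) (om_nonneg P n) k
  have h0 : (0:ℝ) < k.factorial := by exact_mod_cast Nat.factorial_pos k
  rw [div_le_iff₀ h0] at h1
  refine h1.trans ?_
  rw [mul_comm]
  gcongr
  rw [om, Real.exp_sum, m3]
  refine Finset.prod_le_prod (fun _ _ => (Real.exp_pos _).le) fun p _ => ?_
  split_ifs
  · have := Real.exp_one_lt_d9; linarith
  · rw [Real.exp_zero]

/-- sum of reciprocals in a block of log-width at most 1 -/
lemma sum_inv_block (P : Finset ℕ) (hP : ∀ p ∈ P, 1 ≤ p) {s : ℝ} (hs : ∀ p ∈ P, s ≤ Real.log p ∧ Real.log p ≤ s + 1) :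
    ∑ p ∈ P, 1 / (p:ℝ) ≤ 3 := by
  have h1 : (P.card : ℝ) ≤ Real.exp (s + 1) := by
    refine le_trans ?_ (card_NN (s + 1))
    have : P ⊆ Finset.Ico 1 (NN (s + 1)) := fun p hp =>
      Finset.mem_Ico.2 ⟨hP p hp, lt_NN_of_log (hP p hp) (hs p hp).2⟩
    exact_mod_cast Finset.card_le_card this
  calc _ ≤ ∑ p ∈ P, Real.exp (-s) := by
        refine Finset.sum_le_sum fun p hp => ?_
        have hp0 : (0:ℝ) < p := by exact_mod_cast hP p hp
        rw [Real.exp_neg, ← one_div]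
        apply one_div_le_one_div_of_le (Real.exp_pos _)
        rw [← Real.exp_log hp0]
        exact Real.exp_le_exp.2 (hs p hp).1
    _ ≤ Real.exp (s + 1) * Real.exp (-s) := by
        rw [Finset.sum_const, nsmul_eq_mul]; gcongr
    _ = Real.exp 1 := by rw [← Real.exp_add]; congr 1; ring
    _ ≤ 3 := by have := Real.exp_one_lt_d9; linarith

/-- moment estimate -/
lemma moment (P : Finset ℕ) (hP : ∀ p ∈ P, p.Prime) (b c : ℕ → ℂ) (hb : ∀ p ∈ P, ‖b p‖ ≤ 1 / p)
    (hc : ∀ n, 1 ≤ n → ‖c n‖ ≤ 1 / n) {s s' z z' : ℝ} (hss : s ≤ s') (hs' : s' ≤ s + 1)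
    (hs : ∀ p ∈ P, s ≤ Real.log p ∧ Real.log p ≤ s')
    (hcs : ∀ n, 1 ≤ n → c n ≠ 0 → z ≤ Real.log n ∧ Real.log n ≤ z') (N₁ : ℕ) (hN₁ : ∀ m, N₁ ≤ m → c m = 0)
    (ℓ : ℕ) {T : ℝ} (hT : 0 < T) (hzz : z ≤ z') (hL : 0 ≤ z + ℓ * s) (hTL : T ≤ Real.exp (z + ℓ * s)) :
    ∫ t in Set.Icc (-T) T, ‖GD P b (fun n => Real.log n) t ^ ℓ * D N₁ c t‖ ^ 2 ≤
      Real.exp (10 + 2 * (z' - z) + 2 * ℓ) * (2 * ℓ).factorial := by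
  have hP1 : ∀ p ∈ P, 1 ≤ p := fun p hp => (hP p hp).one_lt.le
  obtain ⟨N₀, h1, h2⟩ := mcf_eq P hP1 b c N₁ hN₁ ℓ
  simp_rw [h2]
  set Z := z' + ℓ * s' with hZ
  have hsupp := mcf_supp P hP1 b c hs hcs ℓ
  have e1 : ∀ t, D N₀ (mcf P b c ℓ) t = D (NN Z) (mcf P b c ℓ) t := by
    intro t
    have : ∀ N, NN Z ≤ N → D N (mcf P b c ℓ) t = D (NN Z) (mcf P b c ℓ) t := by
      intro N hN
      rw [D_def, D_def]
      symm
      refine Finset.sum_subset (Finset.Ico_subset_Ico_right hN) fun n hn hn' => ?_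
      rw [Finset.mem_Ico] at hn hn'
      have : mcf P b c ℓ n = 0 := by
        by_contra h
        exact hn' ⟨hn.1, lt_NN_of_log hn.1 (hsupp n hn.1 h).2⟩
      rw [this, zero_mul]
    rw [← this (max N₀ (NN Z)) (le_max_right _ _)]
    rw [← D_ext (le_max_left _ _) h1]
  simp_rw [e1]
  refine (D_mvt _ _ hT).trans ?_
  have h3 := sum_window (c := mcf P b c ℓ) (g := fun n => om P n ^ ℓ) (fun n => pow_nonneg (om_nonneg P n) _)
    (NN Z) (mcf_bound P hP1 b c hb hc ℓ) hsupp 2 two_ne_zero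
  have h4 : ∑ n ∈ Finset.Ico 1 (NN Z), (om P n ^ ℓ) ^ 2 ≤ (2 * ℓ).factorial * (Real.exp Z * Real.exp 6) := by
    calc _ ≤ ∑ n ∈ Finset.Ico 1 (NN Z), (2 * ℓ).factorial * m3 P n := by
          refine Finset.sum_le_sum fun n _ => ?_
          rw [← pow_mul, mul_comm ℓ 2]; exact om_pow_le P n _
      _ ≤ (2 * ℓ).factorial * (⌊Real.exp Z⌋₊ * ∏ p ∈ P, (1 + 2 / (p:ℝ))) := by
          rw [← Finset.mul_sum]; gcongr; exact sum_m3 P hP _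
      _ ≤ _ := by
          gcongr
          · exact Nat.floor_le (Real.exp_pos _).le
          · calc _ ≤ ∏ p ∈ P, Real.exp (2 / (p:ℝ)) := by
                  refine Finset.prod_le_prod (fun _ _ => by positivity) fun p _ => ?_
                  have := Real.add_one_le_exp (2 / (p:ℝ)); linarith
              _ = Real.exp (2 * ∑ p ∈ P, 1 / (p:ℝ)) := by
                  rw [← Real.exp_sum, Finset.mul_sum]; congr 1
                  refine Finset.sum_congr rfl fun p _ => by ring
              _ ≤ _ := by
                  apply Real.exp_le_exp.2
                  have := sum_inv_block P hP1 (s := s) (fun p hp => ⟨(hs p hp).1, (hs p hp).2.trans hs'⟩)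
                  linarith
  have hls : (ℓ:ℝ) * s' ≤ ℓ * s + ℓ := by nlinarith [Nat.cast_nonneg (α := ℝ) ℓ]
  have hZ1 : z + ℓ * s ≤ Z := by
    have : (ℓ:ℝ) * s ≤ ℓ * s' := by gcongr
    linarith
  have hN := NN_le Z
  have h6 : 1 ≤ Real.exp Z := Real.one_le_exp (hL.trans hZ1)
  have h7 : T + 2 * NN Z ≤ 5 * Real.exp Z := by
    have := Real.exp_le_exp.2 hZ1
    linarith
  calc _ ≤ 7 * (5 * Real.exp Z) * (Real.exp (-((2:ℕ) * (z + ℓ * s))) * ((2 * ℓ).factorial * (Real.exp Z * Real.exp 6))) := by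
        gcongr; exact h3.trans (by gcongr)
    _ = 35 * Real.exp (Z + (-((2:ℕ) * (z + ℓ * s))) + Z + 6) * (2 * ℓ).factorial := by
        simp only [Real.exp_add]; ring
    _ ≤ Real.exp 4 * Real.exp (Z + (-((2:ℕ) * (z + ℓ * s))) + Z + 6) * (2 * ℓ).factorial := by
        gcongr
        have h8 : (2.7:ℝ) ≤ Real.exp 1 := by have := Real.exp_one_gt_d9; linarith
        rw [show (4:ℝ) = (4:ℕ) * 1 by norm_num, Real.exp_nat_mul]
        calc (35:ℝ) ≤ 2.7 ^ 4 := by norm_num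
          _ ≤ _ := by gcongr
    _ ≤ _ := by
        rw [← Real.exp_add]
        refine mul_le_mul_of_nonneg_right (Real.exp_le_exp.2 ?_) (Nat.cast_nonneg _)
        push_cast; linarith

lemma theta_lower : ∃ x₀ : ℝ, 1 ≤ x₀ ∧ ∀ x, x₀ ≤ x → x / 2 ≤ Chebyshev.theta x := by
  obtain ⟨C, hC⟩ := Chebyshev.psi_sub_theta_le_mul_sqrt
  refine ⟨(10 * (|C| + 10)) ^ 2, by nlinarith [abs_nonneg C], fun x hx => ?_⟩
  have hC0 := abs_nonneg C
  have hx1 : 1 ≤ x := by nlinarith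
  have h1 := Chebyshev.psi_ge' (x := x) (by linarith)
  have h2 := hC x
  have h3 : 10 * (|C| + 10) ≤ √x := Real.le_sqrt_of_sq_le hx
  have h4 : √x ^ 2 = x := Real.sq_sqrt (by linarith)
  have h5 : Real.log (x + 2) ≤ 2 * (√x + 2) := by
    have : x + 2 ≤ (√x + 2) ^ 2 := by nlinarith
    calc Real.log (x + 2) ≤ Real.log ((√x + 2) ^ 2) := Real.log_le_log (by linarith) this
      _ = 2 * Real.log (√x + 2) := by rw [Real.log_pow]; norm_num
      _ ≤ _ := by
        have := Real.log_le_self (show 0 ≤ √x + 2 by positivity)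
        linarith
  have h6 := Real.log_two_gt_d9
  have h7 : C * √x ≤ |C| * √x := by gcongr; exact le_abs_self C
  have h8 : (x - 1) * 0.69 ≤ (x - 1) * Real.log 2 := by gcongr <;> linarith
  have h9 : √x * (10 * (|C| + 10)) ≤ √x * √x := by gcongr
  nlinarith

/-- primes with log in (s, t] -/
def pr (s t : ℝ) : Finset ℕ := (Finset.Ico 1 (NN t)).filter (fun p => p.Prime ∧ s < Real.log p)

lemma mem_pr {s t : ℝ} {p : ℕ} : p ∈ pr s t ↔ p.Prime ∧ s < Real.log p ∧ Real.log p ≤ t := by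
  unfold pr
  rw [Finset.mem_filter, Finset.mem_Ico]
  constructor
  · rintro ⟨⟨h1, h2⟩, h3, h4⟩
    refine ⟨h3, h4, ?_⟩
    rw [Real.log_le_iff_le_exp (by exact_mod_cast h1)]
    unfold NN at h2
    exact (Nat.le_floor_iff (Real.exp_pos _).le).1 (by omega)
  · rintro ⟨h1, h2, h3⟩
    exact ⟨⟨h1.one_lt.le, lt_NN_of_log h1.one_lt.le h3⟩, h1, h2⟩

lemma theta_eq (s : ℝ) : Chebyshev.theta (Real.exp s) = ∑ p ∈ (Finset.Ico 1 (NN s)).filter Nat.Prime, Real.log p := rfl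

lemma theta_diff (s t : ℝ) (h : s ≤ t) :
    Chebyshev.theta (Real.exp t) = Chebyshev.theta (Real.exp s) + ∑ p ∈ pr s t, Real.log p := by
  rw [theta_eq, theta_eq, ← Finset.sum_union]
  · apply Finset.sum_congr _ fun _ _ => rfl
    ext p
    rw [Finset.mem_union, mem_pr, Finset.mem_filter, Finset.mem_filter, Finset.mem_Ico, Finset.mem_Ico]
    have key : ∀ r, p.Prime → (p < NN r ↔ Real.log p ≤ r) := by
      intro r hp
      have h1 : (0:ℝ) < p := by exact_mod_cast hp.pos
      rw [Real.log_le_iff_le_exp h1]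
      unfold NN
      rw [Nat.lt_succ_iff, Nat.le_floor_iff (Real.exp_pos _).le]
    constructor
    · rintro ⟨⟨h1, h2⟩, h3⟩
      rw [key t h3] at h2
      by_cases h4 : Real.log p ≤ s
      · left; exact ⟨⟨h1, (key s h3).2 h4⟩, h3⟩
      · right; exact ⟨h3, not_le.1 h4, h2⟩
    · rintro (⟨⟨h1, h2⟩, h3⟩ | ⟨h1, h2, h3⟩)
      · exact ⟨⟨h1, (key t h3).2 (((key s h3).1 h2).trans h)⟩, h3⟩
      · exact ⟨⟨h1.one_lt.le, (key t h1).2 h3⟩, h1⟩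
  · rw [Finset.disjoint_left]
    intro p hp hp'
    rw [mem_pr] at hp'
    rw [Finset.mem_filter, Finset.mem_Ico] at hp
    exact absurd (lt_NN_of_log hp.1.1 (le_refl _)) (by
      have h1 : (0:ℝ) < p := by exact_mod_cast hp.2.pos
      have h2 := hp'.2.1
      have h3 : p ≤ ⌊Real.exp s⌋₊ := by have := hp.1.2; unfold NN at this; omega
      rw [Nat.le_floor_iff (Real.exp_pos _).le, ← Real.log_le_iff_le_exp h1] at h3
      linarith)

lemma pr_union {s t u : ℝ} (h1 : s ≤ t) (h2 : t ≤ u) (g : ℕ → ℝ) :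
    ∑ p ∈ pr s u, g p = ∑ p ∈ pr s t, g p + ∑ p ∈ pr t u, g p := by
  rw [← Finset.sum_union]
  · apply Finset.sum_congr _ fun _ _ => rfl
    ext p
    simp only [Finset.mem_union, mem_pr]
    constructor
    · rintro ⟨a, b, c⟩
      by_cases h : Real.log p ≤ t
      · left; exact ⟨a, b, h⟩
      · right; exact ⟨a, not_le.1 h, c⟩
    · rintro (⟨a, b, c⟩ | ⟨a, b, c⟩)
      · exact ⟨a, b, c.trans h2⟩
      · exact ⟨a, h1.trans_lt b, c⟩
  · rw [Finset.disjoint_left]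
    intro p hp hp'
    rw [mem_pr] at hp hp'
    linarith [hp.2.2, hp'.2.1]

lemma mertens_step : ∃ m s₀ : ℝ, 1 ≤ m ∧ m ≤ s₀ ∧ ∀ s, s₀ ≤ s →
    Real.exp (-m) / (s + m) ≤ ∑ p ∈ pr s (s + m), 1 / (p:ℝ) := by
  obtain ⟨x₀, hx₀, h⟩ := theta_lower
  refine ⟨6, 6 + Real.log x₀, by norm_num, by linarith [Real.log_nonneg hx₀], fun s hs => ?_⟩
  have hs6 : 6 ≤ s := by linarith [Real.log_nonneg hx₀]
  have h1 := h (Real.exp (s + 6)) (by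
    rw [← Real.log_le_iff_le_exp (by linarith)]; linarith)
  have h2 := Chebyshev.theta_le_log4_mul_x (Real.exp_pos s).le
  rw [theta_diff s (s + 6) (by linarith)] at h1
  have h3 : Real.log 4 ≤ 2 := by
    have : Real.log 4 = 2 * Real.log 2 := by
      rw [show (4:ℝ) = 2 ^ 2 by norm_num, Real.log_pow]; norm_num
    have := Real.log_two_lt_d9
    linarith
  have h4 : 6 * Real.exp s ≤ Real.exp (s + 6) := by
    rw [Real.exp_add]
    have := Real.add_one_le_exp (6:ℝ)
    nlinarith [Real.exp_pos s]
  have h5 : Real.exp s ≤ ∑ p ∈ pr s (s + 6), Real.log p := by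
    nlinarith [Real.exp_pos s]
  have h6 : ∑ p ∈ pr s (s + 6), Real.log p ≤ ∑ p ∈ pr s (s + 6), (1 / (p:ℝ)) * (Real.exp (s + 6) * (s + 6)) := by
    refine Finset.sum_le_sum fun p hp => ?_
    rw [mem_pr] at hp
    have hp0 : (0:ℝ) < p := by exact_mod_cast hp.1.pos
    have h7 : (p:ℝ) ≤ Real.exp (s + 6) := by rw [← Real.log_le_iff_le_exp hp0]; exact hp.2.2
    calc Real.log p = 1 * Real.log p := (one_mul _).symm
      _ ≤ (1 / p * Real.exp (s + 6)) * (s + 6) := by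
        gcongr
        · rw [one_div, inv_mul_eq_div, le_div_iff₀ hp0, one_mul]; exact h7
        · exact hp.2.2
      _ = _ := by ring
  rw [← Finset.sum_mul] at h6
  have h8 := h5.trans h6
  rw [div_le_iff₀ (by linarith)]
  have h9 : Real.exp s = Real.exp (-6) * Real.exp (s + 6) := by rw [← Real.exp_add]; congr 1; ring
  rw [h9] at h8
  have h10 := Real.exp_pos (s + 6)
  by_contra! hc
  have := mul_lt_mul_of_pos_right hc h10
  nlinarith

lemma mertens : ∃ c s₀ : ℝ, 0 < c ∧ 1 ≤ s₀ ∧ ∀ s t, s₀ ≤ s → 0 < t →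
    ∃ t' < max t (s + 1), c * Real.log (t / (2 * s)) ≤ ∑ p ∈ pr s t', 1 / (p:ℝ) := by
  obtain ⟨m, s₀, hm, hs₀, h⟩ := mertens_step
  have hm0 : 0 < m := by linarith
  have key : ∀ s, s₀ ≤ s → ∀ k : ℕ, Real.exp (-m) / m * Real.log ((s + (k + 1) * m) / (s + m)) ≤
      ∑ p ∈ pr s (s + k * m), 1 / (p:ℝ) := by
    intro s hs k
    have hs1 : 0 < s := by linarith
    induction k with
    | zero =>
      simp only [Nat.cast_zero, zero_add, one_mul, zero_mul, add_zero]
      rw [div_self (by positivity), Real.log_one, mul_zero]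
      exact Finset.sum_nonneg fun _ _ => by positivity
    | succ k ih =>
      have hk : 0 ≤ (k:ℝ) * m := by positivity
      rw [pr_union (t := s + k * m) (by linarith) (by push_cast; linarith)]
      have h1 := h (s + k * m) (by linarith)
      have e : s + k * m + m = s + (k + 1 : ℕ) * m := by push_cast; ring
      rw [e] at h1
      refine le_trans ?_ (add_le_add ih h1)
      have h2 : Real.log ((s + ((k + 1 : ℕ) + 1) * m) / (s + m)) ≤ Real.log ((s + (k + 1) * m) / (s + m)) + m / (s + (k + 1 : ℕ) * m) := by
        have p1 : 0 < s + (k + 1 : ℕ) * m := by positivity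
        have p2 : 0 < s + ((k + 1 : ℕ) + 1) * m := by positivity
        have := Real.log_le_sub_one_of_pos (div_pos p2 p1)
        rw [Real.log_div p2.ne' p1.ne'] at this
        have e2 : (s + ((k + 1 : ℕ) + 1) * m) / (s + (k + 1 : ℕ) * m) - 1 = m / (s + (k + 1 : ℕ) * m) := by
          field_simp; ring
        rw [e2] at this
        rw [Real.log_div p2.ne' (by positivity), Real.log_div (by positivity) (by positivity)]
        push_cast at this ⊢
        linarith
      calc _ ≤ Real.exp (-m) / m * (Real.log ((s + (k + 1) * m) / (s + m)) + m / (s + (k + 1 : ℕ) * m)) := by gcongr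
        _ = _ := by field_simp
  refine ⟨Real.exp (-m) / m, s₀, by positivity, by linarith, fun s t hs ht => ?_⟩
  have hs1 : 0 < s := by linarith
  rcases le_or_gt t s with hts | hts
  · refine ⟨s, lt_max_of_lt_right (by linarith), ?_⟩
    have : Real.log (t / (2 * s)) ≤ 0 := Real.log_nonpos (by positivity) (by rw [div_le_one (by positivity)]; linarith)
    have h0 : (0:ℝ) ≤ ∑ p ∈ pr s s, 1 / (p:ℝ) := Finset.sum_nonneg fun _ _ => by positivity
    have h1 : 0 < Real.exp (-m) / m := by positivity
    nlinarith
  · set n := ⌈(t - s) / m⌉₊ with hn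
    have hn1 : 0 < n := Nat.ceil_pos.2 (div_pos (by linarith) hm0)
    obtain ⟨k, hk⟩ := Nat.exists_eq_succ_of_ne_zero hn1.ne'
    have h1 : (t - s) / m ≤ k + 1 := by
      have := Nat.le_ceil ((t - s) / m); rw [← hn, hk] at this; exact_mod_cast this
    have h2 : (k:ℝ) < (t - s) / m := Nat.lt_ceil.1 (by omega)
    rw [div_le_iff₀ hm0] at h1
    rw [lt_div_iff₀ hm0] at h2
    refine ⟨s + k * m, lt_max_of_lt_left (by linarith), le_trans ?_ (key s hs k)⟩
    gcongr
    · linarith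
    · linarith

/-- lower bound for `SW` -/
lemma SW_lower : ∃ c s₀ : ℝ, 0 < c ∧ 1 ≤ s₀ ∧ ∀ K a b : ℕ, 1 ≤ K → s₀ ≤ (a:ℝ) / K → a + K ≤ b →
    c * Real.log (b / (2 * a)) ≤ SW K a b := by
  obtain ⟨c, s₀, hc, hs₀, h⟩ := mertens
  refine ⟨c, s₀, hc, hs₀, fun K a b hK ha hab => ?_⟩
  have hK0 : (0:ℝ) < K := by exact_mod_cast hK
  have hb : (0:ℝ) < b := by exact_mod_cast (show 0 < b by omega)
  have hab' : (a:ℝ) / K + 1 ≤ b / K := by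
    rw [div_add_one hK0.ne']; gcongr; exact_mod_cast hab
  obtain ⟨t', h1, h2⟩ := h (a / K) (b / K) ha (by positivity)
  rw [max_eq_left hab'] at h1
  have e : (b:ℝ) / K / (2 * (a / K)) = b / (2 * a) := by
    field_simp
  rw [e] at h2
  refine h2.trans ?_
  unfold SW
  refine Finset.sum_le_sum_of_subset_of_nonneg ?_ fun _ _ _ => by positivity
  intro p hp
  rw [mem_pr] at hp
  rw [stg, Finset.mem_biUnion]
  refine ⟨⌊(K:ℝ) * Real.log p⌋₊, ?_, (mem_blk hK).2 ⟨hp.1, rfl⟩⟩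
  rw [Finset.mem_Ico]
  have hl : 0 ≤ Real.log p := Real.log_natCast_nonneg _
  constructor
  · rw [Nat.le_floor_iff (by positivity)]
    have := hp.2.1
    rw [div_lt_iff₀ hK0] at this; linarith
  · rw [Nat.floor_lt (by positivity)]
    have := hp.2.2.trans_lt h1
    rw [lt_div_iff₀ hK0] at this; linarith

/-- Chebyshev upper bound in a block -/
lemma blk_sum_le (K v : ℕ) (hK : 1 ≤ K) (hv : 1 ≤ v) : ∑ p ∈ blk K v, 1 / (p:ℝ) ≤ 6 * K / v := by
  have hK0 : (0:ℝ) < K := by exact_mod_cast hK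
  have hv0 : (0:ℝ) < v := by exact_mod_cast hv
  have h1 := Chebyshev.theta_le_log4_mul_x (Real.exp_pos (((v:ℝ) + 1) / K)).le
  have h2 : ∑ p ∈ blk K v, Real.log p ≤ Chebyshev.theta (Real.exp (((v:ℝ) + 1) / K)) := by
    rw [theta_eq]
    refine Finset.sum_le_sum_of_subset_of_nonneg ?_ fun _ _ _ => Real.log_natCast_nonneg _
    intro p hp
    have hpp := ((mem_blk hK).1 hp).1
    rw [Finset.mem_filter, Finset.mem_Ico]
    exact ⟨⟨hpp.one_lt.le, lt_NN_of_log hpp.one_lt.le (blk_log hK hp).2⟩, hpp⟩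
  have h3 : Real.log 4 ≤ 2 := by
    have : Real.log 4 = 2 * Real.log 2 := by
      rw [show (4:ℝ) = 2 ^ 2 by norm_num, Real.log_pow]; norm_num
    have := Real.log_two_lt_d9
    linarith
  have h4 : ∑ p ∈ blk K v, 1 / (p:ℝ) ≤ ∑ p ∈ blk K v, Real.log p * (Real.exp (-((v:ℝ) / K)) * (K / v)) := by
    refine Finset.sum_le_sum fun p hp => ?_
    have hpp := ((mem_blk hK).1 hp).1
    have hp0 : (0:ℝ) < p := by exact_mod_cast hpp.pos
    have hl := (blk_log hK hp).1
    have h5 : 1 / (p:ℝ) ≤ Real.exp (-((v:ℝ) / K)) := by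
      rw [Real.exp_neg, ← one_div]
      apply one_div_le_one_div_of_le (Real.exp_pos _)
      rw [← Real.exp_log hp0]
      exact Real.exp_le_exp.2 hl
    have h6 : 1 ≤ Real.log p * (K / v) := by
      calc 1 = (v:ℝ) / K * (K / v) := by field_simp
        _ ≤ _ := by gcongr
    calc _ ≤ Real.exp (-((v:ℝ) / K)) * 1 := by rw [mul_one]; exact h5
      _ ≤ Real.exp (-((v:ℝ) / K)) * (Real.log p * (K / v)) := by gcongr
      _ = _ := by ring
  rw [← Finset.sum_mul] at h4
  have h7 : Real.exp (((v:ℝ) + 1) / K) ≤ 3 * Real.exp ((v:ℝ) / K) := by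
    have : Real.exp (((v:ℝ) + 1) / K) ≤ Real.exp ((v:ℝ) / K + 1) := by
      apply Real.exp_le_exp.2
      rw [add_div]; gcongr; rw [div_le_one hK0]; exact_mod_cast hK
    rw [Real.exp_add] at this
    have h8 := Real.exp_one_lt_d9
    nlinarith [Real.exp_pos ((v:ℝ) / K)]
  calc _ ≤ _ := h4
    _ ≤ (2 * (3 * Real.exp ((v:ℝ) / K))) * (Real.exp (-((v:ℝ) / K)) * (K / v)) := by
      gcongr
      refine h2.trans (h1.trans ?_)
      gcongr
    _ = 6 * (Real.exp ((v:ℝ) / K) * Real.exp (-((v:ℝ) / K))) * (K / v) := by ring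
    _ = _ := by rw [← Real.exp_add, add_neg_cancel, Real.exp_zero]; ring

lemma norm_Q_le {f : ℕ → ℂ} (hf : ∀ n, ‖f n‖ ≤ 1) (K v : ℕ) (t : ℝ) : ‖Q f K v t‖ ≤ ∑ p ∈ blk K v, 1 / (p:ℝ) := by
  unfold Q
  refine (norm_GD_le _ _ _ _).trans (Finset.sum_le_sum fun p _ => ?_)
  rw [norm_mul, Complex.norm_real, Real.norm_of_nonneg (by positivity)]
  have := hf p
  have h : (0:ℝ) ≤ 1 / p := by positivity
  nlinarith

/-- `‖R‖²` is dominated on `S` by a function of integral at most `B` over `[-T,T]` -/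
def Dom (f : ℕ → ℂ) (y T : ℝ) (S : Set ℝ) (B : ℝ) : Prop :=
  ∃ F : ℝ → ℝ, Continuous F ∧ (∀ t, 0 ≤ F t) ∧ (∀ t ∈ S, ‖R f y t‖ ^ 2 ≤ F t) ∧
    ∫ t in Set.Icc (-T) T, F t ≤ B

lemma cont_int {F : ℝ → ℝ} (hF : Continuous F) (T : ℝ) : IntegrableOn F (Set.Icc (-T) T) :=
  hF.continuousOn.integrableOn_compact isCompact_Icc

lemma Dom.union {f : ℕ → ℂ} {y T : ℝ} {S S' : Set ℝ} {B B' : ℝ} (h : Dom f y T S B) (h' : Dom f y T S' B') :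
    Dom f y T (S ∪ S') (B + B') := by
  obtain ⟨F, h1, h2, h3, h4⟩ := h
  obtain ⟨F', h1', h2', h3', h4'⟩ := h'
  refine ⟨fun t => F t + F' t, h1.add h1', fun t => add_nonneg (h2 t) (h2' t), ?_, ?_⟩
  · rintro t (ht | ht)
    · have := h3 t ht; have := h2' t; linarith
    · have := h3' t ht; have := h2 t; linarith
  · rw [integral_add (cont_int h1 T) (cont_int h1' T)]; linarith

lemma Dom.mono {f : ℕ → ℂ} {y T : ℝ} {S S' : Set ℝ} {B B' : ℝ} (h : Dom f y T S B) (hS : S' ⊆ S) (hB : B ≤ B') :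
    Dom f y T S' B' := by
  obtain ⟨F, h1, h2, h3, h4⟩ := h
  exact ⟨F, h1, h2, fun t ht => h3 t (hS ht), h4.trans hB⟩

/-- good set of a stage -/
def Good (f : ℕ → ℂ) (K a b : ℕ) (α : ℝ) : Set ℝ :=
  {t | ∀ v ∈ Finset.Ico a b, ‖Q f K v t‖ ≤ Real.exp (-(α * (v / K)))}

/-- reduction to the terms `Q R` -/
lemma dom_of_terms {f : ℕ → ℂ} (hf : MF f) {K a b : ℕ} (hK : 1 ≤ K) {y T : ℝ} (hy : 0 ≤ y)
    (hT : T ≤ Real.exp y) (hb : (b:ℝ) / K ≤ y) (hW : 1 ≤ SW K a b) (S : Set ℝ)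
    (E : ℝ) (hE : 0 ≤ E)
    (hS : ∀ v ∈ Finset.Ico a b, ∃ F : ℝ → ℝ, Continuous F ∧ (∀ t, 0 ≤ F t) ∧
      (∀ t ∈ S, ‖Q f K v t * R f (y - v / K) t‖ ^ 2 ≤ F t) ∧ ∫ t in Set.Icc (-T) T, F t ≤ E) :
    Dom f y T S (4000 * Real.exp 10 * (1 / SW K a b + 1 / K ^ 2) + 2 * b ^ 2 * E) := by
  choose! F h1 h2 h3 h4 using hS
  have hW0 : 0 < SW K a b := by linarith
  set F' : ℕ → ℝ → ℝ := fun v => if v ∈ Finset.Ico a b then F v else 0 with hF'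
  have c' : ∀ v, Continuous (F' v) := by
    intro v; simp only [hF']; split_ifs with h
    · exact h1 v h
    · exact continuous_const
  have cE : Continuous (fun t => ‖R f y t - G f K a b y t / SW K a b‖ ^ 2) :=
    (((continuous_R f y).sub ((continuous_G f K a b y).div_const _)).norm).pow 2
  have cS : Continuous (fun t => ∑ v ∈ Finset.Ico a b, F' v t) := continuous_finsetSum _ fun v _ => c' v
  have eF : ∀ v ∈ Finset.Ico a b, F' v = F v := fun v hv => by simp only [hF']; rw [if_pos hv]
  refine ⟨fun t => 2 * ‖R f y t - G f K a b y t / SW K a b‖ ^ 2 + 2 * (b * ∑ v ∈ Finset.Ico a b, F' v t),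
    (cE.const_mul 2).add ((cS.const_mul _).const_mul 2), fun t => ?_, fun t ht => ?_, ?_⟩
  · have : 0 ≤ ∑ v ∈ Finset.Ico a b, F' v t := Finset.sum_nonneg fun v hv => by rw [eF v hv]; exact h2 v hv t
    positivity
  · have e1 : ‖R f y t‖ ≤ ‖R f y t - G f K a b y t / SW K a b‖ + ‖G f K a b y t‖ := by
      calc ‖R f y t‖ = ‖(R f y t - G f K a b y t / SW K a b) + G f K a b y t / SW K a b‖ := by ring_nf
        _ ≤ _ := norm_add_le _ _
        _ ≤ _ := by
          gcongr
          rw [norm_div, Complex.norm_real, Real.norm_of_nonneg hW0.le]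
          exact div_le_self (norm_nonneg _) hW
    have e2 : ‖G f K a b y t‖ ^ 2 ≤ b * ∑ v ∈ Finset.Ico a b, F' v t := by
      calc ‖G f K a b y t‖ ^ 2 ≤ (∑ v ∈ Finset.Ico a b, ‖Q f K v t * R f (y - v / K) t‖) ^ 2 := by
            gcongr; exact norm_sum_le _ _
        _ ≤ (Finset.Ico a b).card * ∑ v ∈ Finset.Ico a b, ‖Q f K v t * R f (y - v / K) t‖ ^ 2 :=
            sq_sum_le_card_mul_sum_sq
        _ ≤ _ := by
            gcongr with v hv
            · rw [Nat.card_Ico]; omega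
            · rw [eF v hv]; exact h3 v hv t ht
    nlinarith [sq_nonneg (‖R f y t - G f K a b y t / SW K a b‖ - ‖G f K a b y t‖), norm_nonneg (R f y t)]
  · rw [integral_add ((cont_int cE T).const_mul 2) (((cont_int cS T).const_mul _).const_mul 2),
      integral_const_mul, integral_const_mul, integral_const_mul, integral_finsetSum _ (fun v _ => cont_int (c' v) T)]
    have e3 : ∫ t in Set.Icc (-T) T, ‖R f y t - G f K a b y t / SW K a b‖ ^ 2 ≤
        2000 * Real.exp 10 * (1 / SW K a b + 1 / K ^ 2) := by
      refine le_trans ?_ (R_sub_G_ms hf hK hy hb hW)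
      exact setIntegral_mono_set (cont_int cE _) (ae_of_all _ fun t => by positivity)
        (LE.le.eventuallyLE (Set.Icc_subset_Icc (by linarith) hT))
    have e4 : ∑ v ∈ Finset.Ico a b, ∫ t in Set.Icc (-T) T, F' v t ≤ b * E := by
      calc _ ≤ ∑ v ∈ Finset.Ico a b, E := Finset.sum_le_sum fun v hv => by rw [eF v hv]; exact h4 v hv
        _ ≤ _ := by
          rw [Finset.sum_const, nsmul_eq_mul, Nat.card_Ico]
          gcongr; omega
    have : (b:ℝ) * ∑ v ∈ Finset.Ico a b, ∫ t in Set.Icc (-T) T, F' v t ≤ b * (b * E) := by gcongr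
    nlinarith

lemma R_ms {f : ℕ → ℂ} (hf : ∀ n, ‖f n‖ ≤ 1) {y T : ℝ} (hy : 0 ≤ y) (hT : 0 < T) (hT' : T ≤ Real.exp y) :
    ∫ t in Set.Icc (-T) T, ‖R f y t‖ ^ 2 ≤ Real.exp 15 := by
  unfold R
  refine (D_mvt _ _ hT).trans ?_
  have h1 := sum_norm_rc_sq_le hf y (NN (y + 3))
  have h2 := NN_le (y + 3)
  have h3 : Real.exp y ≤ Real.exp (y + 3) := Real.exp_le_exp.2 (by linarith)
  have h4 : 1 ≤ Real.exp (y + 3) := Real.one_le_exp (by linarith)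
  calc _ ≤ 7 * (5 * Real.exp (y + 3)) * Real.exp (5 - y) := by gcongr; linarith
    _ = 35 * (Real.exp (y + 3) * Real.exp (5 - y)) := by ring
    _ = 35 * Real.exp 8 := by rw [← Real.exp_add]; congr 2; ring
    _ ≤ Real.exp 7 * Real.exp 8 := by
      gcongr
      have h8 : (2.7:ℝ) ≤ Real.exp 1 := by have := Real.exp_one_gt_d9; linarith
      rw [show (7:ℝ) = (7:ℕ) * 1 by norm_num, Real.exp_nat_mul]
      calc (35:ℝ) ≤ 2.7 ^ 7 := by norm_num
        _ ≤ _ := by gcongr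
    _ = _ := by rw [← Real.exp_add]; norm_num

/-- first stage -/
lemma dom_first {f : ℕ → ℂ} (hf : MF f) {K a b : ℕ} (hK : 1 ≤ K) {y T α : ℝ} (hα : 0 ≤ α) (hT0 : 0 < T)
    (hy : (b:ℝ) / K ≤ y) (hT : T ≤ Real.exp (y - b / K)) (hW : 1 ≤ SW K a b) :
    Dom f y T (Good f K a b α) (4000 * Real.exp 10 * (1 / SW K a b + 1 / K ^ 2) +
      2 * b ^ 2 * Real.exp (15 - 2 * α * (a / K))) := by
  have hb0 : (0:ℝ) ≤ b / K := by positivity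
  refine dom_of_terms hf hK (hb0.trans hy) (hT.trans (Real.exp_le_exp.2 (by linarith))) hy hW _ _ (Real.exp_pos _).le fun v hv => ?_
  rw [Finset.mem_Ico] at hv
  have hvb : (v:ℝ) / K ≤ b / K := by gcongr; exact_mod_cast hv.2.le
  refine ⟨fun t => Real.exp (-(2 * α * (a / K))) * ‖R f (y - v / K) t‖ ^ 2,
    continuous_const.mul ((continuous_R _ _).norm.pow 2), fun t => by positivity, fun t ht => ?_, ?_⟩
  · rw [norm_mul, mul_pow]
    refine mul_le_mul_of_nonneg_right ?_ (by positivity)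
    have h1 := ht v (Finset.mem_Ico.2 hv)
    have hav : (a:ℝ) / K ≤ v / K := by gcongr; exact_mod_cast hv.1
    calc ‖Q f K v t‖ ^ 2 ≤ Real.exp (-(α * (v / K))) ^ 2 := by gcongr
      _ = Real.exp (-(2 * α * (v / K))) := by rw [← Real.exp_nat_mul]; congr 1; push_cast; ring
      _ ≤ _ := by
        apply Real.exp_le_exp.2
        have : α * (a / K) ≤ α * (v / K) := by gcongr
        linarith
  · rw [integral_const_mul]
    have := R_ms hf.bd (y := y - v / K) (T := T) (by linarith) hT0 (hT.trans (Real.exp_le_exp.2 (by linarith)))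
    calc _ ≤ Real.exp (-(2 * α * (a / K))) * Real.exp 15 := by gcongr
      _ = _ := by rw [← Real.exp_add]; congr 1; ring

/-- transition -/
lemma dom_trans {f : ℕ → ℂ} (hf : MF f) {K a b K' a' b' : ℕ} (hK : 1 ≤ K) (hK' : 1 ≤ K') (ha : 1 ≤ a) (ha' : 1 ≤ a')
    {y T α α' Y : ℝ} (hT0 : 0 < T) (hy : 1 ≤ y)
    (hb : (b:ℝ) / K ≤ y) (hT : T ≤ Real.exp (y - 1)) (hW : 1 ≤ SW K a b)
    (hE : ∀ v ∈ Finset.Ico a b, ∀ r ∈ Finset.Ico a' b', ∀ ℓ : ℕ, 1 ≤ ℓ → (ℓ:ℝ) * (r / K') ≤ v / K + r / K' →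
      -(2 * α * (v / K)) + 2 * ℓ * (α' * (r / K')) + 18 + 2 * ℓ + 2 * ℓ * Real.log (2 * ℓ) ≤ -Y) :
    Dom f y T ((Good f K' a' b' α')ᶜ ∩ Good f K a b α) (4000 * Real.exp 10 * (1 / SW K a b + 1 / K ^ 2) +
      2 * b ^ 2 * (b' * Real.exp (-Y))) := by
  have hK0 : (0:ℝ) < K := by exact_mod_cast hK
  have hK0' : (0:ℝ) < K' := by exact_mod_cast hK'
  refine dom_of_terms hf hK (by linarith) (hT.trans (Real.exp_le_exp.2 (by linarith))) hb hW _ _ (by positivity) fun v hv => ?_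
  have hv' := Finset.mem_Ico.1 hv
  have hvb : (v:ℝ) / K ≤ b / K := by gcongr; exact_mod_cast hv'.2.le
  have hv0 : (0:ℝ) < v / K := by
    have : (0:ℝ) < v := by exact_mod_cast (show 0 < v by omega)
    positivity
  set ℓ : ℕ → ℕ := fun r => ⌈(v / K : ℝ) / (r / K')⌉₊ with hℓ
  set cf : ℕ → ℝ := fun r => Real.exp (-(2 * α * (v / K))) * Real.exp (2 * ℓ r * (α' * (r / K'))) with hcf
  have cts : ∀ r, Continuous (fun t => ‖Q f K' r t ^ ℓ r * R f (y - v / K) t‖ ^ 2) := fun r =>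
    ((((continuous_Q _ _ _).pow _).mul (continuous_R _ _)).norm).pow 2
  refine ⟨fun t => ∑ r ∈ Finset.Ico a' b', cf r * ‖Q f K' r t ^ ℓ r * R f (y - v / K) t‖ ^ 2,
    continuous_finsetSum _ fun r _ => continuous_const.mul (cts r), fun t => Finset.sum_nonneg fun r _ => by positivity,
    fun t ht => ?_, ?_⟩
  · obtain ⟨ht1, ht2⟩ := ht
    have : ∃ r ∈ Finset.Ico a' b', Real.exp (-(α' * (r / K'))) < ‖Q f K' r t‖ := by
      by_contra! h; exact ht1 h
    obtain ⟨r, hr, hrt⟩ := this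
    refine le_trans ?_ (Finset.single_le_sum (f := fun r => cf r * ‖Q f K' r t ^ ℓ r * R f (y - v / K) t‖ ^ 2)
      (fun r _ => by positivity) hr)
    simp only [hcf]
    rw [norm_mul, mul_pow, norm_mul, mul_pow, ← mul_assoc]
    gcongr
    have h1 := ht2 v hv
    have h2 : 1 ≤ Real.exp (2 * ℓ r * (α' * (r / K'))) * ‖Q f K' r t ^ ℓ r‖ ^ 2 := by
      have e : Real.exp (2 * ℓ r * (α' * (r / K'))) * ‖Q f K' r t ^ ℓ r‖ ^ 2 =
          (Real.exp (α' * (r / K')) * ‖Q f K' r t‖) ^ (2 * ℓ r) := by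
        rw [norm_pow, mul_pow, ← pow_mul, mul_comm (ℓ r) 2, ← Real.exp_nat_mul]; push_cast; rfl
      rw [e]
      apply one_le_pow₀
      rw [Real.exp_neg, inv_lt_iff_one_lt_mul₀' (Real.exp_pos _)] at hrt
      exact hrt.le
    calc ‖Q f K v t‖ ^ 2 ≤ Real.exp (-(α * (v / K))) ^ 2 := by gcongr
      _ = Real.exp (-(2 * α * (v / K))) * 1 := by rw [← Real.exp_nat_mul, mul_one]; congr 1; push_cast; ring
      _ ≤ Real.exp (-(2 * α * (v / K))) * (Real.exp (2 * ℓ r * (α' * (r / K'))) * ‖Q f K' r t ^ ℓ r‖ ^ 2) := by gcongr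
      _ = _ := by ring
  · rw [integral_finsetSum _ (fun r _ => (cont_int (cts r) T).const_mul _)]
    have key : ∀ r ∈ Finset.Ico a' b', ∫ t in Set.Icc (-T) T, cf r * ‖Q f K' r t ^ ℓ r * R f (y - v / K) t‖ ^ 2 ≤ Real.exp (-Y) := by
      intro r hr
      have hr' := Finset.mem_Ico.1 hr
      have hr0 : (0:ℝ) < r / K' := by
        have : (0:ℝ) < r := by exact_mod_cast (show 0 < r by omega)
        positivity
      have l1 : (v / K : ℝ) / (r / K') ≤ ℓ r := Nat.le_ceil _
      have l2 : (ℓ r : ℝ) < (v / K : ℝ) / (r / K') + 1 := Nat.ceil_lt_add_one (by positivity)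
      have l3 : 1 ≤ ℓ r := Nat.ceil_pos.2 (by positivity)
      rw [div_le_iff₀ hr0] at l1
      have l4 : (ℓ r : ℝ) * (r / K') ≤ v / K + r / K' := by
        have := mul_lt_mul_of_pos_right l2 hr0
        rw [add_mul, div_mul_cancel₀ _ hr0.ne', one_mul] at this
        exact this.le
      have h1 := hE v hv r hr (ℓ r) l3 l4
      rw [integral_const_mul]
      have hm := moment (blk K' r) (fun p hp => ((mem_blk hK').1 hp).1) (fun p => f p * ((1 / p : ℝ) : ℂ))
        (rc f (y - v / K)) (fun p _ => by
          rw [norm_mul, Complex.norm_real, Real.norm_of_nonneg (by positivity)]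
          exact mul_le_of_le_one_left (by positivity) (hf.bd p))
        (fun n _ => (norm_rc_le hf.bd _ n).trans (by gcongr; exact w_le_one _))
        (s := r / K') (s' := (r + 1) / K') (z := y - v / K - 1) (z' := y - v / K + 3)
        (by gcongr; linarith) (by rw [add_div]; gcongr; rw [div_le_one hK0']; exact_mod_cast hK')
        (fun p hp => blk_log hK' hp) (fun n _ h => rc_supp n h) (NN (y - v / K + 3))
        (fun m hm => rc_eq_zero (Or.inr (le_log_of_NN_le hm))) (ℓ r) hT0 (by linarith) (by linarith)
        (hT.trans (Real.exp_le_exp.2 (by linarith)))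
      have hfac : ((2 * ℓ r).factorial : ℝ) ≤ Real.exp (2 * ℓ r * Real.log (2 * ℓ r)) := by
        have p0 : (0:ℝ) < 2 * ℓ r := by have : (1:ℝ) ≤ ℓ r := by exact_mod_cast l3
                                        linarith
        have : ((2 * ℓ r).factorial : ℝ) ≤ ((2 * ℓ r : ℕ) : ℝ) ^ (2 * ℓ r) := by exact_mod_cast Nat.factorial_le_pow _
        refine this.trans (le_of_eq ?_)
        rw [mul_comm (2 * (ℓ r:ℝ)) (Real.log _), Real.exp_mul, Real.exp_log p0, ← Real.rpow_natCast]; push_cast; rfl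
      calc _ ≤ cf r * (Real.exp (10 + 2 * (y - v / K + 3 - (y - v / K - 1)) + 2 * ℓ r) * Real.exp (2 * ℓ r * Real.log (2 * ℓ r))) := by
            refine mul_le_mul_of_nonneg_left ?_ (by positivity)
            exact hm.trans (by gcongr)
        _ = Real.exp (-(2 * α * (v / K)) + 2 * ℓ r * (α' * (r / K')) + 18 + 2 * ℓ r + 2 * ℓ r * Real.log (2 * ℓ r)) := by
            simp only [hcf]
            rw [← Real.exp_add, ← Real.exp_add, ← Real.exp_add]; congr 1; ring
        _ ≤ _ := Real.exp_le_exp.2 h1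
    calc _ ≤ ∑ r ∈ Finset.Ico a' b', Real.exp (-Y) := Finset.sum_le_sum key
      _ ≤ _ := by
        rw [Finset.sum_const, nsmul_eq_mul, Nat.card_Ico]
        gcongr; omega

lemma expo {A x s α α' γ : ℝ} {ℓ : ℕ} (hA : 1 ≤ A) (hs : A ≤ s) (hs' : s ≤ A ^ 2) (hx : A ≤ x) (hx' : x ≤ A ^ 9)
    (hα' : 0 ≤ α') (hα1 : α' ≤ 1) (hγ : γ ≤ α - α') (h1 : 8 * (3 + 8 * Real.log A) ≤ γ * A)
    (h2 : 2 * A ^ 2 + 18 ≤ γ * x / 2) (hℓ : 1 ≤ ℓ) (hℓs : ℓ * s ≤ x + s) :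
    -(2 * α * x) + 2 * ℓ * (α' * s) + 18 + 2 * ℓ + 2 * ℓ * Real.log (2 * ℓ) ≤ -(γ * x) := by
  have hA0 : 0 < A := by linarith
  have hl1 : (1:ℝ) ≤ ℓ := by exact_mod_cast hℓ
  have hl2 : (ℓ:ℝ) * A ≤ 2 * x := by
    have : ((ℓ:ℝ) - 1) * A ≤ (ℓ - 1) * s := by gcongr
    nlinarith
  have hl3 : (ℓ:ℝ) ≤ 2 * A ^ 8 := by
    have : (ℓ:ℝ) * A ≤ 2 * A ^ 8 * A := by nlinarith
    exact le_of_mul_le_mul_right this hA0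
  have hlog : Real.log (2 * ℓ) ≤ 2 + 8 * Real.log A := by
    have e : Real.log (2 * ℓ) ≤ Real.log (4 * A ^ 8) := Real.log_le_log (by positivity) (by linarith)
    rw [Real.log_mul (x := 4) (by norm_num) (by positivity), Real.log_pow] at e
    have e4 : Real.log 4 ≤ 2 := by
      rw [Real.log_le_iff_le_exp (by norm_num), show (2:ℝ) = 1 + 1 by norm_num, Real.exp_add]
      have := Real.exp_one_gt_d9
      nlinarith
    push_cast at e; linarith
  have hLA : 0 ≤ Real.log A := Real.log_nonneg hA
  have t1 : 2 * ℓ * (α' * s) ≤ 2 * α' * x + 2 * A ^ 2 := by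
    have : α' * (ℓ * s) ≤ α' * (x + s) := by gcongr
    nlinarith
  have t2 : 2 * ℓ + 2 * ℓ * Real.log (2 * ℓ) ≤ γ * x / 2 := by
    have e1 : 2 * ℓ + 2 * ℓ * Real.log (2 * ℓ) ≤ 2 * ℓ * (3 + 8 * Real.log A) := by nlinarith
    have e2 : 8 * (ℓ * (3 + 8 * Real.log A)) ≤ 2 * (γ * x) := by
      have hg : 0 ≤ γ := by
        by_contra! h
        nlinarith
      calc 8 * (ℓ * (3 + 8 * Real.log A)) = ℓ * (8 * (3 + 8 * Real.log A)) := by ring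
        _ ≤ ℓ * (γ * A) := by gcongr
        _ = γ * (ℓ * A) := by ring
        _ ≤ γ * (2 * x) := by gcongr
        _ = _ := by ring
    linarith
  have t3 : γ * x ≤ (α - α') * x := by gcongr; linarith
  nlinarith

def AA (j : ℕ) : ℕ := 2 ^ (3 ^ j)

lemma AA_succ (j : ℕ) : AA (j + 1) = AA j ^ 3 := by unfold AA; rw [← pow_mul, pow_succ]

lemma log_AA (j : ℕ) : Real.log (AA j) = 3 ^ j * Real.log 2 := by
  unfold AA; push_cast; rw [Real.log_pow]; push_cast; ring

lemma AA_ge (j : ℕ) : 3 ^ j ≤ AA j := (Nat.lt_two_pow_self).le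

lemma AA_two (j : ℕ) : 2 ≤ AA j := by
  unfold AA; calc 2 = 2 ^ 1 := rfl
    _ ≤ _ := Nat.pow_le_pow_right (by norm_num) (Nat.one_le_pow _ _ (by norm_num))

lemma AA_mono : Monotone AA := fun i j h => Nat.pow_le_pow_right (by norm_num) (Nat.pow_le_pow_right (by norm_num) h)

lemma AA_tendsto : Tendsto (fun j => (AA j : ℝ)) atTop atTop := by
  refine tendsto_natCast_atTop_atTop.comp ?_
  refine tendsto_atTop_mono AA_ge ?_
  exact tendsto_pow_atTop_atTop_of_one_lt (by norm_num)

def big (η A : ℝ) : Prop := 1000 * Real.log A ^ 2 ≤ η * A ∧ 1 ≤ Real.log A ∧ 5 ≤ A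

lemma big_ev {η : ℝ} (hη : 0 < η) : ∀ᶠ A in atTop, big η A := by
  have h1 := (Real.isLittleO_pow_log_id_atTop (n := 2)).bound (show 0 < η / 1000 by positivity)
  filter_upwards [h1, Real.tendsto_log_atTop.eventually_ge_atTop 1, eventually_ge_atTop (5:ℝ)] with A h1 h2 h3
  refine ⟨?_, h2, h3⟩
  simp only [id, Real.norm_eq_abs] at h1
  rw [abs_of_nonneg (by positivity), abs_of_nonneg (by linarith)] at h1
  linarith

def al (η : ℝ) (j : ℕ) : ℝ := η * (1 - (1 / 3) ^ j)

lemma al_nonneg {η : ℝ} (hη : 0 < η) (j : ℕ) : 0 ≤ al η j := by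
  unfold al
  have : (1 / 3 : ℝ) ^ j ≤ 1 := pow_le_one₀ (by norm_num) (by norm_num)
  have : 0 ≤ 1 - (1 / 3 : ℝ) ^ j := by linarith
  positivity

lemma al_le {η : ℝ} (hη : 0 < η) (j : ℕ) : al η j ≤ η := by
  unfold al
  have : 0 < (1 / 3 : ℝ) ^ j := by positivity
  nlinarith

lemma al_diff (η : ℝ) (j : ℕ) : al η (j + 1) - al η j = 2 / 3 * η * (1 / 3) ^ j := by
  unfold al; ring

lemma gam_ge {η : ℝ} (hη : 0 < η) (j : ℕ) : 0.4 * η / Real.log (AA j) ≤ al η (j + 1) - al η j := by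
  rw [al_diff, log_AA]
  have := Real.log_two_gt_d9
  rw [div_le_iff₀ (by positivity), one_div_pow]
  have e : 2 / 3 * η * (1 / 3 ^ j) * (3 ^ j * Real.log 2) = 2 / 3 * η * Real.log 2 := by field_simp
  rw [e]
  nlinarith

/-- the good set of the `j`-th stage -/
def GS (f : ℕ → ℂ) (η : ℝ) (j : ℕ) : Set ℝ := Good f (AA j) (AA j ^ 2) (AA j ^ 3) (al η j)

lemma pow_exp_le {A L Z : ℝ} (hA : 5 ≤ A) (hL : L = Real.log A) (n : ℕ) (hZ : (n + 2) * L ≤ Z) :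
    2 * A ^ n * Real.exp (-Z) ≤ 1 / A := by
  have hA0 : 0 < A := by linarith
  have : Real.exp (-Z) ≤ 1 / A ^ (n + 2) := by
    rw [Real.exp_neg, ← one_div]
    apply one_div_le_one_div_of_le (by positivity)
    calc A ^ (n + 2) = Real.exp ((n + 2) * L) := by
          rw [hL, show ((n:ℝ) + 2) = ((n + 2 : ℕ) : ℝ) by push_cast; ring, Real.exp_nat_mul, Real.exp_log hA0]
      _ ≤ _ := Real.exp_le_exp.2 hZ
  calc 2 * A ^ n * Real.exp (-Z) ≤ 2 * A ^ n * (1 / A ^ (n + 2)) := by gcongr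
    _ = 2 / A * (1 / A) := by field_simp; ring
    _ ≤ 1 * (1 / A) := by gcongr; rw [div_le_one hA0]; linarith
    _ = _ := one_mul _

lemma stage_err {c W : ℝ} (hc : 0 < c) {j : ℕ} (h5 : (5:ℝ) ≤ AA j) (hW : c * Real.log (AA j / 2) ≤ W) :
    4000 * Real.exp 10 * (1 / W + 1 / (AA j) ^ 2) + 1 / AA j ≤ (4000 * Real.exp 10 * (4 / c + 1) + 1) * (1 / 3) ^ j := by
  have h0 : (0:ℝ) < AA j := by linarith
  have h2 := Real.log_two_gt_d9
  have hl : Real.log (AA j) / 2 ≤ Real.log (AA j / 2) := by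
    rw [div_le_iff₀ (by norm_num), mul_comm, ← Real.log_rpow (by positivity)]
    apply Real.log_le_log h0
    norm_num; nlinarith
  rw [log_AA] at hl
  have h3 : (0:ℝ) < 3 ^ j := by positivity
  have hW' : c / 4 * 3 ^ j ≤ W := by
    refine le_trans ?_ hW
    have : (3:ℝ) ^ j / 4 ≤ Real.log (AA j / 2) := by nlinarith
    nlinarith
  have e1 : 1 / W ≤ 4 / c * (1 / 3) ^ j := by
    calc 1 / W ≤ 1 / (c / 4 * 3 ^ j) := one_div_le_one_div_of_le (by positivity) hW'
      _ = _ := by rw [one_div_pow]; field_simp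
  have e2 : 1 / (AA j : ℝ) ≤ (1 / 3) ^ j := by
    rw [one_div_pow]; apply one_div_le_one_div_of_le h3; exact_mod_cast AA_ge j
  have e3 : 1 / (AA j : ℝ) ^ 2 ≤ (1 / 3) ^ j := by
    refine le_trans ?_ e2
    apply one_div_le_one_div_of_le h0; nlinarith
  calc _ ≤ 4000 * Real.exp 10 * (4 / c * (1 / 3) ^ j + (1 / 3) ^ j) + (1 / 3) ^ j := by gcongr
    _ = _ := by ring

lemma ico_div {A v : ℕ} (hA : 2 ≤ A) (hv : v ∈ Finset.Ico (A ^ 2) (A ^ 3)) : (A:ℝ) ≤ v / A ∧ (v:ℝ) / A ≤ (A:ℝ) ^ 2 := by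
  rw [Finset.mem_Ico] at hv
  have hA0 : (0:ℝ) < A := by exact_mod_cast (show 0 < A by omega)
  have h1 : ((A ^ 2 : ℕ) : ℝ) ≤ v := by exact_mod_cast hv.1
  have h2 : (v:ℝ) ≤ ((A ^ 3 : ℕ) : ℝ) := by exact_mod_cast hv.2.le
  push_cast at h1 h2
  constructor
  · rw [le_div_iff₀ hA0, ← pow_two]; exact h1
  · rw [div_le_iff₀ hA0, ← pow_succ]; exact h2

set_option maxHeartbeats 800000 in
/-- one step of the iteration -/
lemma dom_step {f : ℕ → ℂ} (hf : MF f) {c s₀ : ℝ} (hc : 0 < c)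
    (hSW : ∀ K a b : ℕ, 1 ≤ K → s₀ ≤ (a:ℝ) / K → a + K ≤ b → c * Real.log (b / (2 * a)) ≤ SW K a b)
    {η : ℝ} (hη : 0 < η) (hη1 : η ≤ 1) {j : ℕ} (hb : big η (AA j)) (hs : s₀ ≤ AA j) (hcl : 1 ≤ c * Real.log (AA j / 2))
    {y T : ℝ} (hT0 : 0 < T) (hT : T ≤ Real.exp (y - 1)) (hy : (AA (j + 1) : ℝ) ^ 2 ≤ y) :
    Dom f y T ((GS f η j)ᶜ ∩ GS f η (j + 1)) ((4000 * Real.exp 10 * (4 / c + 1) + 1) * (1 / 3) ^ (j + 1)) := by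
  obtain ⟨hb1, hb2, hb3⟩ := hb
  have hm : (AA j : ℝ) ≤ AA (j + 1) := by exact_mod_cast AA_mono (Nat.le_succ j)
  set A' := AA (j + 1) with hA'
  set A := AA j with hA
  have hAA : A' = A ^ 3 := AA_succ j
  have hAAr : (A':ℝ) = (A:ℝ) ^ 3 := by rw [hAA]; push_cast; rfl
  have hA0 : (0:ℝ) < A := by linarith
  have h2 : 2 ≤ A' := AA_two _
  have h2' : 2 ≤ A := AA_two _
  have hA0' : (0:ℝ) < A' := by linarith
  have ra : ((A' ^ 2 : ℕ) : ℝ) / A' = A' := by push_cast; field_simp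
  have rb : ((A' ^ 3 : ℕ) : ℝ) / A' = A' ^ 2 := by push_cast; field_simp
  have hW : c * Real.log (A' / 2) ≤ SW A' (A' ^ 2) (A' ^ 3) := by
    have := hSW A' (A' ^ 2) (A' ^ 3) (by omega) (by rw [ra]; linarith) (by nlinarith)
    convert this using 3
    push_cast; field_simp
  have hlm : Real.log (A / 2) ≤ Real.log (A' / 2) := Real.log_le_log (by positivity) (by gcongr)
  have hW1 : 1 ≤ SW A' (A' ^ 2) (A' ^ 3) := by nlinarith
  set L := Real.log A with hL
  set γ := 0.4 * η / L with hγ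
  have hγ0 : 0 < γ := by positivity
  have hγL : γ * L = 0.4 * η := by rw [hγ]; field_simp
  have hγ' : γ ≤ al η (j + 1) - al η j := gam_ge hη j
  have c1 : 8 * (3 + 8 * L) ≤ γ * A := by
    have : 8 * (3 + 8 * L) * L ≤ γ * A * L := by nlinarith
    exact le_of_mul_le_mul_right this (by linarith)
  have c2 : 2 * (A:ℝ) ^ 2 + 18 ≤ γ * A ^ 3 / 2 := by
    have a1 : 88 ≤ γ * A := by nlinarith
    have a2 : (A:ℝ) ^ 2 * 88 ≤ A ^ 2 * (γ * A) := by gcongr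
    nlinarith
  have c3 : (((23:ℕ):ℝ) + 2) * L ≤ γ * A ^ 3 := by
    have q1 : (1:ℝ) ≤ (A:ℝ) ^ 2 := by nlinarith
    have q2 : L * 1 ≤ L * L := by gcongr
    have q3 : γ * A * 1 ≤ γ * A * A ^ 2 := by gcongr
    have q4 : 25 * L ≤ γ * A := by linarith
    push_cast; linarith
  have hD := dom_trans hf (K := A') (a := A' ^ 2) (b := A' ^ 3) (K' := A) (a' := A ^ 2) (b' := A ^ 3) (by omega) (by omega)
    (by nlinarith) (by nlinarith) (y := y) (T := T) (α := al η (j + 1)) (α' := al η j) (Y := γ * A ^ 3) hT0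
    (by nlinarith) (by rw [rb]; exact hy) hT hW1 ?_
  · refine hD.mono le_rfl ?_
    refine le_trans ?_ (stage_err hc (by linarith) hW)
    gcongr
    have e0 : 2 * (((A' ^ 3 : ℕ) : ℝ)) ^ 2 * (((A ^ 3 : ℕ) : ℝ) * Real.exp (-(γ * A ^ 3))) = 2 * (A:ℝ) ^ 21 * Real.exp (-(γ * A ^ 3)) := by
      push_cast; rw [hAAr]; ring
    have e1 := pow_exp_le hb3 hL 23 (Z := γ * A ^ 3) c3
    rw [e0, hAAr]
    have ex : 2 * (A:ℝ) ^ 21 * Real.exp (-(γ * A ^ 3)) = 2 * (A:ℝ) ^ 23 * Real.exp (-(γ * A ^ 3)) / A ^ 2 := by field_simp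
    rw [ex]
    calc _ ≤ 1 / (A:ℝ) / A ^ 2 := by gcongr
      _ = _ := by field_simp
  · intro v hv r hr ℓ hℓ hℓs
    obtain ⟨v1, v2⟩ := ico_div h2 hv
    obtain ⟨r1, r2⟩ := ico_div h2' hr
    refine (expo (A := A) (γ := γ) (by linarith) r1 r2 (by linarith) ?_ (al_nonneg hη j) ((al_le hη j).trans hη1) hγ' c1 ?_ hℓ hℓs).trans ?_
    · refine v2.trans ?_
      rw [hAAr, ← pow_mul]; exact pow_le_pow_right₀ (by linarith) (by norm_num)
    · refine c2.trans ?_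
      gcongr; rw [← hAAr]; exact v1
    · rw [hAAr] at v1
      have : γ * A ^ 3 ≤ γ * (v / A') := by rw [hAAr]; gcongr
      linarith

lemma dom_init {f : ℕ → ℂ} (hf : MF f) {c s₀ : ℝ} (hc : 0 < c)
    (hSW : ∀ K a b : ℕ, 1 ≤ K → s₀ ≤ (a:ℝ) / K → a + K ≤ b → c * Real.log (b / (2 * a)) ≤ SW K a b)
    {η : ℝ} (hη : 0 < η) {j : ℕ} (hj : 1 ≤ j) (hb : big η (AA j)) (hs : s₀ ≤ AA j) (hcl : 1 ≤ c * Real.log (AA j / 2))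
    {y T : ℝ} (hT0 : 0 < T) (hT : T ≤ Real.exp (y - (AA j : ℝ) ^ 2)) (hy : (AA j : ℝ) ^ 2 ≤ y) :
    Dom f y T (GS f η j) ((4000 * Real.exp 10 * (4 / c + 1) + 1) * (1 / 3) ^ j) := by
  obtain ⟨hb1, hb2, hb3⟩ := hb
  set A := AA j with hA
  have hA0 : (0:ℝ) < A := by linarith
  have h2 : 2 ≤ A := AA_two _
  have ra : ((A ^ 2 : ℕ) : ℝ) / A = A := by push_cast; field_simp
  have rb : ((A ^ 3 : ℕ) : ℝ) / A = A ^ 2 := by push_cast; field_simp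
  have hW : c * Real.log (A / 2) ≤ SW A (A ^ 2) (A ^ 3) := by
    have := hSW A (A ^ 2) (A ^ 3) (by omega) (by rw [ra]; linarith) (by nlinarith)
    convert this using 3
    push_cast; field_simp
  have hD := dom_first hf (K := A) (a := A ^ 2) (b := A ^ 3) (y := y) (by omega) (al_nonneg hη j) hT0 (by rw [rb]; exact hy)
    (by rw [rb]; exact hT) (by linarith)
  refine hD.mono le_rfl ?_
  refine le_trans ?_ (stage_err hc (by linarith) hW)
  gcongr
  rw [ra]
  have ha : η / 2 ≤ al η j := by
    unfold al
    have : (1 / 3 : ℝ) ^ j ≤ 1 / 3 := by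
      calc (1 / 3 : ℝ) ^ j ≤ (1 / 3) ^ 1 := pow_le_pow_of_le_one (by norm_num) (by norm_num) hj
        _ = _ := by norm_num
    nlinarith
  have e := pow_exp_le hb3 rfl 6 (Z := 2 * al η j * A - 15) ?_
  · rw [show -(2 * al η j * A - 15) = 15 - 2 * al η j * (A:ℝ) by ring] at e
    refine le_trans (le_of_eq ?_) e
    push_cast; ring
  · push_cast
    have : η * A ≤ 2 * al η j * A := by nlinarith
    nlinarith

lemma dom_iter {f : ℕ → ℂ} (hf : MF f) {c s₀ : ℝ} (hc : 0 < c)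
    (hSW : ∀ K a b : ℕ, 1 ≤ K → s₀ ≤ (a:ℝ) / K → a + K ≤ b → c * Real.log (b / (2 * a)) ≤ SW K a b)
    {η : ℝ} (hη : 0 < η) (hη1 : η ≤ 1) {j₀ : ℕ} (hj : 1 ≤ j₀)
    (hb : ∀ j, j₀ ≤ j → big η (AA j)) (hs : s₀ ≤ AA j₀) (hcl : 1 ≤ c * Real.log (AA j₀ / 2))
    {y T : ℝ} (hT0 : 0 < T) (hT : T ≤ Real.exp (y - (AA j₀ : ℝ) ^ 2)) (i : ℕ) :
    (AA (j₀ + i) : ℝ) ^ 2 ≤ y →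
    Dom f y T {t | ∃ k ≤ i, t ∈ GS f η (j₀ + k)}
      ((4000 * Real.exp 10 * (4 / c + 1) + 1) * ((1 / 3) ^ j₀ * (2 - (1 / 3) ^ i))) := by
  induction i with
  | zero =>
    intro hy
    refine (dom_init hf hc hSW hη hj (hb _ le_rfl) hs hcl hT0 hT hy).mono ?_ ?_
    · rintro t ⟨k, hk, ht⟩
      obtain rfl : k = 0 := by omega
      exact ht
    · apply le_of_eq; ring
  | succ i ih =>
    intro hy
    have hm : (AA (j₀ + i) : ℝ) ≤ AA (j₀ + (i + 1)) := by exact_mod_cast AA_mono (by omega)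
    have hm0 : (AA j₀ : ℝ) ≤ AA (j₀ + i) := by exact_mod_cast AA_mono (by omega)
    have hp : (2:ℝ) ≤ AA j₀ := by exact_mod_cast AA_two j₀
    have h1 := ih (le_trans (by gcongr) hy)
    have h2 := dom_step hf hc hSW hη hη1 (hb (j₀ + i) (by omega)) (hs.trans hm0)
      (hcl.trans (by gcongr)) hT0 (hT.trans (Real.exp_le_exp.2 (by nlinarith))) hy
    refine (h1.union h2).mono ?_ ?_
    · rintro t ⟨k, hk, ht⟩
      by_cases h : t ∈ GS f η (j₀ + i)
      · exact Or.inl ⟨i, le_rfl, h⟩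
      rcases Nat.lt_or_ge i k with h' | h'
      · obtain rfl : k = i + 1 := by omega
        exact Or.inr ⟨h, ht⟩
      · exact Or.inl ⟨k, h', ht⟩
    · rw [← mul_add]
      refine mul_le_mul_of_nonneg_left ?_ (by positivity)
      rw [show (1 / 3 : ℝ) ^ (j₀ + i + 1) = (1 / 3) ^ j₀ * ((1 / 3) ^ i * (1 / 3)) by ring, ← mul_add, pow_succ]
      refine mul_le_mul_of_nonneg_left ?_ (by positivity)
      have : (0:ℝ) < (1 / 3) ^ i := by positivity
      linarith

set_option maxHeartbeats 1000000 in
/-- all stages, final good set -/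
lemma iter {f : ℕ → ℂ} (hf : MF f) {η : ℝ} (hη : 0 < η) (hη1 : η ≤ 1) {ε : ℝ} (hε : 0 < ε) :
    ∃ Q₁ : ℝ, 1 ≤ Q₁ ∧ ∀ Q₀ ≥ Q₁, ∀ K : ℕ, 1 ≤ K → ∀ e₂ > 0, ∃ y₀ : ℝ, ∀ y ≥ y₀, ∀ a b : ℕ, e₂ * y ≤ (a:ℝ) / K →
      (b:ℝ) / K ≤ y → 1 ≤ SW K a b →
      Dom f y (Real.exp y / Q₀) (Good f K a b (2 * η)) (ε + 4000 * Real.exp 10 * (1 / SW K a b + 1 / K ^ 2)) := by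
  obtain ⟨c, s₀, hc, hs₀, hSW⟩ := SW_lower
  have ev1 : ∀ᶠ j in atTop, ∀ j' ≥ j, big η (AA j') := by
    exact eventually_forall_ge_atTop.2 (AA_tendsto.eventually (big_ev hη))
  have ev2 : ∀ᶠ j in atTop, s₀ ≤ AA j := AA_tendsto.eventually_ge_atTop s₀
  have ev3 : ∀ᶠ j in atTop, 1 ≤ c * Real.log (AA j / 2) := by
    have : Tendsto (fun j => c * Real.log ((AA j : ℝ) / 2)) atTop atTop :=
      (Real.tendsto_log_atTop.comp (AA_tendsto.atTop_div_const (by norm_num))).const_mul_atTop hc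
    exact this.eventually_ge_atTop 1
  set C := 4000 * Real.exp 10 * (4 / c + 1) + 1 with hC
  have hC0 : 0 < C := by positivity
  have ev4 : ∀ᶠ j in atTop, C * ((1 / 3) ^ j * 2) ≤ ε / 2 := by
    have : Tendsto (fun j : ℕ => C * ((1 / 3 : ℝ) ^ j * 2)) atTop (𝓝 (C * (0 * 2))) :=
      ((tendsto_pow_atTop_nhds_zero_of_lt_one (by norm_num) (by norm_num)).mul_const 2).const_mul C
    rw [zero_mul, mul_zero] at this
    exact this.eventually_le_const (by positivity)
  obtain ⟨j₀, h1, h2, h3, h4, hj⟩ := (ev1.and (ev2.and (ev3.and (ev4.and (eventually_ge_atTop 1))))).exists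
  refine ⟨Real.exp ((AA j₀ : ℝ) ^ 2), Real.one_le_exp (by positivity), fun Q₀ hQ₀ K hK e₂ he₂ => ?_⟩
  have hQpos : 0 < Q₀ := lt_of_lt_of_le (Real.exp_pos _) hQ₀
  -- the index J
  obtain ⟨j₁, hj₁, hj₁'⟩ := ((AA_tendsto.eventually_ge_atTop (6 / (η * e₂))).and (eventually_ge_atTop j₀)).exists
  have evy : ∀ᶠ y : ℝ in atTop, 2 * (K * y) ^ 2 * (y * Real.exp (-(η * (e₂ * y)))) ≤ ε / 2 := by
    have h := tendsto_rpow_mul_exp_neg_mul_atTop_nhds_zero 3 (η * e₂) (by positivity)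
    have h' := (h.const_mul (2 * (K:ℝ) ^ 2))
    rw [mul_zero] at h'
    filter_upwards [h'.eventually_le_const (show (0:ℝ) < ε / 2 by positivity), eventually_ge_atTop 0] with y hy hy0
    refine le_trans (le_of_eq ?_) hy
    rw [show (3:ℝ) = ((3:ℕ):ℝ) by norm_num, Real.rpow_natCast, show -(η * (e₂ * y)) = -(η * e₂) * y by ring]; ring
  obtain ⟨y₁, hy₁⟩ := eventually_atTop.1 evy
  refine ⟨max y₁ (max ((AA j₁ : ℝ) ^ 3) (1 / e₂)), fun y hy a b ha hb hW => ?_⟩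
  have hya := hy₁ y ((le_max_left _ _).trans hy)
  have hyb : (AA j₁ : ℝ) ^ 3 ≤ y := (le_max_left _ _).trans ((le_max_right _ _).trans hy)
  have hyc : 1 / e₂ ≤ y := (le_max_right _ _).trans ((le_max_right _ _).trans hy)
  have hexJ : ∃ J, j₁ ≤ J ∧ (AA J : ℝ) ^ 3 ≤ y ∧ y < (AA J : ℝ) ^ 9 := by
    have hex : ∃ n, y < (AA (j₁ + n) : ℝ) ^ 3 := by
      obtain ⟨n, hn, hn'⟩ := ((AA_tendsto.eventually_gt_atTop y).and (eventually_ge_atTop j₁)).exists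
      refine ⟨n, lt_of_lt_of_le hn ?_⟩
      have a1 : (1:ℝ) ≤ AA n := by exact_mod_cast (AA_two n).trans' (by norm_num)
      have a2 : (AA n:ℝ) ≤ AA (j₁ + n) := by exact_mod_cast AA_mono (by omega)
      calc (AA n:ℝ) ≤ AA n ^ 3 := le_self_pow₀ a1 (by norm_num)
        _ ≤ _ := by gcongr
    classical
    have hs := Nat.find_spec hex
    have hm := fun m => Nat.find_min (m := m) hex
    set n := Nat.find hex
    have hn : n ≠ 0 := by
      intro h; rw [h] at hs; simp only [add_zero] at hs; linarith
    obtain ⟨m, hm'⟩ := Nat.exists_eq_succ_of_ne_zero hn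
    have := hm m (by omega)
    push Not at this
    refine ⟨j₁ + m, by omega, this, ?_⟩
    rw [hm', show j₁ + m.succ = (j₁ + m) + 1 by omega, AA_succ] at hs
    push_cast at hs
    rw [← pow_mul] at hs
    exact hs
  obtain ⟨J, hJ1, hJ2, hJ3⟩ := hexJ
  have hA2 : (2:ℝ) ≤ AA J := by exact_mod_cast AA_two J
  have hm0 : (AA j₀ : ℝ) ≤ AA J := by exact_mod_cast AA_mono (by omega)
  have hm1 : (AA j₁ : ℝ) ≤ AA J := by exact_mod_cast AA_mono (by omega)
  have hp : (2:ℝ) ≤ AA j₀ := by exact_mod_cast AA_two j₀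
  have hy1 : 1 ≤ y := by
    have : (1:ℝ) ≤ (AA J : ℝ) ^ 3 := one_le_pow₀ (by linarith)
    linarith
  have hT : Real.exp y / Q₀ ≤ Real.exp (y - (AA j₀ : ℝ) ^ 2) := by
    rw [Real.exp_sub]; gcongr
  have hT0 : 0 < Real.exp y / Q₀ := by positivity
  obtain ⟨i, hi⟩ : ∃ i, J = j₀ + i := ⟨J - j₀, by omega⟩
  have hD1 := dom_iter hf hc hSW hη hη1 hj h1 h2 h3 hT0 hT i (by
    rw [← hi]; refine le_trans ?_ hJ2; exact pow_le_pow_right₀ (by linarith) (by norm_num))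
  obtain ⟨hb1, hb2, hb3⟩ := h1 J (by omega)
  have hK0 : (0:ℝ) < K := by exact_mod_cast hK
  have ha1 : 1 ≤ a := by
    rw [div_le_iff₀ he₂] at hyc
    have : (0:ℝ) < a := by
      by_contra! h
      have : (a:ℝ) / K ≤ 0 := div_nonpos_of_nonpos_of_nonneg h hK0.le
      nlinarith
    exact_mod_cast this
  have h2J : 2 ≤ AA J := AA_two J
  have hee : 6 ≤ η * e₂ * AA J := by
    have := hj₁.trans hm1
    rw [div_le_iff₀ (by positivity)] at this; linarith
  have hxl : ∀ v ∈ Finset.Ico a b, e₂ * (AA J : ℝ) ^ 3 ≤ (v:ℝ) / K ∧ e₂ * y ≤ (v:ℝ) / K ∧ (v:ℝ) / K ≤ y := by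
    intro v hv
    rw [Finset.mem_Ico] at hv
    have e1 : (a:ℝ) / K ≤ v / K := by gcongr; exact_mod_cast hv.1
    have e2 : (v:ℝ) / K ≤ b / K := by gcongr; exact_mod_cast hv.2.le
    refine ⟨?_, by linarith, by linarith⟩
    calc e₂ * (AA J : ℝ) ^ 3 ≤ e₂ * y := by gcongr
      _ ≤ _ := by linarith
  have hD2 := dom_trans hf (K := K) (a := a) (b := b) (K' := AA J) (a' := AA J ^ 2) (b' := AA J ^ 3) hK (by omega)
    ha1 (by nlinarith) (y := y) (T := Real.exp y / Q₀) (α := 2 * η) (α' := al η J) (Y := η * (e₂ * y)) hT0 hy1 hb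
    (hT.trans (Real.exp_le_exp.2 (by nlinarith))) hW ?_
  · refine (hD1.union hD2).mono ?_ ?_
    · intro t ht
      by_cases h : t ∈ GS f η J
      · exact Or.inl ⟨i, le_rfl, by rw [← hi]; exact h⟩
      · exact Or.inr ⟨h, ht⟩
    · have e1 : C * ((1 / 3) ^ j₀ * (2 - (1 / 3) ^ i)) ≤ ε / 2 := by
        refine le_trans ?_ h4
        gcongr
        have : (0:ℝ) < (1 / 3) ^ i := by positivity
        linarith
      have e2 : 2 * (b:ℝ) ^ 2 * (((AA J ^ 3 : ℕ) : ℝ) * Real.exp (-(η * (e₂ * y)))) ≤ ε / 2 := by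
        refine le_trans ?_ hya
        push_cast
        rw [div_le_iff₀ hK0] at hb
        gcongr
        linarith
      linarith
  · intro v hv r hr ℓ hℓ hℓs
    obtain ⟨x1, x2, x3⟩ := hxl v hv
    obtain ⟨r1, r2⟩ := ico_div h2J hr
    refine (expo (A := AA J) (γ := η) (by linarith) r1 r2 ?_ (by linarith) (al_nonneg hη J) ((al_le hη J).trans hη1)
      (by have := al_le hη J; linarith) ?_ ?_ hℓ hℓs).trans ?_
    · refine le_trans ?_ x1
      have : (AA J:ℝ) * 1 ≤ AA J * (e₂ * (AA J : ℝ) ^ 2) := by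
        gcongr
        have e6 : 6 * (AA J:ℝ) ≤ η * e₂ * AA J * AA J := by gcongr
        have e7 : η * (e₂ * AA J * AA J) ≤ 1 * (e₂ * AA J * AA J) := by gcongr
        linarith
      linarith
    · have : Real.log (AA J) * 1 ≤ Real.log (AA J) * Real.log (AA J) := by gcongr
      linarith
    · have : η * (e₂ * (AA J : ℝ) ^ 3) ≤ η * (v / K) := by gcongr
      have : 6 * (AA J : ℝ) ^ 2 ≤ η * e₂ * AA J * (AA J : ℝ) ^ 2 := by gcongr
      have : (2:ℝ) ^ 2 ≤ (AA J : ℝ) ^ 2 := by gcongr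
      have : (5:ℝ) ^ 2 ≤ (AA J : ℝ) ^ 2 := by gcongr
      linarith
    · have : η * (e₂ * y) ≤ η * (v / K) := by gcongr
      linarith

lemma norm_ee_sub_one_le (x : ℝ) : ‖ee x - 1‖ ≤ |x| := by
  have := Real.norm_exp_I_mul_ofReal_sub_one_le (x := x)
  unfold ee; rw [mul_comm]; exact this

lemma norm_ee_sub_le (x y : ℝ) : ‖ee x - ee y‖ ≤ |x - y| := by
  have : ee x - ee y = (ee (x - y) - 1) * ee y := by
    rw [sub_mul, ← ee_add, sub_add_cancel, one_mul]
  rw [this, norm_mul, norm_ee, mul_one]; exact norm_ee_sub_one_le _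

lemma norm_ee_sub_one_ge {x : ℝ} (h0 : 0 ≤ x) (h1 : x ≤ Real.pi) : 2 / Real.pi * x ≤ ‖ee x - 1‖ := by
  have e : ‖ee x - 1‖ = ‖2 * Real.sin (x / 2)‖ := by
    have := Complex.norm_exp_I_mul_ofReal_sub_one (x := x)
    unfold ee; rw [mul_comm]; exact this
  rw [e]
  have := Real.mul_le_sin (x := x / 2) (by linarith) (by linarith)
  refine le_trans ?_ (le_abs_self _)
  linarith

/-- Kusmin and Landau, weak form -/
lemma kusmin {g : ℕ → ℝ} {C lam : ℝ} (hl : 0 < lam) (hC : C * lam ≤ 3) (L : ℕ)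
    (h1 : ∀ n ≤ L, lam ≤ g (n + 1) - g n ∧ g (n + 1) - g n ≤ C * lam)
    (h2 : ∀ n < L, g (n + 2) - g (n + 1) ≤ g (n + 1) - g n) :
    ‖∑ n ∈ Finset.range (L + 1), ee (g n)‖ ≤ (4 + 4 * C) / lam := by
  have hpi := Real.pi_gt_three
  have hpi4 := Real.pi_lt_four
  set th : ℕ → ℝ := fun n => g (n + 1) - g n with hth
  set c : ℕ → ℂ := fun n => (ee (th n) - 1)⁻¹ with hc
  have hlow : ∀ n ≤ L, lam / 2 ≤ ‖ee (th n) - 1‖ := by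
    intro n hn
    obtain ⟨a, b⟩ := h1 n hn
    refine le_trans ?_ (norm_ee_sub_one_ge (by linarith) (by linarith))
    calc lam / 2 ≤ th n / 2 := by linarith
      _ ≤ 2 / Real.pi * th n := by
        rw [div_mul_eq_mul_div, le_div_iff₀ Real.pi_pos]
        have : 0 < th n := by linarith
        nlinarith
  have hc1 : ∀ n ≤ L, ‖c n‖ ≤ 2 / lam := by
    intro n hn
    simp only [hc]; rw [norm_inv]
    calc ‖ee (th n) - 1‖⁻¹ ≤ (lam / 2)⁻¹ := inv_anti₀ (by positivity) (hlow n hn)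
      _ = _ := by rw [inv_div]
  have hne : ∀ n ≤ L, ee (th n) - 1 ≠ 0 := fun n hn h => by
    have := hlow n hn; rw [h, norm_zero] at this; linarith
  have hc2 : ∀ n < L, ‖c (n + 1) - c n‖ ≤ 4 / lam ^ 2 * (th n - th (n + 1)) := by
    intro n hn
    have e : c (n + 1) - c n = (ee (th n) - ee (th (n + 1))) * (c (n + 1) * c n) := by
      have a1 := hne n (by omega); have a2 := hne (n + 1) (by omega)
      simp only [hc]; field_simp; ring
    rw [e, norm_mul, norm_mul]
    have b1 := norm_ee_sub_le (th n) (th (n + 1))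
    rw [abs_of_nonneg (by have := h2 n hn; simp only [hth]; linarith)] at b1
    calc _ ≤ (th n - th (n + 1)) * (2 / lam * (2 / lam)) := by
          have b2 := hc1 n (by omega); have b3 := hc1 (n + 1) (by omega)
          gcongr
          exact (norm_nonneg _).trans b1
      _ = _ := by ring
  have main : ∀ M ≤ L, ‖∑ n ∈ Finset.range (M + 1), ee (g n) - c M * ee (g (M + 1))‖ ≤
      2 / lam + 4 / lam ^ 2 * (th 0 - th M) := by
    have tele : ∀ n ≤ L, ee (g n) = c n * (ee (g (n + 1)) - ee (g n)) := by
      intro n hn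
      have a1 := hne n hn
      have : ee (g (n + 1)) = ee (th n) * ee (g n) := by rw [← ee_add]; simp only [hth]; ring_nf
      rw [this]; simp only [hc]; field_simp
    intro M
    induction M with
    | zero =>
      intro _
      have : ee (g 0) - c 0 * ee (g 1) = - (c 0 * ee (g 0)) := by
        rw [sub_eq_iff_eq_add]
        nth_rewrite 1 [tele 0 (by omega)]; ring
      simp only [zero_add, Finset.sum_range_one]
      rw [this, norm_neg, norm_mul, norm_ee, mul_one, sub_self, mul_zero, add_zero]
      exact hc1 0 (by omega)
    | succ M ih =>
      intro hM
      have i1 := ih (by omega)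
      have i2 := hc2 M (by omega)
      have e : ∑ n ∈ Finset.range (M + 1 + 1), ee (g n) - c (M + 1) * ee (g (M + 1 + 1)) =
          (∑ n ∈ Finset.range (M + 1), ee (g n) - c M * ee (g (M + 1))) - (c (M + 1) - c M) * ee (g (M + 1)) := by
        have tl := tele (M + 1) hM
        rw [Finset.sum_range_succ]
        linear_combination tl
      rw [e]
      refine (norm_sub_le _ _).trans ?_
      rw [norm_mul, norm_ee, mul_one]
      linarith
  have hm := main L le_rfl
  have hcl := hc1 L le_rfl
  obtain ⟨a1, a2⟩ := h1 0 (by omega)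
  obtain ⟨b1, b2⟩ := h1 L le_rfl
  have e1 : 4 / lam ^ 2 * (th 0 - th L) ≤ 4 * C / lam := by
    calc 4 / lam ^ 2 * (th 0 - th L) ≤ 4 / lam ^ 2 * (C * lam) := by
          gcongr; simp only [hth]; linarith
      _ = _ := by field_simp
  calc _ = ‖(∑ n ∈ Finset.range (L + 1), ee (g n) - c L * ee (g (L + 1))) + c L * ee (g (L + 1))‖ := by ring_nf
    _ ≤ _ := norm_add_le _ _
    _ ≤ (2 / lam + 4 * C / lam) + 2 / lam := by
      rw [norm_mul, norm_ee, mul_one]; linarith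
    _ = _ := by ring

lemma norm_sum_le_card {z : ℕ → ℂ} (hz : ∀ n, ‖z n‖ ≤ 1) (s : Finset ℕ) : ‖∑ n ∈ s, z n‖ ≤ s.card := by
  calc _ ≤ ∑ n ∈ s, ‖z n‖ := norm_sum_le _ _
    _ ≤ ∑ n ∈ s, (1:ℝ) := Finset.sum_le_sum fun n _ => hz n
    _ = _ := by simp

lemma shift_sum {z : ℕ → ℂ} (hz : ∀ n, ‖z n‖ ≤ 1) (L h : ℕ) :
    ‖∑ n ∈ Finset.range L, z n - ∑ n ∈ Finset.range L, z (n + h)‖ ≤ 2 * h := by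
  induction h with
  | zero => simp
  | succ h ih =>
    have e : ∑ n ∈ Finset.range L, z (n + (h + 1)) = ∑ n ∈ Finset.range L, z (n + h) + (z (L + h) - z (0 + h)) := by
      rw [← Finset.sum_range_sub (fun n => z (n + h)), ← Finset.sum_add_distrib]
      refine Finset.sum_congr rfl fun n _ => ?_
      rw [show n + (h + 1) = n + 1 + h by ring]; ring
    rw [e, ← sub_sub]
    refine (norm_sub_le _ _).trans ?_
    have := norm_sub_le (z (L + h)) (z (0 + h))
    have := hz (L + h); have := hz (0 + h)
    push_cast; linarith

/-- van der Corput inequality -/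
lemma vdc {z : ℕ → ℂ} (hz : ∀ n, ‖z n‖ ≤ 1) (L H h₀ : ℕ) (hH : 1 ≤ H) (hh : 1 ≤ h₀) {B : ℝ} (hB : 0 ≤ B)
    (h : ∀ j, h₀ ≤ j → j < H → ∀ i < H, ‖∑ n ∈ Finset.range L, z (n + i + j) * (starRingEnd ℂ) (z (n + i))‖ ≤ B) :
    ‖∑ n ∈ Finset.range L, z n‖ ≤ 2 * H + Real.sqrt (L * (2 * h₀ * L / H + B)) := by
  have hH0 : (0:ℝ) < H := by exact_mod_cast hH
  set S := ∑ n ∈ Finset.range L, z n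
  set V : ℕ → ℂ := fun n => ∑ i ∈ Finset.range H, z (n + i) with hV
  have e1 : ‖(H:ℂ) * S - ∑ n ∈ Finset.range L, V n‖ ≤ 2 * H * H := by
    have : (H:ℂ) * S - ∑ n ∈ Finset.range L, V n = ∑ i ∈ Finset.range H, (S - ∑ n ∈ Finset.range L, z (n + i)) := by
      rw [Finset.sum_sub_distrib, Finset.sum_comm]; simp
    rw [this]
    calc _ ≤ ∑ i ∈ Finset.range H, ‖S - ∑ n ∈ Finset.range L, z (n + i)‖ := norm_sum_le _ _
      _ ≤ ∑ i ∈ Finset.range H, (2 * H : ℝ) := by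
        refine Finset.sum_le_sum fun i hi => (shift_sum hz L i).trans ?_
        have : (i:ℝ) ≤ H := by exact_mod_cast (Finset.mem_range.1 hi).le
        linarith
      _ = _ := by simp; ring
  have e2 : ∑ n ∈ Finset.range L, ‖V n‖ ^ 2 ≤ H * (2 * h₀ * L) + H * H * B := by
    have hc : ∑ n ∈ Finset.range L, ((‖V n‖ ^ 2 : ℝ) : ℂ) = ∑ i ∈ Finset.range H, ∑ i' ∈ Finset.range H,
        ∑ n ∈ Finset.range L, z (n + i) * (starRingEnd ℂ) (z (n + i')) := by
      calc _ = ∑ n ∈ Finset.range L, ∑ i ∈ Finset.range H, ∑ i' ∈ Finset.range H, z (n + i) * (starRingEnd ℂ) (z (n + i')) := by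
            refine Finset.sum_congr rfl fun n _ => ?_
            rw [Complex.ofReal_pow, ← Complex.mul_conj']
            simp only [hV]
            rw [map_sum, Finset.sum_mul_sum]
        _ = _ := by
            rw [Finset.sum_comm]
            refine Finset.sum_congr rfl fun i _ => ?_
            rw [Finset.sum_comm]
    have hn : ∑ n ∈ Finset.range L, ‖V n‖ ^ 2 = ‖∑ n ∈ Finset.range L, ((‖V n‖ ^ 2 : ℝ) : ℂ)‖ := by
      rw [← Complex.ofReal_sum, Complex.norm_real, Real.norm_of_nonneg (by positivity)]
    rw [hn, hc]
    have hsm : ∀ i ∈ Finset.range H, ∀ i' ∈ Finset.range H, ‖∑ n ∈ Finset.range L, z (n + i) * (starRingEnd ℂ) (z (n + i'))‖ ≤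
        (if i' < i + h₀ ∧ i < i' + h₀ then (L:ℝ) else 0) + B := by
      intro i hi i' hi'
      rw [Finset.mem_range] at hi hi'
      split_ifs with hc
      · have := norm_sum_le_card (z := fun n => z (n + i) * (starRingEnd ℂ) (z (n + i'))) (fun n => by
          rw [norm_mul, RCLike.norm_conj]; exact mul_le_one₀ (hz _) (norm_nonneg _) (hz _)) (Finset.range L)
        rw [Finset.card_range] at this; linarith
      · rw [zero_add]
        rcases Nat.lt_or_ge i' i with hl | hl
        · have := h (i - i') (by omega) (by omega) i' hi'
          have e : ∀ n, n + i' + (i - i') = n + i := by omega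
          simp only [e] at this
          exact this
        · have := h (i' - i) (by omega) (by omega) i hi
          have e : ∀ n, n + i + (i' - i) = n + i' := by omega
          simp only [e] at this
          rw [← Complex.norm_conj, map_sum]
          simp only [map_mul, Complex.conj_conj]
          simp only [mul_comm] at this ⊢
          exact this
    calc _ ≤ ∑ i ∈ Finset.range H, ‖∑ i' ∈ Finset.range H, ∑ n ∈ Finset.range L, z (n + i) * (starRingEnd ℂ) (z (n + i'))‖ := norm_sum_le _ _
      _ ≤ ∑ i ∈ Finset.range H, ∑ i' ∈ Finset.range H, ((if i' < i + h₀ ∧ i < i' + h₀ then (L:ℝ) else 0) + B) := by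
        refine Finset.sum_le_sum fun i hi => (norm_sum_le _ _).trans (Finset.sum_le_sum fun i' hi' => hsm i hi i' hi')
      _ ≤ ∑ i ∈ Finset.range H, (2 * h₀ * L + H * B) := by
        refine Finset.sum_le_sum fun i hi => ?_
        rw [Finset.sum_add_distrib, Finset.sum_const, Finset.card_range, nsmul_eq_mul]
        gcongr
        rw [← Finset.sum_filter, Finset.sum_const, nsmul_eq_mul]
        gcongr
        have : (Finset.filter (fun i' => i' < i + h₀ ∧ i < i' + h₀) (Finset.range H)).card ≤ (Finset.Ico (i + 1 - h₀) (i + h₀)).card :=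
          Finset.card_le_card fun x hx => by
            rw [Finset.mem_filter] at hx; rw [Finset.mem_Ico]; omega
        rw [Nat.card_Ico] at this
        have h3 : (Finset.filter (fun i' => i' < i + h₀ ∧ i < i' + h₀) (Finset.range H)).card ≤ 2 * h₀ := by omega
        exact_mod_cast h3
      _ = _ := by rw [Finset.sum_const, Finset.card_range, nsmul_eq_mul]; ring
  have e3 : ‖∑ n ∈ Finset.range L, V n‖ ≤ H * Real.sqrt (L * (2 * h₀ * L / H + B)) := by
    apply le_of_sq_le_sq ?_ (by positivity) 
    rw [mul_pow, Real.sq_sqrt (by positivity)]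
    calc ‖∑ n ∈ Finset.range L, V n‖ ^ 2 ≤ (∑ n ∈ Finset.range L, ‖V n‖) ^ 2 := by gcongr; exact norm_sum_le _ _
      _ ≤ (Finset.range L).card * ∑ n ∈ Finset.range L, ‖V n‖ ^ 2 := sq_sum_le_card_mul_sum_sq
      _ ≤ L * (H * (2 * h₀ * L) + H * H * B) := by rw [Finset.card_range]; gcongr
      _ = _ := by field_simp
  have e4 : (H:ℝ) * ‖S‖ ≤ 2 * H * H + H * Real.sqrt (L * (2 * h₀ * L / H + B)) := by
    calc (H:ℝ) * ‖S‖ = ‖(H:ℂ) * S‖ := by simp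
      _ = ‖((H:ℂ) * S - ∑ n ∈ Finset.range L, V n) + ∑ n ∈ Finset.range L, V n‖ := by ring_nf
      _ ≤ _ := norm_add_le _ _
      _ ≤ _ := by linarith
  have : (H:ℝ) * ‖S‖ ≤ H * (2 * H + Real.sqrt (L * (2 * h₀ * L / H + B))) := by linarith
  exact le_of_mul_le_mul_left this hH0

/-- iterated differences -/
def dk : ℕ → (ℕ → ℝ) → ℕ → ℝ
  | 0, g => g
  | k + 1, g => fun n => dk k g (n + 1) - dk k g n

lemma dk_sub_shift (k : ℕ) (g : ℕ → ℝ) (i j : ℕ) (n : ℕ) :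
    dk k (fun n => g (n + i + j) - g (n + i)) n = dk k g (n + i + j) - dk k g (n + i) := by
  induction k generalizing n with
  | zero => rfl
  | succ k ih =>
    simp only [dk]
    rw [ih, ih, show n + 1 + i + j = n + i + j + 1 by ring, show n + 1 + i = n + i + 1 by ring]; ring

lemma dk_sub_sum (k : ℕ) (g : ℕ → ℝ) (i j : ℕ) (n : ℕ) :
    dk k (fun n => g (n + i + j) - g (n + i)) n = ∑ l ∈ Finset.range j, dk (k + 1) g (n + i + l) := by
  rw [dk_sub_shift]
  simp only [dk]
  have := Finset.sum_range_sub (fun l => dk k g (n + i + l)) j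
  simp only [add_zero] at this
  rw [← this]; rfl

/-- the Weyl-type bound at level `k`, in a window -/
def Wb (k : ℕ) (C τ σ : ℝ) : Prop :=
  ∃ c C' : ℝ, 0 < c ∧ 0 < C' ∧ c ≤ 1 ∧ ∀ (N lam : ℝ) (g : ℕ → ℝ) (L : ℕ), 1 ≤ N → N ^ (-τ) ≤ lam → lam ≤ N ^ (-σ) →
    (∀ n : ℕ, (n:ℝ) ≤ 3 * k * N → lam ≤ dk k g n ∧ dk k g n ≤ C * lam ∧ dk k g (n + 1) ≤ dk k g n) →
    (L:ℝ) ≤ N → ‖∑ n ∈ Finset.range L, ee (g n)‖ ≤ C' * N ^ (1 - c)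

lemma norm_sum_ee_le (g : ℕ → ℝ) (L : ℕ) : ‖∑ n ∈ Finset.range L, ee (g n)‖ ≤ L := by
  have := norm_sum_le_card (z := fun n => ee (g n)) (fun n => (norm_ee _).le) (Finset.range L)
  rwa [Finset.card_range] at this

lemma Wb_one {C τ σ : ℝ} (hC : 1 ≤ C) (hτ : τ < 1) (hτ0 : 0 < τ) (hσ : 0 < σ) : Wb 1 C τ σ := by
  refine ⟨1 - τ, max (4 + 4 * C) (C ^ (1 / σ)), by linarith, by positivity, by linarith, fun N lam g L hN h1 h2 hg hL => ?_⟩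
  have hN0 : 0 < N := by linarith
  have hl0 : 0 < lam := lt_of_lt_of_le (by positivity) h1
  rw [show 1 - (1 - τ) = τ by ring]
  have hNt : 1 ≤ N ^ τ := Real.one_le_rpow hN hτ0.le
  by_cases hc : C * lam ≤ 3
  · rcases Nat.eq_zero_or_pos L with rfl | hL0
    · simp; positivity
    obtain ⟨M, rfl⟩ : ∃ M, L = M + 1 := ⟨L - 1, by omega⟩
    push_cast at hL
    have := kusmin (g := g) (C := C) hl0 hc M (fun n hn => by
        have hn' : (n:ℝ) ≤ M := by exact_mod_cast hn
        have := hg n (by push_cast; linarith)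
        exact ⟨this.1, this.2.1⟩)
      (fun n hn => by
        have hn' : (n:ℝ) ≤ M := by exact_mod_cast hn.le
        exact (hg n (by push_cast; linarith)).2.2)
    refine this.trans ?_
    have : 1 / lam ≤ N ^ τ := by
      rw [Real.rpow_neg hN0.le] at h1
      rw [div_le_iff₀ hl0]
      calc 1 = N ^ τ * (N ^ τ)⁻¹ := by field_simp
        _ ≤ _ := by gcongr
    calc (4 + 4 * C) / lam = (4 + 4 * C) * (1 / lam) := by ring
      _ ≤ (max (4 + 4 * C) (C ^ (1 / σ))) * N ^ τ := by gcongr; exact le_max_left _ _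
  · push Not at hc
    refine (norm_sum_ee_le g L).trans (hL.trans ?_)
    have h3 : N ^ σ ≤ C := by
      rw [Real.rpow_neg hN0.le] at h2
      have : 1 ≤ C * (N ^ σ)⁻¹ := by nlinarith
      rw [← div_eq_mul_inv, le_div_iff₀ (by positivity)] at this
      linarith
    have h4 : N ≤ C ^ (1 / σ) := by
      calc N = (N ^ σ) ^ (1 / σ) := by rw [← Real.rpow_mul hN0.le]; field_simp; simp
        _ ≤ _ := by gcongr
    calc N ≤ C ^ (1 / σ) * 1 := by linarith
      _ ≤ _ := by gcongr; exact le_max_right _ _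

lemma Wb_step {k : ℕ} {C τ σ τ' σ' κ ρ : ℝ} (hρ : 0 ≤ ρ) (hκ : ρ < κ) (hκ' : κ ≤ 1 / 2)
    (h1 : τ' - ρ ≤ τ) (h2 : σ ≤ σ' - κ) (hW : Wb k C τ σ) : Wb (k + 1) C τ' σ' := by
  obtain ⟨c, C', hc, hC', hc1, hW⟩ := hW
  set d := min c (κ - ρ) with hd
  have hd0 : 0 < d := lt_min hc (by linarith)
  have hd1 : d ≤ c := min_le_left _ _
  have hd2 : d ≤ κ - ρ := min_le_right _ _
  refine ⟨d / 2, 2 + Real.sqrt (8 + C'), by linarith, by positivity, by linarith, fun N lam g L hN hl1 hl2 hg hL => ?_⟩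
  have hN0 : 0 < N := by linarith
  have hl0 : 0 < lam := lt_of_lt_of_le (by positivity) hl1
  have hNρ : 1 ≤ N ^ ρ := Real.one_le_rpow hN hρ
  have hNκ : 1 ≤ N ^ κ := Real.one_le_rpow hN (by linarith)
  have hNκN : N ^ κ ≤ N := by
    calc N ^ κ ≤ N ^ (1:ℝ) := Real.rpow_le_rpow_of_exponent_le hN (by linarith)
      _ = N := Real.rpow_one N
  set H := ⌊N ^ κ⌋₊ with hH
  set h₀ := ⌈N ^ ρ⌉₊ with hh₀
  have H1 : 1 ≤ H := (Nat.one_le_floor_iff _).2 hNκ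
  have H2 : (H:ℝ) ≤ N ^ κ := Nat.floor_le (by positivity)
  have H3 : N ^ κ ≤ 2 * H := by
    have := Nat.lt_floor_add_one (N ^ κ)
    have h1' : (1:ℝ) ≤ H := by exact_mod_cast H1
    linarith
  have h01 : 1 ≤ h₀ := Nat.one_le_ceil_iff.2 (by linarith)
  have h02 : N ^ ρ ≤ h₀ := Nat.le_ceil _
  have h03 : (h₀:ℝ) ≤ 2 * N ^ ρ := by
    have := Nat.ceil_lt_add_one (show 0 ≤ N ^ ρ by positivity)
    linarith
  have hB : ∀ j, h₀ ≤ j → j < H → ∀ i < H, ‖∑ n ∈ Finset.range L, ee (g (n + i + j)) * (starRingEnd ℂ) (ee (g (n + i)))‖ ≤ C' * N ^ (1 - c) := by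
    intro j hj hj' i hi
    have e : ∀ n, ee (g (n + i + j)) * (starRingEnd ℂ) (ee (g (n + i))) = ee ((fun n => g (n + i + j) - g (n + i)) n) := by
      intro n; rw [conj_ee, ← ee_add, ← sub_eq_add_neg]
    rw [Finset.sum_congr rfl fun n _ => e n]
    have jr1 : N ^ ρ ≤ j := h02.trans (by exact_mod_cast hj)
    have jr2 : (j:ℝ) ≤ N ^ κ := le_trans (by exact_mod_cast hj'.le) H2
    have ir : (i:ℝ) ≤ N ^ κ := le_trans (by exact_mod_cast hi.le) H2
    refine hW N (j * lam) _ L hN ?_ ?_ (fun n hn => ?_) hL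
    · calc N ^ (-τ) ≤ N ^ (ρ + -τ') := Real.rpow_le_rpow_of_exponent_le hN (by linarith)
        _ = N ^ ρ * N ^ (-τ') := Real.rpow_add hN0 _ _
        _ ≤ _ := by gcongr
    · calc j * lam ≤ N ^ κ * N ^ (-σ') := by gcongr
        _ = N ^ (κ + -σ') := (Real.rpow_add hN0 _ _).symm
        _ ≤ _ := Real.rpow_le_rpow_of_exponent_le hN (by linarith)
    · have hr : ∀ l < j, ((n + i + l : ℕ) : ℝ) ≤ 3 * (k + 1 : ℕ) * N := by
        intro l hl
        have : (l:ℝ) ≤ j := by exact_mod_cast hl.le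
        push_cast; nlinarith
      rw [dk_sub_sum, dk_sub_sum]
      refine ⟨?_, ?_, ?_⟩
      · calc (j:ℝ) * lam = ∑ l ∈ Finset.range j, lam := by simp
          _ ≤ _ := Finset.sum_le_sum fun l hl => (hg _ (hr l (Finset.mem_range.1 hl))).1
      · calc _ ≤ ∑ l ∈ Finset.range j, C * lam := Finset.sum_le_sum fun l hl => (hg _ (hr l (Finset.mem_range.1 hl))).2.1
          _ = _ := by simp; ring
      · refine Finset.sum_le_sum fun l hl => ?_
        have := (hg _ (hr l (Finset.mem_range.1 hl))).2.2
        rw [show n + 1 + i + l = n + i + l + 1 by ring]; exact this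
  have hv := vdc (z := fun n => ee (g n)) (fun n => (norm_ee _).le) L H h₀ H1 h01 (by positivity) hB
  refine hv.trans ?_
  have e1 : (H:ℝ) ≤ N ^ (1 - d / 2) := H2.trans (Real.rpow_le_rpow_of_exponent_le hN (by linarith))
  have H0 : (0:ℝ) < H := by exact_mod_cast H1
  have e2 : 2 * (h₀:ℝ) * L / H ≤ 8 * N ^ (1 - d) := by
    rw [div_le_iff₀ H0]
    have : N ^ (1:ℝ) * N ^ ρ ≤ N ^ (1 - d) * N ^ κ := by
      rw [← Real.rpow_add hN0, ← Real.rpow_add hN0]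
      exact Real.rpow_le_rpow_of_exponent_le hN (by linarith)
    rw [Real.rpow_one] at this
    calc 2 * (h₀:ℝ) * L ≤ 2 * (2 * N ^ ρ) * N := by gcongr
      _ = 4 * (N * N ^ ρ) := by ring
      _ ≤ 4 * (N ^ (1 - d) * N ^ κ) := by gcongr
      _ ≤ 4 * (N ^ (1 - d) * (2 * H)) := by gcongr
      _ = _ := by ring
  have e3 : C' * N ^ (1 - c) ≤ C' * N ^ (1 - d) := by
    gcongr
  have e4 : Real.sqrt (L * (2 * h₀ * L / H + C' * N ^ (1 - c))) ≤ Real.sqrt (8 + C') * N ^ (1 - d / 2) := by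
    have : (L:ℝ) * (2 * h₀ * L / H + C' * N ^ (1 - c)) ≤ (8 + C') * (N ^ (1 - d / 2)) ^ 2 := by
      have e5 : (N ^ (1 - d / 2)) ^ 2 = N * N ^ (1 - d) := by
        rw [← Real.rpow_natCast, ← Real.rpow_mul hN0.le]
        nth_rewrite 2 [← Real.rpow_one N]
        rw [← Real.rpow_add hN0]; congr 1; push_cast; ring
      rw [e5]
      calc _ ≤ N * (8 * N ^ (1 - d) + C' * N ^ (1 - d)) := by gcongr
        _ = _ := by ring
    calc _ ≤ Real.sqrt ((8 + C') * (N ^ (1 - d / 2)) ^ 2) := Real.sqrt_le_sqrt this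
      _ = _ := by rw [Real.sqrt_mul (by positivity), Real.sqrt_sq (by positivity)]
  nlinarith

lemma Wb_all (k : ℕ) : ∀ {C τ σ : ℝ}, 1 ≤ C → τ < 1 → 0 < τ → 0 < σ → σ ≤ 1 → Wb (k + 1) C τ σ := by
  induction k with
  | zero => intro C τ σ h1 h2 h3 h4 _; exact Wb_one h1 h2 h3 h4
  | succ k ih =>
    intro C τ σ h1 h2 h3 h4 h5
    exact Wb_step (ρ := 0) (κ := σ / 2) le_rfl (by linarith) (by linarith) (τ := τ) (σ := σ / 2) (by linarith) (by linarith)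
      (ih h1 h2 h3 (by linarith) (by linarith))

lemma Wb_glue {k : ℕ} {C τ σ τ' σ' : ℝ} (h : τ ≥ σ') (hW : Wb k C τ σ) (hW' : Wb k C τ' σ') : Wb k C τ' σ := by
  obtain ⟨c, D, hc, hD, hc1, hW⟩ := hW
  obtain ⟨c', D', hc', hD', hc1', hW'⟩ := hW'
  refine ⟨min c c', max D D', lt_min hc hc', by positivity, (min_le_left _ _).trans hc1, fun N lam g L hN hl1 hl2 hg hL => ?_⟩
  have hN0 : 0 < N := by linarith
  by_cases hl : lam ≤ N ^ (-σ')
  · refine (hW' N lam g L hN hl1 hl hg hL).trans ?_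
    gcongr
    · exact le_max_right _ _
    · exact min_le_right _ _
  · push Not at hl
    refine (hW N lam g L hN ?_ hl2 hg hL).trans ?_
    · exact le_trans (Real.rpow_le_rpow_of_exponent_le hN (by linarith)) hl.le
    · gcongr
      · exact le_max_left _ _
      · exact min_le_left _ _

lemma Wb_main {k : ℕ} (hk : 2 ≤ k) {C : ℝ} (hC : 1 ≤ C) : Wb k C 1.3 0.2 := by
  obtain ⟨m, rfl⟩ : ∃ m, k = m + 1 + 1 := ⟨k - 2, by omega⟩
  refine Wb_glue (τ := 0.95) (σ' := 0.9) (by norm_num) (Wb_all (m + 1) hC (by norm_num) (by norm_num) (by norm_num) (by norm_num)) ?_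
  exact Wb_step (ρ := 0.35) (κ := 0.4) (by norm_num) (by norm_num) (by norm_num) (τ := 0.95) (σ := 0.5) (by norm_num) (by norm_num)
    (Wb_all m hC (by norm_num) (by norm_num) (by norm_num) (by norm_num))

/-- `∏_{i<k} 1/(x+i)` -/
def rp (k : ℕ) (x : ℝ) : ℝ := ∏ i ∈ Finset.range k, (x + i)⁻¹

lemma rp_succ_sub {x : ℝ} (hx : 0 < x) (k : ℕ) : rp k x - rp k (x + 1) = k * rp (k + 1) x := by
  have a : rp (k + 1) x = rp k x * (x + k)⁻¹ := by unfold rp; rw [Finset.prod_range_succ]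
  have b : rp (k + 1) x = rp k (x + 1) * x⁻¹ := by
    unfold rp; rw [Finset.prod_range_succ']
    congr 1
    · refine Finset.prod_congr rfl fun i _ => ?_
      push_cast; ring_nf
    · simp
  have hk : (0:ℝ) < x + k := by positivity
  have a' : rp k x = rp (k + 1) x * (x + k) := by rw [a]; field_simp
  have b' : rp k (x + 1) = rp (k + 1) x * x := by rw [b]; field_simp
  rw [a', b']; ring

lemma continuousOn_rp (k : ℕ) {x : ℝ} (hx : 0 < x) : ContinuousOn (fun s => rp k (x + s)) (Set.uIcc 0 1) := by
  unfold rp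
  refine continuousOn_finsetProd _ fun i _ => ?_
  refine ContinuousOn.inv₀ (by fun_prop) fun s hs => ?_
  rw [Set.uIcc_of_le zero_le_one, Set.mem_Icc] at hs
  have : (0:ℝ) < x + s + i := by have := hs.1; positivity
  exact this.ne'

/-- the `k`-th differences of the logarithm -/
lemma dk_log {x : ℝ} (hx : 0 < x) (u : ℝ) (k : ℕ) (n : ℕ) :
    dk (k + 1) (fun n : ℕ => u * Real.log (x + n)) n = (-1) ^ k * u * (k.factorial * ∫ s in (0:ℝ)..1, rp (k + 1) (x + n + s)) := by
  induction k generalizing n with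
  | zero =>
    simp only [dk, rp]
    have h0 : (0:ℝ) < x + n := by positivity
    have : ∫ s in (0:ℝ)..1, (x + n + s)⁻¹ = Real.log (x + n + 1) - Real.log (x + n) := by
      rw [intervalIntegral.integral_comp_add_left (fun s => s⁻¹), integral_inv]
      · rw [Real.log_div (by positivity) (by positivity), add_zero]
      · rw [add_zero, Set.uIcc_of_le (by linarith), Set.mem_Icc]; intro h; linarith [h.1]
    simp only [zero_add, Finset.prod_range_one, Nat.cast_zero, add_zero, this]
    push_cast; simp; ring_nf
  | succ k ih =>
    show dk (k + 1) (fun n : ℕ => u * Real.log (x + n)) (n + 1) - dk (k + 1) (fun n : ℕ => u * Real.log (x + n)) n = _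
    have h0 : (0:ℝ) < x + n := by positivity
    rw [ih, ih]
    push_cast
    have e1 : ∫ s in (0:ℝ)..1, (rp (k + 1) (x + n + s) - rp (k + 1) (x + (n + 1) + s)) =
        (k + 1) * ∫ s in (0:ℝ)..1, rp (k + 1 + 1) (x + n + s) := by
      rw [← intervalIntegral.integral_const_mul]
      refine intervalIntegral.integral_congr fun s hs => ?_
      rw [Set.uIcc_of_le zero_le_one, Set.mem_Icc] at hs
      have := rp_succ_sub (x := x + n + s) (by linarith [hs.1]) (k + 1)
      push_cast at this
      rw [← this]; ring_nf
    rw [intervalIntegral.integral_sub (continuousOn_rp _ h0).intervalIntegrable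
      (continuousOn_rp _ (by positivity)).intervalIntegrable] at e1
    rw [Nat.factorial_succ]; push_cast
    rw [show (-1:ℝ) ^ k * u * (k.factorial * ∫ s in (0:ℝ)..1, rp (k + 1) (x + (n + 1) + s)) -
      (-1) ^ k * u * (k.factorial * ∫ s in (0:ℝ)..1, rp (k + 1) (x + n + s)) =
      (-1) ^ (k + 1) * u * (k.factorial * ((∫ s in (0:ℝ)..1, rp (k + 1) (x + n + s)) - ∫ s in (0:ℝ)..1, rp (k + 1) (x + (n + 1) + s))) by ring, e1]
    ring

lemma rp_anti (k : ℕ) {x y : ℝ} (hx : 0 < x) (hxy : x ≤ y) : rp k y ≤ rp k x := by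
  have hy : 0 < y := by linarith
  unfold rp
  refine Finset.prod_le_prod (fun i _ => ?_) fun i _ => ?_
  · have : 0 < y + i := by positivity
    positivity
  · exact inv_anti₀ (by positivity) (by linarith)

lemma rp_le (k : ℕ) {x : ℝ} (hx : 0 < x) : rp k x ≤ (x⁻¹) ^ k := by
  unfold rp
  calc _ ≤ ∏ i ∈ Finset.range k, x⁻¹ := Finset.prod_le_prod (fun i _ => by positivity) fun i _ => by
        exact inv_anti₀ hx (by linarith [show (0:ℝ) ≤ i from Nat.cast_nonneg i])
    _ = _ := by simp

lemma rp_ge (k : ℕ) {x : ℝ} (hx : 0 < x) : ((x + k)⁻¹) ^ k ≤ rp k x := by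
  unfold rp
  calc _ = ∏ i ∈ Finset.range k, (x + k)⁻¹ := by simp
    _ ≤ _ := Finset.prod_le_prod (fun i _ => by positivity) fun i hi => by
        have : (i:ℝ) ≤ k := by exact_mod_cast (Finset.mem_range.1 hi).le
        exact inv_anti₀ (by positivity) (by linarith)

lemma norm_sum_ee_abs (u : ℝ) (l : ℕ → ℝ) (s : Finset ℕ) : ‖∑ n ∈ s, ee (u * l n)‖ = ‖∑ n ∈ s, ee (|u| * l n)‖ := by
  rcases abs_choice u with h | h
  · rw [h]
  · rw [h, ← Complex.norm_conj, map_sum]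
    simp only [conj_ee, neg_mul]

lemma int_rp_bounds (k : ℕ) {x y : ℝ} (hx : 0 < x) (hy : x + 1 + k ≤ y) :
    ((y)⁻¹) ^ k ≤ ∫ s in (0:ℝ)..1, rp k (x + s) ∧ ∫ s in (0:ℝ)..1, rp k (x + s) ≤ (x⁻¹) ^ k := by
  have hi : IntervalIntegrable (fun s => rp k (x + s)) volume 0 1 := (continuousOn_rp k hx).intervalIntegrable
  constructor
  · have := intervalIntegral.integral_mono_on (a := 0) (b := 1) zero_le_one (f := fun _ => ((y)⁻¹) ^ k)
      (by simp) hi (fun s hs => by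
        have h1 := hs.1; have h2 := hs.2
        refine le_trans ?_ (rp_ge k (by linarith))
        have : (0:ℝ) < x + s + k := by positivity
        have hy0 : 0 < y := by linarith
        gcongr; linarith)
    simpa using this
  · have := intervalIntegral.integral_mono_on (a := 0) (b := 1) zero_le_one (g := fun _ => (x⁻¹) ^ k) hi
      (by simp) (fun s hs => by
        have h1 := hs.1
        refine (rp_anti k hx (by linarith)).trans (rp_le k hx))
    simpa using this

lemma int_rp_anti (k : ℕ) {x : ℝ} (hx : 0 < x) :
    ∫ s in (0:ℝ)..1, rp k (x + 1 + s) ≤ ∫ s in (0:ℝ)..1, rp k (x + s) := by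
  refine intervalIntegral.integral_mono_on zero_le_one (continuousOn_rp k (by linarith)).intervalIntegrable
    (continuousOn_rp k hx).intervalIntegrable fun s hs => ?_
  have h1 := hs.1
  exact rp_anti k (by linarith) (by linarith)

/-- differences of `±u log` have constant sign and size -/
lemma dk_log_bounds {N u : ℝ} (hN : 1 ≤ N) (hu : 0 < u) (k : ℕ) (n : ℕ) (hn : (n:ℝ) ≤ 3 * (k + 1 : ℕ) * N) :
    u * k.factorial * (((4 * (k + 1) + 2) * N)⁻¹) ^ (k + 1) ≤ dk (k + 1) (fun n : ℕ => ((-1) ^ k * u) * Real.log (N + n)) n ∧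
    dk (k + 1) (fun n : ℕ => ((-1) ^ k * u) * Real.log (N + n)) n ≤
      (4 * (k + 1) + 2) ^ (k + 1) * (u * k.factorial * (((4 * (k + 1) + 2) * N)⁻¹) ^ (k + 1)) ∧
    dk (k + 1) (fun n : ℕ => ((-1) ^ k * u) * Real.log (N + n)) (n + 1) ≤ dk (k + 1) (fun n : ℕ => ((-1) ^ k * u) * Real.log (N + n)) n := by
  have hN0 : 0 < N := by linarith
  have hsq : ((-1:ℝ) ^ k) * ((-1) ^ k * u) = u := by
    rw [← mul_assoc, ← mul_pow]; norm_num
  rw [dk_log hN0, dk_log hN0, hsq]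
  have hn0 : (0:ℝ) < N + n := by positivity
  push_cast at hn
  obtain ⟨b1, b2⟩ := int_rp_bounds (k + 1) hn0 (y := (4 * (k + 1) + 2) * N) (by push_cast; nlinarith)
  have b3 := int_rp_anti (k + 1) hn0
  have hf : (0:ℝ) < k.factorial := by positivity
  refine ⟨?_, ?_, ?_⟩
  · rw [mul_assoc]; gcongr
  · calc u * (k.factorial * ∫ s in (0:ℝ)..1, rp (k + 1) (N + n + s)) ≤ u * (k.factorial * ((N + n)⁻¹) ^ (k + 1)) := by gcongr
      _ ≤ u * (k.factorial * (N⁻¹) ^ (k + 1)) := by gcongr; linarith [show (0:ℝ) ≤ n from Nat.cast_nonneg n]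
      _ = _ := by rw [mul_inv, mul_pow, inv_pow (4 * ((k:ℝ) + 1) + 2)]; field_simp
  · push_cast
    rw [← add_assoc]
    gcongr

lemma weyl_k (k : ℕ) : ∃ c C : ℝ, 0 < c ∧ c ≤ 1 ∧ 0 < C ∧ ∀ (N u : ℝ) (L : ℕ), 1 ≤ N → (L:ℝ) ≤ N →
    N ^ ((k:ℝ) + 2 - 5 / 4) ≤ |u| → |u| ≤ N ^ ((k:ℝ) + 2 - 1 / 4) →
    ‖∑ n ∈ Finset.range L, ee (u * Real.log (N + n))‖ ≤ C * N ^ (1 - c) := by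
  set E : ℝ := (4 * ((k + 1 : ℕ) + 1) + 2) ^ (k + 1 + 1) with hE
  have hE1 : 1 ≤ E := one_le_pow₀ (by push_cast; linarith [show (0:ℝ) ≤ k from Nat.cast_nonneg k])
  obtain ⟨c, C, hc, hC, hc1, hW⟩ := Wb_main (k := k + 1 + 1) (by omega) hE1
  refine ⟨c, max C (E ^ (20:ℕ)), hc, hc1, by positivity, fun N u L hN hL hu1 hu2 => ?_⟩
  have hN0 : 0 < N := by linarith
  by_cases hbig : N ^ (0.05:ℝ) ≤ E
  · refine (norm_sum_ee_le _ L).trans (hL.trans ?_)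
    have h1 : 1 ≤ N ^ (1 - c) := Real.one_le_rpow hN (by linarith)
    calc N = (N ^ (0.05:ℝ)) ^ (20:ℕ) := by rw [← Real.rpow_natCast, ← Real.rpow_mul hN0.le]; norm_num
      _ ≤ E ^ (20:ℕ) := by gcongr
      _ = E ^ (20:ℕ) * 1 := by ring
      _ ≤ _ := by gcongr; exact le_max_right _ _
  push Not at hbig
  have hu0 : 0 < |u| := lt_of_lt_of_le (by positivity) hu1
  have e1 : ‖∑ n ∈ Finset.range L, ee (u * Real.log (N + n))‖ = ‖∑ n ∈ Finset.range L, ee (((-1) ^ (k + 1) * |u|) * Real.log (N + n))‖ := by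
    rw [norm_sum_ee_abs, norm_sum_ee_abs ((-1) ^ (k + 1) * |u|)]
    simp only [abs_mul, abs_pow, abs_neg, abs_one, one_pow, one_mul, abs_abs]
  rw [e1]
  set lam : ℝ := |u| * (k + 1).factorial * (((4 * ((k + 1 : ℕ) + 1) + 2) * N)⁻¹) ^ (k + 1 + 1) with hlam
  have hle : lam = |u| * (k + 1).factorial / E * N ^ (-((k:ℝ) + 2)) := by
    rw [hlam, mul_inv, mul_pow, inv_pow, ← hE, Real.rpow_neg hN0.le, show (k:ℝ) + 2 = ((k + 1 + 1 : ℕ) : ℝ) by push_cast; ring,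
      Real.rpow_natCast, inv_pow]; ring
  have hfE : ((k + 1).factorial : ℝ) ≤ E := by
    have : ((k + 1).factorial : ℝ) ≤ (((k + 1 : ℕ)) : ℝ) ^ (k + 1) := by exact_mod_cast Nat.factorial_le_pow _
    refine this.trans ?_
    rw [hE]
    calc (((k + 1 : ℕ)) : ℝ) ^ (k + 1) ≤ (4 * ((k + 1 : ℕ) + 1) + 2) ^ (k + 1) := by
          gcongr; linarith [show (0:ℝ) ≤ ((k + 1 : ℕ):ℝ) from Nat.cast_nonneg _]
      _ ≤ _ := pow_le_pow_right₀ (by linarith [show (0:ℝ) ≤ ((k + 1 : ℕ):ℝ) from Nat.cast_nonneg _]) (by omega)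
  have hf1 : (1:ℝ) ≤ (k + 1).factorial := by exact_mod_cast Nat.one_le_iff_ne_zero.2 (Nat.factorial_ne_zero _)
  have hb := hW N lam (fun n => ((-1) ^ (k + 1) * |u|) * Real.log (N + n)) L hN ?_ ?_ (fun n hn => dk_log_bounds hN hu0 (k + 1) n hn) hL
  · refine hb.trans ?_
    gcongr; exact le_max_left _ _
  · rw [hle]
    calc N ^ (-(1.3:ℝ)) = N ^ ((k:ℝ) + 2 - 5 / 4) * (N ^ (0.05:ℝ))⁻¹ * N ^ (-((k:ℝ) + 2)) := by
          rw [← Real.rpow_neg hN0.le, ← Real.rpow_add hN0, ← Real.rpow_add hN0]; congr 1; norm_num; ring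
      _ ≤ |u| * E⁻¹ * N ^ (-((k:ℝ) + 2)) := by gcongr
      _ ≤ |u| * (k + 1).factorial / E * N ^ (-((k:ℝ) + 2)) := by
          have h9 : E⁻¹ ≤ (k + 1).factorial / E := by
            rw [div_eq_mul_inv]; exact le_mul_of_one_le_left (by positivity) hf1
          rw [mul_div_assoc]; gcongr
  · rw [hle]
    calc |u| * (k + 1).factorial / E * N ^ (-((k:ℝ) + 2)) ≤ N ^ ((k:ℝ) + 2 - 1 / 4) * 1 * N ^ (-((k:ℝ) + 2)) := by
          rw [mul_div_assoc]; gcongr; rw [div_le_one (by linarith)]; exact hfE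
      _ = N ^ (-(1 / 4) : ℝ) := by rw [mul_one, ← Real.rpow_add hN0]; congr 1; ring
      _ ≤ _ := Real.rpow_le_rpow_of_exponent_le hN (by norm_num)

lemma weyl_small {N u : ℝ} (L : ℕ) (hN : 1 ≤ N) (hL : (L:ℝ) ≤ N) (hu : 0 < |u|) (hu' : |u| ≤ N) :
    ‖∑ n ∈ Finset.range L, ee (u * Real.log (N + n))‖ ≤ 48 * (N / |u|) := by
  have hN0 : 0 < N := by linarith
  rcases Nat.eq_zero_or_pos L with rfl | hL0
  · simp; positivity
  obtain ⟨M, rfl⟩ : ∃ M, L = M + 1 := ⟨L - 1, by omega⟩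
  push_cast at hL
  rw [norm_sum_ee_abs]
  have hd : ∀ n, dk 1 (fun n : ℕ => |u| * Real.log (N + n)) n = |u| * ∫ s in (0:ℝ)..1, rp 1 (N + n + s) := by
    intro n; have := dk_log hN0 |u| 0 n; simpa using this
  have h := kusmin (g := fun n : ℕ => |u| * Real.log (N + n)) (C := 3) (lam := |u| / (3 * N)) (by positivity)
    (by rw [mul_div_assoc', div_le_iff₀ (by positivity)]; nlinarith) M (fun n hn => ?_) (fun n hn => ?_)
  · refine h.trans (le_of_eq ?_)
    field_simp; norm_num
  · have e := hd n
    simp only [dk] at e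
    have hn' : (n:ℝ) ≤ M := by exact_mod_cast hn
    obtain ⟨b1, b2⟩ := int_rp_bounds 1 (x := N + n) (y := 3 * N) (by positivity) (by push_cast; linarith)
    rw [pow_one] at b1 b2
    rw [e]
    constructor
    · rw [div_eq_mul_inv]; gcongr
    · calc _ ≤ |u| * (N + n)⁻¹ := by gcongr
        _ ≤ |u| * N⁻¹ := by gcongr; linarith [show (0:ℝ) ≤ n from Nat.cast_nonneg n]
        _ = _ := by field_simp
  · have e := hd n; have e' := hd (n + 1)
    simp only [dk] at e e'
    show |u| * Real.log (N + (n + 1 + 1 : ℕ)) - |u| * Real.log (N + (n + 1 : ℕ)) ≤ |u| * Real.log (N + (n + 1 : ℕ)) - |u| * Real.log (N + n)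
    rw [e, e']
    have := int_rp_anti 1 (x := N + n) (by positivity)
    push_cast
    rw [← add_assoc]
    gcongr

/-- Weyl bound -/
theorem weyl (A : ℝ) : ∃ c C : ℝ, 0 < c ∧ c ≤ 1 ∧ 0 < C ∧ ∀ (N u : ℝ) (L : ℕ), 1 ≤ N → (L:ℝ) ≤ N → 0 < |u| →
    |u| ≤ N ^ A → ‖∑ n ∈ Finset.range L, ee (u * Real.log (N + n))‖ ≤ C * (N / |u| + N ^ (1 - c)) := by
  have key : ∀ K : ℕ, ∃ c C : ℝ, 0 < c ∧ c ≤ 1 ∧ 0 < C ∧ ∀ (N u : ℝ) (L : ℕ), 1 ≤ N → (L:ℝ) ≤ N → 0 < |u| →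
      |u| ≤ N ^ ((K:ℝ) + 3 / 4) → ‖∑ n ∈ Finset.range L, ee (u * Real.log (N + n))‖ ≤ C * (N / |u| + N ^ (1 - c)) := by
    intro K
    induction K with
    | zero =>
      refine ⟨1, 48, by norm_num, le_rfl, by norm_num, fun N u L hN hL hu0 hu => ?_⟩
      refine (weyl_small L hN hL hu0 (hu.trans ?_)).trans ?_
      · calc _ ≤ N ^ (1:ℝ) := Real.rpow_le_rpow_of_exponent_le hN (by norm_num)
          _ = N := Real.rpow_one N
      · gcongr; exact le_add_of_nonneg_right (by positivity)
    | succ K ih =>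
      obtain ⟨c, C, h1, h2, h3, h4⟩ := ih
      obtain ⟨c', C', h1', h2', h3', h4'⟩ := weyl_k K
      refine ⟨min c c', max C C', lt_min h1 h1', (min_le_left _ _).trans h2, by positivity, fun N u L hN hL hu0 hu => ?_⟩
      have hN0 : 0 < N := by linarith
      by_cases hc : |u| ≤ N ^ ((K:ℝ) + 3 / 4)
      · refine (h4 N u L hN hL hu0 hc).trans ?_
        gcongr
        · exact le_max_left _ _
        · exact min_le_left _ _
      · push Not at hc
        refine (h4' N u L hN hL ?_ ?_).trans ?_
        · rw [show (K:ℝ) + 2 - 5 / 4 = K + 3 / 4 by ring]; exact hc.le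
        · refine hu.trans (le_of_eq ?_); congr 1; push_cast; ring
        · calc C' * N ^ (1 - c') ≤ max C C' * N ^ (1 - min c c') := by
                gcongr
                · exact le_max_right _ _
                · exact min_le_right _ _
            _ ≤ _ := by gcongr; exact le_add_of_nonneg_left (by positivity)
  obtain ⟨c, C, h1, h2, h3, h4⟩ := key ⌈A⌉₊
  refine ⟨c, C, h1, h2, h3, fun N u L hN hL hu0 hu => h4 N u L hN hL hu0 (hu.trans ?_)⟩
  exact Real.rpow_le_rpow_of_exponent_le hN (by have := Nat.le_ceil A; linarith)

lemma abel_bound (g : ℕ → ℝ) (x : ℕ → ℂ) (L : ℕ) {B : ℝ} (h : ∀ l, l ≤ L → ‖∑ n ∈ Finset.range l, x n‖ ≤ B) :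
    ‖∑ n ∈ Finset.range L, (g n : ℂ) * x n‖ ≤ B * (|g (L - 1)| + ∑ n ∈ Finset.range (L - 1), |g (n + 1) - g n|) := by
  have e := Finset.sum_range_by_parts (fun n => (g n : ℂ)) x L
  simp only [smul_eq_mul] at e
  rw [e, mul_add]
  refine (norm_sub_le _ _).trans (add_le_add ?_ ?_)
  · rw [norm_mul, Complex.norm_real, Real.norm_eq_abs, mul_comm]
    gcongr; exact h L le_rfl
  · rw [Finset.mul_sum]
    refine (norm_sum_le _ _).trans (Finset.sum_le_sum fun i hi => ?_)
    rw [norm_mul, ← Complex.ofReal_sub, Complex.norm_real, Real.norm_eq_abs, mul_comm]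
    gcongr
    rw [Finset.mem_range] at hi
    exact h _ (by omega)

/-- the weight `w(log n - z)/n` -/
def wt (z : ℝ) (n : ℕ) : ℝ := w (Real.log n - z) / n

lemma wt_le (z : ℝ) (n : ℕ) : |wt z n| ≤ 1 / n := by
  unfold wt
  rw [abs_of_nonneg (div_nonneg (w_nonneg _) (Nat.cast_nonneg n))]
  gcongr; exact w_le_one _

lemma log_succ_sub {m : ℕ} (hm : 1 ≤ m) : 0 ≤ Real.log (m + 1 : ℕ) - Real.log m ∧ Real.log (m + 1 : ℕ) - Real.log m ≤ 1 / m ∧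
    1 / (m:ℝ) - 1 / m ^ 2 ≤ Real.log (m + 1 : ℕ) - Real.log m := by
  have hm0 : (0:ℝ) < m := by exact_mod_cast hm
  rw [← Real.log_div (by positivity) (by positivity)]
  push_cast
  have e : ((m:ℝ) + 1) / m = 1 + 1 / m := by field_simp
  rw [e]
  have h1 := Real.log_le_sub_one_of_pos (show (0:ℝ) < 1 + 1 / m by positivity)
  have h2 := Real.one_sub_inv_le_log_of_pos (show (0:ℝ) < 1 + 1 / m by positivity)
  refine ⟨Real.log_nonneg (by simp), by linarith, le_trans ?_ h2⟩
  have : 1 - (1 + 1 / (m:ℝ))⁻¹ = 1 / (m + 1) := by field_simp; ring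
  rw [this, div_sub_div _ _ (by positivity) (by positivity), div_le_div_iff₀ (by positivity) (by positivity)]
  ring_nf; nlinarith [hm0]

lemma wt_diff (z : ℝ) {m : ℕ} (hm : 1 ≤ m) : |wt z (m + 1) - wt z m| ≤ 2 / (m:ℝ) ^ 2 := by
  have hm0 : (0:ℝ) < m := by exact_mod_cast hm
  obtain ⟨h1, h2, _⟩ := log_succ_sub hm
  have e : wt z (m + 1) - wt z m = (w (Real.log (m + 1 : ℕ) - z) - w (Real.log m - z)) / (m + 1) - w (Real.log m - z) * (1 / (m * (m + 1))) := by
    unfold wt; push_cast; field_simp; ring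
  rw [e]
  refine (abs_sub _ _).trans ?_
  have a1 : |(w (Real.log (m + 1 : ℕ) - z) - w (Real.log m - z)) / ((m:ℝ) + 1)| ≤ 1 / (m:ℝ) ^ 2 := by
    rw [abs_div, abs_of_pos (show (0:ℝ) < m + 1 by positivity)]
    have := w_lip (Real.log (m + 1 : ℕ) - z) (Real.log m - z)
    rw [sub_sub_sub_cancel_right, abs_of_nonneg h1] at this
    calc _ ≤ (1 / (m:ℝ)) / m := by gcongr; exact this.trans h2; linarith
      _ = _ := by field_simp
  have a2 : |w (Real.log m - z) * (1 / ((m:ℝ) * (m + 1)))| ≤ 1 / (m:ℝ) ^ 2 := by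
    rw [abs_of_nonneg (mul_nonneg (w_nonneg _) (by positivity))]
    calc _ ≤ 1 * (1 / ((m:ℝ) ^ 2)) := by
          gcongr
          · exact w_le_one _
          · nlinarith
      _ = _ := one_mul _
  calc _ ≤ 1 / (m:ℝ) ^ 2 + 1 / (m:ℝ) ^ 2 := add_le_add a1 a2
    _ = _ := by ring

lemma wt_block (z u : ℝ) {N : ℕ} (hN : 1 ≤ N) {B : ℝ}
    (h : ∀ l, l ≤ N → ‖∑ n ∈ Finset.range l, ee (u * Real.log ((N:ℝ) + n))‖ ≤ B) :
    ‖∑ n ∈ Finset.Ico N (2 * N), (wt z n : ℂ) * ee (u * Real.log n)‖ ≤ 3 * (B / N) := by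
  have hN0 : (0:ℝ) < N := by exact_mod_cast hN
  have hB : 0 ≤ B := le_trans (norm_nonneg _) (h 0 (by omega))
  rw [Finset.sum_Ico_eq_sum_range, show 2 * N - N = N by omega]
  have := abel_bound (fun n => wt z (N + n)) (fun n => ee (u * Real.log ((N:ℝ) + n))) N h
  simp only [Nat.cast_add]
  refine this.trans ?_
  have h1 : |wt z (N + (N - 1))| ≤ 1 / N := (wt_le z _).trans (by gcongr; omega)
  have h2 : ∑ n ∈ Finset.range (N - 1), |wt z (N + (n + 1)) - wt z (N + n)| ≤ 2 / N := by
    calc _ ≤ ∑ n ∈ Finset.range (N - 1), 2 / (N:ℝ) ^ 2 := Finset.sum_le_sum fun n _ => by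
            refine (wt_diff z (m := N + n) (by omega)).trans ?_
            gcongr; omega
      _ = ((N - 1 : ℕ):ℝ) * (2 / (N:ℝ) ^ 2) := by rw [Finset.sum_const, Finset.card_range, nsmul_eq_mul]
      _ ≤ (N:ℝ) * (2 / (N:ℝ) ^ 2) := by gcongr; omega
      _ = _ := by field_simp
  calc _ ≤ B * (1 / N + 2 / N) := by gcongr
    _ = _ := by ring

lemma sum_dyadic (x : ℕ → ℂ) (N : ℕ) {X : ℝ} (h : ∀ j, ‖∑ n ∈ Finset.Ico (2 ^ j * N) (2 * (2 ^ j * N)), x n‖ ≤ X) (k : ℕ) :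
    ‖∑ n ∈ Finset.Ico N (2 ^ k * N), x n‖ ≤ k * X := by
  induction k with
  | zero => simp
  | succ k ih =>
    rw [← Finset.sum_Ico_consecutive x (n := 2 ^ k * N) (Nat.le_mul_of_pos_left _ (by positivity)) (by
      rw [pow_succ]; nlinarith [Nat.zero_le (2 ^ k * N)])]
    refine (norm_add_le _ _).trans ?_
    have := h k
    rw [show 2 * (2 ^ k * N) = 2 ^ (k + 1) * N by ring] at this
    push_cast; linarith

lemma R_one_eq (z u : ℝ) {N : ℕ} (hN : NN (z + 3) ≤ N) : R (fun _ => 1) z (-u) = ∑ n ∈ Finset.Ico 1 N, (wt z n : ℂ) * ee (u * Real.log n) := by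
  rw [R_eq _ _ _ hN, D_def]
  refine Finset.sum_congr rfl fun n _ => ?_
  simp only [rc, wt, one_mul, neg_mul, neg_neg]

lemma R_one_weyl (A : ℝ) : ∃ c C : ℝ, 0 < c ∧ c ≤ 1 ∧ 0 < C ∧ ∀ z u : ℝ, 0 ≤ z → 0 < |u| → |u| ≤ Real.exp (A * z) →
    ‖R (fun _ => 1) z (-u)‖ ≤ C * (1 / |u| + Real.exp (-(c * z))) := by
  obtain ⟨c, C, hc, hc1, hC, hW⟩ := weyl (2 * max A 0)
  refine ⟨c, max (Real.exp 6) (18 * C * Real.exp 1), hc, hc1, by positivity, fun z u hz hu hu' => ?_⟩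
  by_cases hz2 : z < 2
  · refine (norm_R_le (fun _ => by simp) _ _).trans ?_
    calc Real.exp 4 ≤ Real.exp (6 + -(c * z)) := by gcongr; nlinarith
      _ = Real.exp 6 * Real.exp (-(c * z)) := Real.exp_add _ _
      _ ≤ _ := by gcongr; exact le_max_left _ _; exact le_add_of_nonneg_left (by positivity)
  push Not at hz2
  set N : ℕ := ⌈Real.exp (z - 1)⌉₊ with hNdef
  have hNe : Real.exp (z - 1) ≤ N := Nat.le_ceil _
  have hN1 : 1 ≤ N := Nat.one_le_iff_ne_zero.2 (by
    intro h; rw [h] at hNe; exact absurd hNe (by push_cast; linarith [Real.exp_pos (z-1)]))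
  have hbig : NN (z + 3) ≤ 2 ^ 6 * N := by
    have : (NN (z + 3) : ℝ) ≤ 2 ^ 6 * N := by
      refine (NN_le _).trans ?_
      have e4 : Real.exp 4 ≤ 55 := by
        rw [show (4:ℝ) = 1 * (4:ℕ) by norm_num, Real.exp_mul, Real.rpow_natCast]
        calc Real.exp 1 ^ 4 ≤ (2.7182818286:ℝ) ^ 4 := by gcongr; exact Real.exp_one_lt_d9.le
          _ ≤ 55 := by norm_num
      have : Real.exp (z + 3) = Real.exp 4 * Real.exp (z - 1) := by rw [← Real.exp_add]; congr 1; ring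
      have h1 : 1 ≤ Real.exp (z - 1) := Real.one_le_exp (by linarith)
      rw [this]; nlinarith
    exact_mod_cast this
  rw [R_one_eq z u hbig, ← Finset.sum_Ico_consecutive _ hN1 (Nat.le_mul_of_pos_left _ (by positivity))]
  have hz0 : ∑ n ∈ Finset.Ico 1 N, (wt z n : ℂ) * ee (u * Real.log n) = 0 := by
    refine Finset.sum_eq_zero fun n hn => ?_
    rw [Finset.mem_Ico] at hn
    have hn' : (n:ℝ) < Real.exp (z - 1) := Nat.lt_ceil.1 hn.2
    have hl : Real.log n ≤ z - 1 := by
      rw [Real.log_le_iff_le_exp (by exact_mod_cast hn.1)]; exact hn'.le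
    rw [wt, w_eq_zero_left (by linarith)]; simp
  rw [hz0, zero_add]
  have key : ∀ j : ℕ, ‖∑ n ∈ Finset.Ico (2 ^ j * N) (2 * (2 ^ j * N)), (wt z n : ℂ) * ee (u * Real.log n)‖ ≤
      3 * C * Real.exp 1 * (1 / |u| + Real.exp (-(c * z))) := by
    intro j
    set M := 2 ^ j * N
    have hNM : N ≤ M := Nat.le_mul_of_pos_left _ (by positivity)
    have hM1 : 1 ≤ M := hN1.trans hNM
    have hMe : Real.exp (z - 1) ≤ M := hNe.trans (by exact_mod_cast hNM)
    have hM0 : (0:ℝ) < M := by exact_mod_cast hM1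
    refine (wt_block z u hM1 (fun l hl => hW M u l (by exact_mod_cast hM1) (by exact_mod_cast hl) hu ?_)).trans ?_
    · refine hu'.trans ?_
      calc Real.exp (A * z) ≤ Real.exp ((z - 1) * (2 * max A 0)) := by
            refine Real.exp_le_exp.2 ?_
            have m1 := mul_nonneg (sub_nonneg.2 (le_max_left A 0)) hz
            have m2 := mul_nonneg (sub_nonneg.2 hz2) (le_max_right A 0)
            nlinarith
        _ = Real.exp (z - 1) ^ (2 * max A 0) := Real.exp_mul _ _
        _ ≤ _ := by gcongr
    · have e : C * (M / |u| + (M:ℝ) ^ (1 - c)) / M = C * (1 / |u| + (M:ℝ) ^ (-c)) := by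
        rw [sub_eq_add_neg, Real.rpow_add hM0, Real.rpow_one]; field_simp
      rw [e]
      have : (M:ℝ) ^ (-c) ≤ Real.exp 1 * Real.exp (-(c * z)) := by
        calc (M:ℝ) ^ (-c) ≤ Real.exp (z - 1) ^ (-c) := Real.rpow_le_rpow_of_nonpos (Real.exp_pos _) hMe (by linarith)
          _ = Real.exp ((z - 1) * (-c)) := (Real.exp_mul _ _).symm
          _ ≤ Real.exp (1 + -(c * z)) := by gcongr; nlinarith
          _ = _ := Real.exp_add _ _
      have h1 : 1 / |u| ≤ Real.exp 1 * (1 / |u|) := le_mul_of_one_le_left (by positivity) (Real.one_le_exp zero_le_one)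
      calc 3 * (C * (1 / |u| + (M:ℝ) ^ (-c))) ≤ 3 * (C * (Real.exp 1 * (1 / |u|) + Real.exp 1 * Real.exp (-(c * z)))) := by gcongr
        _ = _ := by ring
  refine (sum_dyadic _ N key 6).trans ?_
  calc _ = 18 * C * Real.exp 1 * (1 / |u| + Real.exp (-(c * z))) := by push_cast; ring
    _ ≤ _ := by gcongr; exact le_max_right _ _

/-- transform of the window -/
def wh (u : ℝ) : ℂ := ∫ x in (-1:ℝ)..3, (w x : ℂ) * ee (u * x)

lemma hasDerivAt_ee (u x : ℝ) : HasDerivAt (fun x : ℝ => ee (u * x)) (ee (u * x) * (u * Complex.I)) x := by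
  unfold ee
  have h : HasDerivAt (fun x : ℝ => ((u * x : ℝ) : ℂ) * Complex.I) (u * Complex.I) x := by
    have h1 : HasDerivAt (fun x : ℝ => u * x) u x := by simpa using (hasDerivAt_id x).const_mul u
    exact h1.ofReal_comp.mul_const _
  exact h.cexp

lemma continuous_wee (u : ℝ) : Continuous (fun x : ℝ => (w x : ℂ) * ee (u * x)) :=
  (Complex.continuous_ofReal.comp continuous_w).mul (continuous_ee.comp (by fun_prop))

lemma int_lin {u : ℝ} (hu : u ≠ 0) (p r a b : ℝ) :
    ∫ x in a..b, ((p * x + r : ℝ) : ℂ) * ee (u * x) =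
      (((p * b + r : ℝ) : ℂ) / (u * Complex.I) + p / (u:ℂ) ^ 2) * ee (u * b) -
      (((p * a + r : ℝ) : ℂ) / (u * Complex.I) + p / (u:ℂ) ^ 2) * ee (u * a) := by
  have hu' : (u:ℂ) ≠ 0 := by exact_mod_cast hu
  have hI := Complex.I_ne_zero
  refine intervalIntegral.integral_eq_sub_of_hasDerivAt
    (f := fun x : ℝ => (((p * x + r : ℝ) : ℂ) / (u * Complex.I) + p / (u:ℂ) ^ 2) * ee (u * x)) (fun x _ => ?_) ?_
  · have h1 : HasDerivAt (fun x : ℝ => p * x + r) p x := by simpa using ((hasDerivAt_id x).const_mul p).add_const r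
    have h2 := ((h1.ofReal_comp.div_const ((u:ℂ) * Complex.I)).add_const ((p:ℂ) / (u:ℂ) ^ 2)).mul (hasDerivAt_ee u x)
    refine h2.congr_deriv ?_
    field_simp
    linear_combination ((p:ℂ) * ee (u * x)) * Complex.I_sq
  · refine Continuous.intervalIntegrable ?_ _ _
    exact (Complex.continuous_ofReal.comp (by fun_prop)).mul (continuous_ee.comp (by fun_prop))

lemma wh_eq {u : ℝ} (hu : u ≠ 0) : wh u = (ee (u * 0) - ee (u * (-1)) - ee (u * 3) + ee (u * 2)) / (u:ℂ) ^ 2 := by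
  have hu' : (u:ℂ) ≠ 0 := by exact_mod_cast hu
  have hI := Complex.I_ne_zero
  have hi : ∀ a b, IntervalIntegrable (fun x : ℝ => (w x : ℂ) * ee (u * x)) volume a b := fun a b => (continuous_wee u).intervalIntegrable a b
  unfold wh
  rw [← intervalIntegral.integral_add_adjacent_intervals (hi (-1) 0) (hi 0 3), ← intervalIntegral.integral_add_adjacent_intervals (hi 0 2) (hi 2 3)]
  have e1 : ∫ x in (-1:ℝ)..0, (w x : ℂ) * ee (u * x) = ∫ x in (-1:ℝ)..0, (((1:ℝ) * x + 1 : ℝ) : ℂ) * ee (u * x) := by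
    refine intervalIntegral.integral_congr fun x hx => ?_
    rw [Set.uIcc_of_le (by norm_num)] at hx
    have : w x = 1 * x + 1 := by
      unfold w; rw [min_eq_left (b := 3 - x) (by linarith [hx.2]), min_eq_right (by linarith [hx.2]), max_eq_right (by linarith [hx.1])]; ring
    simp only [this]
  have e2 : ∫ x in (0:ℝ)..2, (w x : ℂ) * ee (u * x) = ∫ x in (0:ℝ)..2, (((0:ℝ) * x + 1 : ℝ) : ℂ) * ee (u * x) := by
    refine intervalIntegral.integral_congr fun x hx => ?_
    rw [Set.uIcc_of_le (by norm_num)] at hx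
    have : w x = 0 * x + 1 := by rw [w_eq_one hx.1 hx.2]; ring
    simp only [this]
  have e3 : ∫ x in (2:ℝ)..3, (w x : ℂ) * ee (u * x) = ∫ x in (2:ℝ)..3, (((-1:ℝ) * x + 3 : ℝ) : ℂ) * ee (u * x) := by
    refine intervalIntegral.integral_congr fun x hx => ?_
    rw [Set.uIcc_of_le (by norm_num)] at hx
    have : w x = (-1) * x + 3 := by
      unfold w; rw [min_eq_right (b := 3 - x) (by linarith [hx.1]), min_eq_right (by linarith [hx.1]), max_eq_right (by linarith [hx.2])]; ring
    simp only [this]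
  rw [e1, e2, e3, int_lin hu, int_lin hu, int_lin hu]
  push_cast
  field_simp
  ring

lemma wh_bound (u : ℝ) : ‖wh u‖ ≤ 8 / (1 + u ^ 2) := by
  have h1 : ‖wh u‖ ≤ 4 := by
    have := intervalIntegral.norm_integral_le_of_norm_le_const (a := (-1:ℝ)) (b := 3) (C := 1) (f := fun x : ℝ => (w x : ℂ) * ee (u * x)) (fun x _ => by
      rw [norm_mul, norm_ee, mul_one, Complex.norm_real, Real.norm_eq_abs, abs_of_nonneg (w_nonneg _)]; exact w_le_one _)
    refine this.trans ?_
    norm_num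
  have h2 : u ^ 2 * ‖wh u‖ ≤ 4 := by
    by_cases hu : u = 0
    · rw [hu]; norm_num
    rw [wh_eq hu, norm_div, norm_pow, Complex.norm_real, Real.norm_eq_abs, sq_abs, mul_div_cancel₀ _ (by positivity)]
    refine (norm_add_le _ _).trans ?_
    have := norm_sub_le (ee (u * 0) - ee (u * (-1))) (ee (u * 3))
    have := norm_sub_le (ee (u * 0)) (ee (u * (-1)))
    simp only [norm_ee] at *
    linarith
  rw [le_div_iff₀ (by positivity)]
  nlinarith

lemma wee_lip (z u x x' : ℝ) : ‖(w (x - z) : ℂ) * ee (u * x) - (w (x' - z) : ℂ) * ee (u * x')‖ ≤ (1 + |u|) * |x - x'| := by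
  have e : (w (x - z) : ℂ) * ee (u * x) - (w (x' - z) : ℂ) * ee (u * x') =
      ((w (x - z) - w (x' - z) : ℝ) : ℂ) * ee (u * x) + (w (x' - z) : ℂ) * (ee (u * x) - ee (u * x')) := by push_cast; ring
  rw [e]
  refine (norm_add_le _ _).trans ?_
  rw [norm_mul, norm_mul, norm_ee, mul_one, Complex.norm_real, Complex.norm_real, Real.norm_eq_abs, Real.norm_eq_abs, abs_of_nonneg (w_nonneg _)]
  have h1 := w_lip (x - z) (x' - z)
  rw [sub_sub_sub_cancel_right] at h1
  have h2 := norm_ee_sub_le (u * x) (u * x')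
  rw [← mul_sub, abs_mul] at h2
  have h3 := w_le_one (x' - z)
  calc _ ≤ |x - x'| + 1 * (|u| * |x - x'|) := by gcongr
    _ = _ := by ring

lemma R_one_int {z u : ℝ} (hz : 1 ≤ z) : ‖R (fun _ => 1) z (-u) - ee (u * z) * wh u‖ ≤ (2 + |u|) * (4 * Real.exp 5) * Real.exp (-z) := by
  set N := NN (z + 3) with hN
  have hN1 : 1 ≤ N := by rw [hN]; unfold NN; omega
  set F : ℝ → ℂ := fun x => (w (x - z) : ℂ) * ee (u * x) with hF
  have hFc : Continuous F := (Complex.continuous_ofReal.comp (continuous_w.comp (by fun_prop))).mul (continuous_ee.comp (by fun_prop))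
  have hi : ∀ a b, IntervalIntegrable F volume a b := fun a b => hFc.intervalIntegrable a b
  have hlogN : z + 3 ≤ Real.log N := le_log_of_NN_le le_rfl
  have e1 : ee (u * z) * wh u = ∫ x in (0:ℝ)..Real.log N, F x := by
    have z1 : ∫ x in (0:ℝ)..(z - 1), F x = 0 := by
      rw [← intervalIntegral.integral_zero (a := 0) (b := z - 1) (μ := volume) (E := ℂ)]
      refine intervalIntegral.integral_congr fun x hx => ?_
      rw [Set.uIcc_of_le (by linarith)] at hx
      simp only [hF, w_eq_zero_left (show x - z ≤ -1 by linarith [hx.2])]; simp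
    have z2 : ∫ x in (z + 3)..Real.log N, F x = 0 := by
      rw [← intervalIntegral.integral_zero (a := z + 3) (b := Real.log N) (μ := volume) (E := ℂ)]
      refine intervalIntegral.integral_congr fun x hx => ?_
      rw [Set.uIcc_of_le (by linarith)] at hx
      simp only [hF, w_eq_zero_right (show 3 ≤ x - z by linarith [hx.1])]; simp
    rw [← intervalIntegral.integral_add_adjacent_intervals (hi 0 (z - 1)) (hi (z - 1) (Real.log N)),
      ← intervalIntegral.integral_add_adjacent_intervals (hi (z - 1) (z + 3)) (hi (z + 3) (Real.log N)), z1, z2, zero_add, add_zero]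
    have := intervalIntegral.integral_comp_add_right (a := -1) (b := 3) F z
    rw [show -1 + z = z - 1 by ring, show 3 + z = z + 3 by ring] at this
    rw [← this, wh, ← intervalIntegral.integral_const_mul]
    refine intervalIntegral.integral_congr fun x _ => ?_
    simp only [hF, add_sub_cancel_right]
    rw [show u * (x + z) = u * z + u * x by ring, ee_add]; ring
  have e2 : ∫ x in (0:ℝ)..Real.log N, F x = ∑ m ∈ Finset.Ico 1 N, ∫ x in Real.log m..Real.log (m + 1 : ℕ), F x := by
    have := intervalIntegral.sum_integral_adjacent_intervals_Ico (a := fun k : ℕ => Real.log k) (f := F) (μ := volume) hN1 (fun k _ => hi _ _)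
    simp only [Nat.cast_one, Real.log_one] at this
    exact this.symm
  rw [e1, e2, R_one_eq z u (le_refl _), ← Finset.sum_sub_distrib]
  have term : ∀ m ∈ Finset.Ico 1 N, ‖(wt z m : ℂ) * ee (u * Real.log m) - ∫ x in Real.log m..Real.log (m + 1 : ℕ), F x‖ ≤
      (2 + |u|) * (4 * Real.exp 2 * Real.exp (-(2 * z))) := by
    intro m hm
    rw [Finset.mem_Ico] at hm
    have hm0 : (0:ℝ) < m := by exact_mod_cast hm.1
    obtain ⟨l1, l2, l3⟩ := log_succ_sub hm.1
    by_cases hs : Real.log (m + 1 : ℕ) ≤ z - 1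
    · have : ∫ x in Real.log m..Real.log (m + 1 : ℕ), F x = 0 := by
        rw [← intervalIntegral.integral_zero (a := Real.log m) (b := Real.log (m + 1 : ℕ)) (μ := volume) (E := ℂ)]
        refine intervalIntegral.integral_congr fun x hx => ?_
        rw [Set.uIcc_of_le (by linarith)] at hx
        simp only [hF, w_eq_zero_left (show x - z ≤ -1 by linarith [hx.2])]; simp
      rw [this, wt, w_eq_zero_left (by linarith)]
      simp; positivity
    push Not at hs
    have hme : Real.exp (z - 1) ≤ 2 * m := by
      rw [Real.lt_log_iff_exp_lt (by positivity)] at hs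
      push_cast at hs
      have : (1:ℝ) ≤ m := by exact_mod_cast hm.1
      linarith
    have b1 : ‖(∫ x in Real.log m..Real.log (m + 1 : ℕ), F x) - ((Real.log (m + 1 : ℕ) - Real.log m : ℝ) : ℂ) * F (Real.log m)‖ ≤ (1 + |u|) / m ^ 2 := by
      have e : ((Real.log (m + 1 : ℕ) - Real.log m : ℝ) : ℂ) * F (Real.log m) = ∫ x in Real.log m..Real.log (m + 1 : ℕ), F (Real.log m) := by
        rw [intervalIntegral.integral_const, Complex.real_smul]
      rw [e, ← intervalIntegral.integral_sub (hi _ _) (by simp)]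
      refine (intervalIntegral.norm_integral_le_of_norm_le_const (C := (1 + |u|) * (1 / m)) fun x hx => ?_).trans ?_
      · rw [Set.uIoc_of_le (by linarith)] at hx
        refine (wee_lip z u x (Real.log m)).trans ?_
        gcongr
        rw [abs_of_nonneg (by linarith [hx.1])]; linarith [hx.2]
      · rw [abs_of_nonneg l1]
        calc _ ≤ (1 + |u|) * (1 / m) * (1 / m) := by gcongr
          _ = _ := by field_simp
    have b2 : ‖(wt z m : ℂ) * ee (u * Real.log m) - ((Real.log (m + 1 : ℕ) - Real.log m : ℝ) : ℂ) * F (Real.log m)‖ ≤ 1 / m ^ 2 := by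
      have e : (wt z m : ℂ) * ee (u * Real.log m) - ((Real.log (m + 1 : ℕ) - Real.log m : ℝ) : ℂ) * F (Real.log m) =
          ((1 / m - (Real.log (m + 1 : ℕ) - Real.log m) : ℝ) : ℂ) * F (Real.log m) := by
        simp only [hF, wt]; push_cast; ring
      rw [e, norm_mul, Complex.norm_real, Real.norm_eq_abs, abs_of_nonneg (by linarith)]
      have : ‖F (Real.log m)‖ ≤ 1 := by
        simp only [hF]
        rw [norm_mul, norm_ee, mul_one, Complex.norm_real, Real.norm_eq_abs, abs_of_nonneg (w_nonneg _)]; exact w_le_one _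
      calc _ ≤ (1 / (m:ℝ) ^ 2) * 1 := by gcongr; linarith
        _ = _ := mul_one _
    calc _ ≤ 1 / (m:ℝ) ^ 2 + (1 + |u|) / m ^ 2 := by
          refine (norm_sub_le_norm_sub_add_norm_sub _ (((Real.log (m + 1 : ℕ) - Real.log m : ℝ) : ℂ) * F (Real.log m)) _).trans (add_le_add b2 ?_)
          rw [norm_sub_rev]; exact b1
      _ = (2 + |u|) * (1 / (m:ℝ) ^ 2) := by ring
      _ ≤ (2 + |u|) * (4 * Real.exp 2 * Real.exp (-(2 * z))) := by
          gcongr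
          rw [div_le_iff₀ (by positivity)]
          have : Real.exp (z - 1) ^ 2 ≤ (2 * m) ^ 2 := by gcongr
          have e3 : Real.exp 2 * Real.exp (-(2 * z)) * Real.exp (z - 1) ^ 2 = 1 := by
            rw [← Real.exp_nat_mul, ← Real.exp_add, ← Real.exp_add, Real.exp_eq_one_iff]; push_cast; ring
          calc (1:ℝ) = Real.exp 2 * Real.exp (-(2 * z)) * Real.exp (z - 1) ^ 2 := e3.symm
            _ ≤ Real.exp 2 * Real.exp (-(2 * z)) * (2 * m) ^ 2 := by gcongr
            _ = _ := by ring
  refine (norm_sum_le _ _).trans ((Finset.sum_le_sum term).trans ?_)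
  rw [Finset.sum_const, nsmul_eq_mul]
  calc _ ≤ Real.exp (z + 3) * ((2 + |u|) * (4 * Real.exp 2 * Real.exp (-(2 * z)))) := by gcongr; exact card_NN _
    _ = (2 + |u|) * 4 * (Real.exp (z + 3) * Real.exp 2 * Real.exp (-(2 * z))) := by ring
    _ = (2 + |u|) * 4 * (Real.exp 5 * Real.exp (-z)) := by
        rw [← Real.exp_add, ← Real.exp_add, ← Real.exp_add]; congr 2; ring
    _ = _ := by ring

/-- kernel approximations -/
lemma kernel (A : ℝ) : ∃ c C : ℝ, 0 < c ∧ c ≤ 1 ∧ 0 < C ∧ ∀ z u : ℝ, 1 ≤ z → |u| ≤ Real.exp (A * z) →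
    ‖R (fun _ => 1) z (-u) - ee (u * z) * wh u‖ ≤ C * Real.exp (-(c * z)) := by
  obtain ⟨c, C, hc, hc1, hC, hW⟩ := R_one_weyl A
  refine ⟨min c (1 / 2), max (12 * Real.exp 5) (2 * C + 8), lt_min hc (by norm_num), (min_le_left _ _).trans hc1, by positivity, fun z u hz hu => ?_⟩
  have hc2 := min_le_right c (1 / 2 : ℝ)
  have hc3 := min_le_left c (1 / 2 : ℝ)
  by_cases hs : |u| ≤ Real.exp (z / 2)
  · refine (R_one_int hz).trans ?_
    have h1 : 1 ≤ Real.exp (z / 2) := Real.one_le_exp (by linarith)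
    calc (2 + |u|) * (4 * Real.exp 5) * Real.exp (-z) ≤ (3 * Real.exp (z / 2)) * (4 * Real.exp 5) * Real.exp (-z) := by gcongr; linarith
      _ = 12 * Real.exp 5 * (Real.exp (z / 2) * Real.exp (-z)) := by ring
      _ = 12 * Real.exp 5 * Real.exp (-(z / 2)) := by rw [← Real.exp_add]; congr 2; ring
      _ ≤ _ := by gcongr; exact le_max_left _ _; nlinarith
  · push Not at hs
    have hu0 : 0 < |u| := (Real.exp_pos _).trans hs
    have h1 := hW z u (by linarith) hu0 hu
    have h2 := wh_bound u
    have h4 : 1 / |u| ≤ Real.exp (-(min c (1 / 2) * z)) := by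
      calc 1 / |u| ≤ 1 / Real.exp (z / 2) := by gcongr
        _ = Real.exp (-(z / 2)) := by rw [Real.exp_neg, one_div]
        _ ≤ _ := by gcongr; nlinarith
    have h3 : 8 / (1 + u ^ 2) ≤ 8 * Real.exp (-(min c (1 / 2) * z)) := by
      have : 1 ≤ Real.exp (z / 2) := Real.one_le_exp (by linarith)
      calc 8 / (1 + u ^ 2) ≤ 8 / |u| := by gcongr; rw [← sq_abs]; nlinarith
        _ = 8 * (1 / |u|) := by ring
        _ ≤ _ := by gcongr
    have h5 : Real.exp (-(c * z)) ≤ Real.exp (-(min c (1 / 2) * z)) := by gcongr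
    refine (norm_sub_le _ _).trans ?_
    rw [norm_mul, norm_ee, one_mul]
    calc _ ≤ C * (Real.exp (-(min c (1 / 2) * z)) + Real.exp (-(min c (1 / 2) * z))) + 8 * Real.exp (-(min c (1 / 2) * z)) := by
          refine add_le_add (h1.trans ?_) (h2.trans h3)
          gcongr
      _ = (2 * C + 8) * Real.exp (-(min c (1 / 2) * z)) := by ring
      _ ≤ _ := by gcongr; exact le_max_right _ _

lemma intU2 {T : ℝ} {U : Set ℝ} (hU : U ⊆ Set.Icc (-T) T) {E : Type*} [NormedAddCommGroup E] {F : ℝ × ℝ → E} (hF : Continuous F) :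
    Integrable F ((volume.restrict U).prod (volume.restrict U)) := by
  rw [Measure.prod_restrict]
  have : IntegrableOn F (Set.Icc (-T) T ×ˢ Set.Icc (-T) T) (volume.prod volume) :=
    hF.continuousOn.integrableOn_compact (isCompact_Icc.prod isCompact_Icc)
  exact this.mono_set (Set.prod_mono hU hU)

lemma intU {T : ℝ} {U : Set ℝ} (hU : U ⊆ Set.Icc (-T) T) {E : Type*} [NormedAddCommGroup E] {F : ℝ → E} (hF : Continuous F) :
    IntegrableOn F U := (hF.continuousOn.integrableOn_compact isCompact_Icc).mono_set hU

lemma int_cauchy_shift (t : ℝ) : Integrable (fun t' : ℝ => (1 + (t' - t) ^ 2)⁻¹) ∧ ∫ t' : ℝ, (1 + (t' - t) ^ 2)⁻¹ = Real.pi := by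
  refine ⟨integrable_inv_one_add_sq.comp_sub_right t, ?_⟩
  rw [integral_sub_right_eq_self (fun x : ℝ => (1 + x ^ 2)⁻¹) t, integral_univ_inv_one_add_sq]

lemma schur_int {T : ℝ} {U : Set ℝ} (hU : U ⊆ Set.Icc (-T) T) (hUm : MeasurableSet U) {q : ℝ → ℂ} (hq : Continuous q)
    {A B : ℝ} (hA : 0 ≤ A) (hB : 0 ≤ B) :
    ∫ z, ‖q z.1‖ * ‖q z.2‖ * (A * (1 + (z.2 - z.1) ^ 2)⁻¹ + B) ∂((volume.restrict U).prod (volume.restrict U)) ≤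
      (A * Real.pi + B * volume.real U) * ∫ t in U, ‖q t‖ ^ 2 := by
  set k : ℝ → ℝ := fun u => A * (1 + u ^ 2)⁻¹ + B with hk
  have hkc : Continuous k := by
    refine (continuous_const.mul (Continuous.inv₀ (by fun_prop) fun x => ?_)).add continuous_const
    positivity
  have hk0 : ∀ u, 0 ≤ k u := fun u => by simp only [hk]; positivity
  have hfin : volume U ≠ ⊤ := ((measure_mono hU).trans_lt (by simp)).ne
  have hc1 : Continuous (fun z : ℝ × ℝ => ‖q z.1‖ ^ 2 * k (z.2 - z.1)) := by fun_prop
  have hc2 : Continuous (fun z : ℝ × ℝ => ‖q z.2‖ ^ 2 * k (z.2 - z.1)) := by fun_prop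
  have i1 := intU2 hU hc1
  have i2 := intU2 hU hc2
  have kk : ∀ t, ∫ t' in U, k (t' - t) ≤ A * Real.pi + B * volume.real U := by
    intro t
    obtain ⟨c1, c2⟩ := int_cauchy_shift t
    simp only [hk]
    rw [integral_add (c1.integrableOn.const_mul A) (integrableOn_const hfin), integral_const_mul, setIntegral_const, smul_eq_mul, mul_comm (volume.real U)]
    gcongr
    rw [← c2]
    exact setIntegral_le_integral c1 (Eventually.of_forall fun x => by positivity)
  have v1 : ∫ z, ‖q z.1‖ ^ 2 * k (z.2 - z.1) ∂((volume.restrict U).prod (volume.restrict U)) ≤ (A * Real.pi + B * volume.real U) * ∫ t in U, ‖q t‖ ^ 2 := by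
    rw [integral_prod _ i1, mul_comm, ← integral_mul_const]
    have i3 : Integrable (fun t => ‖q t‖ ^ 2) (volume.restrict U) := intU hU (by fun_prop)
    refine integral_mono i1.integral_prod_left (i3.mul_const _) fun t => ?_
    simp only
    rw [integral_const_mul]
    gcongr
    exact kk t
  have v2 : ∫ z, ‖q z.2‖ ^ 2 * k (z.2 - z.1) ∂((volume.restrict U).prod (volume.restrict U)) =
      ∫ z, ‖q z.1‖ ^ 2 * k (z.2 - z.1) ∂((volume.restrict U).prod (volume.restrict U)) := by
    rw [← integral_prod_swap]
    refine integral_congr_ae (Eventually.of_forall fun z => ?_)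
    simp only [Prod.fst_swap, Prod.snd_swap, hk]
    rw [← neg_sub z.2 z.1, neg_sq]
  calc _ ≤ ∫ z, (1 / 2) * (‖q z.1‖ ^ 2 * k (z.2 - z.1) + ‖q z.2‖ ^ 2 * k (z.2 - z.1)) ∂((volume.restrict U).prod (volume.restrict U)) := by
        have hc3 : Continuous (fun z : ℝ × ℝ => ‖q z.1‖ * ‖q z.2‖ * k (z.2 - z.1)) := by fun_prop
        refine integral_mono (intU2 hU hc3) ((i1.add i2).const_mul _) fun z => ?_
        have := mul_nonneg (sq_nonneg (‖q z.1‖ - ‖q z.2‖)) (hk0 (z.2 - z.1))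
        simp only [hk] at this ⊢
        nlinarith
    _ = ∫ z, ‖q z.1‖ ^ 2 * k (z.2 - z.1) ∂((volume.restrict U).prod (volume.restrict U)) := by
        rw [integral_const_mul, integral_add i1 i2, v2]; ring
    _ ≤ _ := v1

/-- large sieve by duality with a majorant -/
lemma dual_ls {T : ℝ} {U : Set ℝ} (hU : U ⊆ Set.Icc (-T) T) (hUm : MeasurableSet U) (P S : Finset ℕ) (hPS : P ⊆ S)
    (a : ℕ → ℂ) (κ : ℕ → ℝ) (hκ : ∀ n ∈ S, 0 ≤ κ n) (hP : ∀ p ∈ P, 1 ≤ p ∧ 1 / (p:ℝ) ≤ κ p) {A B : ℝ} (hA : 0 ≤ A) (hB : 0 ≤ B)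
    (hK : ∀ u, |u| ≤ 2 * T → ‖∑ n ∈ S, (κ n : ℂ) * ee (u * Real.log n)‖ ≤ A * (1 + u ^ 2)⁻¹ + B) :
    ∫ t in U, ‖GD P a (fun n => Real.log n) t‖ ^ 2 ≤ (A * Real.pi + B * volume.real U) * ∑ p ∈ P, p * ‖a p‖ ^ 2 := by
  set q : ℝ → ℂ := GD P a (fun n => Real.log n) with hq
  have hqc : Continuous q := continuous_GD _ _ _
  set X := ∫ t in U, ‖q t‖ ^ 2 with hX
  have hX0 : 0 ≤ X := integral_nonneg fun t => by positivity
  set Φ : ℕ → ℂ := fun n => ∫ t in U, ee (-(t * Real.log n)) * (starRingEnd ℂ) (q t) with hΦ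
  have hec : ∀ n : ℕ, Continuous (fun t : ℝ => ee (-(t * Real.log n))) := fun n => continuous_ee.comp (by fun_prop)
  have hec' : ∀ n : ℕ, Continuous (fun t : ℝ => ee ((t * Real.log n))) := fun n => continuous_ee.comp (by fun_prop)
  have hqs : Continuous (fun t => (starRingEnd ℂ) (q t)) := Complex.continuous_conj.comp hqc
  have x1 : (X : ℂ) = ∑ p ∈ P, a p * Φ p := by
    have e0 : ((∫ t in U, ‖q t‖ ^ 2 : ℝ) : ℂ) = ∫ t in U, ((‖q t‖ ^ 2 : ℝ) : ℂ) := integral_ofReal.symm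
    rw [hX, e0]
    have : ∀ t, ((‖q t‖ ^ 2 : ℝ) : ℂ) = ∑ p ∈ P, a p * (ee (-(t * Real.log p)) * (starRingEnd ℂ) (q t)) := by
      intro t
      rw [Complex.ofReal_pow, ← Complex.mul_conj']
      nth_rewrite 1 [hq]
      rw [GD, Finset.sum_mul]
      exact Finset.sum_congr rfl fun p _ => by ring
    refine (integral_congr_ae (Eventually.of_forall this)).trans ?_
    have i4 : ∀ p ∈ P, Integrable (fun t => a p * (ee (-(t * Real.log p)) * (starRingEnd ℂ) (q t))) (volume.restrict U) := fun p _ =>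
      intU hU (continuous_const.mul ((hec p).mul hqs))
    rw [integral_finsetSum _ i4]
    simp only [integral_const_mul, hΦ]
  set Y := ∑ n ∈ S, κ n * ‖Φ n‖ ^ 2 with hY
  have x2 : X ^ 2 ≤ (∑ p ∈ P, p * ‖a p‖ ^ 2) * Y := by
    have h1 : X ≤ ∑ p ∈ P, ‖a p‖ * ‖Φ p‖ := by
      have : ‖(X:ℂ)‖ ≤ ∑ p ∈ P, ‖a p‖ * ‖Φ p‖ := by
        rw [x1]; refine (norm_sum_le _ _).trans (le_of_eq ?_)
        simp only [norm_mul]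
      rwa [Complex.norm_real, Real.norm_eq_abs, abs_of_nonneg hX0] at this
    have h2 : (∑ p ∈ P, ‖a p‖ * ‖Φ p‖) ^ 2 ≤ (∑ p ∈ P, (p:ℝ) * ‖a p‖ ^ 2) * ∑ p ∈ P, 1 / (p:ℝ) * ‖Φ p‖ ^ 2 := by
      refine Finset.sum_sq_le_sum_mul_sum_of_sq_le_mul P (fun _ _ => by positivity) (fun _ _ => by positivity) fun p hp => ?_
      have : (0:ℝ) < p := by exact_mod_cast (hP p hp).1
      refine le_of_eq ?_
      field_simp
    have h3 : ∑ p ∈ P, 1 / (p:ℝ) * ‖Φ p‖ ^ 2 ≤ Y := by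
      calc _ ≤ ∑ p ∈ P, κ p * ‖Φ p‖ ^ 2 := Finset.sum_le_sum fun p hp => by gcongr; exact (hP p hp).2
        _ ≤ _ := Finset.sum_le_sum_of_subset_of_nonneg hPS fun n hn _ => mul_nonneg (hκ n hn) (by positivity)
    calc X ^ 2 ≤ (∑ p ∈ P, ‖a p‖ * ‖Φ p‖) ^ 2 := by gcongr
      _ ≤ _ := h2
      _ ≤ _ := by gcongr
  have x3 : Y ≤ (A * Real.pi + B * volume.real U) * X := by
    set μ₂ := (volume.restrict U).prod (volume.restrict U)
    set W : ℝ × ℝ → ℂ := fun z => (starRingEnd ℂ) (q z.1) * q z.2 * ∑ n ∈ S, (κ n : ℂ) * ee ((z.2 - z.1) * Real.log n) with hW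
    have hYW : (Y : ℂ) = ∫ z, W z ∂μ₂ := by
      have e : ∀ z, W z = ∑ n ∈ S, (κ n : ℂ) * ((ee (-(z.1 * Real.log n)) * (starRingEnd ℂ) (q z.1)) * (ee (z.2 * Real.log n) * q z.2)) := by
        intro z
        simp only [hW, Finset.mul_sum]
        refine Finset.sum_congr rfl fun n _ => ?_
        rw [show (z.2 - z.1) * Real.log n = -(z.1 * Real.log n) + z.2 * Real.log n by ring, ee_add]; ring
      rw [integral_congr_ae (Eventually.of_forall e), integral_finsetSum]
      · rw [hY]; push_cast
        refine Finset.sum_congr rfl fun n _ => ?_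
        rw [integral_const_mul, integral_prod_mul (fun t => ee (-(t * Real.log n)) * (starRingEnd ℂ) (q t)) (fun t => ee (t * Real.log n) * q t)]
        congr 1
        have : (∫ t in U, ee (t * Real.log n) * q t) = (starRingEnd ℂ) (Φ n) := by
          rw [hΦ]; simp only
          rw [← integral_conj]
          refine integral_congr_ae (Eventually.of_forall fun t => ?_)
          simp only [map_mul, conj_ee, Complex.conj_conj, neg_neg]
        rw [this, Complex.mul_conj']
      · intro n _
        exact (intU2 hU ((((hec n).comp continuous_fst).mul (hqs.comp continuous_fst)).mul
          (((hec' n).comp continuous_snd).mul (hqc.comp continuous_snd)))).const_mul _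
    have : Y ≤ ∫ z, ‖W z‖ ∂μ₂ := by
      have h := norm_integral_le_integral_norm (μ := μ₂) W
      rw [← hYW, Complex.norm_real] at h
      exact (le_abs_self _).trans h
    refine this.trans (le_trans ?_ (schur_int hU hUm hqc hA hB))
    have hWc : Continuous W := by
      refine ((hqs.comp continuous_fst).mul (hqc.comp continuous_snd)).mul (continuous_finsetSum _ fun n _ => continuous_const.mul (continuous_ee.comp (by fun_prop)))
    have hinv : Continuous (fun z : ℝ × ℝ => (1 + (z.2 - z.1) ^ 2)⁻¹) :=
      Continuous.inv₀ (by fun_prop) fun z => by positivity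
    refine integral_mono_ae (intU2 hU (by fun_prop)) (intU2 hU (by fun_prop)) ?_
    simp only [μ₂, Measure.prod_restrict]
    refine (ae_restrict_iff' (hUm.prod hUm)).2 (Eventually.of_forall fun z hz => ?_)
    have h1 := hU hz.1; have h2 := hU hz.2
    simp only [hW, norm_mul, Complex.norm_conj]
    gcongr
    exact hK _ (by rw [abs_le]; constructor <;> linarith [h1.1, h1.2, h2.1, h2.2])
  have hE : 0 ≤ ∑ p ∈ P, (p:ℝ) * ‖a p‖ ^ 2 := Finset.sum_nonneg fun _ _ => by positivity
  rcases hX0.eq_or_lt with h | h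
  · rw [← h]; positivity
  · have : X * X ≤ ((A * Real.pi + B * volume.real U) * ∑ p ∈ P, p * ‖a p‖ ^ 2) * X := by
      calc X * X = X ^ 2 := by ring
        _ ≤ _ := x2
        _ ≤ (∑ p ∈ P, p * ‖a p‖ ^ 2) * ((A * Real.pi + B * volume.real U) * X) := by gcongr
        _ = _ := by ring
    exact le_of_mul_le_mul_right this h

/-- Selberg normalisation -/
def SG (D : ℕ) : ℝ := ∑ e ∈ Finset.Icc 1 D, (ArithmeticFunction.moebius e : ℝ) ^ 2 / (Nat.totient e : ℝ)
def ysel (D e : ℕ) : ℝ := (ArithmeticFunction.moebius e : ℝ) / (Nat.totient e * SG D)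
/-- Selberg weights -/
def lam (D d : ℕ) : ℝ := d * ∑ e ∈ Finset.Icc 1 D, if d ∣ e then (ArithmeticFunction.moebius (e / d) : ℝ) * ysel D e else 0

lemma SG_ge_one {D : ℕ} (hD : 1 ≤ D) : 1 ≤ SG D := by
  unfold SG
  have := Finset.single_le_sum (f := fun e => (ArithmeticFunction.moebius e : ℝ) ^ 2 / (Nat.totient e : ℝ)) (s := Finset.Icc 1 D)
    (fun _ _ => by positivity) (Finset.mem_Icc.2 ⟨le_rfl, hD⟩)
  simpa using this

lemma lam_one {D : ℕ} (hD : 1 ≤ D) : lam D 1 = 1 := by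
  have h := SG_ge_one hD
  unfold lam ysel
  simp only [Nat.cast_one, one_mul, one_dvd, if_true, Nat.div_one]
  have : ∀ e ∈ Finset.Icc 1 D, (ArithmeticFunction.moebius e : ℝ) * (ArithmeticFunction.moebius e / (Nat.totient e * SG D)) =
      ((ArithmeticFunction.moebius e : ℝ) ^ 2 / (Nat.totient e : ℝ)) * (SG D)⁻¹ := by
    intro e _
    rw [div_eq_mul_inv, div_eq_mul_inv, mul_inv]; ring
  rw [Finset.sum_congr rfl this, ← Finset.sum_mul]
  have h0 : SG D ≠ 0 := ne_of_gt (by linarith)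
  exact mul_inv_cancel₀ h0

lemma sum_mu_between {D e e' : ℕ} (he : e ∈ Finset.Icc 1 D) (he' : e' ∈ Finset.Icc 1 D) :
    ∑ d ∈ Finset.Icc 1 D, (if e ∣ d ∧ d ∣ e' then (ArithmeticFunction.moebius (e' / d) : ℝ) else 0) = if e' = e then 1 else 0 := by
  rw [Finset.mem_Icc] at he he'
  by_cases hd : e ∣ e'
  · obtain ⟨k, rfl⟩ := hd
    have hk : k ≠ 0 := by rintro rfl; omega
    have he0 : 0 < e := he.1
    rw [← Finset.sum_filter]
    have : (Finset.Icc 1 D).filter (fun d => e ∣ d ∧ d ∣ e * k) = (Nat.divisors k).image (fun j => e * j) := by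
      ext d
      simp only [Finset.mem_filter, Finset.mem_Icc, Finset.mem_image, Nat.mem_divisors]
      constructor
      · rintro ⟨_, ⟨j, rfl⟩, h⟩
        exact ⟨j, ⟨Nat.dvd_of_mul_dvd_mul_left he0 h, hk⟩, rfl⟩
      · rintro ⟨j, ⟨hj, _⟩, rfl⟩
        have hjd : e * j ∣ e * k := Nat.mul_dvd_mul_left e hj
        have hj0 : 0 < j := Nat.pos_of_dvd_of_pos hj (by omega)
        exact ⟨⟨Nat.mul_pos he0 hj0, (Nat.le_of_dvd (by omega) hjd).trans he'.2⟩, Dvd.intro _ rfl, hjd⟩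
    rw [this, Finset.sum_image (fun a _ b _ h => Nat.eq_of_mul_eq_mul_left he0 h)]
    simp only [Nat.mul_div_mul_left _ _ he0]
    rw [Nat.sum_div_divisors k (fun j => (ArithmeticFunction.moebius j : ℝ))]
    have h := congrArg (fun f : ArithmeticFunction ℤ => f k) ArithmeticFunction.moebius_mul_coe_zeta
    simp only [ArithmeticFunction.coe_mul_zeta_apply, ArithmeticFunction.one_apply] at h
    have h' : ∑ j ∈ k.divisors, (ArithmeticFunction.moebius j : ℝ) = if k = 1 then 1 else 0 := by
      have := congrArg (fun z : ℤ => (z:ℝ)) h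
      simpa using this
    rw [h']
    have : e * k = e ↔ k = 1 := by
      constructor
      · intro h; exact Nat.eq_of_mul_eq_mul_left he0 (by rw [h, mul_one])
      · rintro rfl; rw [mul_one]
    simp only [this]
  · rw [if_neg (fun h => hd (by rw [h])), Finset.sum_eq_zero]
    intro d _
    rw [if_neg (fun h => hd (h.1.trans h.2))]

lemma sum_lam {D e : ℕ} (he : e ∈ Finset.Icc 1 D) :
    ∑ d ∈ Finset.Icc 1 D, (if e ∣ d then lam D d / d else 0) = ysel D e := by
  have h1 : ∀ d ∈ Finset.Icc 1 D, (if e ∣ d then lam D d / d else 0) =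
      ∑ e' ∈ Finset.Icc 1 D, (if e ∣ d ∧ d ∣ e' then (ArithmeticFunction.moebius (e' / d) : ℝ) else 0) * ysel D e' := by
    intro d hd
    have hd0 : (d:ℝ) ≠ 0 := by have := (Finset.mem_Icc.1 hd).1; positivity
    by_cases h : e ∣ d
    · rw [if_pos h, lam, mul_div_cancel_left₀ _ hd0]
      refine Finset.sum_congr rfl fun e' _ => ?_
      simp only [h, true_and]
      split_ifs <;> simp
    · simp [h]
  rw [Finset.sum_congr rfl h1, Finset.sum_comm]
  simp only [← Finset.sum_mul]
  rw [Finset.sum_congr rfl fun e' he' => by rw [sum_mu_between he he']]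
  simp [Finset.mem_Icc.1 he]

lemma lam_quad {D : ℕ} (hD : 1 ≤ D) :
    ∑ d₁ ∈ Finset.Icc 1 D, ∑ d₂ ∈ Finset.Icc 1 D, lam D d₁ * lam D d₂ / (Nat.lcm d₁ d₂ : ℝ) = 1 / SG D := by
  have hG := SG_ge_one hD
  have h1 : ∀ d₁ ∈ Finset.Icc 1 D, ∀ d₂ ∈ Finset.Icc 1 D, lam D d₁ * lam D d₂ / (Nat.lcm d₁ d₂ : ℝ) =
      ∑ e ∈ Finset.Icc 1 D, (Nat.totient e : ℝ) * ((if e ∣ d₁ then lam D d₁ / d₁ else 0) * (if e ∣ d₂ then lam D d₂ / d₂ else 0)) := by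
    intro d₁ h₁ d₂ h₂
    rw [Finset.mem_Icc] at h₁ h₂
    have hd1 : (d₁:ℝ) ≠ 0 := by have := h₁.1; positivity
    have hd2 : (d₂:ℝ) ≠ 0 := by have := h₂.1; positivity
    have hg0 : 0 < Nat.gcd d₁ d₂ := Nat.gcd_pos_of_pos_left _ h₁.1
    have hl0 : (Nat.lcm d₁ d₂ : ℝ) ≠ 0 := by
      have : 0 < Nat.lcm d₁ d₂ := Nat.lcm_pos h₁.1 h₂.1
      positivity
    have hgl : (Nat.gcd d₁ d₂ : ℝ) * Nat.lcm d₁ d₂ = d₁ * d₂ := by exact_mod_cast Nat.gcd_mul_lcm d₁ d₂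
    have hsum : ((Nat.gcd d₁ d₂ : ℕ) : ℝ) = ∑ e ∈ Finset.Icc 1 D, if e ∣ d₁ ∧ e ∣ d₂ then (Nat.totient e : ℝ) else 0 := by
      rw [← Finset.sum_filter]
      have : (Finset.Icc 1 D).filter (fun e => e ∣ d₁ ∧ e ∣ d₂) = (Nat.gcd d₁ d₂).divisors := by
        ext e
        simp only [Finset.mem_filter, Finset.mem_Icc, Nat.mem_divisors, Nat.dvd_gcd_iff]
        constructor
        · rintro ⟨_, h⟩; exact ⟨h, by omega⟩
        · rintro ⟨h, _⟩
          exact ⟨⟨Nat.pos_of_dvd_of_pos h.1 h₁.1, (Nat.le_of_dvd h₁.1 h.1).trans h₁.2⟩, h⟩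
      rw [this]
      exact_mod_cast (Nat.sum_totient _).symm
    have e1 : lam D d₁ * lam D d₂ / (Nat.lcm d₁ d₂ : ℝ) = (Nat.gcd d₁ d₂ : ℝ) * (lam D d₁ / d₁ * (lam D d₂ / d₂)) := by
      rw [div_mul_div_comm, ← hgl]
      have : (Nat.gcd d₁ d₂ : ℝ) ≠ 0 := by positivity
      field_simp
    rw [e1, hsum, Finset.sum_mul]
    refine Finset.sum_congr rfl fun e _ => ?_
    by_cases ha : e ∣ d₁ <;> by_cases hb : e ∣ d₂ <;> simp [ha, hb]
  rw [Finset.sum_congr rfl fun d₁ h₁ => Finset.sum_congr rfl fun d₂ h₂ => h1 d₁ h₁ d₂ h₂]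
  rw [Finset.sum_congr rfl fun d₁ _ => Finset.sum_comm, Finset.sum_comm]
  have h2 : ∀ e ∈ Finset.Icc 1 D, ∑ d₁ ∈ Finset.Icc 1 D, ∑ d₂ ∈ Finset.Icc 1 D,
      (Nat.totient e : ℝ) * ((if e ∣ d₁ then lam D d₁ / d₁ else 0) * (if e ∣ d₂ then lam D d₂ / d₂ else 0)) =
      ((ArithmeticFunction.moebius e : ℝ) ^ 2 / (Nat.totient e : ℝ)) * ((SG D)⁻¹) ^ 2 := by
    intro e he
    simp only [← Finset.mul_sum, ← Finset.sum_mul]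
    rw [sum_lam he, ysel]
    have : (Nat.totient e : ℝ) ≠ 0 := by
      have := Nat.totient_pos.2 (Finset.mem_Icc.1 he).1
      positivity
    field_simp
  rw [Finset.sum_congr rfl h2, ← Finset.sum_mul]
  show SG D * _ = _
  field_simp

lemma lam_le {D d : ℕ} (hD : 1 ≤ D) (hd : d ≤ D) : |lam D d| ≤ (D:ℝ) ^ 2 := by
  have hG := SG_ge_one hD
  have hmu : ∀ n : ℕ, |(ArithmeticFunction.moebius n : ℝ)| ≤ 1 := fun n => by
    exact_mod_cast ArithmeticFunction.abs_moebius_le_one (n := n)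
  unfold lam
  rw [abs_mul, abs_of_nonneg (Nat.cast_nonneg d), sq]
  gcongr
  refine (Finset.abs_sum_le_sum_abs _ _).trans ?_
  calc _ ≤ ∑ e ∈ Finset.Icc 1 D, (1:ℝ) := Finset.sum_le_sum fun e he => by
          split_ifs
          · rw [abs_mul]
            refine mul_le_one₀ (hmu _) (abs_nonneg _) ?_
            unfold ysel
            have h1 : (1:ℝ) ≤ Nat.totient e := by exact_mod_cast Nat.totient_pos.2 (Finset.mem_Icc.1 he).1
            have h2 : (1:ℝ) ≤ Nat.totient e * SG D := one_le_mul_of_one_le_of_one_le h1 hG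
            rw [abs_div, abs_of_pos (lt_of_lt_of_le one_pos h2)]
            exact div_le_one_of_le₀ ((hmu e).trans h2) (by linarith)
          · simp
    _ = D := by simp

lemma SG_lower (D : ℕ) : Real.log (D + 1) / 2 ≤ SG D := by
  have h1 : Real.log (D + 1) ≤ ∑ n ∈ Finset.Icc 1 D, 1 / (n:ℝ) := by
    have := log_add_one_le_harmonic D
    rw [harmonic_eq_sum_Icc] at this
    push_cast at this ⊢
    simpa [one_div] using this
  set A := (Finset.Icc 1 D).filter Squarefree
  have h2 : ∑ n ∈ Finset.Icc 1 D, 1 / (n:ℝ) ≤ ∑ a ∈ A, ∑ b ∈ Finset.Icc 1 D, (1 / (a:ℝ)) * (1 / (b:ℝ) ^ 2) := by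
    have : ∀ n ∈ Finset.Icc 1 D, 1 / (n:ℝ) ≤ ∑ z ∈ A ×ˢ Finset.Icc 1 D, if z.2 ^ 2 * z.1 = n then (1 / (z.1:ℝ)) * (1 / (z.2:ℝ) ^ 2) else 0 := by
      intro n hn
      rw [Finset.mem_Icc] at hn
      obtain ⟨a, b, hab, hsq⟩ := Nat.sq_mul_squarefree n
      have hb0 : 0 < b := Nat.pos_of_ne_zero (by rintro rfl; simp at hab; omega)
      have ha0 : 0 < a := Nat.pos_of_ne_zero (by rintro rfl; simp at hab; omega)
      have hm : (a, b) ∈ A ×ˢ Finset.Icc 1 D := by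
        simp only [A, Finset.mem_product, Finset.mem_filter, Finset.mem_Icc]
        refine ⟨⟨⟨ha0, ?_⟩, hsq⟩, hb0, ?_⟩
        · nlinarith [Nat.one_le_pow 2 b hb0]
        · nlinarith
      refine le_trans (le_of_eq ?_) (Finset.single_le_sum (f := fun z : ℕ × ℕ => if z.2 ^ 2 * z.1 = n then (1 / (z.1:ℝ)) * (1 / (z.2:ℝ) ^ 2) else 0) (fun z _ => ?_) hm)
      · simp only [if_pos hab]; rw [← hab]; push_cast; field_simp
      · split_ifs
        · positivity
        · exact le_rfl
    refine (Finset.sum_le_sum this).trans ?_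
    rw [Finset.sum_comm, ← Finset.sum_product' A (Finset.Icc 1 D) (fun a b : ℕ => (1 / (a:ℝ)) * (1 / (b:ℝ) ^ 2))]
    refine Finset.sum_le_sum fun z _ => ?_
    rw [Finset.sum_ite_eq]
    split_ifs
    · exact le_rfl
    · positivity
  have h3 : ∑ a ∈ A, ∑ b ∈ Finset.Icc 1 D, (1 / (a:ℝ)) * (1 / (b:ℝ) ^ 2) ≤ 2 * ∑ a ∈ A, 1 / (a:ℝ) := by
    simp only [← Finset.mul_sum, ← Finset.sum_mul]
    rw [mul_comm]
    gcongr
    exact sum_inv_sq_le _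
  have h4 : ∑ a ∈ A, 1 / (a:ℝ) ≤ SG D := by
    unfold SG
    rw [Finset.sum_filter]
    refine Finset.sum_le_sum fun e he => ?_
    split_ifs with h
    · have : (ArithmeticFunction.moebius e : ℝ) ^ 2 = 1 := by
        have := (ArithmeticFunction.moebius_ne_zero_iff_eq_or).1 (ArithmeticFunction.moebius_ne_zero_iff_squarefree.2 h)
        rcases this with h | h <;> rw [h] <;> norm_num
      rw [this]
      have h1 : 0 < Nat.totient e := Nat.totient_pos.2 (Finset.mem_Icc.1 he).1
      gcongr
      exact Nat.totient_le e
    · positivity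
  linarith

/-- sieve majorant -/
def nus (D n : ℕ) : ℝ := (∑ d ∈ Finset.Icc 1 D, if d ∣ n then lam D d else 0) ^ 2

lemma nus_prime {D p : ℕ} (hD : 1 ≤ D) (hp : p.Prime) (h : D < p) : nus D p = 1 := by
  unfold nus
  rw [Finset.sum_eq_single 1]
  · simp [lam_one hD]
  · intro d hd h1
    rw [Finset.mem_Icc] at hd
    rw [if_neg]
    intro hdp
    rcases (Nat.dvd_prime hp).1 hdp with h2 | h2 <;> omega
  · intro h2; exact absurd (Finset.mem_Icc.2 ⟨le_rfl, hD⟩) h2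

lemma sum_mult {l : ℕ} (hl : 1 ≤ l) (s u : ℝ) : ∑ n ∈ Finset.Ico 1 (NN (s + 3)), (if l ∣ n then (wt s n : ℂ) * ee (u * Real.log n) else 0) =
    (1 / (l:ℂ)) * (ee (u * Real.log l) * R (fun _ => 1) (s - Real.log l) (-u)) := by
  have hl0 : (0:ℝ) < l := by exact_mod_cast hl
  have hlog : 0 ≤ Real.log l := Real.log_nonneg (by exact_mod_cast hl)
  rw [R_one_eq (s - Real.log l) u (N := NN (s + 3)) (NN_mono (by linarith)), ← Finset.sum_filter, Finset.mul_sum, Finset.mul_sum]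
  have e : ∀ m ∈ Finset.Ico 1 (NN (s + 3)), (1 / (l:ℂ)) * (ee (u * Real.log l) * ((wt (s - Real.log l) m : ℂ) * ee (u * Real.log m))) =
      (wt s (l * m) : ℂ) * ee (u * Real.log (l * m : ℕ)) := by
    intro m hm
    have hm0 : (0:ℝ) < m := by exact_mod_cast (Finset.mem_Ico.1 hm).1
    have hlm : Real.log (l * m : ℕ) = Real.log l + Real.log m := by push_cast; exact Real.log_mul hl0.ne' hm0.ne'
    unfold wt
    rw [hlm, mul_add, ee_add, show Real.log m - (s - Real.log l) = Real.log l + Real.log m - s by ring]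
    push_cast
    have : (l:ℂ) ≠ 0 := by exact_mod_cast hl0.ne'
    have : (m:ℂ) ≠ 0 := by exact_mod_cast hm0.ne'
    field_simp
  rw [Finset.sum_congr rfl e]
  symm
  have : ∀ m ∈ Finset.Ico 1 (NN (s + 3)), ¬ (l * m < NN (s + 3)) → (wt s (l * m) : ℂ) * ee (u * Real.log (l * m : ℕ)) = 0 := by
    intro m _ h
    rw [wt, w_eq_zero_right (by linarith [le_log_of_NN_le (not_lt.1 h)])]; simp
  rw [← Finset.sum_filter_of_ne (p := fun m => l * m < NN (s + 3)) (fun m hm h => by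
    by_contra hh; exact h (this m hm hh))]
  refine Finset.sum_bij (fun m _ => l * m) ?_ ?_ ?_ ?_
  · intro m hm
    simp only [Finset.mem_filter, Finset.mem_Ico] at hm ⊢
    exact ⟨⟨Nat.mul_pos hl hm.1.1, hm.2⟩, Dvd.intro _ rfl⟩
  · intro m _ m' _ h; exact Nat.eq_of_mul_eq_mul_left hl h
  · intro n hn
    simp only [Finset.mem_filter, Finset.mem_Ico] at hn
    obtain ⟨⟨h1, h2⟩, m, rfl⟩ := hn
    have hm : 1 ≤ m := Nat.one_le_iff_ne_zero.2 (by rintro rfl; simp at h1)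
    refine ⟨m, ?_, rfl⟩
    simp only [Finset.mem_filter, Finset.mem_Ico]
    exact ⟨⟨hm, lt_of_le_of_lt (Nat.le_mul_of_pos_left m hl) h2⟩, h2⟩
  · intro m _; rfl

lemma KS_eq (D : ℕ) (s u : ℝ) : ∑ n ∈ Finset.Ico 1 (NN (s + 3)), ((nus D n * wt s n : ℝ) : ℂ) * ee (u * Real.log n) =
    ∑ d₁ ∈ Finset.Icc 1 D, ∑ d₂ ∈ Finset.Icc 1 D, ((lam D d₁ * lam D d₂ : ℝ) : ℂ) *
      ∑ n ∈ Finset.Ico 1 (NN (s + 3)), (if Nat.lcm d₁ d₂ ∣ n then (wt s n : ℂ) * ee (u * Real.log n) else 0) := by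
  simp only [Finset.mul_sum]
  rw [Finset.sum_congr rfl fun d₁ _ => Finset.sum_comm, Finset.sum_comm]
  refine Finset.sum_congr rfl fun n _ => ?_
  have : nus D n = ∑ d₁ ∈ Finset.Icc 1 D, ∑ d₂ ∈ Finset.Icc 1 D, if Nat.lcm d₁ d₂ ∣ n then lam D d₁ * lam D d₂ else 0 := by
    unfold nus
    rw [sq, Finset.sum_mul_sum]
    refine Finset.sum_congr rfl fun d₁ _ => Finset.sum_congr rfl fun d₂ _ => ?_
    simp only [Nat.lcm_dvd_iff]
    by_cases ha : d₁ ∣ n <;> by_cases hb : d₂ ∣ n <;> simp [ha, hb]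
  rw [this, Complex.ofReal_mul, Complex.ofReal_sum, mul_assoc, Finset.sum_mul]
  refine Finset.sum_congr rfl fun d₁ _ => ?_
  rw [Complex.ofReal_sum, Finset.sum_mul]
  refine Finset.sum_congr rfl fun d₂ _ => ?_
  split_ifs <;> simp

lemma sieve_kernel {A : ℝ} (hA : 0 ≤ A) : ∃ c C : ℝ, 0 < c ∧ c ≤ 1 ∧ 0 < C ∧ ∀ (s u : ℝ) (D : ℕ), 2 ≤ s → 1 ≤ D →
    (D:ℝ) ^ 2 ≤ Real.exp (s / 2) → |u| ≤ Real.exp (A * (s / 2)) →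
    ‖∑ n ∈ Finset.Ico 1 (NN (s + 3)), ((nus D n * wt s n : ℝ) : ℂ) * ee (u * Real.log n)‖ ≤
      8 / SG D * (1 + u ^ 2)⁻¹ + C * (D:ℝ) ^ 6 * Real.exp (-(c * s)) := by
  obtain ⟨c, C, hc, hc1, hC, hW⟩ := kernel A
  refine ⟨c, C, hc, hc1, hC, fun s u D hs hD hDs hu => ?_⟩
  have hG := SG_ge_one hD
  have hD1 : (1:ℝ) ≤ D := by exact_mod_cast hD
  have key : ∀ d₁ ∈ Finset.Icc 1 D, ∀ d₂ ∈ Finset.Icc 1 D, ‖((lam D d₁ * lam D d₂ : ℝ) : ℂ) *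
      ∑ n ∈ Finset.Ico 1 (NN (s + 3)), (if Nat.lcm d₁ d₂ ∣ n then (wt s n : ℂ) * ee (u * Real.log n) else 0) -
      ((lam D d₁ * lam D d₂ / (Nat.lcm d₁ d₂ : ℝ) : ℝ) : ℂ) * (ee (u * s) * wh u)‖ ≤ (D:ℝ) ^ 4 * (C * Real.exp (-(c * s))) := by
    intro d₁ h₁ d₂ h₂
    rw [Finset.mem_Icc] at h₁ h₂
    set l := Nat.lcm d₁ d₂ with hl
    have hl1 : 1 ≤ l := Nat.lcm_pos h₁.1 h₂.1
    have hl0 : (0:ℝ) < l := by exact_mod_cast hl1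
    have hlD : (l:ℝ) ≤ Real.exp (s / 2) := by
      refine le_trans ?_ hDs
      have : l ≤ D ^ 2 := (Nat.lcm_le_mul (by omega) (by omega)).trans (by rw [sq]; exact Nat.mul_le_mul h₁.2 h₂.2)
      exact_mod_cast this
    have hlog : Real.log l ≤ s / 2 := by rwa [Real.log_le_iff_le_exp hl0]
    have hlog0 : 0 ≤ Real.log l := Real.log_nonneg (by exact_mod_cast hl1)
    have hk := hW (s - Real.log l) u (by linarith) (hu.trans (by gcongr; linarith))
    rw [sum_mult hl1]
    have e : ee (u * s) = ee (u * Real.log l) * ee (u * (s - Real.log l)) := by rw [← ee_add]; congr 1; ring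
    rw [e]
    have e2 : ((lam D d₁ * lam D d₂ : ℝ) : ℂ) * (1 / (l:ℂ) * (ee (u * Real.log l) * R (fun _ => 1) (s - Real.log l) (-u))) -
      ((lam D d₁ * lam D d₂ / (l : ℝ) : ℝ) : ℂ) * (ee (u * Real.log l) * ee (u * (s - Real.log l)) * wh u) =
      ((lam D d₁ * lam D d₂ : ℝ) : ℂ) * (((l:ℝ)⁻¹ : ℝ) : ℂ) * ee (u * Real.log l) * (R (fun _ => 1) (s - Real.log l) (-u) - ee (u * (s - Real.log l)) * wh u) := by
      push_cast; ring
    rw [e2, norm_mul, norm_mul, norm_mul, norm_ee, mul_one, Complex.norm_real, Complex.norm_real, Real.norm_eq_abs, Real.norm_eq_abs,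
      abs_mul, abs_of_pos (inv_pos.2 hl0)]
    have l1 := lam_le hD h₁.2
    have l2 := lam_le hD h₂.2
    have e3 : Real.exp (-(c * (s - Real.log l))) ≤ Real.exp (-(c * s)) * l := by
      have : (l:ℝ) = Real.exp (Real.log l) := (Real.exp_log hl0).symm
      nth_rewrite 2 [this]
      rw [← Real.exp_add]; gcongr; nlinarith
    calc _ ≤ (D:ℝ) ^ 2 * (D:ℝ) ^ 2 * (l:ℝ)⁻¹ * (C * (Real.exp (-(c * s)) * l)) := by
          gcongr
          exact hk.trans (by gcongr)
      _ = _ := by field_simp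
  rw [KS_eq]
  have hq : ∑ d₁ ∈ Finset.Icc 1 D, ∑ d₂ ∈ Finset.Icc 1 D, ((lam D d₁ * lam D d₂ / (Nat.lcm d₁ d₂ : ℝ) : ℝ) : ℂ) * (ee (u * s) * wh u) =
      ((1 / SG D : ℝ) : ℂ) * (ee (u * s) * wh u) := by
    rw [← lam_quad hD]; push_cast
    simp only [Finset.sum_mul]
  have hdiff : ‖(∑ d₁ ∈ Finset.Icc 1 D, ∑ d₂ ∈ Finset.Icc 1 D, ((lam D d₁ * lam D d₂ : ℝ) : ℂ) *
      ∑ n ∈ Finset.Ico 1 (NN (s + 3)), (if Nat.lcm d₁ d₂ ∣ n then (wt s n : ℂ) * ee (u * Real.log n) else 0)) -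
      ((1 / SG D : ℝ) : ℂ) * (ee (u * s) * wh u)‖ ≤ C * (D:ℝ) ^ 6 * Real.exp (-(c * s)) := by
    rw [← hq, ← Finset.sum_sub_distrib]
    simp only [← Finset.sum_sub_distrib]
    refine (norm_sum_le _ _).trans ?_
    calc _ ≤ ∑ d₁ ∈ Finset.Icc 1 D, ∑ d₂ ∈ Finset.Icc 1 D, (D:ℝ) ^ 4 * (C * Real.exp (-(c * s))) :=
          Finset.sum_le_sum fun d₁ h₁ => (norm_sum_le _ _).trans (Finset.sum_le_sum fun d₂ h₂ => key d₁ h₁ d₂ h₂)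
      _ = _ := by simp; ring
  have hmain : ‖((1 / SG D : ℝ) : ℂ) * (ee (u * s) * wh u)‖ ≤ 8 / SG D * (1 + u ^ 2)⁻¹ := by
    rw [norm_mul, norm_mul, norm_ee, one_mul, Complex.norm_real, Real.norm_eq_abs, abs_of_pos (by positivity)]
    calc _ ≤ 1 / SG D * (8 / (1 + u ^ 2)) := by gcongr; exact wh_bound u
      _ = _ := by rw [div_eq_mul_inv 8]; ring
  have := norm_le_norm_add_norm_sub' (∑ d₁ ∈ Finset.Icc 1 D, ∑ d₂ ∈ Finset.Icc 1 D, ((lam D d₁ * lam D d₂ : ℝ) : ℂ) *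
      ∑ n ∈ Finset.Ico 1 (NN (s + 3)), (if Nat.lcm d₁ d₂ ∣ n then (wt s n : ℂ) * ee (u * Real.log n) else 0)) (((1 / SG D : ℝ) : ℂ) * (ee (u * s) * wh u))
  linarith

lemma qv_bad {A : ℝ} (hA : 0 ≤ A) : ∃ c C : ℝ, 0 < c ∧ c ≤ 1 ∧ 0 < C ∧ ∀ (f : ℕ → ℂ) (K v : ℕ) (T : ℝ) (U : Set ℝ),
    (∀ n, ‖f n‖ ≤ 1) → 1 ≤ K → 2 ≤ (v:ℝ) / K → U ⊆ Set.Icc (-T) T → MeasurableSet U →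
    2 * T ≤ Real.exp (A * ((v:ℝ) / K / 2)) →
    ∫ t in U, ‖Q f K v t‖ ^ 2 ≤
      (C / ((v:ℝ) / K) + C * Real.exp (-(c * ((v:ℝ) / K))) * volume.real U) * (6 * K / v) := by
  obtain ⟨c, C, hc, hc1, hC, hker⟩ := sieve_kernel hA
  refine ⟨c / 2, max C (192 / c * Real.pi), by linarith, by linarith, lt_max_of_lt_left hC,
    fun f K v T U hf hK hv hU hUm hT => ?_⟩
  have hK0 : (0:ℝ) < K := by exact_mod_cast hK
  have hK1 : (1:ℝ) ≤ K := by exact_mod_cast hK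
  set s : ℝ := (v:ℝ) / K with hs
  have hv1 : 1 ≤ v := by
    by_contra h
    have : v = 0 := by omega
    rw [hs, this] at hv
    norm_num at hv
  set D := ⌊Real.exp (c / 12 * s)⌋₊ with hD
  have hcs : 0 < c / 12 * s := by positivity
  have hD1 : 1 ≤ D := by
    rw [hD, Nat.one_le_floor_iff]
    exact Real.one_le_exp hcs.le
  have hDle : (D:ℝ) ≤ Real.exp (c / 12 * s) := Nat.floor_le (Real.exp_pos _).le
  have hD2 : (D:ℝ) ^ 2 ≤ Real.exp (s / 2) := by
    calc (D:ℝ) ^ 2 ≤ Real.exp (c / 12 * s) ^ 2 := by gcongr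
      _ = Real.exp (2 * (c / 12 * s)) := by rw [← Real.exp_nat_mul]; norm_num
      _ ≤ _ := Real.exp_le_exp.2 (by nlinarith)
  have hD6 : (D:ℝ) ^ 6 * Real.exp (-(c * s)) ≤ Real.exp (-(c / 2 * s)) := by
    calc (D:ℝ) ^ 6 * Real.exp (-(c * s)) ≤ Real.exp (c / 12 * s) ^ 6 * Real.exp (-(c * s)) := by gcongr
      _ = Real.exp (-(c / 2 * s)) := by rw [← Real.exp_nat_mul, ← Real.exp_add]; congr 1; push_cast; ring
  have hSG : c * s / 24 ≤ SG D := by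
    refine le_trans ?_ (SG_lower D)
    have : c / 12 * s ≤ Real.log (D + 1) := by
      rw [Real.le_log_iff_exp_le (by positivity)]
      exact (Nat.lt_floor_add_one _).le
    linarith
  have hs0 : 0 < s := by linarith
  have hd := dual_ls hU hUm (blk K v) (Finset.Ico 1 (NN (s + 3))) (by
      intro p hp
      have := blk_log hK hp
      have hp1 := ((mem_blk hK).1 hp).1.one_lt.le
      rw [Finset.mem_Ico]
      refine ⟨hp1, lt_NN_of_log hp1 ?_⟩
      rw [add_div] at this
      have : (1:ℝ) / K ≤ 1 := by rw [div_le_one hK0]; exact hK1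
      linarith) (fun p => f p * ((1 / p : ℝ) : ℂ)) (fun n => nus D n * wt s n)
    (fun n _ => mul_nonneg (sq_nonneg _) (div_nonneg (w_nonneg _) (Nat.cast_nonneg _))) (by
      intro p hp
      have h := blk_log hK hp
      have hp1 := ((mem_blk hK).1 hp).1
      refine ⟨hp1.one_lt.le, ?_⟩
      rw [nus_prime hD1 hp1, wt, w_eq_one, one_mul]
      · linarith [h.1]
      · rw [add_div] at h
        have : (1:ℝ) / K ≤ 1 := by rw [div_le_one hK0]; exact hK1
        linarith
      · have h2 : Real.exp s ≤ p := by
          rw [← Real.le_log_iff_exp_le (by exact_mod_cast hp1.pos)]; exact h.1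
        have h3 : Real.exp (c / 12 * s) < Real.exp s := Real.exp_lt_exp.2 (by nlinarith)
        exact_mod_cast hDle.trans_lt (h3.trans_le h2))
    (A := 192 / c / s) (B := C * Real.exp (-(c / 2 * s))) (by positivity) (by positivity) (by
      intro u hu
      refine (hker s u D hv hD1 hD2 (hu.trans hT)).trans ?_
      have h1 : 8 / SG D ≤ 192 / c / s := by
        rw [div_div, div_le_div_iff₀ (by have := SG_ge_one hD1; linarith) (by positivity)]
        linarith
      have h2 : C * (D:ℝ) ^ 6 * Real.exp (-(c * s)) ≤ C * Real.exp (-(c / 2 * s)) := by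
        rw [mul_assoc]; gcongr
      gcongr)
  refine hd.trans ?_
  have h3 : ∑ p ∈ blk K v, (p:ℝ) * ‖f p * ((1 / p : ℝ) : ℂ)‖ ^ 2 ≤ 6 * K / v := by
    refine le_trans (Finset.sum_le_sum fun p hp => ?_) (blk_sum_le K v hK hv1)
    have hp0 : (0:ℝ) < p := by exact_mod_cast ((mem_blk hK).1 hp).1.pos
    rw [norm_mul, Complex.norm_real, Real.norm_of_nonneg (by positivity), mul_pow]
    have : ‖f p‖ ^ 2 ≤ 1 := pow_le_one₀ (norm_nonneg _) (hf p)
    calc (p:ℝ) * (‖f p‖ ^ 2 * (1 / p) ^ 2) = ‖f p‖ ^ 2 * (1 / (p:ℝ)) := by field_simp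
      _ ≤ 1 * (1 / (p:ℝ)) := by gcongr
      _ = 1 / (p:ℝ) := one_mul _
  have h4 : 192 / c / s * Real.pi ≤ max C (192 / c * Real.pi) / s := by
    rw [div_mul_eq_mul_div]; gcongr; exact le_max_right _ _
  have h5 : C * Real.exp (-(c / 2 * s)) ≤ max C (192 / c * Real.pi) * Real.exp (-(c / 2 * s)) := by
    gcongr; exact le_max_left _ _
  have h6 : (0:ℝ) ≤ volume.real U := measureReal_nonneg
  refine mul_le_mul (by gcongr) h3 (Finset.sum_nonneg fun _ _ => by positivity) (by positivity)

lemma bad_meas {f : ℕ → ℂ} (hf : ∀ n, ‖f n‖ ≤ 1) {K v : ℕ} (hK : 1 ≤ K) {y T α : ℝ} (hα : 0 ≤ α)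
    (hv : 0 < (v:ℝ) / K) (hvy : (v:ℝ) / K ≤ y) (hT0 : 0 < T) (hT : T ≤ Real.exp y) {L : ℕ} (hL : y / ((v:ℝ) / K) ≤ L) :
    volume.real {t ∈ Set.Icc (-T) T | Real.exp (-(α * ((v:ℝ) / K))) < ‖Q f K v t‖} ≤
      Real.exp (4 * α * y) * (Real.exp (10 + 2 * L) * (2 * L).factorial) := by
  set s : ℝ := (v:ℝ) / K with hs
  set S := {t ∈ Set.Icc (-T) T | Real.exp (-(α * s)) < ‖Q f K v t‖} with hS
  have hK0 : (0:ℝ) < K := by exact_mod_cast hK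
  set ℓ := ⌈y / s⌉₊ with hℓ
  have l1 : y / s ≤ ℓ := Nat.le_ceil _
  have l2 : (ℓ:ℝ) < y / s + 1 := Nat.ceil_lt_add_one (div_nonneg (by linarith) hv.le)
  have l3 : ℓ ≤ L := Nat.ceil_le.2 hL
  rw [div_le_iff₀ hv] at l1
  have l4 : (ℓ:ℝ) * s ≤ 2 * y := by
    have := mul_lt_mul_of_pos_right l2 hv
    rw [add_mul, div_mul_cancel₀ _ hv.ne', one_mul] at this
    linarith
  have hcQ := continuous_Q f K v
  have hSm : MeasurableSet S := by
    apply MeasurableSet.inter measurableSet_Icc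
    exact (isOpen_lt continuous_const hcQ.norm).measurableSet
  have hSs : S ⊆ Set.Icc (-T) T := fun t ht => ht.1
  have hm := moment (blk K v) (fun p hp => ((mem_blk hK).1 hp).1) (fun p => f p * ((1 / p : ℝ) : ℂ))
    (fun m => if m = 1 then 1 else 0) (fun p _ => by
          rw [norm_mul, Complex.norm_real, Real.norm_of_nonneg (by positivity)]
          exact mul_le_of_le_one_left (by positivity) (hf p))
    (fun n hn => by
      by_cases h : n = 1
      · simp [h]
      · simp [h])
    (s := v / K) (s' := (v + 1) / K) (z := 0) (z' := 0)
    (by gcongr; linarith) (by rw [add_div]; gcongr; rw [div_le_one hK0]; exact_mod_cast hK)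
    (fun p hp => blk_log hK hp) (fun n _ h => by
      by_cases h1 : n = 1
      · simp [h1]
      · simp [h1] at h) 2
    (fun m hm => by rw [if_neg (by omega)]) ℓ hT0 le_rfl (by positivity)
    (hT.trans (Real.exp_le_exp.2 (by rw [zero_add]; exact l1)))
  have hD : ∀ t, D 2 (fun m => if m = 1 then 1 else 0) t = 1 := by
    intro t
    rw [D_def]
    simp [ee_zero]
  simp_rw [hD, mul_one] at hm
  have hcont : Continuous (fun t => ‖(Q f K v t) ^ ℓ‖ ^ 2) := (hcQ.pow ℓ).norm.pow 2
  have h1 : volume.real S * Real.exp (-(4 * α * y)) ≤ ∫ t in S, ‖(Q f K v t) ^ ℓ‖ ^ 2 := by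
    have : ∫ t in S, Real.exp (-(4 * α * y)) = volume.real S * Real.exp (-(4 * α * y)) := by
      rw [setIntegral_const, smul_eq_mul]
    rw [← this]
    have hfin : volume S < ⊤ := (measure_mono hSs).trans_lt measure_Icc_lt_top
    refine setIntegral_mono_on ?_ (intU hSs hcont) hSm fun t ht => ?_
    · exact integrableOn_const hfin.ne
    · rw [norm_pow, ← pow_mul]
      have h2 : Real.exp (-(α * s)) ^ (ℓ * 2) ≤ ‖Q f K v t‖ ^ (ℓ * 2) := by
        gcongr; exact ht.2.le
      refine le_trans ?_ h2
      rw [← Real.exp_nat_mul]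
      apply Real.exp_le_exp.2
      push_cast
      nlinarith
  have h2 : ∫ t in S, ‖(Q f K v t) ^ ℓ‖ ^ 2 ≤ ∫ t in Set.Icc (-T) T, ‖(Q f K v t) ^ ℓ‖ ^ 2 :=
    setIntegral_mono_set (cont_int hcont T) (ae_of_all _ fun t => by positivity) hSs.eventuallyLE
  have h3 : Real.exp (10 + 2 * ((0:ℝ) - 0) + 2 * ℓ) * (2 * ℓ).factorial ≤ Real.exp (10 + 2 * L) * (2 * L).factorial := by
    have hl : (ℓ:ℝ) ≤ L := by exact_mod_cast l3
    have : ((2 * ℓ).factorial : ℝ) ≤ (2 * L).factorial := by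
      exact_mod_cast Nat.factorial_le (by omega)
    refine mul_le_mul (Real.exp_le_exp.2 (by linarith)) this (by positivity) (by positivity)
  have h4 : volume.real S * Real.exp (-(4 * α * y)) ≤ Real.exp (10 + 2 * L) * (2 * L).factorial :=
    h1.trans (h2.trans (hm.trans h3))
  calc volume.real S = Real.exp (4 * α * y) * (volume.real S * Real.exp (-(4 * α * y))) := by
        rw [mul_left_comm, ← Real.exp_add, add_neg_cancel, Real.exp_zero, mul_one]
    _ ≤ _ := by gcongr

lemma closed_Good (f : ℕ → ℂ) (K a b : ℕ) (α : ℝ) : IsClosed (Good f K a b α) := by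
  have : Good f K a b α = ⋂ v ∈ Finset.Ico a b, {t | ‖Q f K v t‖ ≤ Real.exp (-(α * (v / K)))} := by
    ext t; simp [Good]
  rw [this]
  exact isClosed_biInter fun v _ => isClosed_le (continuous_Q f K v).norm continuous_const

lemma bad_total {f : ℕ → ℂ} (hf : ∀ n, ‖f n‖ ≤ 1) {K a b : ℕ} (hK : 1 ≤ K) {y T α e₂ : ℝ} (hα : 0 ≤ α) (hy : 0 < y)
    (he : 0 < e₂) (ha : e₂ * y ≤ (a:ℝ) / K) (hb : (b:ℝ) / K ≤ y) (hT0 : 0 < T) (hT : T ≤ Real.exp y) :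
    volume.real (Set.Icc (-T) T \ Good f K a b α) ≤
      K * y * (Real.exp (4 * α * y) * (Real.exp (10 + 2 * ⌈1 / e₂⌉₊) * (2 * ⌈1 / e₂⌉₊).factorial)) := by
  have hK0 : (0:ℝ) < K := by exact_mod_cast hK
  set X := (Real.exp (4 * α * y) * (Real.exp (10 + 2 * ⌈1 / e₂⌉₊) * (2 * ⌈1 / e₂⌉₊).factorial)) with hX
  have h1 : Set.Icc (-T) T \ Good f K a b α ⊆ ⋃ v ∈ Finset.Ico a b, {t ∈ Set.Icc (-T) T | Real.exp (-(α * ((v:ℝ) / K))) < ‖Q f K v t‖} := by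
    rintro t ⟨ht, hg⟩
    simp only [Good, Set.mem_ofPred_eq, not_forall, not_le] at hg
    obtain ⟨v, hv, h⟩ := hg
    simp only [Set.mem_iUnion]
    exact ⟨v, hv, ht, h⟩
  have hfin : volume (⋃ v ∈ Finset.Ico a b, {t ∈ Set.Icc (-T) T | Real.exp (-(α * ((v:ℝ) / K))) < ‖Q f K v t‖}) ≠ ⊤ := by
    refine ((measure_mono (t := Set.Icc (-T) T) ?_).trans_lt measure_Icc_lt_top).ne
    exact Set.iUnion₂_subset fun v _ t ht => ht.1
  refine (measureReal_mono h1 hfin).trans ((measureReal_biUnion_finset_le _ _).trans ?_)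
  have h2 : ∀ v ∈ Finset.Ico a b, volume.real {t ∈ Set.Icc (-T) T | Real.exp (-(α * ((v:ℝ) / K))) < ‖Q f K v t‖} ≤ X := by
    intro v hv
    rw [Finset.mem_Ico] at hv
    have hav : (a:ℝ) / K ≤ v / K := by have := hv.1; gcongr
    have hvb : (v:ℝ) / K ≤ b / K := by have := hv.2.le; gcongr
    have h0 : 0 < e₂ * y := by positivity
    refine bad_meas hf hK hα (by linarith) (by linarith) hT0 hT ?_
    refine le_trans ?_ (Nat.le_ceil (1 / e₂))
    rw [div_le_div_iff₀ (by linarith) he]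
    linarith
  refine (Finset.sum_le_card_nsmul _ _ _ h2).trans ?_
  rw [nsmul_eq_mul, Nat.card_Ico]
  have : ((b - a : ℕ) : ℝ) ≤ K * y := by
    have h3 : ((b - a : ℕ) : ℝ) ≤ b := by exact_mod_cast Nat.sub_le _ _
    rw [div_le_iff₀ hK0] at hb
    linarith
  gcongr

/-- pointwise smallness -/
def Hal (f : ℕ → ℂ) : Prop := ∀ ε > 0, ∃ y₁ : ℝ, ∀ y ≥ y₁, ∀ t : ℝ, |t| ≤ Real.exp (2 * y) → ‖R f y t‖ ≤ ε

/-- mean square smallness -/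
def MRP (f : ℕ → ℂ) : Prop := ∀ ε > 0, ∃ Q₁ : ℝ, 1 ≤ Q₁ ∧ ∀ Q₀ ≥ Q₁, ∃ y₀ : ℝ, ∀ y ≥ y₀,
  ∫ t in Set.Icc (-(Real.exp y / Q₀)) (Real.exp y / Q₀), ‖R f y t‖ ^ 2 ≤ ε

lemma exp_sq_ev {c M : ℝ} (hc : 0 < c) : ∀ᶠ y : ℝ in atTop, Real.exp (-(c * y)) * M * y ^ 2 ≤ 1 := by
  have h : Tendsto (fun y : ℝ => Real.exp (-(c * y)) * M * y ^ 2) atTop (𝓝 0) := by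
    have h1 : Tendsto (fun y : ℝ => y ^ 2 * Real.exp (-(c * y))) atTop (𝓝 0) := by
      have h2 := (Real.tendsto_pow_mul_exp_neg_atTop_nhds_zero 2).comp (tendsto_id.const_mul_atTop hc)
      have h3 := h2.const_mul ((c ^ 2)⁻¹)
      rw [mul_zero] at h3
      refine h3.congr fun y => ?_
      simp only [Function.comp, id]
      field_simp
    have := h1.const_mul M
    rw [mul_zero] at this
    exact this.congr fun y => by ring
  exact h.eventually_le_const one_pos

/-- contribution of the bad set -/
lemma bad_G {f : ℕ → ℂ} {K a b : ℕ} (hK : 1 ≤ K) {y σ C e₂ T : ℝ} (hσ : 0 ≤ σ) (hC : 0 ≤ C) (he : 0 < e₂) (hy : 0 < y)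
    (ha : e₂ * y ≤ (a:ℝ) / K) (hb : (b:ℝ) / K ≤ y) {U : Set ℝ} (hU : U ⊆ Set.Icc (-T) T) (hUm : MeasurableSet U)
    (hR : ∀ v ∈ Finset.Ico a b, ∀ t ∈ U, ‖R f (y - v / K) t‖ ≤ σ)
    (hQ : ∀ v ∈ Finset.Ico a b, ∫ t in U, ‖Q f K v t‖ ^ 2 ≤ C / (v:ℝ) ^ 2) :
    ∫ t in U, ‖G f K a b y t‖ ^ 2 ≤ σ ^ 2 * C / e₂ ^ 2 := by
  have hK0 : (0:ℝ) < K := by exact_mod_cast hK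
  have ha0 : (0:ℝ) < a := by
    by_contra! h
    have : (a:ℝ) / K ≤ 0 := div_nonpos_of_nonpos_of_nonneg h hK0.le
    nlinarith [mul_pos he hy]
  have hv0 : ∀ v ∈ Finset.Ico a b, (0:ℝ) < v := fun v hv => ha0.trans_le (by exact_mod_cast (Finset.mem_Ico.1 hv).1)
  have hS : ∑ v ∈ Finset.Ico a b, 1 / (v:ℝ) ≤ 1 / e₂ := by
    calc ∑ v ∈ Finset.Ico a b, 1 / (v:ℝ) ≤ ∑ v ∈ Finset.Ico a b, 1 / (a:ℝ) := by
          refine Finset.sum_le_sum fun v hv => ?_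
          have := (Finset.mem_Ico.1 hv).1
          gcongr
      _ = ((b - a : ℕ):ℝ) / a := by rw [Finset.sum_const, Nat.card_Ico, nsmul_eq_mul]; ring
      _ ≤ b / a := by gcongr; exact Nat.sub_le _ _
      _ ≤ 1 / e₂ := by
          rw [div_le_div_iff₀ ha0 he]
          rw [le_div_iff₀ hK0] at ha
          rw [div_le_iff₀ hK0] at hb
          nlinarith
  have hpt : ∀ t ∈ U, ‖G f K a b y t‖ ^ 2 ≤ σ ^ 2 * (1 / e₂) * ∑ v ∈ Finset.Ico a b, (v:ℝ) * ‖Q f K v t‖ ^ 2 := by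
    intro t ht
    have h1 : ‖G f K a b y t‖ ≤ σ * ∑ v ∈ Finset.Ico a b, ‖Q f K v t‖ := by
      unfold G
      refine (norm_sum_le _ _).trans ?_
      rw [Finset.mul_sum]
      refine Finset.sum_le_sum fun v hv => ?_
      rw [norm_mul, mul_comm]
      gcongr
      exact hR v hv t ht
    have h2 : (∑ v ∈ Finset.Ico a b, ‖Q f K v t‖) ^ 2 ≤ (∑ v ∈ Finset.Ico a b, 1 / (v:ℝ)) * ∑ v ∈ Finset.Ico a b, (v:ℝ) * ‖Q f K v t‖ ^ 2 := by
      refine Finset.sum_sq_le_sum_mul_sum_of_sq_le_mul _ (fun v hv => ?_) (fun v hv => ?_) (fun v hv => ?_)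
      · positivity
      · positivity
      · have := hv0 v hv
        rw [← mul_assoc, one_div_mul_cancel this.ne', one_mul]
    calc ‖G f K a b y t‖ ^ 2 ≤ (σ * ∑ v ∈ Finset.Ico a b, ‖Q f K v t‖) ^ 2 := by gcongr
      _ = σ ^ 2 * (∑ v ∈ Finset.Ico a b, ‖Q f K v t‖) ^ 2 := by ring
      _ ≤ σ ^ 2 * ((∑ v ∈ Finset.Ico a b, 1 / (v:ℝ)) * ∑ v ∈ Finset.Ico a b, (v:ℝ) * ‖Q f K v t‖ ^ 2) := by gcongr
      _ ≤ σ ^ 2 * ((1 / e₂) * ∑ v ∈ Finset.Ico a b, (v:ℝ) * ‖Q f K v t‖ ^ 2) := by gcongr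
      _ = _ := by ring
  have hcq : ∀ v : ℕ, Continuous (fun t => (v:ℝ) * ‖Q f K v t‖ ^ 2) := fun v => continuous_const.mul ((continuous_Q f K v).norm.pow 2)
  have hcs : Continuous (fun t => ∑ v ∈ Finset.Ico a b, (v:ℝ) * ‖Q f K v t‖ ^ 2) := continuous_finsetSum _ fun v _ => hcq v
  calc ∫ t in U, ‖G f K a b y t‖ ^ 2 ≤ ∫ t in U, σ ^ 2 * (1 / e₂) * ∑ v ∈ Finset.Ico a b, (v:ℝ) * ‖Q f K v t‖ ^ 2 :=
        setIntegral_mono_on (intU hU ((continuous_G f K a b y).norm.pow 2)) (intU hU (continuous_const.mul hcs)) hUm hpt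
    _ = σ ^ 2 * (1 / e₂) * ∑ v ∈ Finset.Ico a b, (v:ℝ) * ∫ t in U, ‖Q f K v t‖ ^ 2 := by
        rw [integral_const_mul, integral_finsetSum _ (fun v _ => intU hU (hcq v))]
        simp_rw [integral_const_mul]
    _ ≤ σ ^ 2 * (1 / e₂) * ∑ v ∈ Finset.Ico a b, C * (1 / (v:ℝ)) := by
        refine mul_le_mul_of_nonneg_left (Finset.sum_le_sum fun v hv => ?_) (by positivity)
        have := hv0 v hv
        calc (v:ℝ) * ∫ t in U, ‖Q f K v t‖ ^ 2 ≤ v * (C / (v:ℝ) ^ 2) := by gcongr; exact hQ v hv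
          _ = _ := by field_simp
    _ ≤ σ ^ 2 * (1 / e₂) * (C * (1 / e₂)) := by rw [← Finset.mul_sum]; gcongr
    _ = _ := by field_simp

lemma params {W₀ : ℝ} (hW₀1 : 1 ≤ W₀) : ∃ e₂ : ℝ, 0 < e₂ ∧ e₂ ≤ 1 / 16 ∧ ∀ K : ℕ, 1 ≤ K → ∃ y₀ : ℝ, 8 ≤ y₀ ∧ ∀ y ≥ y₀,
    ∃ a b : ℕ, e₂ * y ≤ (a:ℝ) / K ∧ (b:ℝ) ≤ K * (y / 2) ∧ a ≤ b ∧ W₀ ≤ SW K a b := by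
  obtain ⟨c₀, s₀, hc₀, hs₀, hSW⟩ := SW_lower
  set e₂ : ℝ := Real.exp (-(W₀ / c₀)) / 16 with he₂
  have he0 : 0 < e₂ := by positivity
  have he1 : e₂ ≤ 1 / 16 := by
    rw [he₂]; gcongr; exact Real.exp_le_one_iff.2 (by rw [neg_nonpos]; positivity)
  refine ⟨e₂, he0, he1, fun K hK1 => ⟨max 8 (max (s₀ / e₂) (2 / e₂)), le_max_left _ _, fun y hy => ?_⟩⟩
  have hK0 : (0:ℝ) < K := by exact_mod_cast hK1
  have hK1' : (1:ℝ) ≤ K := by exact_mod_cast hK1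
  simp only [ge_iff_le, max_le_iff] at hy
  obtain ⟨g4, g5, g6⟩ := hy
  rw [div_le_iff₀ he0] at g5 g6
  have hy0 : 0 < y := by linarith
  set a := ⌈(K:ℝ) * (e₂ * y)⌉₊ with ha
  set b := ⌊(K:ℝ) * (y / 2)⌋₊ with hb
  have ha1 : (K:ℝ) * (e₂ * y) ≤ a := Nat.le_ceil _
  have ha2 : (a:ℝ) < K * (e₂ * y) + 1 := Nat.ceil_lt_add_one (by positivity)
  have hb1 : (b:ℝ) ≤ K * (y / 2) := Nat.floor_le (by positivity)
  have hb2 : (K:ℝ) * (y / 2) < b + 1 := Nat.lt_floor_add_one _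
  have haK : e₂ * y ≤ (a:ℝ) / K := by rw [le_div_iff₀ hK0]; linarith
  have hKy : (8:ℝ) ≤ K * y := by nlinarith
  have hb3 : (K:ℝ) * y / 4 ≤ b := by linarith
  have hKe : 1 ≤ (K:ℝ) * (e₂ * y) := by
    calc (1:ℝ) ≤ 1 * (e₂ * y) := by linarith
      _ ≤ _ := by gcongr
  have ha3 : (a:ℝ) ≤ 2 * K * e₂ * y := by linarith
  have ha0 : (0:ℝ) < a := by linarith
  have hab : a + K ≤ b := by
    have h1 : 2 * K * e₂ * y ≤ 2 * K * (1 / 16) * y := by gcongr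
    have h2 : (K:ℝ) * 8 ≤ K * y := by gcongr
    have : (a:ℝ) + K ≤ b := by linarith
    exact_mod_cast this
  refine ⟨a, b, haK, hb1, by omega, ?_⟩
  refine le_trans ?_ (hSW K a b hK1 (by linarith) hab)
  have : W₀ / c₀ ≤ Real.log (b / (2 * a)) := by
    have hb0 : (0:ℝ) < b := by linarith
    rw [Real.le_log_iff_exp_le (by positivity), le_div_iff₀ (by positivity)]
    have h1 : Real.exp (W₀ / c₀) * e₂ = 1 / 16 := by
      rw [he₂, ← mul_div_assoc, ← Real.exp_add, add_neg_cancel, Real.exp_zero]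
    calc Real.exp (W₀ / c₀) * (2 * a) ≤ Real.exp (W₀ / c₀) * (2 * (2 * K * e₂ * y)) := by gcongr
      _ = (Real.exp (W₀ / c₀) * e₂) * (4 * K * y) := by ring
      _ = K * y / 4 := by rw [h1]; ring
      _ ≤ b := hb3
  rw [div_le_iff₀ hc₀] at this; linarith

set_option maxHeartbeats 1000000 in
lemma MRP_of_Hal {f : ℕ → ℂ} (hf : MF f) (hH : Hal f) : MRP f := by
  intro ε hε
  set E : ℝ := 8000 * Real.exp 10 with hE
  have hE0 : 0 < E := by positivity
  obtain ⟨K, hK1, hKε⟩ : ∃ K : ℕ, 1 ≤ K ∧ E * (1 / (K:ℝ) ^ 2) ≤ ε / 4 := by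
    obtain ⟨K, hK⟩ := exists_nat_ge (max 1 (4 * E / ε))
    have h1 : (1:ℝ) ≤ K := (le_max_left _ _).trans hK
    have h2 := (le_max_right _ _).trans hK
    refine ⟨K, by exact_mod_cast h1, ?_⟩
    rw [div_le_iff₀ hε] at h2
    rw [mul_one_div, div_le_iff₀ (by positivity)]
    nlinarith
  set W₀ : ℝ := max 1 (4 * E / ε) with hW₀
  have hW₀1 : 1 ≤ W₀ := le_max_left _ _
  obtain ⟨e₂, he0, he1, hpar⟩ := params hW₀1
  obtain ⟨c, C, hc, hc1, hC, hqv⟩ := qv_bad (A := 4 / e₂) (by positivity)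
  set η : ℝ := c * e₂ / 16 with hη
  have hη0 : 0 < η := by positivity
  have hη1 : η ≤ 1 := by rw [hη]; nlinarith
  obtain ⟨Q₁, hQ₁, hiter⟩ := iter hf hη0 hη1 (show 0 < ε / 4 by positivity)
  refine ⟨Q₁, hQ₁, fun Q₀ hQ₀ => ?_⟩
  obtain ⟨y₀, hy₀⟩ := hiter Q₀ hQ₀ K hK1 e₂ he0
  have hK0 : (0:ℝ) < K := by exact_mod_cast hK1
  have hK1' : (1:ℝ) ≤ K := by exact_mod_cast hK1
  set C' : ℝ := 12 * C * (K:ℝ) ^ 2 with hC'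
  have hC'0 : 0 < C' := by positivity
  obtain ⟨σ, hσ, hσε⟩ : ∃ σ : ℝ, 0 < σ ∧ 2 * (σ ^ 2 * C' / e₂ ^ 2) ≤ ε / 4 := by
    refine ⟨Real.sqrt (ε * e₂ ^ 2 / (8 * C')), Real.sqrt_pos.2 (by positivity), ?_⟩
    rw [Real.sq_sqrt (by positivity)]
    apply le_of_eq; field_simp; ring
  obtain ⟨y₁, hy₁⟩ := hH σ hσ
  set M : ℝ := Real.exp (10 + 2 * ⌈1 / e₂⌉₊) * (2 * ⌈1 / e₂⌉₊).factorial with hM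
  have hM0 : 0 < M := by positivity
  have hev := exp_sq_ev (c := c * e₂ / 2) (M := K * M) (by positivity)
  obtain ⟨y₂, hy₂⟩ := eventually_atTop.1 hev
  obtain ⟨yp, hyp8, hpar⟩ := hpar K hK1
  refine ⟨max (max y₀ (2 * y₁)) (max y₂ (max yp (2 / e₂))), fun y hy => ?_⟩
  simp only [ge_iff_le, max_le_iff] at hy
  obtain ⟨⟨g1, g2⟩, g3, g4, g6⟩ := hy
  rw [div_le_iff₀ he0] at g6
  obtain ⟨a, b, haK, hb1, -, hW⟩ := hpar y g4
  have hy0 : 0 < y := by linarith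
  have hbK2 : (b:ℝ) / K ≤ y / 2 := by rw [div_le_iff₀ hK0]; linarith
  have hbK : (b:ℝ) / K ≤ y := by linarith
  have ha0 : (0:ℝ) < a := by
    have : 0 < (a:ℝ) / K := lt_of_lt_of_le (by positivity) haK
    rwa [div_pos_iff_of_pos_right hK0] at this
  have hW1 : 1 ≤ SW K a b := hW₀1.trans hW
  set Wt := SW K a b with hWt
  have hWε : E * (1 / Wt) ≤ ε / 4 := by
    have h1 : 4 * E / ε ≤ Wt := (le_max_right _ _).trans hW
    rw [div_le_iff₀ hε] at h1
    rw [mul_one_div, div_le_iff₀ (by linarith)]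
    linarith
  set T := Real.exp y / Q₀ with hT
  have hQ0 : 1 ≤ Q₀ := hQ₁.trans hQ₀
  have hT0 : 0 < T := by have : 0 < Q₀ := by linarith
                         positivity
  have hTy : T ≤ Real.exp y := div_le_self (Real.exp_pos y).le hQ0
  obtain ⟨F, hFc, hF0, hFR, hFi⟩ := hy₀ y g1 a b haK hbK hW1
  set S := Good f K a b (2 * η) with hS
  set U := Set.Icc (-T) T \ S with hUdef
  have hSm : MeasurableSet S := (closed_Good _ _ _ _ _).measurableSet
  have hU : U ⊆ Set.Icc (-T) T := Set.sdiff_subset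
  have hUm : MeasurableSet U := measurableSet_Icc.diff hSm
  have hcR : Continuous (fun t => ‖R f y t‖ ^ 2) := (continuous_R f y).norm.pow 2
  have hvol := bad_total hf.bd hK1 (show 0 ≤ 2 * η by linarith) hy0 he0 haK hbK hT0 hTy
  rw [← hM] at hvol
  have hvol' : volume.real U ≤ K * y * (Real.exp (4 * (2 * η) * y) * M) := hvol
  -- the bad part
  have hQb : ∀ v ∈ Finset.Ico a b, ∫ t in U, ‖Q f K v t‖ ^ 2 ≤ C' / (v:ℝ) ^ 2 := by
    intro v hv
    rw [Finset.mem_Ico] at hv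
    have hav : (a:ℝ) / K ≤ v / K := by have := hv.1; gcongr
    have hvb : (v:ℝ) / K ≤ b / K := by have := hv.2.le; gcongr
    have hv0 : (0:ℝ) < v := ha0.trans_le (by exact_mod_cast hv.1)
    have hs : e₂ * y ≤ (v:ℝ) / K := haK.trans hav
    set s : ℝ := (v:ℝ) / K with hsdef
    have hs0 : 0 < s := by positivity
    have h1 := hqv f K v T U hf.bd hK1 (by linarith) hU hUm (by
      have h2 : (2:ℝ) ≤ Real.exp y := by linarith [Real.add_one_le_exp y]
      calc 2 * T ≤ Real.exp y * Real.exp y := by gcongr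
        _ = Real.exp (2 * y) := by rw [← Real.exp_add]; ring_nf
        _ ≤ _ := Real.exp_le_exp.2 (by
            calc 2 * y = 4 / e₂ * (e₂ * y / 2) := by field_simp; ring
              _ ≤ _ := by gcongr))
    refine h1.trans ?_
    have h2 : Real.exp (-(c * s)) * volume.real U ≤ 1 / s := by
      rw [le_div_iff₀ hs0]
      calc Real.exp (-(c * s)) * volume.real U * s ≤ Real.exp (-(c * (e₂ * y))) * (K * y * (Real.exp (4 * (2 * η) * y) * M)) * y := by
            gcongr
            linarith
        _ = (Real.exp (-(c * (e₂ * y))) * Real.exp (4 * (2 * η) * y)) * (K * M) * y ^ 2 := by ring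
        _ = Real.exp (-(c * e₂ / 2 * y)) * (K * M) * y ^ 2 := by
            rw [← Real.exp_add]; congr 3; rw [hη]; ring
        _ ≤ 1 := hy₂ y g3
    calc (C / s + C * Real.exp (-(c * s)) * volume.real U) * (6 * K / v)
        = (C / s + C * (Real.exp (-(c * s)) * volume.real U)) * (6 * K / v) := by ring
      _ ≤ (C / s + C * (1 / s)) * (6 * K / v) := by gcongr
      _ = C' / (v:ℝ) ^ 2 := by rw [hC', hsdef]; field_simp; ring
  have hG := bad_G (f := f) hK1 hσ.le hC'0.le he0 hy0 haK hbK hU hUm (by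
    intro v hv t ht
    rw [Finset.mem_Ico] at hv
    have hvb : (v:ℝ) / K ≤ b / K := by have := hv.2.le; gcongr
    refine hy₁ _ (by linarith) t ?_
    have h1 : |t| ≤ T := abs_le.2 (hU ht)
    refine h1.trans (hTy.trans (Real.exp_le_exp.2 (by linarith)))) hQb
  have hms := R_sub_G_ms hf hK1 hy0.le hbK hW1
  rw [← hWt] at hms hFi
  have hbad : ∫ t in U, ‖R f y t‖ ^ 2 ≤ 2 * (∫ t in U, ‖G f K a b y t‖ ^ 2) +
      2 * ∫ t in Set.Icc (-Real.exp y) (Real.exp y), ‖R f y t - G f K a b y t / Wt‖ ^ 2 := by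
    have hcG : Continuous (fun t => ‖G f K a b y t‖ ^ 2) := (continuous_G f K a b y).norm.pow 2
    have hcD : Continuous (fun t => ‖R f y t - G f K a b y t / Wt‖ ^ 2) :=
      ((continuous_R f y).sub ((continuous_G f K a b y).div_const _)).norm.pow 2
    have hU' : U ⊆ Set.Icc (-Real.exp y) (Real.exp y) := hU.trans (Set.Icc_subset_Icc (by linarith) hTy)
    have h1 : ∫ t in U, ‖R f y t‖ ^ 2 ≤ ∫ t in U, (2 * ‖G f K a b y t‖ ^ 2 + 2 * ‖R f y t - G f K a b y t / Wt‖ ^ 2) := by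
      refine setIntegral_mono_on (intU hU hcR) (intU hU ((continuous_const.mul hcG).add (continuous_const.mul hcD))) hUm fun t _ => ?_
      have h2 : ‖R f y t‖ ≤ ‖G f K a b y t‖ + ‖R f y t - G f K a b y t / Wt‖ := by
        have h3 : ‖G f K a b y t / Wt‖ ≤ ‖G f K a b y t‖ := by
          rw [norm_div, Complex.norm_real]
          exact div_le_self (norm_nonneg _) (hW1.trans (Real.le_norm_self _))
        have h4 := norm_add_le (G f K a b y t / Wt) (R f y t - G f K a b y t / Wt)
        rw [add_sub_cancel] at h4
        linarith
      have h5 := pow_le_pow_left₀ (norm_nonneg _) h2 2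
      nlinarith [sq_nonneg (‖G f K a b y t‖ - ‖R f y t - G f K a b y t / Wt‖)]
    have i1 : Integrable (fun t => 2 * ‖G f K a b y t‖ ^ 2) (volume.restrict U) := intU hU (continuous_const.mul hcG)
    have i2 : Integrable (fun t => 2 * ‖R f y t - G f K a b y t / Wt‖ ^ 2) (volume.restrict U) := intU hU (continuous_const.mul hcD)
    rw [integral_add i1 i2, integral_const_mul, integral_const_mul] at h1
    have h6 : ∫ t in U, ‖R f y t - G f K a b y t / Wt‖ ^ 2 ≤ ∫ t in Set.Icc (-Real.exp y) (Real.exp y), ‖R f y t - G f K a b y t / Wt‖ ^ 2 :=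
      setIntegral_mono_set (cont_int hcD _) (ae_of_all _ fun t => by positivity) hU'.eventuallyLE
    linarith
  have hgood : ∫ t in Set.Icc (-T) T ∩ S, ‖R f y t‖ ^ 2 ≤ ∫ t in Set.Icc (-T) T, F t := by
    refine (setIntegral_mono_on (intU Set.inter_subset_left hcR) (intU Set.inter_subset_left hFc) (measurableSet_Icc.inter hSm)
      fun t ht => hFR t ht.2).trans ?_
    exact setIntegral_mono_set (cont_int hFc T) (ae_of_all _ fun t => hF0 t) Set.inter_subset_left.eventuallyLE
  have hsplit := integral_inter_add_sdiff (f := fun t => ‖R f y t‖ ^ 2) (μ := volume) (s := Set.Icc (-T) T) hSm (cont_int hcR T)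
  rw [← hsplit]
  have e1 : E * (1 / Wt) + E * (1 / (K:ℝ) ^ 2) = 8000 * Real.exp 10 * (1 / Wt + 1 / (K:ℝ) ^ 2) := by rw [hE]; ring
  change (∫ t in Set.Icc (-T) T ∩ S, ‖R f y t‖ ^ 2) + (∫ t in U, ‖R f y t‖ ^ 2) ≤ ε
  linarith

lemma term_ee (f : ℕ → ℂ) {σ : ℝ} (hσ : 0 < σ) (θ : ℝ) (n : ℕ) :
    LSeries.term f ((σ:ℂ) + (θ:ℂ) * Complex.I) n = f n * (((n:ℝ) ^ (-σ) : ℝ) : ℂ) * ee (-(θ * Real.log n)) := by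
  rcases Nat.eq_zero_or_pos n with rfl | hn
  · rw [LSeries.term_zero, Nat.cast_zero, Real.zero_rpow (by linarith)]; simp
  · have hn0 : (0:ℝ) < n := by exact_mod_cast hn
    rw [LSeries.term_of_ne_zero hn.ne', div_eq_mul_inv, mul_assoc]
    congr 1
    rw [← Complex.cpow_neg, Complex.ofReal_cpow hn0.le]
    unfold ee
    rw [Complex.cpow_def_of_ne_zero (by exact_mod_cast hn.ne'), Complex.cpow_def_of_ne_zero (by exact_mod_cast hn.ne'), ← Complex.exp_add]
    congr 1
    push_cast
    rw [← Complex.natCast_log]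
    ring

lemma weyl_block {c C A : ℝ} (hC : 0 < C) (hc : 0 < c)
    (hW : ∀ (N u : ℝ) (L : ℕ), 1 ≤ N → (L:ℝ) ≤ N → 0 < |u| → |u| ≤ N ^ A →
      ‖∑ n ∈ Finset.range L, ee (u * Real.log (N + n))‖ ≤ C * (N / |u| + N ^ (1 - c)))
    (hA : 0 ≤ A) {q : ℕ} (hq : 1 ≤ q) {r : ℕ} (hr : r ≤ q) (j : ℕ) {u α : ℝ} (hα : 0 < α) (hu0 : 0 < |u|) (hu : |u| ≤ ((2:ℝ) ^ j) ^ A) :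
    ‖∑ i ∈ Finset.range (2 ^ j), ((((q * (2 ^ j + i) + r : ℕ):ℝ) ^ (-(1 + α)) : ℝ) : ℂ) * ee (-(u * Real.log ((q * (2 ^ j + i) + r : ℕ):ℝ)))‖
      ≤ 2 * C * (((2:ℝ) ^ (-α)) ^ j / |u| + ((2:ℝ) ^ (-c)) ^ j) := by
  have hq0 : (0:ℝ) < q := by exact_mod_cast hq
  have hrq : (r:ℝ) ≤ q := by exact_mod_cast hr
  set X : ℝ := (2:ℝ) ^ j with hX
  have hX1 : 1 ≤ X := one_le_pow₀ (by norm_num)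
  have hX0 : 0 < X := by linarith
  set N : ℝ := X + r / q with hN
  have hrq' : (r:ℝ) / q ≤ 1 := by rw [div_le_one hq0]; exact hrq
  have hr0 : 0 ≤ (r:ℝ) / q := by positivity
  have hNX : X ≤ N := by linarith
  have hN2 : N ≤ 2 * X := by linarith
  have hN0 : 0 < N := by linarith
  set g : ℕ → ℝ := fun i => ((q * (2 ^ j + i) + r : ℕ):ℝ) ^ (-(1 + α)) with hg
  have hpos : ∀ i : ℕ, 0 < ((q * (2 ^ j + i) + r : ℕ):ℝ) := by
    intro i
    have : 0 < q * (2 ^ j + i) + r := by positivity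
    exact_mod_cast this
  have hanti : ∀ i, g (i + 1) ≤ g i := by
    intro i
    apply Real.rpow_le_rpow_of_nonpos (hpos i) _ (by linarith)
    push_cast
    nlinarith
  have hg0 : ∀ i, 0 ≤ g i := fun i => Real.rpow_nonneg (hpos i).le _
  set B : ℝ := C * (N / |u| + N ^ (1 - c)) with hB
  have hx : ∀ i : ℕ, ee (-(u * Real.log ((q * (2 ^ j + i) + r : ℕ):ℝ))) = ee (-(u * Real.log q)) * ee ((-u) * Real.log (N + i)) := by
    intro i
    rw [← ee_add]
    congr 1
    have : ((q * (2 ^ j + i) + r : ℕ):ℝ) = q * (N + i) := by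
      rw [hN, hX]; push_cast; field_simp; ring
    rw [this, Real.log_mul hq0.ne' (by positivity)]
    ring
  have h1 := abel_bound g (fun i => ee (-(u * Real.log ((q * (2 ^ j + i) + r : ℕ):ℝ)))) (2 ^ j) (B := B) (by
    intro l hl
    simp_rw [hx]
    rw [← Finset.mul_sum, norm_mul, norm_ee, one_mul]
    have hl' : (l:ℝ) ≤ X := by rw [hX]; exact_mod_cast hl
    have := hW N (-u) l (by linarith) (by linarith) (by rwa [abs_neg]) (by
      rw [abs_neg]; exact hu.trans (Real.rpow_le_rpow hX0.le hNX hA))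
    rwa [abs_neg] at this)
  refine h1.trans ?_
  have h2 : |g (2 ^ j - 1)| + ∑ n ∈ Finset.range (2 ^ j - 1), |g (n + 1) - g n| = g 0 := by
    have : ∀ L, |g L| + ∑ n ∈ Finset.range L, |g (n + 1) - g n| = g 0 := by
      intro L
      have : ∑ n ∈ Finset.range L, |g (n + 1) - g n| = ∑ n ∈ Finset.range L, (g n - g (n + 1)) :=
        Finset.sum_congr rfl fun n _ => by rw [abs_sub_comm, abs_of_nonneg (by linarith [hanti n])]
      rw [this, Finset.sum_range_sub', abs_of_nonneg (hg0 L)]; ring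
    exact this _
  rw [h2]
  have h3 : g 0 ≤ X⁻¹ * ((2:ℝ) ^ (-α)) ^ j := by
    have e1 : X⁻¹ * ((2:ℝ) ^ (-α)) ^ j = X ^ (-(1 + α)) := by
      rw [neg_add, Real.rpow_add hX0, Real.rpow_neg_one, hX, ← Real.rpow_natCast, ← Real.rpow_natCast, ← Real.rpow_mul (by norm_num), ← Real.rpow_mul (by norm_num)]
      congr 2; ring
    rw [e1]
    apply Real.rpow_le_rpow_of_nonpos hX0 _ (by linarith)
    have : (1:ℝ) ≤ q := by exact_mod_cast hq
    push_cast
    rw [hX]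
    have h5 : (0:ℝ) ≤ r := Nat.cast_nonneg _
    nlinarith
  have h4 : B ≤ C * (2 * X) * (1 / |u| + ((2:ℝ) ^ (-c)) ^ j) := by
    have e2 : N ^ (1 - c) ≤ 2 * X * ((2:ℝ) ^ (-c)) ^ j := by
      rw [sub_eq_add_neg, Real.rpow_add hN0, Real.rpow_one]
      have : N ^ (-c) ≤ ((2:ℝ) ^ (-c)) ^ j := by
        have e3 : ((2:ℝ) ^ (-c)) ^ j = X ^ (-c) := by
          rw [hX, ← Real.rpow_natCast, ← Real.rpow_natCast, ← Real.rpow_mul (by norm_num), ← Real.rpow_mul (by norm_num)]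
          congr 1; ring
        rw [e3]
        exact Real.rpow_le_rpow_of_nonpos hX0 hNX (by linarith)
      gcongr
    rw [hB, mul_assoc]
    gcongr
    rw [mul_add]
    refine add_le_add ?_ e2
    rw [mul_one_div]; gcongr
  have h6 : (0:ℝ) < ((2:ℝ) ^ (-α)) ^ j := by positivity
  have h7 : ((2:ℝ) ^ (-α)) ^ j ≤ 1 := pow_le_one₀ (by positivity) (Real.rpow_le_one_of_one_le_of_nonpos (by norm_num) (by linarith))
  have hB0 : 0 ≤ B := by positivity
  calc B * g 0 ≤ (C * (2 * X) * (1 / |u| + ((2:ℝ) ^ (-c)) ^ j)) * (X⁻¹ * ((2:ℝ) ^ (-α)) ^ j) :=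
        mul_le_mul h4 h3 (hg0 0) (by positivity)
    _ = 2 * C * (((2:ℝ) ^ (-α)) ^ j / |u| + ((2:ℝ) ^ (-c)) ^ j * ((2:ℝ) ^ (-α)) ^ j) := by field_simp
    _ ≤ 2 * C * (((2:ℝ) ^ (-α)) ^ j / |u| + ((2:ℝ) ^ (-c)) ^ j * 1) := by gcongr
    _ = _ := by rw [mul_one]

lemma sum_range_mul_eq (q : ℕ) (g : ℕ → ℂ) (M : ℕ) :
    ∑ n ∈ Finset.range (q * M), g n = ∑ r ∈ Finset.range q, ∑ m ∈ Finset.range M, g (q * m + r) := by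
  induction M with
  | zero => simp
  | succ M ih =>
    rw [Nat.mul_succ, Finset.sum_range_add, ih]
    simp_rw [Finset.sum_range_succ]
    rw [Finset.sum_add_distrib]

lemma geom_le {ρ : ℝ} (h0 : 0 ≤ ρ) (h1 : ρ < 1) (s : Finset ℕ) : ∑ j ∈ s, ρ ^ j ≤ 1 / (1 - ρ) := by
  rw [one_div, ← tsum_geometric_of_lt_one h0 h1]
  exact (summable_geometric_of_lt_one h0 h1).sum_le_tsum _ fun _ _ => by positivity

lemma two_rpow_gap {α : ℝ} (h0 : 0 < α) (h1 : α ≤ 1) : 1 / (1 - (2:ℝ) ^ (-α)) ≤ 2 / α := by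
  have h : (2:ℝ) ^ (-α) ≤ 1 - α / 2 := by
    have := rpow_one_add_le_one_add_mul_self (s := -1/2) (by norm_num) h0.le h1
    have e : (2:ℝ) ^ (-α) = (1 + (-1/2)) ^ α := by
      rw [Real.rpow_neg (by norm_num), ← Real.inv_rpow (by norm_num)]; norm_num
    rw [e]; linarith
  rw [div_le_div_iff₀ (by linarith) h0]
  linarith

lemma L_small {q : ℕ} [NeZero q] (ψ : DirichletCharacter ℂ q) {ε : ℝ} (hε : 0 < ε) :
    ∃ T₀ y₁ : ℝ, 0 < T₀ ∧ ∀ y ≥ y₁, ∀ u : ℝ, T₀ ≤ |u| → |u| ≤ Real.exp (4 * y) →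
      ‖LSeries (fun n => ψ n) (((1 + 1 / y : ℝ) : ℂ) + (u:ℂ) * Complex.I)‖ ≤ ε * y := by
  have hq : 1 ≤ q := Nat.one_le_iff_ne_zero.2 (NeZero.ne q)
  have hq0 : (0:ℝ) < q := by exact_mod_cast hq
  set ε₂ : ℝ := ε / (4 * q) with hε₂
  have hε₂0 : 0 < ε₂ := by positivity
  obtain ⟨c, C, hc, hc1, hC, hW⟩ := weyl (8 / ε₂)
  set ρ' : ℝ := (2:ℝ) ^ (-c) with hρ'
  have hρ'0 : 0 < ρ' := by positivity
  have hρ'1 : ρ' < 1 := Real.rpow_lt_one_of_one_lt_of_neg (by norm_num) (by linarith)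
  set E : ℝ := q * (2 + 2 * C * (1 / (1 - ρ'))) with hE
  refine ⟨16 * C * q / ε + 1, max 1 (4 * E / ε), by positivity, fun y hy u hu1 hu2 => ?_⟩
  have hy1 : 1 ≤ y := (le_max_left _ _).trans hy
  have hyE : E ≤ ε / 4 * y := by
    have := (le_max_right _ _).trans hy
    rw [div_le_iff₀ hε] at this
    linarith
  have hy0 : 0 < y := by linarith
  set α : ℝ := 1 / y with hα
  have hα0 : 0 < α := by positivity
  have hα1 : α ≤ 1 := by rw [hα, div_le_one hy0]; exact hy1
  have hu0 : 0 < |u| := lt_of_lt_of_le (by positivity) hu1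
  set ρ : ℝ := (2:ℝ) ^ (-α) with hρ
  have hρ0 : 0 < ρ := by positivity
  have hρ1 : ρ < 1 := Real.rpow_lt_one_of_one_lt_of_neg (by norm_num) (by linarith)
  have hgap : 1 / (1 - ρ) ≤ 2 * y := (two_rpow_gap hα0 hα1).trans (by rw [hα]; field_simp; exact le_rfl)
  set J := ⌈ε₂ * y⌉₊ with hJ
  have hJ1 : ε₂ * y ≤ J := Nat.le_ceil _
  have hJ2 : (J:ℝ) < ε₂ * y + 1 := Nat.ceil_lt_add_one (by positivity)
  have huJ : ∀ j, J ≤ j → |u| ≤ ((2:ℝ) ^ j) ^ (8 / ε₂) := by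
    intro j hj
    refine hu2.trans ?_
    have h1 : ((2:ℝ) ^ J) ^ (8 / ε₂) ≤ ((2:ℝ) ^ j) ^ (8 / ε₂) := by
      apply Real.rpow_le_rpow (by positivity) _ (by positivity)
      exact pow_le_pow_right₀ (by norm_num) hj
    refine le_trans ?_ h1
    rw [← Real.rpow_natCast, ← Real.rpow_mul (by norm_num), Real.rpow_def_of_pos (by norm_num)]
    apply Real.exp_le_exp.2
    have h2 : 8 * y ≤ J * (8 / ε₂) := by
      rw [← mul_div_assoc, le_div_iff₀ hε₂0]; linarith
    have h3 : (1:ℝ)/2 ≤ Real.log 2 := by linarith [Real.log_two_gt_d9]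
    nlinarith
  set σ : ℝ := 1 + α with hσ
  set a : ℕ → ℂ := fun n => (((n:ℝ) ^ (-(1 + α)) : ℝ) : ℂ) * ee (-(u * Real.log n)) with ha
  have hna : ∀ n, ‖a n‖ ≤ (n:ℝ) ^ (-(1 + α)) := by
    intro n
    rw [ha]; simp only
    rw [norm_mul, norm_ee, mul_one, Complex.norm_real, Real.norm_of_nonneg (by positivity)]
  have hS0 : ∀ r < q, ∀ j : ℕ, ‖∑ m ∈ Finset.range (2 ^ j), a (q * m + r)‖ ≤ 1 + j := by
    intro r hr j
    induction j with
    | zero =>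
      simp only [pow_zero, Finset.range_one, Finset.sum_singleton, mul_zero, zero_add, Nat.cast_zero, add_zero]
      refine (hna r).trans ?_
      rcases Nat.eq_zero_or_pos r with rfl | h
      · rw [Nat.cast_zero, Real.zero_rpow (by linarith)]; norm_num
      · exact Real.rpow_le_one_of_one_le_of_nonpos (by exact_mod_cast h) (by linarith)
    | succ j ih =>
      rw [pow_succ, mul_two, Finset.sum_range_add]
      have : ‖∑ x ∈ Finset.range (2 ^ j), a (q * (2 ^ j + x) + r)‖ ≤ 1 := by
        refine (norm_sum_le _ _).trans ?_
        calc _ ≤ ∑ x ∈ Finset.range (2 ^ j), ((2:ℝ) ^ j)⁻¹ := by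
              refine Finset.sum_le_sum fun x _ => (hna _).trans ?_
              have h1 : (2:ℝ) ^ j ≤ ((q * (2 ^ j + x) + r : ℕ):ℝ) := by
                have : 2 ^ j ≤ q * (2 ^ j + x) + r := by nlinarith [Nat.zero_le (q * x), Nat.one_le_two_pow (n := j)]
                exact_mod_cast this
              have h2 : (1:ℝ) ≤ 2 ^ j := one_le_pow₀ (by norm_num)
              calc ((q * (2 ^ j + x) + r : ℕ):ℝ) ^ (-(1 + α)) ≤ ((q * (2 ^ j + x) + r : ℕ):ℝ) ^ (-1 : ℝ) :=
                    Real.rpow_le_rpow_of_exponent_le (by linarith) (by linarith)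
                _ = (((q * (2 ^ j + x) + r : ℕ):ℝ))⁻¹ := Real.rpow_neg_one _
                _ ≤ _ := by gcongr
          _ = 1 := by
              rw [Finset.sum_const, Finset.card_range, nsmul_eq_mul]; push_cast
              exact mul_inv_cancel₀ (by positivity)
      have := (norm_add_le (∑ m ∈ Finset.range (2 ^ j), a (q * m + r)) (∑ x ∈ Finset.range (2 ^ j), a (q * (2 ^ j + x) + r))).trans (add_le_add ih this)
      push_cast; linarith
  have hS1 : ∀ r < q, ∀ k : ℕ, ‖∑ m ∈ Finset.range (2 ^ (J + k)), a (q * m + r)‖ ≤ 1 + J + ∑ j ∈ Finset.Ico J (J + k), 2 * C * (ρ ^ j / |u| + ρ' ^ j) := by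
    intro r hr k
    induction k with
    | zero => simpa using hS0 r hr J
    | succ k ih =>
      rw [← add_assoc, pow_succ, mul_two, Finset.sum_range_add, Finset.sum_Ico_succ_top (by omega), ← add_assoc]
      refine (norm_add_le _ _).trans (add_le_add ih ?_)
      exact weyl_block hC hc hW (by positivity) hq hr.le (J + k) hα0 hu0 (huJ _ (by omega))
  have hS2 : ∀ r < q, ∀ k : ℕ, ‖∑ m ∈ Finset.range (2 ^ (J + k)), a (q * m + r)‖ ≤ 1 + J + 2 * C * (2 * y / |u| + 1 / (1 - ρ')) := by
    intro r hr k
    refine (hS1 r hr k).trans ?_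
    rw [← Finset.mul_sum, Finset.sum_add_distrib, ← Finset.sum_div]
    have h1 := (geom_le hρ0.le hρ1 (Finset.Ico J (J + k))).trans hgap
    have h2 := geom_le hρ'0.le hρ'1 (Finset.Ico J (J + k))
    gcongr
  have hsum : LSeriesSummable (fun n => ψ n) (((1 + 1 / y : ℝ) : ℂ) + (u:ℂ) * Complex.I) := by
    apply DirichletCharacter.LSeriesSummable_of_one_lt_re
    simp
    linarith [hα0]
  have hlim := hsum.hasSum.tendsto_sum_nat
  have hsub : Tendsto (fun k => q * 2 ^ (J + k)) atTop atTop := by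
    refine tendsto_atTop_mono (fun k => ?_) tendsto_id
    have h1 : k < 2 ^ (J + k) := lt_of_le_of_lt (by omega) (Nat.lt_two_pow_self (n := J + k))
    simp only [id]
    nlinarith
  have hlim2 := hlim.comp hsub
  refine le_of_tendsto hlim2.norm (Eventually.of_forall fun k => ?_)
  simp only [Function.comp]
  have e1 : ∀ n, LSeries.term (fun n => ψ n) (((1 + 1 / y : ℝ) : ℂ) + (u:ℂ) * Complex.I) n = ψ n * a n := by
    intro n
    rw [term_ee _ (by positivity), ha, mul_assoc]
  simp_rw [e1]
  rw [sum_range_mul_eq]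
  have e2 : ∀ r m : ℕ, ψ ((q * m + r : ℕ) : ZMod q) = ψ (r : ZMod q) := by
    intro r m; congr 1; simp
  simp_rw [e2, ← Finset.mul_sum]
  refine (norm_sum_le _ _).trans ?_
  have h8 : ∀ r ∈ Finset.range q, ‖ψ (r : ZMod q) * ∑ m ∈ Finset.range (2 ^ (J + k)), a (q * m + r)‖ ≤ 1 + J + 2 * C * (2 * y / |u| + 1 / (1 - ρ')) := by
    intro r hr
    rw [norm_mul]
    have := mul_le_mul (ψ.norm_le_one (r : ZMod q)) (hS2 r (Finset.mem_range.1 hr) k) (norm_nonneg _) zero_le_one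
    rwa [one_mul] at this
  refine (Finset.sum_le_card_nsmul _ _ _ h8).trans ?_
  rw [Finset.card_range, nsmul_eq_mul]
  have h9 : 4 * C * q * (y / |u|) ≤ ε / 4 * y := by
    rw [← mul_div_assoc, div_le_iff₀ hu0]
    have : 16 * C * q / ε ≤ |u| := by linarith
    rw [div_le_iff₀ hε] at this
    nlinarith
  have h10 : (q:ℝ) * (ε₂ * y) = ε / 4 * y := by rw [hε₂]; field_simp
  calc (q:ℝ) * (1 + J + 2 * C * (2 * y / |u| + 1 / (1 - ρ'))) ≤ q * (1 + (ε₂ * y + 1) + 2 * C * (2 * y / |u| + 1 / (1 - ρ'))) := by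
        gcongr
    _ = q * (ε₂ * y) + 4 * C * q * (y / |u|) + E := by rw [hE]; ring
    _ ≤ ε * y := by
        have := mul_pos hε hy0
        linarith

/-- integer part of the logarithm -/
def fl (n : ℕ) : ℕ := ⌊Real.log (n:ℝ)⌋₊

lemma block_gen (g : ℕ → ℝ) (hg : ∀ n, 0 ≤ g n) {C₀ : ℝ}
    (hb : ∀ (s : Finset ℕ) (k : ℕ), ∑ n ∈ s with fl n = k, g n / n ≤ C₀)
    (φ : ℕ → ℝ) (Φ : ℕ → ℝ) (hΦ : ∀ k, 0 ≤ Φ k) (h : ∀ n, 1 ≤ n → φ n ≤ Φ (fl n))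
    (s : Finset ℕ) :
    ∑ n ∈ s, g n / n * φ n ≤ C₀ * ∑ k ∈ s.image fl, Φ k := by
  rw [← Finset.sum_fiberwise_of_maps_to (t := s.image fl)
    (g := fl) (fun n hn => Finset.mem_image_of_mem _ hn), Finset.mul_sum]
  refine Finset.sum_le_sum fun k _ => ?_
  calc ∑ n ∈ s with fl n = k, g n / n * φ n
      ≤ ∑ n ∈ s with fl n = k, g n / n * Φ k := by
        refine Finset.sum_le_sum fun n hn => ?_
        rw [Finset.mem_filter] at hn
        rcases Nat.eq_zero_or_pos n with h0 | h0
        · subst h0; simp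
        · exact mul_le_mul_of_nonneg_left (hn.2 ▸ h n h0) (div_nonneg (hg n) (Nat.cast_nonneg _))
    _ = (∑ n ∈ s with fl n = k, g n / n) * Φ k := by rw [Finset.sum_mul]
    _ ≤ C₀ * Φ k := mul_le_mul_of_nonneg_right (hb s k) (hΦ k)

lemma block_of_partial (g : ℕ → ℝ) (hg : ∀ n, 0 ≤ g n) {C : ℝ}
    (hs : ∀ x : ℝ, 1 ≤ x → ∑ n ∈ Finset.Ioc 0 ⌊x⌋₊, g n ≤ C * x) (s : Finset ℕ) (k : ℕ) :
    ∑ n ∈ s with fl n = k, g n / n ≤ C * Real.exp 1 := by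
  have key : ∀ n : ℕ, 1 ≤ n → fl n = k → Real.exp k ≤ n ∧ (n:ℝ) ≤ Real.exp (k + 1) := by
    intro n hn hk
    have hn0 : (0:ℝ) < n := by exact_mod_cast hn
    unfold fl at hk
    have h0 : 0 ≤ Real.log n := Real.log_nonneg (by exact_mod_cast hn)
    constructor
    · rw [← Real.le_log_iff_exp_le hn0, ← hk]; exact Nat.floor_le h0
    · rw [← Real.log_le_iff_le_exp hn0, ← hk]; exact (Nat.lt_floor_add_one _).le
  calc ∑ n ∈ s with fl n = k, g n / n
      = ∑ n ∈ s with (fl n = k ∧ 1 ≤ n), g n / n := by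
        rw [← Finset.filter_filter]
        refine (Finset.sum_subset (Finset.filter_subset _ _) fun n hn hn' => ?_).symm
        have : n = 0 := by
          by_contra h; exact hn' (Finset.mem_filter.2 ⟨hn, Nat.one_le_iff_ne_zero.2 h⟩)
        simp [this]
    _ ≤ ∑ n ∈ s with (fl n = k ∧ 1 ≤ n), g n * Real.exp (-k) := by
        refine Finset.sum_le_sum fun n hn => ?_
        rw [Finset.mem_filter] at hn
        rw [div_eq_mul_inv, Real.exp_neg]
        exact mul_le_mul_of_nonneg_left
          (inv_anti₀ (Real.exp_pos _) (key n hn.2.2 hn.2.1).1) (hg n)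
    _ ≤ ∑ n ∈ Finset.Ioc 0 ⌊Real.exp (k + 1)⌋₊, g n * Real.exp (-k) := by
        refine Finset.sum_le_sum_of_subset_of_nonneg ?_
          (fun n _ _ => mul_nonneg (hg n) (Real.exp_pos _).le)
        intro n hn
        rw [Finset.mem_filter] at hn
        exact Finset.mem_Ioc.2 ⟨hn.2.2, Nat.le_floor (key n hn.2.2 hn.2.1).2⟩
    _ ≤ (C * Real.exp (k + 1)) * Real.exp (-k) := by
        rw [← Finset.sum_mul]
        exact mul_le_mul_of_nonneg_right (hs _ (Real.one_le_exp (by positivity))) (Real.exp_pos _).le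
    _ = C * Real.exp 1 := by rw [mul_assoc, ← Real.exp_add]; congr 2; ring

lemma block_one (s : Finset ℕ) (k : ℕ) :
    ∑ n ∈ s with fl n = k, (1:ℝ) / n ≤ 1 * Real.exp 1 := by
  refine block_of_partial (fun _ => 1) (fun _ => zero_le_one) (fun x hx => ?_) s k
  simpa using Nat.floor_le (by linarith)

lemma block_Lam (s : Finset ℕ) (k : ℕ) :
    ∑ n ∈ s with fl n = k, (ArithmeticFunction.vonMangoldt n) / n
      ≤ (Real.log 4 + 4) * Real.exp 1 := by
  refine block_of_partial _ (fun _ => ArithmeticFunction.vonMangoldt_nonneg) (fun x hx => ?_) s k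
  exact Chebyshev.psi_le_const_mul_self (by linarith)

lemma exp_gap {α : ℝ} (h0 : 0 < α) (h1 : α ≤ 1) : 1 / (1 - Real.exp (-α)) ≤ 2 / α := by
  have h : Real.exp (-α) ≤ 1 - α / 2 := by
    rw [Real.exp_neg]
    have := Real.add_one_le_exp α
    calc (Real.exp α)⁻¹ ≤ (α + 1)⁻¹ := inv_anti₀ (by linarith) this
      _ ≤ 1 - α / 2 := by rw [inv_le_iff_one_le_mul₀ (by linarith)]; nlinarith
  rw [div_le_div_iff₀ (by linarith) h0]
  linarith

lemma pow_sum_le (g : ℕ → ℝ) (hg : ∀ n, 0 ≤ g n) {C₀ : ℝ}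
    (hb : ∀ (s : Finset ℕ) (k : ℕ), ∑ n ∈ s with fl n = k, g n / n ≤ C₀)
    {y : ℝ} (hy : 1 ≤ y) (s : Finset ℕ) :
    ∑ n ∈ s, g n * (n:ℝ) ^ (-(1 + 1 / y)) ≤ 2 * C₀ * y := by
  have hy0 : 0 < y := by linarith
  have hC : 0 ≤ C₀ := by simpa using hb ∅ 0
  have hα0 : 0 < 1 / y := by positivity
  have hα1 : 1 / y ≤ 1 := by rw [div_le_one hy0]; exact hy
  have h := block_gen g hg hb (fun n => (n:ℝ) ^ (-(1/y))) (fun k => Real.exp (-(1/y)) ^ k)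
    (fun k => by positivity) (fun n hn => by
      have hn0 : (0:ℝ) < n := by exact_mod_cast hn
      rw [Real.rpow_def_of_pos hn0, ← Real.exp_nat_mul]
      refine Real.exp_le_exp.2 ?_
      have : ((fl n : ℕ) : ℝ) ≤ Real.log n := Nat.floor_le (Real.log_nonneg (show (1:ℝ) ≤ n by exact_mod_cast hn))
      have := mul_le_mul_of_nonneg_right this hα0.le
      linarith) s
  have e : ∀ n ∈ s, g n * (n:ℝ) ^ (-(1 + 1 / y)) = g n / n * (n:ℝ) ^ (-(1/y)) := by
    intro n _
    rcases Nat.eq_zero_or_pos n with h0 | h0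
    · subst h0; rw [Nat.cast_zero, Real.zero_rpow (by linarith)]; simp
    · have hn0 : (0:ℝ) < n := by exact_mod_cast h0
      rw [neg_add, Real.rpow_add hn0, Real.rpow_neg_one]; ring
  rw [Finset.sum_congr rfl e]
  refine h.trans ?_
  have h2 := (geom_le (Real.exp_pos (-(1/y))).le (Real.exp_lt_one_iff.2 (by linarith))
    (s.image fl)).trans (exp_gap hα0 hα1)
  calc _ ≤ C₀ * (2 / (1/y)) := mul_le_mul_of_nonneg_left h2 hC
    _ = 2 * C₀ * y := by field_simp

/-- trivial bounds for Dirichlet series near the line one -/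
lemma LS_le (f : ℕ → ℂ) (g : ℕ → ℝ) (hg : ∀ n, 0 ≤ g n) (hfg : ∀ n, ‖f n‖ ≤ g n) {C₀ : ℝ}
    (hb : ∀ (s : Finset ℕ) (k : ℕ), ∑ n ∈ s with fl n = k, g n / n ≤ C₀)
    {y : ℝ} (hy : 1 ≤ y) (u : ℝ) :
    ‖LSeries f (((1 + 1 / y : ℝ) : ℂ) + (u:ℂ) * Complex.I)‖ ≤ 2 * C₀ * y := by
  have hσ : 0 < 1 + 1 / y := by positivity
  have hC : 0 ≤ C₀ := by simpa using hb ∅ 0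
  have hs : Summable (fun n : ℕ => g n * (n:ℝ) ^ (-(1 + 1 / y))) :=
    summable_of_sum_le (fun n => mul_nonneg (hg n) (Real.rpow_nonneg (Nat.cast_nonneg _) _))
      (pow_sum_le g hg hb hy)
  refine (tsum_of_norm_bounded hs.hasSum fun n => ?_).trans
    (hs.tsum_le_of_sum_le (pow_sum_le g hg hb hy))
  rw [term_ee f hσ, norm_mul, norm_mul, norm_ee, mul_one, Complex.norm_real, Real.norm_eq_abs,
    abs_of_nonneg (Real.rpow_nonneg (Nat.cast_nonneg _) _)]
  exact mul_le_mul_of_nonneg_right (hfg n) (Real.rpow_nonneg (Nat.cast_nonneg _) _)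

lemma LS_one {f : ℕ → ℂ} (hf : ∀ n, ‖f n‖ ≤ 1) {y : ℝ} (hy : 1 ≤ y) (u : ℝ) :
    ‖LSeries f (((1 + 1 / y : ℝ) : ℂ) + (u:ℂ) * Complex.I)‖ ≤ 6 * y := by
  refine (LS_le f (fun _ => 1) (fun _ => zero_le_one) hf block_one hy u).trans ?_
  have := Real.exp_one_lt_d9
  nlinarith

/-- the twisted Moebius function -/
def mc {q : ℕ} (χ : DirichletCharacter ℂ q) (n : ℕ) : ℂ := χ n * (ArithmeticFunction.moebius n : ℂ)

lemma norm_mc {q : ℕ} (χ : DirichletCharacter ℂ q) (n : ℕ) : ‖mc χ n‖ ≤ 1 := by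
  unfold mc
  rw [norm_mul]
  refine mul_le_one₀ (χ.norm_le_one _) (norm_nonneg _) ?_
  rw [Complex.norm_intCast]
  exact_mod_cast ArithmeticFunction.abs_moebius_le_one

lemma mc_mul {q : ℕ} (χ : DirichletCharacter ℂ q) {s : ℂ} (hs : 1 < s.re) :
    LSeries (fun n => χ n) s * LSeries (mc χ) s = 1 := DirichletCharacter.LSeries.mul_mu_eq_one χ hs

lemma mc_compact {q : ℕ} [NeZero q] (χ : DirichletCharacter ℂ q) (T : ℝ) :
    ∃ B : ℝ, ∀ s : ℂ, 1 < s.re → s.re ≤ 2 → |s.im| ≤ T → ‖LSeries (mc χ) s‖ ≤ B := by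
  have hK : IsCompact (Set.Icc (1:ℝ) 2 ×ℂ Set.Icc (-T) T) := isCompact_Icc.reProdIm isCompact_Icc
  have hmem : ∀ s : ℂ, s ∈ Set.Icc (1:ℝ) 2 ×ℂ Set.Icc (-T) T → 1 ≤ s.re := fun s hs => hs.1.1
  have main : ∀ (h k : ℂ → ℂ), Continuous h → Continuous k → (∀ s, 1 ≤ s.re → h s ≠ 0) →
      (∀ s, 1 < s.re → LSeries (mc χ) s = k s / h s) →
      ∃ B : ℝ, ∀ s : ℂ, 1 < s.re → s.re ≤ 2 → |s.im| ≤ T → ‖LSeries (mc χ) s‖ ≤ B := by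
    intro h k hh hk h0 he
    obtain ⟨B, hB⟩ := hK.exists_bound_of_continuousOn (f := fun s => k s / h s)
      (hk.continuousOn.div hh.continuousOn fun s hs => h0 s (hmem s hs))
    refine ⟨B, fun s h1 h2 h3 => ?_⟩
    rw [he s h1]
    exact hB s ⟨⟨h1.le, h2⟩, abs_le.1 h3⟩
  by_cases hχ : χ = 1
  · refine main (DirichletCharacter.LFunctionTrivChar₁ q) (fun s => s - 1)
      (DirichletCharacter.differentiable_LFunctionTrivChar₁ q).continuous (by fun_prop) ?_ ?_
    · intro s hs
      by_cases h1 : s = 1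
      · rw [h1]; exact DirichletCharacter.LFunctionTrivChar₁_apply_one_ne_zero q
      · rw [DirichletCharacter.LFunctionTrivChar₁, Function.update_of_ne h1]
        exact mul_ne_zero (sub_ne_zero.2 h1)
          (DirichletCharacter.LFunction_ne_zero_of_one_le_re _ (Or.inr h1) hs)
    · intro s hs
      have h1 : s ≠ 1 := by rintro rfl; simp at hs
      rw [DirichletCharacter.LFunctionTrivChar₁, Function.update_of_ne h1]
      have h2 := mc_mul χ hs
      rw [← DirichletCharacter.LFunction_eq_LSeries χ hs, hχ] at h2
      have h3 := left_ne_zero_of_mul_eq_one h2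
      have h4 := sub_ne_zero.2 h1
      rw [hχ, eq_div_iff (mul_ne_zero h4 h3)]
      linear_combination (s - 1) * h2
  · refine main (DirichletCharacter.LFunction χ) (fun _ => 1)
      (DirichletCharacter.differentiable_LFunction hχ).continuous continuous_const ?_ ?_
    · intro s hs
      exact DirichletCharacter.LFunction_ne_zero_of_one_le_re _ (Or.inl hχ) hs
    · intro s hs
      have h2 := mc_mul χ hs
      rw [← DirichletCharacter.LFunction_eq_LSeries χ hs] at h2
      rw [eq_div_iff (left_ne_zero_of_mul_eq_one h2)]
      linear_combination h2

lemma mc_small {q : ℕ} [NeZero q] (χ : DirichletCharacter ℂ q) {ε : ℝ} (hε : 0 < ε) :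
    ∃ y₁ : ℝ, ∀ y ≥ y₁, ∀ u : ℝ, |u| ≤ Real.exp (3 * y) →
      ‖LSeries (mc χ) (((1 + 1 / y : ℝ) : ℂ) + (u:ℂ) * Complex.I)‖ ≤ ε * y := by
  have hε' : 0 < ε ^ 4 / 216 := by positivity
  obtain ⟨T₀, y₁, hT₀, hL⟩ := L_small (χ ^ 2) hε'
  obtain ⟨B, hB⟩ := mc_compact χ T₀
  refine ⟨max (max y₁ 1) (B / ε), fun y hy u hu => ?_⟩
  have hy1 : y₁ ≤ y := (le_max_left _ _).trans ((le_max_left _ _).trans hy)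
  have hy2 : 1 ≤ y := (le_max_right _ _).trans ((le_max_left _ _).trans hy)
  have hy3 : B ≤ ε * y := by
    have := (le_max_right _ _).trans hy
    rw [div_le_iff₀ hε] at this; linarith
  have hy0 : 0 < y := by linarith
  have hα0 : 0 < 1 / y := by positivity
  have hα1 : 1 / y ≤ 1 := by rw [div_le_one hy0]; exact hy2
  set s : ℂ := ((1 + 1 / y : ℝ) : ℂ) + (u:ℂ) * Complex.I with hs
  have hre : s.re = 1 + 1 / y := by simp [hs]
  have him : s.im = u := by simp [hs]
  have hs1 : 1 < s.re := by rw [hre]; linarith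
  by_cases hu2 : |u| ≤ T₀
  · exact (hB s hs1 (by rw [hre]; linarith) (by rw [him]; exact hu2)).trans hy3
  push Not at hu2
  have h341 := DirichletCharacter.norm_LSeries_product_ge_one χ hα0 u
  have e1 : (1:ℂ) + ((1 / y : ℝ) : ℂ) = ((1 + 1 / y : ℝ) : ℂ) + ((0:ℝ):ℂ) * Complex.I := by
    push_cast; ring
  have e2 : (1:ℂ) + ((1 / y : ℝ) : ℂ) + Complex.I * (u:ℂ) = s := by
    rw [hs]; push_cast; ring
  have e3 : (1:ℂ) + ((1 / y : ℝ) : ℂ) + 2 * Complex.I * (u:ℂ) = ((1 + 1 / y : ℝ) : ℂ) + ((2 * u:ℝ):ℂ) * Complex.I := by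
    push_cast; ring
  rw [e2, e3, e1, norm_mul, norm_mul, norm_pow, norm_pow] at h341
  have a1 := LS_one (f := fun n => (1 : DirichletCharacter ℂ q) n) (fun n => DirichletCharacter.norm_le_one _ _) hy2 0
  have a2 := hL y hy1 (2 * u) (by rw [abs_mul, abs_two]; linarith [abs_nonneg u]) (by
    rw [abs_mul, abs_two]
    calc 2 * |u| ≤ Real.exp y * Real.exp (3 * y) := by
          refine mul_le_mul ?_ hu (abs_nonneg _) (Real.exp_pos _).le
          have := Real.add_one_le_exp y; linarith
      _ = Real.exp (4 * y) := by rw [← Real.exp_add]; congr 1; ring)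
  have hm := congrArg norm (mc_mul χ hs1)
  rw [norm_mul, norm_one] at hm
  set A := ‖LSeries (fun n => χ n) s‖ with hA
  set F := ‖LSeries (mc χ) s‖ with hF
  have hF0 : 0 ≤ F := norm_nonneg _
  have hA4 : A ^ 4 * F ^ 4 = 1 := by rw [← mul_pow, hm, one_pow]
  set X := ‖LSeries (fun n => (1 : DirichletCharacter ℂ q) n) (((1 + 1 / y : ℝ) : ℂ) + ((0:ℝ):ℂ) * Complex.I)‖ with hX
  set Z := ‖LSeries (fun n => (χ ^ 2) n) (((1 + 1 / y : ℝ) : ℂ) + ((2 * u:ℝ):ℂ) * Complex.I)‖ with hZ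
  have h5 : 1 ≤ X ^ 3 * A ^ 4 * Z := h341
  have hF4 : 0 ≤ F ^ 4 := by positivity
  have h6 : F ^ 4 ≤ X ^ 3 * Z := by
    calc F ^ 4 = 1 * F ^ 4 := by ring
      _ ≤ (X ^ 3 * A ^ 4 * Z) * F ^ 4 := mul_le_mul_of_nonneg_right h5 hF4
      _ = X ^ 3 * Z * (A ^ 4 * F ^ 4) := by ring
      _ = X ^ 3 * Z := by rw [hA4, mul_one]
  have h7 : X ^ 3 * Z ≤ (6 * y) ^ 3 * (ε ^ 4 / 216 * y) :=
    mul_le_mul (pow_le_pow_left₀ (norm_nonneg _) a1 3) a2 (norm_nonneg _) (by positivity)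
  have h8 : F ^ 4 ≤ (ε * y) ^ 4 := (h6.trans h7).trans_eq (by ring)
  exact le_of_pow_le_pow_left₀ (by norm_num) (by positivity) h8

lemma trunc (f : ℕ → ℂ) {σ : ℝ} (hσ : 0 < σ) (hf : Summable fun n : ℕ => ‖f n‖ * (n:ℝ) ^ (-σ)) :
    ∃ N₀ : ℕ, ∀ N ≥ N₀, ∀ u : ℝ, ‖LSeries f ((σ:ℂ) + (u:ℂ) * Complex.I)
      - GD (Finset.Ico 1 N) (fun n : ℕ => f n * (((n:ℝ) ^ (-σ) : ℝ) : ℂ)) (fun n : ℕ => Real.log n) u‖ ≤ 1 := by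
  obtain ⟨g, hg⟩ : ∃ g : ℕ → ℝ, g = fun n : ℕ => ‖f n‖ * (n:ℝ) ^ (-σ) := ⟨_, rfl⟩
  rw [← hg] at hf
  have ht := tendsto_sum_nat_add g
  obtain ⟨N₀, hN₀⟩ := eventually_atTop.1 (ht.eventually_le_const (show (0:ℝ) < 1 by norm_num))
  refine ⟨max N₀ 1, fun N hN u => ?_⟩
  have hN1 : 1 ≤ N := (le_max_right _ _).trans hN
  have hn : ∀ n, ‖LSeries.term f ((σ:ℂ) + (u:ℂ) * Complex.I) n‖ = g n := by
    intro n
    rw [hg, term_ee f hσ, norm_mul, norm_mul, norm_ee, mul_one, Complex.norm_real, Real.norm_eq_abs,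
      abs_of_nonneg (Real.rpow_nonneg (Nat.cast_nonneg _) _)]
  have hs : Summable fun n => ‖LSeries.term f ((σ:ℂ) + (u:ℂ) * Complex.I) n‖ := by
    simp_rw [hn]; exact hf
  have e1 : GD (Finset.Ico 1 N) (fun n : ℕ => f n * (((n:ℝ) ^ (-σ) : ℝ) : ℂ)) (fun n : ℕ => Real.log n) u
      = ∑ n ∈ Finset.range N, LSeries.term f ((σ:ℂ) + (u:ℂ) * Complex.I) n := by
    rw [Finset.range_eq_Ico, Finset.sum_eq_sum_Ico_succ_bot (by omega), LSeries.term_zero, zero_add]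
    unfold GD
    exact Finset.sum_congr rfl fun n _ => by rw [term_ee f hσ]
  have e2 : LSeries f ((σ:ℂ) + (u:ℂ) * Complex.I)
      = ∑ n ∈ Finset.range N, LSeries.term f ((σ:ℂ) + (u:ℂ) * Complex.I) n
        + ∑' n, LSeries.term f ((σ:ℂ) + (u:ℂ) * Complex.I) (n + N) :=
    (hs.of_norm.sum_add_tsum_nat_add N).symm
  rw [e1, e2, add_sub_cancel_left]
  have hs' : Summable fun n => ‖LSeries.term f ((σ:ℂ) + (u:ℂ) * Complex.I) (n + N)‖ :=
    hs.comp_injective (add_left_injective N)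
  refine (norm_tsum_le_tsum_norm hs').trans ?_
  simp_rw [hn]
  exact hN₀ N ((le_max_left _ _).trans hN)

lemma Lam_summable {y : ℝ} (hy : 1 ≤ y) {q : ℕ} (χ : DirichletCharacter ℂ q) :
    Summable fun n : ℕ => ‖χ n * (ArithmeticFunction.vonMangoldt n : ℂ)‖ * (n:ℝ) ^ (-(1 + 1 / y)) := by
  refine summable_of_sum_le (c := 2 * ((Real.log 4 + 4) * Real.exp 1) * y) (fun n => by positivity) fun s => ?_
  refine (Finset.sum_le_sum fun n _ => ?_).trans
    (pow_sum_le _ (fun _ => ArithmeticFunction.vonMangoldt_nonneg) block_Lam hy s)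
  refine mul_le_mul_of_nonneg_right ?_ (by positivity)
  rw [norm_mul, Complex.norm_real, Real.norm_of_nonneg ArithmeticFunction.vonMangoldt_nonneg]
  exact mul_le_of_le_one_left ArithmeticFunction.vonMangoldt_nonneg (χ.norm_le_one _)

lemma norm_chi_Lam {q : ℕ} (χ : DirichletCharacter ℂ q) (n : ℕ) :
    ‖χ n * (ArithmeticFunction.vonMangoldt n : ℂ)‖ ≤ ArithmeticFunction.vonMangoldt n := by
  rw [norm_mul, Complex.norm_real, Real.norm_of_nonneg ArithmeticFunction.vonMangoldt_nonneg]
  exact mul_le_of_le_one_left ArithmeticFunction.vonMangoldt_nonneg (χ.norm_le_one _)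

lemma Lam_near {y : ℝ} (hy : 1 ≤ y) (x : ℝ) (hx : 0 ≤ x) (s : Finset ℕ) :
    ∑ n ∈ s, ArithmeticFunction.vonMangoldt n * (n:ℝ) ^ (-(1 + 1 / y)) * Real.exp (-|x - Real.log n|)
      ≤ (Real.log 4 + 4) * Real.exp 1 * (Real.exp 1 * 3) := by
  have hy0 : 0 < y := by linarith
  have hr0 : 0 ≤ Real.exp (-1) := (Real.exp_pos _).le
  have hr1 : Real.exp (-1) < 1 / 2 := by
    rw [Real.exp_neg, one_div]
    exact inv_strictAnti₀ (by norm_num) (by linarith [Real.exp_one_gt_d9])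
  have h := block_gen _ (fun _ => ArithmeticFunction.vonMangoldt_nonneg) block_Lam
    (fun n => Real.exp (-|x - Real.log n|)) (fun k => Real.exp 1 * Real.exp (-1) ^ (max ⌊x⌋₊ k - min ⌊x⌋₊ k))
    (fun k => by positivity) (fun n hn => by
      rw [← Real.exp_nat_mul, ← Real.exp_add]
      refine Real.exp_le_exp.2 ?_
      have hl := Real.log_nonneg (show (1:ℝ) ≤ n by exact_mod_cast hn)
      have h1 : ((fl n : ℕ) : ℝ) ≤ Real.log n := Nat.floor_le hl
      have h2 : Real.log n < ((fl n : ℕ) : ℝ) + 1 := Nat.lt_floor_add_one _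
      have h3 := Nat.floor_le hx
      have h4 := Nat.lt_floor_add_one x
      rcases le_total ⌊x⌋₊ (fl n) with h | h
      · rw [max_eq_right h, min_eq_left h, Nat.cast_sub h]
        have := neg_abs_le (x - Real.log n); linarith
      · rw [max_eq_left h, min_eq_right h, Nat.cast_sub h]
        have := le_abs_self (x - Real.log n); linarith) s
  refine (Finset.sum_le_sum fun n _ => ?_).trans (h.trans ?_)
  · refine mul_le_mul_of_nonneg_right ?_ (Real.exp_pos _).le
    rw [div_eq_mul_inv (ArithmeticFunction.vonMangoldt n)]
    refine mul_le_mul_of_nonneg_left ?_ ArithmeticFunction.vonMangoldt_nonneg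
    rcases Nat.eq_zero_or_pos n with h0 | h0
    · subst h0; rw [Nat.cast_zero, Real.zero_rpow (by
        have : 0 < 1 / y := by positivity
        exact (by linarith : -(1 + 1 / y) < 0).ne)]; simp
    · rw [← Real.rpow_neg_one (n:ℝ)]
      exact Real.rpow_le_rpow_of_exponent_le (show (1:ℝ) ≤ n from Nat.one_le_cast.2 h0)
        (by have : 0 < 1 / y := by positivity
            linarith)
  · refine mul_le_mul_of_nonneg_left ?_ (by have := Real.log_nonneg (show (1:ℝ) ≤ 4 by norm_num); positivity)
    rw [← Finset.mul_sum]
    refine mul_le_mul_of_nonneg_left ?_ (Real.exp_pos _).le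
    refine (sum_geom_abs hr0 (by linarith) _ _).trans ?_
    rw [div_le_iff₀ (by linarith)]; linarith

lemma log_summable {y : ℝ} (hy : 1 ≤ y) (f : ℕ → ℂ) (hf : ∀ n, ‖f n‖ ≤ 1) :
    Summable fun n : ℕ => ‖LSeries.logMul f n‖ * (n:ℝ) ^ (-(1 + 1 / y)) := by
  have hy0 : 0 < y := by linarith
  have hσ : 0 < 1 + 1 / y := by positivity
  have h := LSeriesSummable_logMul_of_lt_re (f := f) (s := ((1 + 1 / y : ℝ) : ℂ) + ((0:ℝ):ℂ) * Complex.I) (by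
    refine lt_of_le_of_lt (LSeries.abscissaOfAbsConv_le_of_le_const ⟨1, fun n _ => hf n⟩) ?_
    have : 0 < 1 / y := by positivity
    simp only [Complex.add_re, Complex.ofReal_re, Complex.mul_re, Complex.I_re, Complex.ofReal_im, Complex.I_im]
    norm_num
    exact_mod_cast (show (1:ℝ) < 1 + y⁻¹ by rw [one_div] at this; linarith))
  refine h.norm.congr fun n => ?_
  rw [term_ee _ hσ, norm_mul, norm_mul, norm_ee, mul_one, Complex.norm_real, Real.norm_eq_abs,
      abs_of_nonneg (Real.rpow_nonneg (Nat.cast_nonneg _) _)]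

lemma logMul_eq {q : ℕ} [NeZero q] (χ : DirichletCharacter ℂ q) {s : ℂ} (hs : 1 < s.re) :
    LSeries (LSeries.logMul (mc χ)) s
      = - (LSeries (mc χ) s * LSeries (fun n => χ n * (ArithmeticFunction.vonMangoldt n : ℂ)) s) := by
  have hab : ∀ f : ℕ → ℂ, (∀ n, ‖f n‖ ≤ 1) → LSeries.abscissaOfAbsConv f < s.re := fun f hf =>
    lt_of_le_of_lt (LSeries.abscissaOfAbsConv_le_of_le_const ⟨1, fun n _ => hf n⟩) (by exact_mod_cast hs)
  have h1 := LSeries_hasDerivAt (hab _ (norm_mc χ))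
  have h2 := LSeries_hasDerivAt (hab (fun n => χ n) (fun n => χ.norm_le_one _))
  have h3 := DirichletCharacter.LSeries_twist_vonMangoldt_eq χ hs
  have h4 := h2.mul h1
  have h5 : (fun z => LSeries (fun n => χ n) z * LSeries (mc χ) z) =ᶠ[𝓝 s] fun _ => 1 := by
    filter_upwards [(isOpen_lt continuous_const Complex.continuous_re).mem_nhds hs] with z hz
    exact mc_mul χ hz
  have h6 := (h4.congr_of_eventuallyEq (h5.symm)).unique (hasDerivAt_const s (1:ℂ))
  have h7 := mc_mul χ hs
  have hL := left_ne_zero_of_mul_eq_one h7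
  rw [h2.deriv] at h3
  have h8 : LSeries (fun n => χ n * (ArithmeticFunction.vonMangoldt n : ℂ)) s
    = LSeries (LSeries.logMul fun n => χ n) s / LSeries (fun n => χ n) s := by
    rw [neg_neg] at h3; exact h3
  rw [h8]
  field_simp
  linear_combination (-1:ℂ) * h6

lemma GD_shift {ι : Type*} (s : Finset ι) (c : ι → ℂ) (l : ι → ℝ) (t τ : ℝ) :
    GD s (fun n => c n * ee (-(t * l n))) l τ = GD s c l (t + τ) := by
  unfold GD
  refine Finset.sum_congr rfl fun n _ => ?_
  rw [mul_assoc, ← ee_add]; congr 2; ring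

/-- Chebyshev block constant -/
def CL : ℝ := (Real.log 4 + 4) * Real.exp 1

lemma CL_pos : 0 < CL := by
  have := Real.log_nonneg (show (1:ℝ) ≤ 4 by norm_num); unfold CL; positivity

/-- coefficients of the twisted von Mangoldt series -/
def cL {q : ℕ} (χ : DirichletCharacter ℂ q) (y : ℝ) (n : ℕ) : ℂ :=
  χ n * (ArithmeticFunction.vonMangoldt n : ℂ) * (((n:ℝ) ^ (-(1 + 1 / y)) : ℝ) : ℂ)

/-- coefficients of the logarithmically weighted series -/
def cM {q : ℕ} (χ : DirichletCharacter ℂ q) (y t : ℝ) (n : ℕ) : ℂ :=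
  LSeries.logMul (mc χ) n * (((n:ℝ) ^ (-(1 + 1 / y)) : ℝ) : ℂ) * ee (-(t * Real.log n))

lemma cL_norm {q : ℕ} (χ : DirichletCharacter ℂ q) (y : ℝ) (n : ℕ) :
    ‖cL χ y n‖ ≤ ArithmeticFunction.vonMangoldt n * (n:ℝ) ^ (-(1 + 1 / y)) := by
  unfold cL
  rw [norm_mul, Complex.norm_real, Real.norm_eq_abs, abs_of_nonneg (Real.rpow_nonneg (Nat.cast_nonneg _) _)]
  exact mul_le_mul_of_nonneg_right (norm_chi_Lam χ n) (Real.rpow_nonneg (Nat.cast_nonneg _) _)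

lemma ms_Lam {q : ℕ} (χ : DirichletCharacter ℂ q) {y : ℝ} (hy : 1 ≤ y) (t : ℝ) (N : ℕ) :
    ∫ τ, ‖GD (Finset.Ico 1 N) (cL χ y) (fun n : ℕ => Real.log n) (t + τ)‖ ^ 2 * (1 + (1 * τ) ^ 2)⁻¹
      ≤ Real.pi * (CL * (Real.exp 1 * 3) * (2 * CL * y)) := by
  have hC := CL_pos
  simp_rw [← GD_shift]
  refine (PL_le _ _ _ one_pos).trans ?_
  rw [div_one]
  refine mul_le_mul_of_nonneg_left ?_ Real.pi_pos.le
  have h1 : ∀ i ∈ Finset.Ico 1 N, ∑ j ∈ Finset.Ico 1 N, ‖cL χ y i * ee (-(t * Real.log i))‖ *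
      ‖cL χ y j * ee (-(t * Real.log j))‖ * Real.exp (-(|Real.log i - Real.log j| / 1))
      ≤ ‖cL χ y i‖ * (CL * (Real.exp 1 * 3)) := by
    intro i hi
    have hi1 : 1 ≤ i := (Finset.mem_Ico.1 hi).1
    simp_rw [norm_mul (cL _ _ _), norm_ee, mul_one, div_one, mul_assoc, ← Finset.mul_sum]
    refine mul_le_mul_of_nonneg_left ?_ (norm_nonneg _)
    refine (Finset.sum_le_sum fun j _ => mul_le_mul_of_nonneg_right (cL_norm χ y j) (Real.exp_pos _).le).trans ?_
    refine (Lam_near hy _ (Real.log_nonneg (by exact_mod_cast hi1)) _).trans (le_of_eq ?_)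
    unfold CL; ring
  refine (Finset.sum_le_sum h1).trans ?_
  rw [← Finset.sum_mul, mul_comm]
  refine mul_le_mul_of_nonneg_left ?_ (by positivity)
  exact (Finset.sum_le_sum fun n _ => cL_norm χ y n).trans
    (pow_sum_le _ (fun _ => ArithmeticFunction.vonMangoldt_nonneg) block_Lam hy _)

lemma GA_small {q : ℕ} [NeZero q] (χ : DirichletCharacter ℂ q) {ε : ℝ} (hε : 0 < ε) :
    ∃ y₁ : ℝ, ∀ y ≥ y₁, ∀ t : ℝ, |t| ≤ Real.exp (2 * y) → ∃ N₀ : ℕ, ∀ N ≥ N₀,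
      ∫ u, ‖GA (Finset.Ico 1 N) (cM χ y t) (fun n : ℕ => Real.log n) 1 u‖ ^ 2 ≤ ε * y ^ 3 := by
  have hC := CL_pos
  have hpi := Real.pi_pos
  set A : ℝ := 4 * (Real.pi * (CL * (Real.exp 1 * 3) * (2 * CL))) + 4 * Real.pi with hA
  have hA0 : 0 < A := by positivity
  set η : ℝ := Real.sqrt (ε / A) with hη
  have hη0 : 0 < η := Real.sqrt_pos.2 (by positivity)
  have hη2 : η ^ 2 = ε / A := Real.sq_sqrt (by positivity)
  obtain ⟨y₁, hF⟩ := mc_small χ hη0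
  set B : ℝ := 2 * Real.pi + 144 * (2 * CL) ^ 2 * Real.pi with hB
  have hB0 : 0 < B := by positivity
  refine ⟨max (max y₁ 1) (B / ε), fun y hy t ht => ?_⟩
  have hy1 : y₁ ≤ y := (le_max_left _ _).trans ((le_max_left _ _).trans hy)
  have hy2 : 1 ≤ y := (le_max_right _ _).trans ((le_max_left _ _).trans hy)
  have hy3 : B ≤ ε * y := by
    have := (le_max_right _ _).trans hy
    rw [div_le_iff₀ hε] at this; linarith
  have hy0 : 0 < y := by linarith
  have hσ : 0 < 1 + 1 / y := by positivity
  obtain ⟨N₁, hN₁⟩ := trunc _ hσ (Lam_summable hy2 χ)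
  obtain ⟨N₂, hN₂⟩ := trunc _ hσ (log_summable hy2 (mc χ) (norm_mc χ))
  refine ⟨max N₁ N₂, fun N hN => ?_⟩
  set s := Finset.Ico 1 N with hs
  set l : ℕ → ℝ := fun n => Real.log n with hl
  set δ : ℝ := Real.exp (-(2 * y)) with hδ
  have hδ0 : 0 < δ := Real.exp_pos _
  have hδ1 : δ * Real.exp (2 * y) = 1 := by rw [hδ, ← Real.exp_add]; simp
  -- pointwise bound
  have hpt : ∀ τ, ‖GD s (cM χ y t) l τ‖ ^ 2 * (1 + (1 * τ) ^ 2)⁻¹ ≤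
      4 * η ^ 2 * y ^ 2 * (‖GD s (cL χ y) l (t + τ)‖ ^ 2 * (1 + (1 * τ) ^ 2)⁻¹)
      + (4 * η ^ 2 * y ^ 2 + 2) * (1 + (1 * τ) ^ 2)⁻¹
      + 144 * (2 * CL) ^ 2 * y ^ 4 * δ ^ 2 * (1 + (δ * τ) ^ 2)⁻¹ := by
    intro τ
    have e1 : GD s (cM χ y t) l τ = GD s (fun n : ℕ => LSeries.logMul (mc χ) n *
        (((n:ℝ) ^ (-(1 + 1 / y)) : ℝ) : ℂ)) l (t + τ) := GD_shift _ _ _ _ _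
    have b1 := hN₁ N ((le_max_left _ _).trans hN) (t + τ)
    have b2 := hN₂ N ((le_max_right _ _).trans hN) (t + τ)
    rw [← e1] at b2
    set z : ℂ := ((1 + 1 / y : ℝ) : ℂ) + ((t + τ : ℝ) : ℂ) * Complex.I with hz
    have hre : z.re = 1 + 1 / y := by simp [hz]
    have hz1 : 1 < z.re := by
      have : 0 < 1 / y := by positivity
      rw [hre]; linarith
    rw [logMul_eq χ hz1] at b2
    have hX1 := norm_sub_norm_le (LSeries (fun n => χ n * (ArithmeticFunction.vonMangoldt n : ℂ)) z) (GD s (cL χ y) l (t + τ))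
    have hX2 := norm_sub_norm_le (GD s (cM χ y t) l τ) (-(LSeries (mc χ) z * LSeries (fun n => χ n * (ArithmeticFunction.vonMangoldt n : ℂ)) z))
    rw [norm_sub_rev (GD s (cM χ y t) l τ), norm_neg, norm_mul] at hX2
    have c1 : ‖LSeries (fun n => χ n * (ArithmeticFunction.vonMangoldt n : ℂ)) z‖ ≤ ‖GD s (cL χ y) l (t + τ)‖ + 1 := by
      have : ‖LSeries (fun n => χ n * (ArithmeticFunction.vonMangoldt n : ℂ)) z - GD s (cL χ y) l (t + τ)‖ ≤ 1 := b1
      linarith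
    have c2 : ‖LSeries (fun n => χ n * (ArithmeticFunction.vonMangoldt n : ℂ)) z‖ ≤ 2 * CL * y :=
      LS_le _ _ (fun _ => ArithmeticFunction.vonMangoldt_nonneg) (norm_chi_Lam χ) block_Lam hy2 _
    have c3 : ‖LSeries (mc χ) z‖ ≤ 6 * y := LS_one (norm_mc χ) hy2 _
    have c4 : |τ| ≤ Real.exp (2 * y) → ‖LSeries (mc χ) z‖ ≤ η * y := by
      intro hτ
      refine hF y hy1 (t + τ) ?_
      calc |t + τ| ≤ |t| + |τ| := abs_add_le _ _
        _ ≤ 2 * Real.exp (2 * y) := by linarith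
        _ ≤ Real.exp y * Real.exp (2 * y) := by
          refine mul_le_mul_of_nonneg_right ?_ (Real.exp_pos _).le
          have := Real.add_one_le_exp y; linarith
        _ = Real.exp (3 * y) := by rw [← Real.exp_add]; congr 1; ring
    set G := ‖GD s (cM χ y t) l τ‖
    set P := ‖GD s (cL χ y) l (t + τ)‖
    set La := ‖LSeries (fun n => χ n * (ArithmeticFunction.vonMangoldt n : ℂ)) z‖
    set Fn := ‖LSeries (mc χ) z‖
    have hG0 : 0 ≤ G := norm_nonneg _
    have hP0 : 0 ≤ P := norm_nonneg _
    have hLa0 : 0 ≤ La := norm_nonneg _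
    have hFn0 : 0 ≤ Fn := norm_nonneg _
    have hGl : G ≤ Fn * La + 1 := by linarith
    have hG2 : G ^ 2 ≤ 2 * (Fn * La) ^ 2 + 2 := by
      calc G ^ 2 ≤ (Fn * La + 1) ^ 2 := pow_le_pow_left₀ hG0 hGl 2
        _ ≤ 2 * (Fn * La) ^ 2 + 2 := by nlinarith only [sq_nonneg (Fn * La - 1)]
    set V := (1 + (1 * τ) ^ 2)⁻¹ with hV
    have hV0 : 0 < V := by positivity
    have hU0 : 0 < (1 + (δ * τ) ^ 2)⁻¹ := by positivity
    have step : G ^ 2 * V ≤ (2 * (Fn * La) ^ 2 + 2) * V := mul_le_mul_of_nonneg_right hG2 hV0.le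
    by_cases hτ : |τ| ≤ Real.exp (2 * y)
    · have d1 : (Fn * La) ^ 2 ≤ (η * y * (P + 1)) ^ 2 :=
        pow_le_pow_left₀ (by positivity) (mul_le_mul (c4 hτ) c1 hLa0 (by positivity)) 2
      have d2 : (η * y * (P + 1)) ^ 2 ≤ η ^ 2 * y ^ 2 * (2 * P ^ 2 + 2) := by
        rw [mul_pow, mul_pow]
        exact mul_le_mul_of_nonneg_left (by nlinarith only [sq_nonneg (P - 1)]) (by positivity)
      have d3 : (2 * (Fn * La) ^ 2 + 2) * V ≤ (2 * (η ^ 2 * y ^ 2 * (2 * P ^ 2 + 2)) + 2) * V :=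
        mul_le_mul_of_nonneg_right (by linarith) hV0.le
      have d4 : 0 ≤ 144 * (2 * CL) ^ 2 * y ^ 4 * δ ^ 2 * (1 + (δ * τ) ^ 2)⁻¹ := by positivity
      have d5 : (2 * (η ^ 2 * y ^ 2 * (2 * P ^ 2 + 2)) + 2) * V
        = 4 * η ^ 2 * y ^ 2 * (P ^ 2 * V) + (4 * η ^ 2 * y ^ 2 + 2) * V := by ring
      linarith
    · push Not at hτ
      have d1 : (Fn * La) ^ 2 ≤ (6 * y * (2 * CL * y)) ^ 2 :=
        pow_le_pow_left₀ (by positivity) (mul_le_mul c3 c2 hLa0 (by positivity)) 2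
      have d2 : V ≤ 2 * δ ^ 2 * (1 + (δ * τ) ^ 2)⁻¹ := by
        have hδτ : 1 ≤ (δ * τ) ^ 2 := by
          rw [← sq_abs, abs_mul, abs_of_pos hδ0]
          refine one_le_pow₀ ?_
          rw [← hδ1]; exact mul_le_mul_of_nonneg_left hτ.le hδ0.le
        rw [hV, ← div_eq_mul_inv, le_div_iff₀ (by positivity), inv_mul_le_iff₀ (by positivity)]
        nlinarith only [hδτ, sq_nonneg δ]
      have d3 : (2 * (Fn * La) ^ 2 + 2) * V ≤ 2 * (6 * y * (2 * CL * y)) ^ 2 * (2 * δ ^ 2 * (1 + (δ * τ) ^ 2)⁻¹) + 2 * V := by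
        have : (Fn * La) ^ 2 * V ≤ (6 * y * (2 * CL * y)) ^ 2 * (2 * δ ^ 2 * (1 + (δ * τ) ^ 2)⁻¹) :=
          mul_le_mul d1 d2 hV0.le (by positivity)
        linarith
      have d4 : 0 ≤ 4 * η ^ 2 * y ^ 2 * (P ^ 2 * V) + (4 * η ^ 2 * y ^ 2) * V := by positivity
      have d5 : 2 * (6 * y * (2 * CL * y)) ^ 2 * (2 * δ ^ 2 * (1 + (δ * τ) ^ 2)⁻¹)
        = 144 * (2 * CL) ^ 2 * y ^ 4 * δ ^ 2 * (1 + (δ * τ) ^ 2)⁻¹ := by ring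
      linarith
  have i1 : Integrable fun τ => ‖GD s (cL χ y) l (t + τ)‖ ^ 2 * (1 + (1 * τ) ^ 2)⁻¹ := by
    simp_rw [← GD_shift]; exact integrable_GD_sq _ _ _ one_pos
  have i2 := integrable_cauchy_scaled one_pos
  have i3 := integrable_cauchy_scaled hδ0
  have j : ∀ {r : ℝ}, 0 < r → ∫ τ : ℝ, (1 + (r * τ) ^ 2)⁻¹ = Real.pi / r := by
    intro r hr
    have := Measure.integral_comp_mul_left (fun τ : ℝ => (1 + τ ^ 2)⁻¹) r
    rw [integral_univ_inv_one_add_sq, abs_of_pos (inv_pos.2 hr)] at this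
    rw [this, smul_eq_mul]; field_simp
  have hInt := integral_mono (integrable_GD_sq s (cM χ y t) l one_pos)
    (((i1.const_mul (4 * η ^ 2 * y ^ 2)).add (i2.const_mul (4 * η ^ 2 * y ^ 2 + 2))).add
      (i3.const_mul (144 * (2 * CL) ^ 2 * y ^ 4 * δ ^ 2))) hpt
  rw [PL s _ l one_pos] at hInt
  have hsplit : ∫ τ, (4 * η ^ 2 * y ^ 2 * (‖GD s (cL χ y) l (t + τ)‖ ^ 2 * (1 + (1 * τ) ^ 2)⁻¹)
      + (4 * η ^ 2 * y ^ 2 + 2) * (1 + (1 * τ) ^ 2)⁻¹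
      + 144 * (2 * CL) ^ 2 * y ^ 4 * δ ^ 2 * (1 + (δ * τ) ^ 2)⁻¹)
      = 4 * η ^ 2 * y ^ 2 * (∫ τ, ‖GD s (cL χ y) l (t + τ)‖ ^ 2 * (1 + (1 * τ) ^ 2)⁻¹)
      + (4 * η ^ 2 * y ^ 2 + 2) * (Real.pi / 1) + 144 * (2 * CL) ^ 2 * y ^ 4 * δ ^ 2 * (Real.pi / δ) := by
    have i12 : Integrable fun τ => 4 * η ^ 2 * y ^ 2 * (‖GD s (cL χ y) l (t + τ)‖ ^ 2 * (1 + (1 * τ) ^ 2)⁻¹)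
      + (4 * η ^ 2 * y ^ 2 + 2) * (1 + (1 * τ) ^ 2)⁻¹ := (i1.const_mul _).add (i2.const_mul _)
    rw [integral_add i12 (i3.const_mul _),
      integral_add (i1.const_mul _) (i2.const_mul _), integral_const_mul, integral_const_mul,
      integral_const_mul, j one_pos, j hδ0]
  have hInt2 : 2 * Real.pi / 1 ^ 2 * ∫ u, ‖GA s (cM χ y t) l 1 u‖ ^ 2 ≤ _ := hInt.trans_eq hsplit
  set I := ∫ u, ‖GA s (cM χ y t) l 1 u‖ ^ 2 with hI
  have hI0 : 0 ≤ I := integral_nonneg fun u => by positivity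
  have k1 : 4 * η ^ 2 * y ^ 2 * (∫ τ, ‖GD s (cL χ y) l (t + τ)‖ ^ 2 * (1 + (1 * τ) ^ 2)⁻¹)
      ≤ 4 * η ^ 2 * y ^ 2 * (Real.pi * (CL * (Real.exp 1 * 3) * (2 * CL * y))) :=
    mul_le_mul_of_nonneg_left (ms_Lam χ hy2 t N) (by positivity)
  have k2 : 144 * (2 * CL) ^ 2 * y ^ 4 * δ ^ 2 * (Real.pi / δ) ≤ 144 * (2 * CL) ^ 2 * Real.pi * y ^ 2 := by
    have e : 144 * (2 * CL) ^ 2 * y ^ 4 * δ ^ 2 * (Real.pi / δ) = 144 * (2 * CL) ^ 2 * Real.pi * y ^ 2 * (y ^ 2 * δ) := by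
      field_simp
    rw [e]
    refine mul_le_of_le_one_right (by positivity) ?_
    rw [← hδ1, mul_comm]
    refine mul_le_mul_of_nonneg_left ?_ hδ0.le
    have := Real.add_one_le_exp y
    calc y ^ 2 ≤ (Real.exp y) ^ 2 := pow_le_pow_left₀ hy0.le (by linarith) 2
      _ = Real.exp (2 * y) := by rw [← Real.exp_nat_mul]; norm_num
  have k3 : 4 * η ^ 2 * y ^ 2 * Real.pi ≤ 4 * η ^ 2 * y ^ 3 * Real.pi := by
    refine mul_le_mul_of_nonneg_right (mul_le_mul_of_nonneg_left ?_ (by positivity)) hpi.le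
    exact pow_le_pow_right₀ hy2 (by norm_num)
  have hyy : (1:ℝ) ≤ y ^ 2 := one_le_pow₀ hy2
  have k4 : 2 * Real.pi ≤ 2 * Real.pi * y ^ 2 := le_mul_of_one_le_right (by positivity) hyy
  have k5 : B * y ^ 2 ≤ ε * y ^ 3 := by
    calc B * y ^ 2 ≤ (ε * y) * y ^ 2 := mul_le_mul_of_nonneg_right hy3 (by positivity)
      _ = ε * y ^ 3 := by ring
  have k6 : η ^ 2 * A = ε := by rw [hη2]; field_simp
  have k7 : 4 * η ^ 2 * y ^ 2 * (Real.pi * (CL * (Real.exp 1 * 3) * (2 * CL * y))) + 4 * η ^ 2 * y ^ 3 * Real.pi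
      = ε * y ^ 3 := by rw [← k6, hA]; ring
  have k8 : B * y ^ 2 = 2 * Real.pi * y ^ 2 + 144 * (2 * CL) ^ 2 * Real.pi * y ^ 2 := by rw [hB]; ring
  have k9 : 2 * I ≤ 2 * Real.pi / 1 ^ 2 * I := by
    rw [one_pow, div_one]
    exact mul_le_mul_of_nonneg_right (by linarith [Real.pi_gt_three]) hI0
  have k10 : (4 * η ^ 2 * y ^ 2 + 2) * (Real.pi / 1) = 4 * η ^ 2 * y ^ 2 * Real.pi + 2 * Real.pi := by ring
  linarith

/-- derivative of the window -/
def kd (s : ℝ) : ℝ := (if s < 0 then 1 else 0) - (if 2 < s then 1 else 0)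

/-- deconvolution kernel -/
def kap (s : ℝ) : ℝ := w s + kd s

lemma kap_bd (s : ℝ) : |kap s| ≤ 2 := by
  have h1 := w_nonneg s
  have h2 := w_le_one s
  unfold kap kd
  rw [abs_le]
  split_ifs <;> constructor <;> linarith

lemma kap_meas : Measurable kap := by
  unfold kap kd
  refine continuous_w.measurable.add (Measurable.sub ?_ ?_)
  · exact Measurable.ite measurableSet_Iio measurable_const measurable_const
  · exact Measurable.ite measurableSet_Ioi measurable_const measurable_const

lemma w_deriv {s : ℝ} (h : s ∈ Set.Ioo (-1:ℝ) 3) (h0 : s ≠ 0) (h2 : s ≠ 2) : HasDerivAt w (kd s) s := by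
  rcases lt_or_gt_of_ne h0 with a | a
  · have e : w =ᶠ[𝓝 s] fun x => x + 1 := by
      filter_upwards [Ioo_mem_nhds h.1 a] with x hx
      unfold w
      rw [min_eq_left (a := x + 1) (by linarith [hx.2]), min_eq_right (by linarith [hx.2]), max_eq_right (by linarith [hx.1])]
    have : kd s = 1 := by unfold kd; rw [if_pos a, if_neg (by linarith)]; norm_num
    rw [this]
    exact ((hasDerivAt_id s).add_const 1).congr_of_eventuallyEq e
  rcases lt_or_gt_of_ne h2 with b | b
  · have e : w =ᶠ[𝓝 s] fun _ => 1 := by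
      filter_upwards [Ioo_mem_nhds a b] with x hx
      exact w_eq_one hx.1.le hx.2.le
    have : kd s = 0 := by unfold kd; rw [if_neg (by linarith), if_neg (by linarith)]; norm_num
    rw [this]
    exact (hasDerivAt_const s 1).congr_of_eventuallyEq e
  · have e : w =ᶠ[𝓝 s] fun x => 3 - x := by
      filter_upwards [Ioo_mem_nhds b h.2] with x hx
      unfold w
      rw [min_eq_right (a := x + 1) (by linarith [hx.1]), min_eq_right (by linarith [hx.1]), max_eq_right (by linarith [hx.2])]
    have : kd s = -1 := by unfold kd; rw [if_neg (by linarith), if_pos b]; norm_num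
    rw [this]
    simpa using ((hasDerivAt_id s).const_sub 3).congr_of_eventuallyEq e

lemma ii_bdd {E : Type*} [NormedAddCommGroup E] [MeasurableSpace E] [BorelSpace E]
    [SecondCountableTopology E] {f : ℝ → E} (hm : Measurable f) {C : ℝ}
    (hb : ∀ x, ‖f x‖ ≤ C) (a b : ℝ) : IntervalIntegrable f volume a b := by
  rw [intervalIntegrable_iff]
  exact Measure.integrableOn_of_bounded (by simp [Set.uIoc]) hm.aestronglyMeasurable (ae_of_all _ hb)

/-- one-sided exponential -/
def E1 (x : ℝ) : ℝ := if 0 < x then Real.exp (-x) else 0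

lemma E1_meas : Measurable E1 :=
  Measurable.ite measurableSet_Ioi (Real.measurable_exp.comp measurable_neg) measurable_const

lemma E1_bd (x : ℝ) : |E1 x| ≤ 1 := by
  unfold E1
  split_ifs with h
  · rw [abs_of_pos (Real.exp_pos _)]; exact Real.exp_le_one_iff.2 (by linarith)
  · simp

lemma kap_int (x : ℝ) : ∫ s in (-1:ℝ)..3, kap s * E1 (x - s) = w x := by
  have h := integral_eq_of_hasDerivAt_off_countable_of_le
    (fun s => Real.exp (min s x - x) * w (min s x)) (fun s => kap s * E1 (x - s))
    (show (-1:ℝ) ≤ 3 by norm_num) (s := {0, 2, x}) (Set.toFinite _).countable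
    (by have := continuous_w; exact Continuous.continuousOn (by fun_prop)) ?_ ?_
  · rw [h]
    have e1 : w (min (-1) x) = 0 := w_eq_zero_left (min_le_left _ _)
    rw [e1, mul_zero, sub_zero]
    rcases le_total x 3 with h3 | h3
    · rw [min_eq_right h3]; simp
    · rw [min_eq_left h3, w_eq_zero_right h3, w_eq_zero_right le_rfl, mul_zero]
  · rintro s ⟨hs, hs'⟩
    simp only [Set.mem_insert_iff, Set.mem_singleton_iff, not_or] at hs'
    obtain ⟨h0, h2, hx⟩ := hs'
    rcases lt_or_gt_of_ne hx with a | a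
    · have e : (fun s => Real.exp (min s x - x) * w (min s x)) =ᶠ[𝓝 s] fun s => Real.exp (s - x) * w s := by
        filter_upwards [Iio_mem_nhds a] with r hr
        rw [min_eq_left (le_of_lt hr)]
      have d := (((hasDerivAt_id s).sub_const x).exp.mul (w_deriv hs h0 h2)).congr_of_eventuallyEq e
      convert d using 1
      unfold kap E1
      rw [if_pos (by linarith), neg_sub]; simp; ring
    · have e : (fun s => Real.exp (min s x - x) * w (min s x)) =ᶠ[𝓝 s] fun _ => Real.exp (x - x) * w x := by
        filter_upwards [Ioi_mem_nhds a] with r hr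
        rw [min_eq_right (le_of_lt hr)]
      have d := (hasDerivAt_const s (Real.exp (x - x) * w x)).congr_of_eventuallyEq e
      convert d using 1
      unfold E1
      rw [if_neg (by linarith), mul_zero]
  · refine ii_bdd (kap_meas.mul (E1_meas.comp (measurable_const.sub measurable_id))) (C := 2 * 1) (fun s => ?_) _ _
    simp only [Pi.mul_apply, Function.comp_apply, norm_mul]
    exact mul_le_mul (kap_bd s) (E1_bd _) (norm_nonneg _) (by norm_num)

lemma GA_eq {ι : Type*} (s : Finset ι) (c : ι → ℂ) (l : ι → ℝ) (u : ℝ) :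
    GA s c l 1 u = ∑ i ∈ s, c i * ((E1 (l i - u) : ℝ) : ℂ) := by
  unfold GA E1
  simp only [div_one, sub_pos]

lemma GA_meas {ι : Type*} (s : Finset ι) (c : ι → ℂ) (l : ι → ℝ) : Measurable (GA s c l 1) := by
  have : GA s c l 1 = fun u => ∑ i ∈ s, c i * ((E1 (l i - u) : ℝ) : ℂ) := funext (GA_eq s c l)
  rw [this]
  exact Finset.measurable_fun_sum _ fun i _ => measurable_const.mul
    (Complex.measurable_ofReal.comp (E1_meas.comp (measurable_const.sub measurable_id)))

lemma GA_bd {ι : Type*} (s : Finset ι) (c : ι → ℂ) (l : ι → ℝ) (u : ℝ) :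
    ‖GA s c l 1 u‖ ≤ ∑ i ∈ s, ‖c i‖ := by
  rw [GA_eq]
  refine norm_sum_le_of_le _ fun i _ => ?_
  rw [norm_mul, Complex.norm_real]
  exact mul_le_of_le_one_right (norm_nonneg _) (E1_bd _)

lemma T_bound {ι : Type*} (s : Finset ι) (c : ι → ℂ) (l : ι → ℝ) (u : ℝ) :
    ‖∑ i ∈ s, c i * ((w (l i - u) : ℝ) : ℂ)‖ ≤ 2 * ∫ v in (u - 1)..(u + 3), ‖GA s c l 1 v‖ := by
  have e : ∑ i ∈ s, c i * ((w (l i - u) : ℝ) : ℂ) = ∫ r in (-1:ℝ)..3, ((kap r : ℝ) : ℂ) * GA s c l 1 (u + r) := by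
    simp_rw [GA_eq, Finset.mul_sum]
    rw [intervalIntegral.integral_finsetSum]
    · refine Finset.sum_congr rfl fun i _ => ?_
      rw [← kap_int, ← intervalIntegral.integral_ofReal, ← intervalIntegral.integral_const_mul]
      refine intervalIntegral.integral_congr fun r _ => ?_
      rw [sub_add_eq_sub_sub]; push_cast; ring
    · intro i _
      refine ii_bdd ((Complex.measurable_ofReal.comp kap_meas).mul (measurable_const.mul
        (Complex.measurable_ofReal.comp (E1_meas.comp (measurable_const.sub (measurable_const.add measurable_id))))))
        (C := 2 * (‖c i‖ * 1)) (fun r => ?_) _ _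
      simp only [Pi.mul_apply, Function.comp_apply, norm_mul, Complex.norm_real]
      exact mul_le_mul (kap_bd r) (mul_le_mul_of_nonneg_left (E1_bd _) (norm_nonneg _)) (by positivity) (by norm_num)
  rw [e]
  have hi : IntervalIntegrable (fun r => 2 * ‖GA s c l 1 (u + r)‖) volume (-1) 3 := by
    refine ii_bdd (C := 2 * ∑ i ∈ s, ‖c i‖) (measurable_const.mul ((GA_meas s c l).comp (measurable_const.add measurable_id)).norm) (fun r => ?_) _ _
    simp only [Pi.mul_apply, Function.comp_apply, norm_mul, norm_norm, Real.norm_two]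
    exact mul_le_mul_of_nonneg_left (GA_bd _ _ _ _) (by norm_num)
  refine (intervalIntegral.norm_integral_le_of_norm_le (by norm_num) (ae_of_all _ fun r _ => ?_) hi).trans ?_
  · rw [norm_mul, Complex.norm_real]
    exact mul_le_mul_of_nonneg_right (kap_bd r) (norm_nonneg _)
  · rw [intervalIntegral.integral_const_mul, intervalIntegral.integral_comp_add_left (fun v => ‖GA s c l 1 v‖)]
    rw [← sub_eq_add_neg]

lemma slide {ψ : ℝ → ℝ} (hψ : ∀ a b, IntervalIntegrable ψ volume a b) (h0 : ∀ x, 0 ≤ ψ x) {y : ℝ} (hy : 0 ≤ y) :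
    ∫ u in (0:ℝ)..y, (∫ v in (u - 1)..(u + 3), ψ v) ≤ 4 * ∫ v in (-1:ℝ)..(y + 3), ψ v := by
  set P : ℝ → ℝ := fun x => ∫ v in (-1:ℝ)..x, ψ v with hP
  have hc : Continuous P := intervalIntegral.continuous_primitive hψ _
  have hi : ∀ a b, IntervalIntegrable P volume a b := fun a b => hc.intervalIntegrable a b
  have hmono : ∀ a b, a ≤ b → P a ≤ P b := by
    intro a b hab
    have := intervalIntegral.integral_add_adjacent_intervals (hψ (-1) a) (hψ a b)
    have h1 := intervalIntegral.integral_nonneg hab (fun x _ => h0 x) (μ := volume)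
    simp only [hP]; linarith
  have hP1 : P (-1) = 0 := by simp [hP]
  have e : ∀ u, (∫ v in (u - 1)..(u + 3), ψ v) = P (u + 3) - P (u - 1) := fun u =>
    (intervalIntegral.integral_interval_sub_left (hψ _ _) (hψ _ _)).symm
  simp_rw [e]
  have c3 : Continuous fun u => P (u + 3) := by fun_prop
  have c1 : Continuous fun u => P (u - 1) := by fun_prop
  rw [intervalIntegral.integral_sub (c3.intervalIntegrable _ _) (c1.intervalIntegrable _ _),
    intervalIntegral.integral_comp_add_right, intervalIntegral.integral_comp_sub_right]
  rw [zero_add, zero_sub]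
  have a1 := intervalIntegral.integral_add_adjacent_intervals (hi (-1) 3) (hi 3 (y + 3))
  have a2 := intervalIntegral.integral_add_adjacent_intervals (hi (-1) (y - 1)) (hi (y - 1) (y + 3))
  have b1 : 0 ≤ ∫ x in (-1:ℝ)..3, P x :=
    intervalIntegral.integral_nonneg (by norm_num) fun x hx => hP1 ▸ hmono _ _ hx.1
  have b2 : ∫ x in (y - 1)..(y + 3), P x ≤ ∫ x in (y - 1)..(y + 3), P (y + 3) :=
    intervalIntegral.integral_mono_on (by linarith) (hi _ _) (by simp) fun x hx => hmono _ _ hx.2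
  rw [intervalIntegral.integral_const, smul_eq_mul] at b2
  have : (y + 3 - (y - 1)) * P (y + 3) = 4 * P (y + 3) := by ring
  linarith

lemma continuous_R_u {f : ℕ → ℂ} (hf : ∀ n, ‖f n‖ ≤ 1) (t : ℝ) : Continuous fun u => R f u t := by
  rw [Metric.continuous_iff]
  intro b ε hε
  have he := Real.exp_pos 5
  refine ⟨min 1 (ε / Real.exp 5), lt_min one_pos (by positivity), fun a ha => ?_⟩
  rw [Real.dist_eq] at ha
  have h1 := ha.trans_le (min_le_left _ _)
  have h2 := ha.trans_le (min_le_right _ _)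
  rw [lt_div_iff₀ he] at h2
  have h3 := le_abs_self (a - b)
  have h4 := neg_abs_le (a - b)
  rw [dist_eq_norm]
  rcases le_total a b with h | h
  · have := norm_R_sub_le hf h (by linarith) t
    rw [abs_of_nonpos (by linarith)] at h2; nlinarith only [this, h2]
  · have := norm_R_sub_le hf h (by linarith) t
    rw [norm_sub_rev]
    rw [abs_of_nonneg (by linarith)] at h2; nlinarith only [this, h2]

lemma A_lip {α x z : ℝ} (hα : 0 < α) (hx : 0 ≤ x) (hz : 0 ≤ z) :
    |x * Real.exp (-(α * x)) - z * Real.exp (-(α * z))| ≤ |x - z| := by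
  have main : ∀ {x z : ℝ}, 0 ≤ x → x ≤ z →
      |x * Real.exp (-(α * x)) - z * Real.exp (-(α * z))| ≤ z - x := by
    intro x z hx hxz
    have e1 : Real.exp (-(α * z)) = Real.exp (-(α * x)) * Real.exp (-(α * (z - x))) := by
      rw [← Real.exp_add]; congr 1; ring
    have e2 : Real.exp (-(α * z)) ≤ 1 := Real.exp_le_one_iff.2 (by have := mul_nonneg hα.le (hx.trans hxz); linarith)
    have e3 : Real.exp (-(α * z)) ≤ Real.exp (-(α * x)) :=
      Real.exp_le_exp.2 (by have := mul_le_mul_of_nonneg_left hxz hα.le; linarith)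
    have e4 : 1 - Real.exp (-(α * (z - x))) ≤ α * (z - x) := by
      have := Real.add_one_le_exp (-(α * (z - x))); linarith
    have e5 : α * x * Real.exp (-(α * x)) ≤ 1 := by
      rw [Real.exp_neg, ← div_eq_mul_inv, div_le_one (Real.exp_pos _)]
      have := Real.add_one_le_exp (α * x); linarith
    have hE := Real.exp_pos (-(α * x))
    have hE' := Real.exp_pos (-(α * z))
    have hd : 0 ≤ z - x := by linarith
    rw [abs_le]
    constructor
    · have h1 : x * Real.exp (-(α * z)) ≤ x * Real.exp (-(α * x)) := mul_le_mul_of_nonneg_left e3 hx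
      have h2 : (z - x) * Real.exp (-(α * z)) ≤ (z - x) := mul_le_of_le_one_right hd e2
      nlinarith only [h1, h2]
    · have h1 : x * Real.exp (-(α * x)) * (1 - Real.exp (-(α * (z - x)))) ≤ x * Real.exp (-(α * x)) * (α * (z - x)) :=
        mul_le_mul_of_nonneg_left e4 (by positivity)
      have h2 : (α * x * Real.exp (-(α * x))) * (z - x) ≤ 1 * (z - x) := mul_le_mul_of_nonneg_right e5 hd
      have h3 : 0 ≤ (z - x) * Real.exp (-(α * z)) := by positivity
      have h4 : x * Real.exp (-(α * x)) - z * Real.exp (-(α * z)) = x * Real.exp (-(α * x)) * (1 - Real.exp (-(α * (z - x)))) - (z - x) * Real.exp (-(α * z)) := by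
        rw [e1]; ring
      rw [h4]; linarith
  rcases le_total x z with h | h
  · rw [abs_of_nonpos (show x - z ≤ 0 by linarith)]; exact (main hx h).trans (by linarith)
  · rw [abs_sub_comm, abs_of_nonneg (show 0 ≤ x - z by linarith)]; exact main hz h

lemma uR_le {q : ℕ} (χ : DirichletCharacter ℂ q) {y : ℝ} (hy : 1 ≤ y) (t : ℝ) {N : ℕ} (hN : NN (y + 3) ≤ N)
    {u : ℝ} (h0 : 0 ≤ u) (hu : u ≤ y) :
    u * ‖R (mc χ) u t‖ ≤ Real.exp 1 * (‖∑ n ∈ Finset.Ico 1 N, cM χ y t n * ((w (Real.log n - u) : ℝ) : ℂ)‖ + 3 * Real.exp 4) := by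
  have hy0 : 0 < y := by linarith
  have hα : 0 < 1 / y := by positivity
  set α := 1 / y with hαd
  have hR : R (mc χ) u t = D N (rc (mc χ) u) t :=
    R_eq _ _ _ (le_trans (by unfold NN; gcongr) hN)
  have hd : ‖((u * Real.exp (-(α * u)) : ℝ) : ℂ) * R (mc χ) u t - ∑ n ∈ Finset.Ico 1 N, cM χ y t n * ((w (Real.log n - u) : ℝ) : ℂ)‖
      ≤ 3 * Real.exp 4 := by
    rw [hR, D_def, Finset.mul_sum, ← Finset.sum_sub_distrib]
    calc _ ≤ ∑ n ∈ Finset.Ico 1 N, 3 * ‖rc (mc χ) u n‖ := by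
          refine norm_sum_le_of_le _ fun n hn => ?_
          have hn1 : 1 ≤ n := (Finset.mem_Ico.1 hn).1
          have hn0 : (0:ℝ) < n := by exact_mod_cast hn1
          have hl : 0 ≤ Real.log n := Real.log_nonneg (by exact_mod_cast hn1)
          have e1 : (n:ℝ) ^ (-(1 + 1 / y)) = (n:ℝ)⁻¹ * Real.exp (-(α * Real.log n)) := by
            rw [neg_add, Real.rpow_add hn0, Real.rpow_neg_one, Real.rpow_def_of_pos hn0]
            congr 2; rw [hαd]; ring
          have e2 : cM χ y t n * ((w (Real.log n - u) : ℝ) : ℂ)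
              = ((Real.log n * Real.exp (-(α * Real.log n)) : ℝ) : ℂ) * (rc (mc χ) u n * ee (-(t * Real.log n))) := by
            unfold cM rc LSeries.logMul
            rw [e1, ← Complex.natCast_log]; push_cast; ring
          rw [e2, ← sub_mul, ← Complex.ofReal_sub, norm_mul, norm_mul, norm_ee, mul_one, Complex.norm_real]
          by_cases hz : rc (mc χ) u n = 0
          · rw [hz]; simp
          refine mul_le_mul_of_nonneg_right ?_ (norm_nonneg _)
          have := rc_supp n hz
          refine (A_lip hα h0 hl).trans ?_
          rw [abs_le]; constructor <;> linarith
      _ ≤ 3 * Real.exp 4 := by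
          rw [← Finset.mul_sum]
          exact mul_le_mul_of_nonneg_left (sum_norm_rc_le (norm_mc χ) u N) (by norm_num)
  set T := ∑ n ∈ Finset.Ico 1 N, cM χ y t n * ((w (Real.log n - u) : ℝ) : ℂ)
  have h1 := norm_sub_norm_le (((u * Real.exp (-(α * u)) : ℝ) : ℂ) * R (mc χ) u t) T
  rw [norm_mul, Complex.norm_real, Real.norm_of_nonneg (by positivity)] at h1
  have h2 : u * ‖R (mc χ) u t‖ = Real.exp (α * u) * (u * Real.exp (-(α * u)) * ‖R (mc χ) u t‖) := by
    have : Real.exp (α * u) * Real.exp (-(α * u)) = 1 := by rw [← Real.exp_add]; simp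
    linear_combination (-(u * ‖R (mc χ) u t‖)) * this
  rw [h2]
  refine mul_le_mul (Real.exp_le_exp.2 ?_) (by linarith) (by positivity) (Real.exp_pos _).le
  rw [hαd, one_div, inv_mul_le_iff₀ hy0]; linarith

lemma avg_small {q : ℕ} [NeZero q] (χ : DirichletCharacter ℂ q) {ε : ℝ} (hε : 0 < ε) :
    ∃ y₁ : ℝ, ∀ y ≥ y₁, ∀ t : ℝ, |t| ≤ Real.exp (2 * y) →
      ∫ u in (0:ℝ)..y, u * ‖R (mc χ) u t‖ ≤ ε * y ^ 2 := by
  have he := Real.exp_pos 1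
  have he4 := Real.exp_pos 4
  set η : ℝ := ε / (48 * Real.exp 1) with hη
  have hη0 : 0 < η := by positivity
  obtain ⟨y₁, hG⟩ := GA_small χ (show 0 < η ^ 2 by positivity)
  refine ⟨max (max y₁ 1) (Real.exp 1 * (6 * Real.exp 4) / ε), fun y hy t ht => ?_⟩
  have hy1 : y₁ ≤ y := (le_max_left _ _).trans ((le_max_left _ _).trans hy)
  have hy2 : 1 ≤ y := (le_max_right _ _).trans ((le_max_left _ _).trans hy)
  have hy3 : Real.exp 1 * (6 * Real.exp 4) ≤ ε * y := by
    have := (le_max_right _ _).trans hy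
    rw [div_le_iff₀ hε] at this; linarith
  have hy0 : 0 < y := by linarith
  obtain ⟨N₀, hN₀⟩ := hG y hy1 t ht
  set N := max N₀ (NN (y + 3)) with hN
  have hI := hN₀ N (le_max_left _ _)
  set s := Finset.Ico 1 N with hs
  set l : ℕ → ℝ := fun n => Real.log n with hl
  set g : ℝ → ℝ := fun v => ‖GA s (cM χ y t) l 1 v‖ with hg
  have hgi : ∀ a b, IntervalIntegrable g volume a b := fun a b =>
    ii_bdd (C := ∑ n ∈ s, ‖cM χ y t n‖) (GA_meas _ _ _).norm (fun x => by
      rw [norm_norm]; exact GA_bd _ _ _ x) a b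
  have hRc := (continuous_R_u (norm_mc χ) t).norm
  have hPc : Continuous fun u => ∫ v in (u - 1)..(u + 3), g v := by
    have hc : Continuous fun x => ∫ v in (0:ℝ)..x, g v := intervalIntegral.continuous_primitive hgi _
    have e : ∀ u, (∫ v in (u - 1)..(u + 3), g v) = (∫ v in (0:ℝ)..(u + 3), g v) - ∫ v in (0:ℝ)..(u - 1), g v := fun u =>
      (intervalIntegral.integral_interval_sub_left (hgi _ _) (hgi _ _)).symm
    simp_rw [e]
    exact (hc.comp (by fun_prop : Continuous fun u : ℝ => u + 3)).sub (hc.comp (by fun_prop : Continuous fun u : ℝ => u - 1))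
  have step1 : ∫ u in (0:ℝ)..y, u * ‖R (mc χ) u t‖ ≤
      ∫ u in (0:ℝ)..y, (Real.exp 1 * 2 * (∫ v in (u - 1)..(u + 3), g v) + Real.exp 1 * (3 * Real.exp 4)) := by
    refine intervalIntegral.integral_mono_on hy0.le ((continuous_id.mul hRc).intervalIntegrable _ _)
      ((by fun_prop : Continuous fun u => Real.exp 1 * 2 * (∫ v in (u - 1)..(u + 3), g v) + Real.exp 1 * (3 * Real.exp 4)).intervalIntegrable _ _) fun u hu => ?_
    refine (uR_le (N := N) χ hy2 t (le_max_right N₀ (NN (y + 3))) hu.1 hu.2).trans ?_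
    have := mul_le_mul_of_nonneg_left (T_bound s (cM χ y t) l u) he.le
    rw [mul_add]
    have e : Real.exp 1 * 2 * (∫ v in (u - 1)..(u + 3), g v) = Real.exp 1 * (2 * (∫ v in (u - 1)..(u + 3), g v)) := by ring
    rw [e]
    exact add_le_add this le_rfl
  have hPc2 : Continuous fun u => Real.exp 1 * 2 * (∫ v in (u - 1)..(u + 3), g v) := by fun_prop
  rw [intervalIntegral.integral_add (hPc2.intervalIntegrable _ _) (by simp),
    intervalIntegral.integral_const_mul, intervalIntegral.integral_const, smul_eq_mul, sub_zero] at step1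
  have step2 := slide hgi (fun x => norm_nonneg _) hy0.le
  have step3 : ∫ v in (-1:ℝ)..(y + 3), g v ≤ 3 * η * y ^ 2 := by
    have hgs : Integrable fun v => g v ^ 2 := integrable_GA_sq _ _ _ one_pos
    have hηy : 0 < η * y := by positivity
    have a1 : ∫ v in (-1:ℝ)..(y + 3), g v ≤ ∫ v in (-1:ℝ)..(y + 3), (η * y / 2 + 1 / (2 * (η * y)) * g v ^ 2) := by
      refine intervalIntegral.integral_mono_on (by linarith) (hgi _ _) ((by simp : IntervalIntegrable (fun _ => η * y / 2) volume _ _).add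
        (hgs.intervalIntegrable.const_mul _)) fun v _ => ?_
      have : η * y / 2 + 1 / (2 * (η * y)) * g v ^ 2 - g v = (η * y - g v) ^ 2 / (2 * (η * y)) := by field_simp; ring
      have h2 : 0 ≤ (η * y - g v) ^ 2 / (2 * (η * y)) := by positivity
      linarith
    rw [intervalIntegral.integral_add (by simp) (hgs.intervalIntegrable.const_mul _),
      intervalIntegral.integral_const_mul, intervalIntegral.integral_const, smul_eq_mul] at a1
    have a2 : ∫ v in (-1:ℝ)..(y + 3), g v ^ 2 ≤ η ^ 2 * y ^ 3 := by
      rw [intervalIntegral.integral_of_le (by linarith)]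
      exact (setIntegral_le_integral hgs (ae_of_all _ fun v => by positivity)).trans hI
    have a3 : 1 / (2 * (η * y)) * ∫ v in (-1:ℝ)..(y + 3), g v ^ 2 ≤ 1 / (2 * (η * y)) * (η ^ 2 * y ^ 3) :=
      mul_le_mul_of_nonneg_left a2 (by positivity)
    have a4 : 1 / (2 * (η * y)) * (η ^ 2 * y ^ 3) = η * y ^ 2 / 2 := by field_simp
    have a5 : η * y ≤ η * y ^ 2 := mul_le_mul_of_nonneg_left (by nlinarith only [hy2]) hη0.le
    nlinarith only [a1, a3, a4, a5]
  have h1 : Real.exp 1 * 2 * (∫ u in (0:ℝ)..y, ∫ v in (u - 1)..(u + 3), g v) ≤ Real.exp 1 * 2 * (4 * (3 * η * y ^ 2)) :=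
    mul_le_mul_of_nonneg_left (by linarith) (by positivity)
  have h2 : Real.exp 1 * 2 * (4 * (3 * η * y ^ 2)) = ε * y ^ 2 / 2 := by rw [hη]; field_simp; norm_num
  have h3 : y * (Real.exp 1 * (3 * Real.exp 4)) ≤ y * (ε * y / 2) := mul_le_mul_of_nonneg_left (by linarith) hy0.le
  have h4 : y * (ε * y / 2) = ε * y ^ 2 / 2 := by ring
  linarith

lemma MF_mc {q : ℕ} (χ : DirichletCharacter ℂ q) : MF (mc χ) := by
  refine ⟨norm_mc χ, fun p m hp hpm => ?_⟩
  unfold mc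
  rw [ArithmeticFunction.isMultiplicative_moebius.map_mul_of_coprime ((Nat.Prime.coprime_iff_not_dvd hp).2 hpm)]
  push_cast; rw [map_mul]; ring

lemma R_pt_le {f : ℕ → ℂ} (hf : ∀ n, ‖f n‖ ≤ 1) (y t v : ℝ) {η : ℝ} (h0 : 0 < η) (h1 : η ≤ 1) :
    η * ‖R f (y - v) t‖ ≤ Real.exp 5 * η ^ 2 + ∫ x in v..(v + η), ‖R f (y - x) t‖ := by
  have hc : Continuous fun x => ‖R f (y - x) t‖ :=
    ((continuous_R_u hf t).comp (by fun_prop : Continuous fun x : ℝ => y - x)).norm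
  have h : ∫ _ in v..(v + η), (‖R f (y - v) t‖ - Real.exp 5 * η) ≤ ∫ x in v..(v + η), ‖R f (y - x) t‖ := by
    refine intervalIntegral.integral_mono_on (by linarith) (by simp) (hc.intervalIntegrable _ _) fun x hx => ?_
    have a1 := norm_R_sub_le hf (y := y - x) (y' := y - v) (by linarith [hx.1]) (by linarith [hx.2]) t
    have a2 := norm_sub_norm_le (R f (y - v) t) (R f (y - x) t)
    rw [norm_sub_rev] at a1
    have a3 : Real.exp 5 * (y - v - (y - x)) ≤ Real.exp 5 * η := by gcongr; linarith [hx.2]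
    linarith
  rw [intervalIntegral.integral_const, smul_eq_mul] at h
  nlinarith only [h]

lemma Hal_mc {q : ℕ} [NeZero q] (χ : DirichletCharacter ℂ q) : Hal (mc χ) := by
  intro ε hε
  set E : ℝ := 45 * Real.exp 10 with hE
  have hE0 : 0 < E := by positivity
  obtain ⟨K, hK⟩ := exists_nat_ge (max 1 (8 * E / ε ^ 2))
  have hK1 : (1:ℝ) ≤ K := (le_max_left _ _).trans hK
  have hK2 := (le_max_right _ _).trans hK
  have hK0 : (0:ℝ) < K := by linarith
  have hKn : 1 ≤ K := by exact_mod_cast hK1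
  obtain ⟨e₂, he0, -, hpar⟩ := params (W₀ := K) hK1
  obtain ⟨y₀, hy₀, hpar⟩ := hpar K hKn
  set η : ℝ := min (1 / K) (ε * e₂ / (12 * K * Real.exp 5)) with hη
  have hη0 : 0 < η := by rw [hη]; positivity
  have hηK : η ≤ 1 / K := min_le_left _ _
  have hη1 : η ≤ 1 := hηK.trans (by rw [div_le_iff₀ hK0]; linarith)
  have hηε : 6 / e₂ * (K * Real.exp 5 * η / 2) ≤ ε / 4 := by
    have : η ≤ ε * e₂ / (12 * K * Real.exp 5) := min_le_right _ _
    calc _ ≤ 6 / e₂ * (K * Real.exp 5 * (ε * e₂ / (12 * K * Real.exp 5)) / 2) := by gcongr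
      _ = ε / 4 := by field_simp; norm_num
  obtain ⟨y₁, hy₁⟩ := avg_small χ (show 0 < ε * e₂ * η / 48 by positivity)
  refine ⟨max y₀ y₁, fun y hy t ht => ?_⟩
  have g0 : y₀ ≤ y := (le_max_left _ _).trans hy
  have hy0 : 0 < y := by linarith
  obtain ⟨a, b, ha, hb, hab, hW⟩ := hpar y g0
  have hA := hy₁ y ((le_max_right _ _).trans hy) t ht
  have hW1 : 1 ≤ SW K a b := hK1.trans hW
  have hbK : (b:ℝ) / K ≤ y / 2 := by rw [div_le_iff₀ hK0]; linarith
  have hpt := R_sub_G_pt (MF_mc χ) hKn (y := y) (by linarith) hW1 t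
  have hW0 : 0 < SW K a b := by linarith
  have ha0 : (0:ℝ) < a := by
    have : 0 < (a:ℝ) / K := lt_of_lt_of_le (by positivity) ha
    by_contra h
    have : (a:ℝ) / K ≤ 0 := div_nonpos_of_nonpos_of_nonneg (not_lt.1 h) hK0.le
    linarith
  have h1 : ‖R (mc χ) y t - G (mc χ) K a b y t / SW K a b‖ ≤ ε / 2 := by
    refine (sq_le_sq₀ (norm_nonneg _) (by positivity)).1 (hpt.trans ?_)
    have b1 : 1 / SW K a b ≤ 1 / K := one_div_le_one_div_of_le hK0 hW
    have b2 : 1 / (K:ℝ) ^ 2 ≤ 1 / K := one_div_le_one_div_of_le hK0 (by nlinarith only [hK1])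
    have b3 : E * (1 / K) ≤ ε ^ 2 / 8 := by
      rw [div_le_iff₀ (by positivity)] at hK2
      rw [mul_one_div, div_le_iff₀ hK0]; linarith
    calc _ ≤ E * (1 / K + 1 / K) := by gcongr
      _ ≤ _ := by nlinarith only [b3]
  set h : ℝ → ℝ := fun x => ‖R (mc χ) (y - x) t‖ with hh
  have hc : Continuous h :=
    ((continuous_R_u (norm_mc χ) t).comp (by fun_prop : Continuous fun x : ℝ => y - x)).norm
  have h0 : ∀ x, 0 ≤ h x := fun x => norm_nonneg _
  have hi : ∀ a b, IntervalIntegrable h volume a b := fun a b => hc.intervalIntegrable _ _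
  have s1 : ∀ v : ℕ, η * h (v / K) ≤ Real.exp 5 * η ^ 2 + ∫ x in ((v:ℝ) / K)..((v + 1 : ℕ) : ℝ) / K, h x := by
    intro v
    refine (R_pt_le (norm_mc χ) y t (v / K) hη0 hη1).trans (add_le_add le_rfl ?_)
    refine intervalIntegral.integral_mono_interval le_rfl (by linarith) ?_ (ae_of_all _ h0) (hi _ _)
    push_cast; rw [add_div]; linarith
  have s2 : η * ∑ v ∈ Finset.Ico a b, h (v / K) ≤ (b - a) * (Real.exp 5 * η ^ 2) + ∫ x in ((a:ℝ) / K)..((b:ℝ) / K), h x := by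
    rw [Finset.mul_sum, ← intervalIntegral.sum_integral_adjacent_intervals_Ico (a := fun v : ℕ => (v:ℝ) / K) hab (fun k _ => hi _ _)]
    refine (Finset.sum_le_sum fun v _ => s1 v).trans (le_of_eq ?_)
    rw [Finset.sum_add_distrib, Finset.sum_const, Nat.card_Ico, nsmul_eq_mul, Nat.cast_sub hab]
  have s3 : ∫ x in ((a:ℝ) / K)..((b:ℝ) / K), h x ≤ ε * e₂ * η / 24 * y := by
    have hRc := (continuous_R_u (norm_mc χ) t).norm
    have hcu : Continuous fun u => u * ‖R (mc χ) u t‖ := continuous_id.mul hRc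
    have c1 : ∫ x in ((a:ℝ) / K)..((b:ℝ) / K), h x ≤ ∫ x in (0:ℝ)..(y / 2), h x :=
      intervalIntegral.integral_mono_interval (by positivity) (by gcongr) hbK (ae_of_all _ h0) (hi _ _)
    have c2 : ∫ x in (0:ℝ)..(y / 2), h x = ∫ u in (y / 2)..y, ‖R (mc χ) u t‖ := by
      rw [hh, intervalIntegral.integral_comp_sub_left (fun u => ‖R (mc χ) u t‖) y]
      congr 1 <;> ring
    have c3 : y / 2 * ∫ u in (y / 2)..y, ‖R (mc χ) u t‖ ≤ ∫ u in (y / 2)..y, u * ‖R (mc χ) u t‖ := by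
      rw [← intervalIntegral.integral_const_mul]
      exact intervalIntegral.integral_mono_on (by linarith) ((hRc.const_mul _).intervalIntegrable _ _)
        (hcu.intervalIntegrable _ _) fun u hu => mul_le_mul_of_nonneg_right hu.1 (norm_nonneg _)
    have c4 : ∫ u in (y / 2)..y, u * ‖R (mc χ) u t‖ ≤ ∫ u in (0:ℝ)..y, u * ‖R (mc χ) u t‖ := by
      have e := intervalIntegral.integral_add_adjacent_intervals (hcu.intervalIntegrable 0 (y / 2) (μ := volume)) (hcu.intervalIntegrable (y / 2) y)
      have := intervalIntegral.integral_nonneg (a := 0) (b := y / 2) (μ := volume) (f := fun u => u * ‖R (mc χ) u t‖) (by linarith) (fun u hu => mul_nonneg hu.1 (norm_nonneg _))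
      linarith
    rw [c2] at c1
    refine c1.trans ?_
    have c5 : y / 2 * ∫ u in (y / 2)..y, ‖R (mc χ) u t‖ ≤ y / 2 * (ε * e₂ * η / 24 * y) := by
      refine c3.trans (c4.trans (hA.trans (le_of_eq ?_))); ring
    exact le_of_mul_le_mul_left c5 (by positivity)
  have hG : ‖G (mc χ) K a b y t‖ ≤ 6 / (e₂ * y) * ∑ v ∈ Finset.Ico a b, h (v / K) := by
    unfold G
    rw [Finset.mul_sum]
    refine norm_sum_le_of_le _ fun v hv => ?_
    have hv1 : (a:ℝ) ≤ v := by exact_mod_cast (Finset.mem_Ico.1 hv).1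
    have hv0 : (0:ℝ) < v := by linarith
    rw [norm_mul]
    refine mul_le_mul_of_nonneg_right ?_ (h0 _)
    refine (norm_Q_le (norm_mc χ) K v t).trans ((blk_sum_le K v hKn (by exact_mod_cast hv0)).trans ?_)
    rw [div_le_div_iff₀ hv0 (by positivity)]
    rw [le_div_iff₀ hK0] at ha
    nlinarith only [ha, hv1]
  have hS : ∑ v ∈ Finset.Ico a b, h (v / K) ≤ (K * Real.exp 5 * η / 2 + ε * e₂ / 24) * y := by
    have d1 : ((b:ℝ) - a) * (Real.exp 5 * η ^ 2) ≤ (K * (y / 2)) * (Real.exp 5 * η ^ 2) := by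
      gcongr; linarith
    refine le_of_mul_le_mul_left (s2.trans ((add_le_add d1 s3).trans (le_of_eq ?_))) hη0
    ring
  have hGf : ‖G (mc χ) K a b y t / SW K a b‖ ≤ ε / 2 := by
    rw [norm_div, Complex.norm_real, Real.norm_of_nonneg hW0.le]
    refine (div_le_self (norm_nonneg _) hW1).trans (hG.trans ?_)
    calc _ ≤ 6 / (e₂ * y) * ((K * Real.exp 5 * η / 2 + ε * e₂ / 24) * y) := by gcongr
      _ = 6 / e₂ * (K * Real.exp 5 * η / 2) + ε / 4 := by field_simp; ring
      _ ≤ _ := by linarith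
  have := norm_sub_norm_le (R (mc χ) y t) (G (mc χ) K a b y t / SW K a b)
  linarith

lemma MRP_mc {q : ℕ} [NeZero q] (χ : DirichletCharacter ℂ q) : MRP (mc χ) := MRP_of_Hal (MF_mc χ) (Hal_mc χ)

lemma MRP_zero : MRP fun _ => 0 := fun ε hε => ⟨1, le_rfl, fun Q₀ _ => ⟨0, fun y _ => by
  have : ∀ t, R (fun _ => (0:ℂ)) y t = 0 := fun t => by unfold R; rw [D_def]; simp [rc]
  simp [this, hε.le]⟩⟩

lemma MRP_smul {f : ℕ → ℂ} (h : MRP f) (c : ℂ) : MRP fun n => c * f n := by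
  intro ε hε
  obtain ⟨Q₁, h1, h2⟩ := h (ε / (‖c‖ ^ 2 + 1)) (by positivity)
  refine ⟨Q₁, h1, fun Q₀ hQ => ?_⟩
  obtain ⟨y₀, hy₀⟩ := h2 Q₀ hQ
  refine ⟨y₀, fun y hy => ?_⟩
  have e : ∀ t, R (fun n => c * f n) y t = c * R f y t := fun t => by
    unfold R; rw [D_def, D_def, Finset.mul_sum]
    exact Finset.sum_congr rfl fun n _ => by unfold rc; ring
  simp_rw [e, norm_mul, mul_pow]
  rw [integral_const_mul]
  have := hy₀ y hy
  rw [le_div_iff₀ (by positivity)] at this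
  have h0 : 0 ≤ ∫ t in Set.Icc (-(Real.exp y / Q₀)) (Real.exp y / Q₀), ‖R f y t‖ ^ 2 :=
    integral_nonneg fun t => by positivity
  nlinarith only [this, h0]

lemma MRP_add {f g : ℕ → ℂ} (hf : MRP f) (hg : MRP g) : MRP fun n => f n + g n := by
  intro ε hε
  obtain ⟨Q₁, h1, h2⟩ := hf (ε / 4) (by positivity)
  obtain ⟨Q₂, h3, h4⟩ := hg (ε / 4) (by positivity)
  refine ⟨max Q₁ Q₂, h1.trans (le_max_left _ _), fun Q₀ hQ => ?_⟩
  obtain ⟨y₀, hy₀⟩ := h2 Q₀ ((le_max_left _ _).trans hQ)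
  obtain ⟨y₁, hy₁⟩ := h4 Q₀ ((le_max_right _ _).trans hQ)
  refine ⟨max y₀ y₁, fun y hy => ?_⟩
  have a1 := hy₀ y ((le_max_left _ _).trans hy)
  have a2 := hy₁ y ((le_max_right _ _).trans hy)
  have e : ∀ t, R (fun n => f n + g n) y t = R f y t + R g y t := fun t => by
    unfold R; rw [D_def, D_def, D_def, ← Finset.sum_add_distrib]
    exact Finset.sum_congr rfl fun n _ => by unfold rc; ring
  have i1 : IntegrableOn (fun t => 2 * ‖R f y t‖ ^ 2) _ := cont_int (((continuous_R f y).norm.pow 2).const_mul 2) (Real.exp y / Q₀)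
  have i2 : IntegrableOn (fun t => 2 * ‖R g y t‖ ^ 2) _ := cont_int (((continuous_R g y).norm.pow 2).const_mul 2) (Real.exp y / Q₀)
  have i3 := cont_int ((continuous_R (fun n => f n + g n) y).norm.pow 2) (Real.exp y / Q₀)
  have := integral_mono i3 (i1.add i2) (fun t => by
    simp only [Pi.add_apply, Pi.pow_apply, e]
    have h := norm_add_le (R f y t) (R g y t)
    have h' := pow_le_pow_left₀ (norm_nonneg _) h 2
    nlinarith only [h', sq_nonneg (‖R f y t‖ - ‖R g y t‖)])
  refine this.trans ?_
  simp only [Pi.add_apply, Pi.pow_apply]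
  rw [integral_add i1 i2, integral_const_mul, integral_const_mul]
  linarith

lemma MRP_sum {ι : Type*} (s : Finset ι) (F : ι → ℕ → ℂ) (h : ∀ i ∈ s, MRP (F i)) : MRP fun n => ∑ i ∈ s, F i n := by
  classical
  induction s using Finset.induction_on with
  | empty => simpa using MRP_zero
  | insert i s hi ih =>
    simp_rw [Finset.sum_insert hi]
    exact MRP_add (h i (by simp)) (ih fun j hj => h j (by simp [hj]))

/-- dilation -/
def dil (d : ℕ) (F : ℕ → ℂ) (n : ℕ) : ℂ := if d ∣ n then F (n / d) else 0

lemma norm_R_dil {d : ℕ} (hd : 1 ≤ d) (F : ℕ → ℂ) (y t : ℝ) :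
    ‖R (dil d F) y t‖ ≤ ‖R F (y - Real.log d) t‖ := by
  have hd0 : (0:ℝ) < d := by exact_mod_cast hd
  set N := max (NN (y + 3)) (NN (y - Real.log d + 3)) with hN
  have h1 : NN (y + 3) ≤ d * N := (le_max_left _ _).trans (Nat.le_mul_of_pos_left _ hd)
  have h2 : NN (y - Real.log d + 3) ≤ N := le_max_right _ _
  have e : R (dil d F) y t = ((1 / d : ℝ) : ℂ) * ee (-(t * Real.log d)) * R F (y - Real.log d) t := by
    rw [R_eq _ _ _ h1, R_eq _ _ _ h2, D_def, D_def, Finset.mul_sum]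
    symm
    refine Finset.sum_of_injOn (fun m => d * m) (fun a _ b _ h => Nat.eq_of_mul_eq_mul_left hd h) ?_ ?_ ?_
    · intro m hm
      simp only [Finset.coe_Ico, Set.mem_Ico] at hm ⊢
      exact ⟨Nat.mul_pos hd hm.1, Nat.mul_lt_mul_of_pos_left hm.2 hd⟩
    · intro n hn hn'
      have : ¬ d ∣ n := by
        rintro ⟨m, rfl⟩
        refine hn' ⟨m, ?_, rfl⟩
        simp only [Finset.coe_Ico, Set.mem_Ico, Finset.mem_Ico] at hn ⊢
        exact ⟨Nat.pos_of_mul_pos_left hn.1, Nat.lt_of_mul_lt_mul_left hn.2⟩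
      simp [rc, dil, this]
    · intro m hm
      have hm0 : (0:ℝ) < m := by exact_mod_cast (Finset.mem_Ico.1 hm).1
      simp only [rc, dil, dvd_mul_right, if_true, Nat.mul_div_cancel_left m hd]
      push_cast
      rw [Real.log_mul hd0.ne' hm0.ne', mul_add, neg_add, ee_add]
      have : Real.log d + Real.log m - y = Real.log m - (y - Real.log d) := by ring
      rw [this]
      have hd0' : (d:ℂ) ≠ 0 := by exact_mod_cast hd0.ne'
      field_simp
  rw [e, norm_mul, norm_mul, norm_ee, Complex.norm_real, Real.norm_of_nonneg (by positivity), mul_one]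
  exact mul_le_of_le_one_left (norm_nonneg _) (by rw [div_le_one hd0]; exact_mod_cast hd)

lemma MRP_dil {F : ℕ → ℂ} (h : MRP F) {d : ℕ} (hd : 1 ≤ d) : MRP (dil d F) := by
  intro ε hε
  have hd0 : (0:ℝ) < d := by exact_mod_cast hd
  have hd1 : (1:ℝ) ≤ d := by exact_mod_cast hd
  obtain ⟨Q₁, h1, h2⟩ := h ε hε
  refine ⟨d * Q₁, by nlinarith, fun Q₀ hQ => ?_⟩
  obtain ⟨y₀, hy₀⟩ := h2 (Q₀ / d) (by rw [ge_iff_le, le_div_iff₀ hd0]; linarith)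
  refine ⟨y₀ + Real.log d, fun y hy => ?_⟩
  have := hy₀ (y - Real.log d) (by linarith)
  have e : Real.exp (y - Real.log d) / (Q₀ / d) = Real.exp y / Q₀ := by
    rw [Real.exp_sub, Real.exp_log hd0]; field_simp
  rw [e] at this
  refine le_trans (integral_mono (cont_int ((continuous_R _ y).norm.pow 2) _) (cont_int ((continuous_R _ _).norm.pow 2) _) fun t => ?_) this
  exact pow_le_pow_left₀ (norm_nonneg _) (norm_R_dil hd F y t) 2

lemma MRP_res {q : ℕ} [NeZero q] (u : (ZMod q)ˣ) :
    MRP fun n => if (u : ZMod q) = (n : ZMod q) then (ArithmeticFunction.moebius n : ℂ) else 0 := by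
  have h := MRP_smul (MRP_sum Finset.univ (fun (χ : DirichletCharacter ℂ q) n => χ (u:ZMod q)⁻¹ * mc χ n)
    fun χ _ => MRP_smul (MRP_mc χ) _) (q.totient : ℂ)⁻¹
  convert h using 2 with n
  have := DirichletCharacter.sum_char_inv_mul_char_eq ℂ u.isUnit (n : ZMod q)
  have hq : (q.totient : ℂ) ≠ 0 := by exact_mod_cast (Nat.totient_pos.2 (NeZero.pos q)).ne'
  simp only [mc, ← mul_assoc]
  rw [← Finset.sum_mul, this]
  split_ifs <;> field_simp
  simp

lemma MRP_periodic {q : ℕ} (hq : 1 ≤ q) {a : ℕ → ℂ} (ha : ∀ n, a (n + q) = a n) :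
    MRP fun n => a n * (ArithmeticFunction.moebius n : ℂ) := by
  haveI : NeZero q := ⟨by omega⟩
  have hmod : ∀ m n : ℕ, (m : ZMod q) = n → a m = a n := by
    intro m n h
    rw [ZMod.natCast_eq_natCast_iff] at h
    have hp : Function.Periodic a q := ha
    rw [← hp.map_mod_nat m, ← hp.map_mod_nat n, h]
  have h := MRP_sum q.divisors (fun d n => ∑ u : (ZMod q)ˣ, (ArithmeticFunction.moebius d : ℂ) * a (d * (u : ZMod q).val) *
      dil d (fun n => if (u : ZMod q) = (n : ZMod q) then (ArithmeticFunction.moebius n : ℂ) else 0) n)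
    fun d hd => MRP_sum _ _ fun u _ => MRP_smul (MRP_dil (MRP_res u) (Nat.pos_of_mem_divisors hd)) _
  convert h using 2 with n
  have key : ∀ d ∈ q.divisors, (∑ u : (ZMod q)ˣ, (ArithmeticFunction.moebius d : ℂ) * a (d * (u : ZMod q).val) *
      dil d (fun n => if (u : ZMod q) = (n : ZMod q) then (ArithmeticFunction.moebius n : ℂ) else 0) n)
      = if d ∣ n ∧ (n / d).Coprime q then a n * (ArithmeticFunction.moebius n : ℂ) else 0 := by
    intro d hd
    unfold dil
    by_cases h1 : d ∣ n
    swap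
    · simp [h1]
    by_cases h2 : (n / d).Coprime q
    · rw [if_pos ⟨h1, h2⟩]
      simp only [h1, if_true]
      rw [Finset.sum_eq_single (ZMod.unitOfCoprime (n / d) h2)]
      · rw [ZMod.coe_unitOfCoprime, if_pos rfl]
        have e1 : a (d * ((n / d : ℕ) : ZMod q).val) = a n := by
          refine hmod _ _ ?_
          rw [Nat.cast_mul, ZMod.natCast_zmod_val, ← Nat.cast_mul, Nat.mul_div_cancel' h1]
        have e2 : ArithmeticFunction.moebius n = ArithmeticFunction.moebius d * ArithmeticFunction.moebius (n / d) := by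
          rw [← ArithmeticFunction.isMultiplicative_moebius.map_mul_of_coprime, Nat.mul_div_cancel' h1]
          exact (h2.symm.coprime_dvd_left (Nat.dvd_of_mem_divisors hd))
        rw [e1, e2]; push_cast; ring
      · intro u _ hu
        rw [if_neg, mul_zero]
        intro h; apply hu; ext; rw [ZMod.coe_unitOfCoprime, h]
      · simp
    · rw [if_neg fun h => h2 h.2]
      simp only [h1, if_true]
      refine Finset.sum_eq_zero fun u _ => ?_
      rw [if_neg, mul_zero]
      intro h
      exact h2 ((ZMod.isUnit_iff_coprime _ _).1 (h ▸ u.isUnit))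
  rw [Finset.sum_congr rfl key]
  by_cases hs : Squarefree n
  · rw [Finset.sum_eq_single (n.gcd q)]
    · rw [if_pos]
      refine ⟨Nat.gcd_dvd_left _ _, ?_⟩
      have hg : 0 < n.gcd q := Nat.gcd_pos_of_pos_right _ (by omega)
      have c1 : (n / n.gcd q).Coprime (q / n.gcd q) := Nat.coprime_div_gcd_div_gcd hg
      have c2 : (n / n.gcd q).Coprime (n.gcd q) := by
        have : Squarefree (n / n.gcd q * n.gcd q) := by rwa [Nat.div_mul_cancel (Nat.gcd_dvd_left _ _)]
        exact Nat.coprime_of_squarefree_mul this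
      have := c1.mul_right c2
      rwa [Nat.div_mul_cancel (Nat.gcd_dvd_right _ _)] at this
    · intro d hd hne
      rw [if_neg]
      rintro ⟨h1, h2⟩
      apply hne
      obtain ⟨m, rfl⟩ := h1
      have hd0 := Nat.pos_of_mem_divisors hd
      rw [Nat.mul_div_cancel_left m hd0] at h2
      rw [Nat.Coprime.gcd_mul_right_cancel d h2]
      exact (Nat.gcd_eq_left (Nat.dvd_of_mem_divisors hd)).symm
    · intro h; exact absurd (Nat.mem_divisors.2 ⟨Nat.gcd_dvd_right _ _, by omega⟩) h
  · rw [ArithmeticFunction.moebius_eq_zero_of_not_squarefree hs]; simp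

lemma GA_L2 {g : ℕ → ℂ} (hg : ∀ n, ‖g n‖ ≤ 1) (h : MRP g) {θ : ℝ} (hθ : 0 < θ) :
    ∃ Q₀ : ℝ, 1 ≤ Q₀ ∧ ∃ y₀ : ℝ, 0 ≤ y₀ ∧ ∀ y ≥ y₀, ∫ u, ‖GA (Finset.Ico 1 (NN (y + 3))) (rc g y) (fun n : ℕ => Real.log n)
      (Q₀ ^ 2 * Real.exp (-y)) u‖ ^ 2 ≤ (Q₀ ^ 2 * Real.exp (-y)) ^ 2 * θ ^ 2 := by
  obtain ⟨Q₁, hQ₁, hM⟩ := h (θ ^ 2 / 2) (by positivity)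
  set C : ℝ := Real.pi * (3 + 2 * Real.exp 3) * Real.exp 5 with hC
  have hpi := Real.pi_pos
  have hC0 : 0 < C := by positivity
  set Q₀ : ℝ := max Q₁ (4 * C / θ ^ 2) with hQ
  have hQ1 : 1 ≤ Q₀ := hQ₁.trans (le_max_left _ _)
  have hQC : 2 * C / Q₀ ^ 2 ≤ θ ^ 2 / 2 := by
    have h1 : 4 * C / θ ^ 2 ≤ Q₀ := le_max_right _ _
    rw [div_le_iff₀ (by positivity)] at h1 ⊢
    nlinarith only [h1, hQ1, mul_le_mul_of_nonneg_left hQ1 (show 0 ≤ θ ^ 2 * Q₀ by positivity)]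
  obtain ⟨y₀, hy₀⟩ := hM Q₀ (le_max_left _ _)
  refine ⟨Q₀, hQ1, max 0 y₀, le_max_left _ _, fun y hy => ?_⟩
  have a1 := hy₀ y ((le_max_right _ _).trans hy)
  have hy0 : 0 ≤ y := (le_max_left _ _).trans hy
  set T := Real.exp y / Q₀ with hT
  have hT0 : 0 < T := by positivity
  set δ := Q₀ ^ 2 * Real.exp (-y) with hδ
  have hδ0 : 0 < δ := by positivity
  have hδT : δ * T = Q₀ := by
    rw [hδ, hT, Real.exp_neg]; field_simp
  set N := NN (y + 3) with hN
  set s := Finset.Ico 1 N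
  set l : ℕ → ℝ := fun n => Real.log n with hl
  have hNle : (N:ℝ) ≤ Real.exp 3 * Real.exp y + 1 := by
    have := NN_le (y + 3); rwa [Real.exp_add, mul_comm] at this
  have hey : 1 ≤ Real.exp y := Real.one_le_exp hy0
  have hW : ∫ t, ‖GD s (rc g y) l t‖ ^ 2 * (1 + (T⁻¹ * t) ^ 2)⁻¹ ≤ C := by
    refine (PL_le s (rc g y) l (inv_pos.2 hT0)).trans ?_
    have b1 := schur_sum s (fun n => ‖rc g y n‖) (fun i j => Real.exp (-(|l i - l j| / T⁻¹)))
      (fun i _ j _ => (Real.exp_pos _).le) (fun i _ j _ => by rw [abs_sub_comm]) (1 + 2 * N / T) (fun i hi => by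
        refine le_trans (le_of_eq ?_) (exp_log_sum hi hT0)
        refine Finset.sum_congr rfl fun j _ => ?_
        rw [div_inv_eq_mul, mul_comm])
    have b2 := sum_norm_rc_sq_le hg y N
    calc _ ≤ Real.pi / T⁻¹ * ((1 + 2 * N / T) * Real.exp (5 - y)) := by
          gcongr
          exact b1.trans (by gcongr)
      _ = Real.pi * (T + 2 * N) * Real.exp (5 - y) := by field_simp
      _ ≤ Real.pi * (Real.exp y + 2 * (Real.exp 3 * Real.exp y + Real.exp y)) * Real.exp (5 - y) := by
          gcongr
          · exact div_le_self (by positivity) hQ1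
          · linarith
      _ = C := by rw [hC, Real.exp_sub]; field_simp; ring
  have hI := integrable_GD_sq s (rc g y) l (inv_pos.2 hT0)
  have hS : Integrable ((Set.Icc (-T) T).indicator fun t => ‖R g y t‖ ^ 2) :=
    (cont_int ((continuous_R g y).norm.pow 2) T).integrable_indicator measurableSet_Icc
  have hmain : ∫ t, ‖GD s (rc g y) l t‖ ^ 2 * (1 + (δ * t) ^ 2)⁻¹ ≤ θ ^ 2 := by
    have := integral_mono (integrable_GD_sq s (rc g y) l hδ0) (hS.add (hI.const_mul (2 / Q₀ ^ 2))) (fun t => by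
      simp only [Pi.add_apply]
      have hRD : GD s (rc g y) l t = R g y t := rfl
      rw [hRD]
      by_cases ht : t ∈ Set.Icc (-T) T
      · rw [Set.indicator_of_mem ht]
        have c1 : ‖R g y t‖ ^ 2 * (1 + (δ * t) ^ 2)⁻¹ ≤ ‖R g y t‖ ^ 2 :=
          mul_le_of_le_one_right (by positivity) (inv_le_one_of_one_le₀ (by nlinarith only [sq_nonneg (δ * t)]))
        have c2 : 0 ≤ 2 / Q₀ ^ 2 * (‖R g y t‖ ^ 2 * (1 + (T⁻¹ * t) ^ 2)⁻¹) := by positivity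
        linarith
      · rw [Set.indicator_of_notMem ht, zero_add]
        have hx : 1 ≤ (T⁻¹ * t) ^ 2 := by
          rw [Set.mem_Icc, ← abs_le] at ht
          have : 1 ≤ |T⁻¹ * t| := by
            rw [abs_mul, abs_of_pos (inv_pos.2 hT0), inv_mul_eq_div, one_le_div hT0]; linarith [not_le.1 ht]
          rw [← sq_abs]; nlinarith only [this]
        have e : δ * t = Q₀ * (T⁻¹ * t) := by rw [← hδT]; field_simp
        rw [e]
        set x := T⁻¹ * t
        calc ‖R g y t‖ ^ 2 * (1 + (Q₀ * x) ^ 2)⁻¹ ≤ ‖R g y t‖ ^ 2 * (Q₀ ^ 2 / 2 * (1 + x ^ 2))⁻¹ := by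
              gcongr
              nlinarith only [mul_le_mul_of_nonneg_left hx (show 0 ≤ Q₀ ^ 2 by positivity)]
          _ = _ := by field_simp)
    refine this.trans ?_
    simp only [Pi.add_apply]
    rw [integral_add hS (hI.const_mul _), integral_const_mul, integral_indicator measurableSet_Icc]
    have c3 : 2 / Q₀ ^ 2 * ∫ t, ‖GD s (rc g y) l t‖ ^ 2 * (1 + (T⁻¹ * t) ^ 2)⁻¹ ≤ 2 / Q₀ ^ 2 * C := by gcongr
    have c4 : 2 / Q₀ ^ 2 * C = 2 * C / Q₀ ^ 2 := by ring
    linarith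
  rw [PL s _ l hδ0, div_mul_eq_mul_div, div_le_iff₀ (by positivity)] at hmain
  have h0 : 0 ≤ ∫ u, ‖GA s (rc g y) l δ u‖ ^ 2 := integral_nonneg fun u => by positivity
  nlinarith only [hmain, h0, mul_le_mul_of_nonneg_right Real.pi_gt_three.le h0]

/-- one-sided kernel -/
def ker (δ l u : ℝ) : ℝ := if u < l then Real.exp (-((l - u) / δ)) else 0

lemma ker_meas (δ l : ℝ) : Measurable (ker δ l) :=
  Measurable.ite measurableSet_Iio (by fun_prop) measurable_const

lemma ker_bd {δ : ℝ} (hδ : 0 < δ) (l u : ℝ) : ‖ker δ l u‖ ≤ 1 := by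
  unfold ker
  split_ifs with h
  · rw [Real.norm_of_nonneg (Real.exp_pos _).le]
    refine Real.exp_le_one_iff.2 (neg_nonpos.2 (div_nonneg (by linarith) hδ.le))
  · simp

lemma ker_int {δ : ℝ} (hδ : 0 < δ) (l : ℝ) {α β : ℝ} (hab : α ≤ β) :
    |(if α < l ∧ l ≤ β then δ else 0) - ∫ u in α..β, ker δ l u| ≤
      δ * (Real.exp (-(δ⁻¹ * |α - l|)) + Real.exp (-(δ⁻¹ * |β - l|))) := by
  have h := integral_eq_of_hasDerivAt_off_countable_of_le (fun u => δ * Real.exp (-((l - min u l) / δ))) (ker δ l) hab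
    (Set.countable_singleton l) (by fun_prop) (fun x hx => by
      rcases lt_or_gt_of_ne (show x ≠ l from fun h => hx.2 h) with h | h
      · have e : (fun u => δ * Real.exp (-((l - min u l) / δ))) =ᶠ[𝓝 x] fun u => δ * Real.exp (-((l - u) / δ)) := by
          filter_upwards [Iio_mem_nhds h] with u hu
          rw [min_eq_left (le_of_lt hu)]
        refine HasDerivAt.congr_of_eventuallyEq ?_ e
        have := ((((hasDerivAt_id x).const_sub l).div_const δ).neg.exp).const_mul δ
        refine this.congr_deriv ?_
        unfold ker; rw [if_pos h]; simp only [id]; field_simp; rfl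
      · have e : (fun u => δ * Real.exp (-((l - min u l) / δ))) =ᶠ[𝓝 x] fun u => δ * Real.exp (-((l - l) / δ)) := by
          filter_upwards [Ioi_mem_nhds h] with u hu
          rw [min_eq_right (le_of_lt hu)]
        have e2 : ker δ l x = 0 := by simp [ker, not_lt.2 h.le]
        rw [e2]
        exact (hasDerivAt_const x _).congr_of_eventuallyEq e) (ii_bdd (ker_meas δ l) (ker_bd hδ l) _ _)
  rw [h]
  have p1 := mul_pos hδ (Real.exp_pos (-(δ⁻¹ * |α - l|)))
  have p2 := mul_pos hδ (Real.exp_pos (-(δ⁻¹ * |β - l|)))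
  have E : ∀ x, x ≤ l → δ * Real.exp (-((l - min x l) / δ)) = δ * Real.exp (-(δ⁻¹ * |x - l|)) := fun x hx => by
    rw [min_eq_left hx, abs_of_nonpos (by linarith)]; congr 3; ring
  have E' : ∀ x, l ≤ x → δ * Real.exp (-((l - min x l) / δ)) = δ := fun x hx => by
    rw [min_eq_right hx]; simp
  rw [mul_add]
  by_cases c1 : α < l
  · by_cases c2 : l ≤ β
    · rw [if_pos ⟨c1, c2⟩, E α c1.le, E' β c2, abs_le]; constructor <;> linarith
    · rw [if_neg fun h => c2 h.2, E α c1.le, E β (not_le.1 c2).le, abs_le]; constructor <;> linarith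
  · rw [if_neg fun h => c1 h.1, E' α (not_lt.1 c1), E' β ((not_lt.1 c1).trans hab), abs_le]; constructor <;> linarith

lemma GA_eq' (s : Finset ℕ) (c : ℕ → ℂ) (l : ℕ → ℝ) (δ : ℝ) :
    GA s c l δ = fun u => ∑ i ∈ s, c i * ((ker δ (l i) u : ℝ) : ℂ) := rfl

lemma GA_ii (s : Finset ℕ) (c : ℕ → ℂ) (l : ℕ → ℝ) {δ : ℝ} (hδ : 0 < δ) (a b : ℝ) :
    IntervalIntegrable (GA s c l δ) volume a b := by
  rw [GA_eq']
  refine ii_bdd (C := ∑ i ∈ s, ‖c i‖) (Finset.measurable_fun_sum _ fun i _ => measurable_const.mul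
    (Complex.measurable_ofReal.comp (ker_meas _ _))) (fun u => ?_) a b
  refine norm_sum_le_of_le _ fun i _ => ?_
  simp only [Pi.mul_apply, Function.comp]
  rw [norm_mul, Complex.norm_real]
  exact mul_le_of_le_one_right (norm_nonneg _) (ker_bd hδ _ _)

lemma short_one {g : ℕ → ℂ} (hg : ∀ n, ‖g n‖ ≤ 1) {M m H : ℕ} (hM : 1 ≤ M) (hm : M ≤ m) (hm2 : m ≤ 2 * M) (hH : H ≤ M)
    {δ : ℝ} (hδ : 0 < δ) {N : ℕ} (hN : N = NN (Real.log M + 3)) :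
    ‖∑ n ∈ Finset.Ioc m (m + H), g n‖ ≤ (H:ℝ) ^ 2 / M + 2 * M / δ *
      (∫ u in (Real.log m)..(Real.log (m + H : ℕ)), ‖GA (Finset.Ico 1 N) (rc g (Real.log M)) (fun n : ℕ => Real.log n) δ u‖)
      + 4 * Real.exp 1 * (1 + 2 * N * δ) := by
  have hM0 : (0:ℝ) < M := by exact_mod_cast hM
  have hm0 : (0:ℝ) < m := by exact_mod_cast (hM.trans hm)
  have hmM : (M:ℝ) ≤ m := by exact_mod_cast hm
  have hmM2 : (m:ℝ) ≤ 2 * M := by exact_mod_cast hm2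
  have he3 : (3:ℝ) ≤ Real.exp 2 := by linarith [Real.add_one_le_exp (2:ℝ)]
  set y := Real.log M with hy
  set s := Finset.Ico 1 N with hs
  set l : ℕ → ℝ := fun n => Real.log n with hl
  set c := rc g y with hc
  have h3N : 3 * M < N := by
    have h1 := lt_NN (y + 3)
    rw [Real.exp_add, hy, Real.exp_log hM0, ← hN] at h1
    have h2 : Real.exp 2 ≤ Real.exp 3 := Real.exp_le_exp.2 (by norm_num)
    have : (3 * M : ℝ) < N := by nlinarith only [h1, h2, he3, hM0]
    exact_mod_cast this
  set α := Real.log m with hα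
  set β := Real.log (m + H : ℕ) with hβ
  have hab : α ≤ β := Real.log_le_log hm0 (by push_cast; linarith [(Nat.cast_nonneg H : (0:ℝ) ≤ H)])
  have hcn : ∀ n ∈ s, ‖c n‖ ≤ Real.exp 1 / M := by
    intro n hn
    by_cases hz : c n = 0
    · rw [hz, norm_zero]; positivity
    have h1 := (rc_supp n hz).1
    have hn0 : (0:ℝ) < n := by exact_mod_cast (Finset.mem_Ico.1 hn).1
    rw [Real.le_log_iff_exp_le hn0, Real.exp_sub, hy, Real.exp_log hM0, div_le_iff₀ (Real.exp_pos _)] at h1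
    refine (norm_rc_le hg y n).trans ?_
    rw [div_le_div_iff₀ hn0 hM0]
    calc _ ≤ 1 * (M:ℝ) := by gcongr; exact w_le_one _
      _ ≤ _ := by linarith
  have key : ‖(δ:ℂ) * (∑ n ∈ Finset.Ioc m (m + H), c n) - ∫ u in α..β, GA s c l δ u‖ ≤
      δ * (Real.exp 1 / M * (2 * (1 + 2 * N * δ))) := by
    have i1 : ∫ u in α..β, GA s c l δ u = ∑ n ∈ s, c n * ((∫ u in α..β, ker δ (l n) u : ℝ) : ℂ) := by
      rw [GA_eq', intervalIntegral.integral_finsetSum]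
      · refine Finset.sum_congr rfl fun n _ => ?_
        rw [intervalIntegral.integral_const_mul, intervalIntegral.integral_ofReal]
      · intro n _
        exact (ii_bdd (Complex.measurable_ofReal.comp (ker_meas δ (l n))) (C := 1) (fun u => by
          simp only [Function.comp, Complex.norm_real]; exact ker_bd hδ _ _) α β).const_mul _
    have i2 : (δ:ℂ) * (∑ n ∈ Finset.Ioc m (m + H), c n) = ∑ n ∈ s, c n * ((if α < l n ∧ l n ≤ β then δ else 0 : ℝ) : ℂ) := by
      have e : Finset.Ioc m (m + H) = s.filter fun n => α < l n ∧ l n ≤ β := by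
        ext n
        simp only [Finset.mem_Ioc, Finset.mem_filter, hs, Finset.mem_Ico, hα, hβ, hl]
        constructor
        · rintro ⟨h1, h2⟩
          have : (0:ℝ) < n := by exact_mod_cast (by omega : 0 < n)
          exact ⟨⟨by omega, by omega⟩, Real.log_lt_log hm0 (by exact_mod_cast h1), Real.log_le_log this (by exact_mod_cast h2)⟩
        · rintro ⟨⟨h1, h2⟩, h3, h4⟩
          have hn0 : (0:ℝ) < n := by exact_mod_cast h1
          have hmH : (0:ℝ) < (m + H : ℕ) := by exact_mod_cast (by omega : 0 < m + H)
          rw [Real.log_lt_log_iff hm0 hn0] at h3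
          rw [Real.log_le_log_iff hn0 hmH] at h4
          exact ⟨by exact_mod_cast h3, by exact_mod_cast h4⟩
      rw [e, Finset.sum_filter, Finset.mul_sum]
      refine Finset.sum_congr rfl fun n _ => ?_
      split_ifs
      · ring
      · simp
    rw [i1, i2, ← Finset.sum_sub_distrib]
    calc _ ≤ ∑ n ∈ s, Real.exp 1 / M * (δ * (Real.exp (-(δ⁻¹ * |α - l n|)) + Real.exp (-(δ⁻¹ * |β - l n|)))) := by
          refine norm_sum_le_of_le _ fun n hn => ?_
          rw [← mul_sub, norm_mul, ← Complex.ofReal_sub, Complex.norm_real]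
          exact mul_le_mul (hcn n hn) (ker_int hδ (l n) hab) (norm_nonneg _) (by positivity)
      _ = Real.exp 1 / M * (δ * (∑ n ∈ s, Real.exp (-(δ⁻¹ * |α - l n|)) + ∑ n ∈ s, Real.exp (-(δ⁻¹ * |β - l n|)))) := by
          rw [← Finset.mul_sum, ← Finset.mul_sum, Finset.sum_add_distrib]
      _ ≤ Real.exp 1 / M * (δ * ((1 + 2 * N / δ⁻¹) + (1 + 2 * N / δ⁻¹))) := by
          gcongr
          · exact exp_log_sum (Finset.mem_Ico.2 ⟨by omega, by omega⟩) (inv_pos.2 hδ)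
          · exact exp_log_sum (Finset.mem_Ico.2 ⟨by omega, by omega⟩) (inv_pos.2 hδ)
      _ = _ := by rw [div_inv_eq_mul]; ring
  have hsum : ‖∑ n ∈ Finset.Ioc m (m + H), c n‖ ≤ δ⁻¹ * (∫ u in α..β, ‖GA s c l δ u‖) + Real.exp 1 / M * (2 * (1 + 2 * N * δ)) := by
    have h1 := norm_sub_norm_le ((δ:ℂ) * (∑ n ∈ Finset.Ioc m (m + H), c n)) (∫ u in α..β, GA s c l δ u)
    rw [norm_mul, Complex.norm_real, Real.norm_of_nonneg hδ.le] at h1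
    have h2 := intervalIntegral.norm_integral_le_integral_norm (f := GA s c l δ) (μ := volume) hab
    refine le_of_mul_le_mul_left ?_ hδ
    rw [mul_add, ← mul_assoc, mul_inv_cancel₀ hδ.ne', one_mul]
    linarith
  have hdiff : ‖∑ n ∈ Finset.Ioc m (m + H), g n - (m:ℂ) * ∑ n ∈ Finset.Ioc m (m + H), c n‖ ≤ (H:ℝ) ^ 2 / M := by
    rw [Finset.mul_sum, ← Finset.sum_sub_distrib]
    calc _ ≤ ∑ n ∈ Finset.Ioc m (m + H), (H:ℝ) / M := by
          refine norm_sum_le_of_le _ fun n hn => ?_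
          obtain ⟨h1, h2⟩ := Finset.mem_Ioc.1 hn
          have hn1 : (m:ℝ) < n := by exact_mod_cast h1
          have hn2 : (n:ℝ) ≤ m + H := by exact_mod_cast h2
          have hHM : (H:ℝ) ≤ M := by exact_mod_cast hH
          have hn0 : (0:ℝ) < n := by linarith
          have hw : w (Real.log n - y) = 1 := by
            refine w_eq_one (sub_nonneg.2 (Real.log_le_log hM0 (by linarith))) ?_
            rw [hy, ← Real.log_div hn0.ne' hM0.ne', Real.log_le_iff_le_exp (by positivity), div_le_iff₀ hM0]
            nlinarith only [he3, hM0, hn2, hHM, hmM2]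
          have e : g n - (m:ℂ) * c n = g n * (((n - m) / n : ℝ) : ℂ) := by
            rw [hc]; unfold rc; rw [hw]; push_cast
            have : (n:ℂ) ≠ 0 := by exact_mod_cast hn0.ne'
            field_simp
          rw [e, norm_mul, Complex.norm_real, Real.norm_of_nonneg (div_nonneg (by linarith) hn0.le)]
          calc _ ≤ 1 * ((n - m) / n : ℝ) := mul_le_mul_of_nonneg_right (hg n) (div_nonneg (by linarith) hn0.le)
            _ ≤ (H:ℝ) / M := by
              rw [one_mul]
              exact div_le_div₀ (by positivity) (by linarith) hM0 (by linarith)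
      _ = _ := by rw [Finset.sum_const, Nat.card_Ioc, nsmul_eq_mul]; push_cast [Nat.add_sub_cancel_left]; ring
  have h1 := norm_sub_norm_le (∑ n ∈ Finset.Ioc m (m + H), g n) ((m:ℂ) * ∑ n ∈ Finset.Ioc m (m + H), c n)
  rw [norm_mul, Complex.norm_natCast] at h1
  have h2 : (m:ℝ) * ‖∑ n ∈ Finset.Ioc m (m + H), c n‖ ≤ 2 * M * (δ⁻¹ * (∫ u in α..β, ‖GA s c l δ u‖) + Real.exp 1 / M * (2 * (1 + 2 * N * δ))) :=
    mul_le_mul hmM2 hsum (norm_nonneg _) (by positivity)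
  have e : 2 * M * (δ⁻¹ * (∫ u in α..β, ‖GA s c l δ u‖) + Real.exp 1 / M * (2 * (1 + 2 * N * δ)))
    = 2 * M / δ * (∫ u in α..β, ‖GA s c l δ u‖) + 4 * Real.exp 1 * (1 + 2 * N * δ) := by field_simp; ring
  linarith

lemma cover {ψ : ℝ → ℝ} (hi : ∀ a b, IntervalIntegrable ψ volume a b) (h0 : ∀ x, 0 ≤ ψ x) {M H : ℕ} (hM : 1 ≤ M) (hH : H ≤ M) :
    ∑ m ∈ Finset.Ico M (2 * M), ∫ u in (Real.log m)..(Real.log (m + H : ℕ)), ψ u ≤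
      H * ∫ u in (Real.log M)..(Real.log M + 2), ψ u := by
  have hM0 : (0:ℝ) < M := by exact_mod_cast hM
  have e1 : ∀ m : ℕ, ∫ u in (Real.log m)..(Real.log (m + H : ℕ)), ψ u =
      ∑ j ∈ Finset.range H, ∫ u in (Real.log (m + j : ℕ))..(Real.log (m + (j + 1) : ℕ)), ψ u := fun m =>
    (intervalIntegral.sum_integral_adjacent_intervals (a := fun j : ℕ => Real.log (m + j : ℕ)) (n := H) fun k _ => hi _ _).symm
  simp_rw [e1]
  rw [Finset.sum_comm]
  have e2 : ∀ j ∈ Finset.range H, ∑ m ∈ Finset.Ico M (2 * M), ∫ u in (Real.log (m + j : ℕ))..(Real.log (m + (j + 1) : ℕ)), ψ u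
      ≤ ∫ u in (Real.log M)..(Real.log M + 2), ψ u := by
    intro j hj
    have hj' : j < H := Finset.mem_range.1 hj
    have e3 := intervalIntegral.sum_integral_adjacent_intervals_Ico (a := fun m : ℕ => Real.log (m + j : ℕ)) (f := ψ) (μ := volume)
      (show M ≤ 2 * M by omega) fun k _ => hi _ _
    have e4 : ∀ m : ℕ, m + (j + 1) = m + 1 + j := fun m => by omega
    simp_rw [e4]
    rw [e3]
    refine intervalIntegral.integral_mono_interval (Real.log_le_log hM0 (by exact_mod_cast (by omega : M ≤ M + j)))
      (Real.log_le_log (by exact_mod_cast (by omega : 0 < M + j)) (by exact_mod_cast (by omega : M + j ≤ 2 * M + j))) ?_ (ae_of_all _ h0) (hi _ _)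
    have he3 : (3:ℝ) ≤ Real.exp 2 := by linarith [Real.add_one_le_exp (2:ℝ)]
    have h3 : ((2 * M + j : ℕ) : ℝ) ≤ M * 3 := by exact_mod_cast (by omega : 2 * M + j ≤ M * 3)
    rw [Real.log_le_iff_le_exp (by exact_mod_cast (by omega : 0 < 2 * M + j)), Real.exp_add, Real.exp_log hM0]
    exact h3.trans (by gcongr)
  refine (Finset.sum_le_sum e2).trans (le_of_eq ?_)
  rw [Finset.sum_const, Finset.card_range, nsmul_eq_mul]

lemma phys {g : ℕ → ℂ} (hg : ∀ n, ‖g n‖ ≤ 1) (h : MRP g) {θ : ℝ} (hθ : 0 < θ) :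
    ∃ C : ℝ, 0 ≤ C ∧ ∃ M₀ : ℕ, ∀ M ≥ M₀, ∀ H : ℕ, H ≤ M →
      ∑ m ∈ Finset.Ico M (2 * M), ‖∑ n ∈ Finset.Ioc m (m + H), g n‖ ≤ (H:ℝ) ^ 2 + 3 * θ * M * H + C * M := by
  obtain ⟨Q₀, hQ, y₀, hy₀, hL⟩ := GA_L2 hg h hθ
  refine ⟨4 * Real.exp 1 * (1 + 2 * (Real.exp 3 + 1) * Q₀ ^ 2), by positivity, max 1 ⌈Real.exp y₀⌉₊, fun M hM H hH => ?_⟩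
  have hM1 : 1 ≤ M := (le_max_left _ _).trans hM
  have hM1' : (1:ℝ) ≤ M := by exact_mod_cast hM1
  have hM0 : (0:ℝ) < M := by linarith
  have hMy : y₀ ≤ Real.log M := by
    rw [Real.le_log_iff_exp_le hM0]; exact (Nat.le_ceil _).trans (by exact_mod_cast (le_max_right _ _).trans hM)
  have hGA := hL _ hMy
  set y := Real.log M with hy
  set δ := Q₀ ^ 2 * Real.exp (-y) with hδ
  have hδ0 : 0 < δ := by positivity
  have hδM : δ = Q₀ ^ 2 / M := by rw [hδ, Real.exp_neg, hy, Real.exp_log hM0]; rfl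
  set N := NN (y + 3) with hN
  set A := GA (Finset.Ico 1 N) (rc g y) (fun n : ℕ => Real.log n) δ with hA
  have hNle : (N:ℝ) ≤ (Real.exp 3 + 1) * M := by
    have := NN_le (y + 3); rw [Real.exp_add, hy, Real.exp_log hM0] at this
    rw [hN, hy]; linarith
  have hNδ : 1 + 2 * N * δ ≤ 1 + 2 * (Real.exp 3 + 1) * Q₀ ^ 2 := by
    have : (N:ℝ) * δ ≤ (Real.exp 3 + 1) * M * (Q₀ ^ 2 / M) := by rw [hδM]; gcongr
    have e : (Real.exp 3 + 1) * M * (Q₀ ^ 2 / M) = (Real.exp 3 + 1) * Q₀ ^ 2 := by field_simp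
    rw [e] at this; linarith
  have hi : ∀ a b, IntervalIntegrable (fun u => ‖A u‖) volume a b := fun a b => (GA_ii _ _ _ hδ0 a b).norm
  have hInt : ∫ u in y..(y + 2), ‖A u‖ ≤ 3 / 2 * (δ * θ) := by
    have hgs : Integrable fun v => ‖A v‖ ^ 2 := integrable_GA_sq _ _ _ hδ0
    have hκ : 0 < δ * θ := by positivity
    have a1 : ∫ v in y..(y + 2), ‖A v‖ ≤ ∫ v in y..(y + 2), (δ * θ / 2 + 1 / (2 * (δ * θ)) * ‖A v‖ ^ 2) := by
      refine intervalIntegral.integral_mono_on (by linarith) (hi _ _) ((by simp : IntervalIntegrable (fun _ => δ * θ / 2) volume _ _).add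
        (hgs.intervalIntegrable.const_mul _)) fun v _ => ?_
      have e : δ * θ / 2 + 1 / (2 * (δ * θ)) * ‖A v‖ ^ 2 - ‖A v‖ = (δ * θ - ‖A v‖) ^ 2 / (2 * (δ * θ)) := by field_simp; ring
      have h2 : 0 ≤ (δ * θ - ‖A v‖) ^ 2 / (2 * (δ * θ)) := by positivity
      linarith
    rw [intervalIntegral.integral_add (by simp) (hgs.intervalIntegrable.const_mul _),
      intervalIntegral.integral_const_mul, intervalIntegral.integral_const, smul_eq_mul] at a1
    have a2 : ∫ v in y..(y + 2), ‖A v‖ ^ 2 ≤ δ ^ 2 * θ ^ 2 := by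
      rw [intervalIntegral.integral_of_le (by linarith)]
      exact (setIntegral_le_integral hgs (ae_of_all _ fun v => by positivity)).trans hGA
    have a3 : 1 / (2 * (δ * θ)) * ∫ v in y..(y + 2), ‖A v‖ ^ 2 ≤ 1 / (2 * (δ * θ)) * (δ ^ 2 * θ ^ 2) :=
      mul_le_mul_of_nonneg_left a2 (by positivity)
    have a4 : 1 / (2 * (δ * θ)) * (δ ^ 2 * θ ^ 2) = δ * θ / 2 := by field_simp
    linarith
  have hcov := cover hi (fun x => norm_nonneg _) hM1 hH
  calc _ ≤ ∑ m ∈ Finset.Ico M (2 * M), ((H:ℝ) ^ 2 / M + 2 * M / δ *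
      (∫ u in (Real.log m)..(Real.log (m + H : ℕ)), ‖A u‖) + 4 * Real.exp 1 * (1 + 2 * N * δ)) :=
        Finset.sum_le_sum fun m hm => by
          have := Finset.mem_Ico.1 hm
          exact short_one hg hM1 this.1 this.2.le hH hδ0 rfl
    _ = (H:ℝ) ^ 2 + 2 * M / δ * (∑ m ∈ Finset.Ico M (2 * M), ∫ u in (Real.log m)..(Real.log (m + H : ℕ)), ‖A u‖) + M * (4 * Real.exp 1 * (1 + 2 * N * δ)) := by
        rw [Finset.sum_add_distrib, Finset.sum_add_distrib, ← Finset.mul_sum, Finset.sum_const, Finset.sum_const, Nat.card_Ico,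
          nsmul_eq_mul, nsmul_eq_mul, show 2 * M - M = M by omega]
        congr 2; field_simp
    _ ≤ (H:ℝ) ^ 2 + 2 * M / δ * (H * (3 / 2 * (δ * θ))) + M * (4 * Real.exp 1 * (1 + 2 * (Real.exp 3 + 1) * Q₀ ^ 2)) := by
        gcongr
        exact hcov.trans (by gcongr)
    _ = _ := by field_simp

end
end MR

open Filter Topology

theorem periodic_weighted_moebius_short_intervals (a : ℕ → ℂ)
    (hper : ∃ q : ℕ, 1 ≤ q ∧ ∀ n : ℕ, a (n + q) = a n)
    (H : ℕ → ℕ) (hHpos : ∀ M, 1 ≤ H M)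
    (hHinf : Tendsto H atTop atTop)
    (hHsmall : Tendsto (fun M : ℕ => (H M : ℝ) / M) atTop (nhds 0)) :
    Tendsto
      (fun M : ℕ => (1 / (M : ℝ)) *
        ∑ m ∈ Finset.Ico M (2 * M),
          norm ((1 / (H M : ℂ)) *
            ∑ h ∈ Finset.Ico m (m + H M), a h * (ArithmeticFunction.moebius h : ℂ)))
      atTop (nhds 0) := by
  obtain ⟨q, hq, hqa⟩ := hper
  set B : ℝ := ∑ i ∈ Finset.range q, ‖a i‖ + 1 with hB
  have hB0 : 0 < B := by
    have : 0 ≤ ∑ i ∈ Finset.range q, ‖a i‖ := Finset.sum_nonneg fun i _ => norm_nonneg _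
    linarith
  have haB : ∀ n, ‖a n‖ ≤ B := by
    intro n
    have hp : Function.Periodic a q := hqa
    rw [← hp.map_mod_nat n]
    have := Finset.single_le_sum (f := fun i => ‖a i‖) (fun i _ => norm_nonneg _) (Finset.mem_range.2 (Nat.mod_lt n hq))
    linarith
  set g : ℕ → ℂ := fun n => (B:ℂ)⁻¹ * (a n * (ArithmeticFunction.moebius n : ℂ)) with hg
  have hBc : (B:ℂ) ≠ 0 := by exact_mod_cast hB0.ne'
  have hg1 : ∀ n, ‖g n‖ ≤ 1 := by
    intro n
    have hμ : ‖(ArithmeticFunction.moebius n : ℂ)‖ ≤ 1 := by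
      rw [Complex.norm_intCast]; exact_mod_cast ArithmeticFunction.abs_moebius_le_one
    rw [hg]
    simp only [norm_mul, norm_inv, Complex.norm_real, Real.norm_of_nonneg hB0.le]
    rw [inv_mul_le_iff₀ hB0, mul_one]
    calc ‖a n‖ * ‖(ArithmeticFunction.moebius n : ℂ)‖ ≤ B * 1 := mul_le_mul (haB n) hμ (norm_nonneg _) hB0.le
      _ = B := mul_one B
  have hgM : MR.MRP g := MR.MRP_smul (MR.MRP_periodic hq hqa) _
  refine tendsto_order.2 ⟨fun x hx => Eventually.of_forall fun M => lt_of_lt_of_le hx (by positivity), fun ε hε => ?_⟩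
  obtain ⟨C, hC, M₀, hM₀⟩ := MR.phys hg1 hgM (θ := ε / (12 * B)) (by positivity)
  have t1 : ∀ᶠ M : ℕ in atTop, (H M : ℝ) / M < min 1 (ε / (4 * B)) := hHsmall.eventually (gt_mem_nhds (by positivity))
  have t2 : ∀ᶠ M : ℕ in atTop, ⌈4 * B * (C + 2) / ε⌉₊ ≤ H M := hHinf.eventually_ge_atTop _
  filter_upwards [t1, t2, eventually_ge_atTop M₀, eventually_ge_atTop 1] with M h1 h2 h3 h4
  have hM0 : (0:ℝ) < M := by exact_mod_cast h4
  have hH0 : (0:ℝ) < H M := by exact_mod_cast hHpos M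
  have h2' : 4 * B * (C + 2) ≤ H M * ε := by
    have := (Nat.le_ceil (4 * B * (C + 2) / ε)).trans (by exact_mod_cast h2 : ((⌈4 * B * (C + 2) / ε⌉₊ : ℕ) : ℝ) ≤ H M)
    rwa [div_le_iff₀ hε] at this
  have h1a : (H M : ℝ) < M := by
    have := h1.trans_le (min_le_left _ _); rwa [div_lt_one hM0] at this
  have h1b : (H M : ℝ) * (4 * B) < ε * M := by
    have := h1.trans_le (min_le_right _ _); rwa [div_lt_div_iff₀ hM0 (by positivity)] at this
  have hP := hM₀ M h3 (H M) (by exact_mod_cast h1a.le)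
  have hterm : ∀ m, norm ((1 / (H M : ℂ)) * ∑ h ∈ Finset.Ico m (m + H M), a h * (ArithmeticFunction.moebius h : ℂ))
      ≤ B / H M * (‖∑ n ∈ Finset.Ioc m (m + H M), g n‖ + 2) := by
    intro m
    have e1 : ∑ h ∈ Finset.Ico m (m + H M), a h * (ArithmeticFunction.moebius h : ℂ) = (B:ℂ) * ∑ n ∈ Finset.Ico m (m + H M), g n := by
      rw [Finset.mul_sum]; refine Finset.sum_congr rfl fun n _ => ?_
      rw [hg]; field_simp
    have e2 : ∑ n ∈ Finset.Ico m (m + H M), g n + g (m + H M) = g m + ∑ n ∈ Finset.Ioc m (m + H M), g n := by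
      rw [← Finset.sum_Ico_succ_top (by omega), Finset.sum_eq_sum_Ico_succ_bot (by omega)]
      have : Finset.Ico (m + 1) (m + H M + 1) = Finset.Ioc m (m + H M) := by ext n; simp only [Finset.mem_Ico, Finset.mem_Ioc]; omega
      rw [this]
    have e3 : ∑ n ∈ Finset.Ico m (m + H M), g n = ∑ n ∈ Finset.Ioc m (m + H M), g n + (g m - g (m + H M)) := by
      linear_combination e2
    have e4 : ‖∑ n ∈ Finset.Ico m (m + H M), g n‖ ≤ ‖∑ n ∈ Finset.Ioc m (m + H M), g n‖ + 2 := by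
      rw [e3]
      have b1 := norm_add_le (∑ n ∈ Finset.Ioc m (m + H M), g n) (g m - g (m + H M))
      have b2 := norm_sub_le (g m) (g (m + H M))
      linarith [hg1 m, hg1 (m + H M)]
    rw [e1, norm_mul, norm_mul, norm_div, norm_one, Complex.norm_natCast, Complex.norm_real, Real.norm_of_nonneg hB0.le,
      ← mul_assoc, one_div_mul_eq_div]
    gcongr
  calc _ ≤ 1 / (M:ℝ) * ∑ m ∈ Finset.Ico M (2 * M), B / H M * (‖∑ n ∈ Finset.Ioc m (m + H M), g n‖ + 2) := by
        gcongr with m _; exact hterm m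
    _ = 1 / (M:ℝ) * (B / H M * (∑ m ∈ Finset.Ico M (2 * M), ‖∑ n ∈ Finset.Ioc m (m + H M), g n‖ + 2 * M)) := by
        rw [← Finset.mul_sum, Finset.sum_add_distrib, Finset.sum_const, Nat.card_Ico, nsmul_eq_mul, show 2 * M - M = M by omega, mul_comm (M:ℝ) 2]
    _ ≤ 1 / (M:ℝ) * (B / H M * (((H M:ℝ) ^ 2 + 3 * (ε / (12 * B)) * M * H M + C * M) + 2 * M)) := by gcongr
    _ = (H M:ℝ) * (4 * B) / (4 * M) + ε / 4 + 4 * B * (C + 2) / (4 * H M) := by field_simp; ring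
    _ ≤ ε * M / (4 * M) + ε / 4 + H M * ε / (4 * H M) := by gcongr
    _ = 3 / 4 * ε := by field_simp; ring
    _ < ε := by linarith
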